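/- For every integer n ≥ 0, writing N_i = N(i,11,11n+2) and M_i = M(i,11,11n+2), the following hold: 3N_2 + N_4 ≥ 2N_0 + 2N_5; 2N_1 + 2N_3 + N_5 + 2M_0 ≥ 2N_2 + 3N_4 + 2M_2; 3N_0 + 2N_2 + M_2 ≥ N_1 + N_3 + 3N_5 + M_0; 2N_0 + N_1 + N_3 + 3N_4 + M_0 ≥ 4N_2 + 3N_5 + M_2; and N_0 + 3N_1 + N_2 + 8N_5 + 3M_0 ≥ 8N_3 + 5N_4 + 3M_2. -/

import Mathlib

/-- `p n`: the number of partitions of `n`. -/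
def partitionCount (n : ℕ) : ℕ := Fintype.card (Nat.Partition n)

/-- The rank of a partition: its largest part minus its number of parts
(the empty partition has rank 0). -/
def partitionRank {n : ℕ} (π : Nat.Partition n) : ℤ :=
  (π.parts.sup : ℤ) - (Multiset.card π.parts : ℤ)

/-- The crank of a partition `π`: if `π` has no parts equal to 1, it is the largest part;
otherwise it is (number of parts larger than the number of ones) − (number of ones). -/
def partitionCrank {n : ℕ} (π : Nat.Partition n) : ℤ :=
  if π.parts.count 1 = 0 then (π.parts.sup : ℤ)
  else ((π.parts.filter fun x => π.parts.count 1 < x).card : ℤ) - (π.parts.count 1 : ℤ)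

/-- `rankCount a r n` = `N(a,r,n)`: the number of partitions of `n` whose rank is
congruent to `a` modulo `r`. -/
def rankCount (a r : ℤ) (n : ℕ) : ℕ :=
  (Finset.univ.filter fun π : Nat.Partition n => partitionRank π % r = a % r).card

/-- `crankCount a n` = `M(a,11,n)`: for `n ≠ 1`, the number of partitions of `n` whose crank
is congruent to `a` modulo 11; at `n = 1` the standard convention `M(0,11,1) = −1`,
`M(1,11,1) = M(10,11,1) = 1`, and `M(a,11,1) = 0` otherwise. -/
def crankCount (a : ℤ) (n : ℕ) : ℤ :=
  if n = 1 then
    if a % 11 = 0 then -1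
    else if a % 11 = 1 ∨ a % 11 = 10 then 1
    else 0
  else ((Finset.univ.filter fun π : Nat.Partition n => partitionCrank π % 11 = a % 11).card : ℤ)

open Filter Topology

/-- The triangular exponent `n (n - 1) / 2`. -/
def tri (n : ℤ) : ℤ := n * (n - 1) / 2

theorem two_mul_tri (n : ℤ) : 2 * tri n = n * (n - 1) := by
  unfold tri
  exact Int.mul_ediv_cancel' (Int.even_mul_pred_self n).two_dvd

theorem tri_add_one (n : ℤ) : tri (n + 1) = tri n + n := by
  have h1 := two_mul_tri n
  have h2 := two_mul_tri (n + 1)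
  linarith

theorem tri_one_sub (n : ℤ) : tri (1 - n) = tri n := by
  have h1 := two_mul_tri n
  have h2 := two_mul_tri (1 - n)
  linarith

theorem tri_neg (n : ℤ) : tri (-n) = tri n + n := by
  have h1 := two_mul_tri n
  have h2 := two_mul_tri (-n)
  linarith

theorem tri_one : tri 1 = 0 := rfl

theorem summable_pow_tri_aux {f : ℕ → ℝ} {ρ c : ℝ} (h0 : 0 < ρ) (h1 : ρ < 1)
    (hpos : ∀ n, 0 < f n) (hf : ∀ n, f (n + 1) = f n * (ρ ^ n * c)) : Summable f := by
  refine summable_of_ratio_test_tendsto_lt_one zero_lt_one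
    (Eventually.of_forall fun n => (hpos n).ne') ?_
  have : (fun n => ‖f (n + 1)‖ / ‖f n‖) = fun n => ρ ^ n * |c| := by
    ext n
    have := (hpos n).ne'
    rw [hf, norm_mul, mul_div_cancel_left₀]
    · simp [abs_of_pos h0]
    · simpa using this
  rw [this]
  simpa using (tendsto_pow_atTop_nhds_zero_of_lt_one h0.le h1).mul_const |c|

theorem summable_pow_tri {ρ c : ℝ} (h0 : 0 < ρ) (h1 : ρ < 1) (hc : 0 < c) :
    Summable fun n : ℤ => ρ ^ tri n * c ^ n := by
  refine Summable.of_nat_of_neg ?_ ?_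
  · refine summable_pow_tri_aux (c := c) h0 h1 (fun n => by positivity) fun n => ?_
    push_cast
    rw [tri_add_one, zpow_add₀ h0.ne', zpow_add₀ hc.ne']
    simp; ring
  · refine summable_pow_tri_aux (c := ρ * c⁻¹) h0 h1 (fun n => by positivity) fun n => ?_
    push_cast
    rw [tri_neg, tri_neg, tri_add_one, zpow_add₀ h0.ne', zpow_add₀ h0.ne', zpow_add₀ h0.ne',
      neg_add, zpow_add₀ hc.ne']
    simp; ring

/-- The Jacobi theta function `∑ (-1)^n q^(n(n-1)/2) z^n`. -/
noncomputable def theta (q z : ℂ) : ℂ := ∑' n : ℤ, (-1) ^ n * q ^ tri n * z ^ n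

theorem norm_theta_term (q z : ℂ) (n : ℤ) :
    ‖(-1 : ℂ) ^ n * q ^ tri n * z ^ n‖ = ‖q‖ ^ tri n * ‖z‖ ^ n := by
  simp

theorem zpow_le_add_zpow {r s R : ℝ} (hr : 0 < r) (h1 : r ≤ s) (h2 : s ≤ R) (n : ℤ) :
    s ^ n ≤ R ^ n + r ^ n := by
  have hs := hr.trans_le h1
  rcases le_or_gt 0 n with h | h
  · have := zpow_le_zpow_left₀ h hs.le h2
    have : 0 < r ^ n := zpow_pos hr n
    linarith
  · have : s ^ n ≤ r ^ n := by
      have h3 := zpow_le_zpow_left₀ (n := -n) (by omega) hr.le h1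
      rw [zpow_neg, zpow_neg] at h3
      exact (inv_le_inv₀ (zpow_pos hr n) (zpow_pos hs n)).1 h3
    have : 0 < R ^ n := zpow_pos (hs.trans_le h2) n
    linarith

theorem summable_theta {q z : ℂ} (h0 : q ≠ 0) (h1 : ‖q‖ < 1) (hz : z ≠ 0) :
    Summable fun n : ℤ => (-1) ^ n * q ^ tri n * z ^ n := by
  refine Summable.of_norm ?_
  simp_rw [norm_theta_term]
  exact summable_pow_tri (norm_pos_iff.2 h0) h1 (norm_pos_iff.2 hz)

/-- A bilateral sum of `z ^ n` with theta-like coefficients is holomorphic off `0`. -/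
theorem differentiableAt_tsum_zpow {q : ℂ} (h0 : q ≠ 0) (h1 : ‖q‖ < 1) {a : ℤ → ℂ} {b : ℝ}
    (hb : 0 < b) (ha : ∀ n, ‖a n‖ ≤ ‖q‖ ^ tri n * b ^ n) {z : ℂ} (hz : z ≠ 0) :
    DifferentiableAt ℂ (fun z : ℂ => ∑' n : ℤ, a n * z ^ n) z := by
  have hz' := norm_pos_iff.2 hz
  have hq' := norm_pos_iff.2 h0
  set U : Set ℂ := {w | ‖z‖ / 2 < ‖w‖ ∧ ‖w‖ < 2 * ‖z‖} with hU
  have hUo : IsOpen U :=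
    (isOpen_lt continuous_const continuous_norm).inter (isOpen_lt continuous_norm continuous_const)
  have hzU : z ∈ U := ⟨by linarith, by linarith⟩
  refine (DifferentiableOn.differentiableAt (s := U) ?_ (hUo.mem_nhds hzU))
  refine DifferentiableOn.mono (Complex.differentiableOn_tsum_of_summable_norm
    (u := fun n : ℤ => ‖q‖ ^ tri n * (b * (2 * ‖z‖)) ^ n + ‖q‖ ^ tri n * (b * (‖z‖ / 2)) ^ n)
    ?_ (fun n => ?_) hUo fun n w hw => ?_) subset_rfl
  · exact (summable_pow_tri hq' h1 (by positivity)).add (summable_pow_tri hq' h1 (by positivity))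
  · intro w hw
    have : w ≠ 0 := norm_pos_iff.1 ((half_pos hz').trans hw.1)
    exact ((differentiableAt_zpow.2 (Or.inl this)).const_mul _).differentiableWithinAt
  · rw [norm_mul, norm_zpow, mul_zpow b, mul_zpow b]
    have := zpow_le_add_zpow (half_pos hz') hw.1.le hw.2.le n
    calc _ ≤ ‖q‖ ^ tri n * b ^ n * ((2 * ‖z‖) ^ n + (‖z‖ / 2) ^ n) := by
          gcongr
          exact ha n
      _ = _ := by ring

theorem differentiableAt_theta {q z : ℂ} (h0 : q ≠ 0) (h1 : ‖q‖ < 1) (hz : z ≠ 0) :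
    DifferentiableAt ℂ (theta q) z :=
  differentiableAt_tsum_zpow h0 h1 (b := 1) one_pos (by simp) hz

theorem theta_mul_base {q z : ℂ} (h0 : q ≠ 0) (hz : z ≠ 0) :
    theta q (q * z) = -z⁻¹ * theta q z := by
  unfold theta
  rw [← (Equiv.addRight (1 : ℤ)).tsum_eq fun n : ℤ => (-1 : ℂ) ^ n * q ^ tri n * z ^ n,
    ← tsum_mul_left]
  refine tsum_congr fun n => ?_
  simp only [Equiv.coe_addRight]
  rw [tri_add_one, zpow_add₀ h0, mul_zpow, zpow_add_one₀ hz,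
    zpow_add_one₀ (by norm_num : (-1 : ℂ) ≠ 0)]
  field_simp

theorem theta_inv {q z : ℂ} (hz : z ≠ 0) : theta q z⁻¹ = -z⁻¹ * theta q z := by
  unfold theta
  rw [← (Equiv.subLeft (1 : ℤ)).tsum_eq fun n : ℤ => (-1 : ℂ) ^ n * q ^ tri n * z ^ n,
    ← tsum_mul_left]
  refine tsum_congr fun n => ?_
  simp only [Equiv.subLeft_apply]
  rw [tri_one_sub, zpow_sub₀ hz, zpow_sub₀ (by norm_num : (-1 : ℂ) ≠ 0), inv_zpow]
  rcases Int.even_or_odd n with h | h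
  · rw [h.neg_one_zpow]; field_simp
  · rw [h.neg_one_zpow]; field_simp

theorem theta_one (q : ℂ) : theta q 1 = 0 := by
  have := theta_inv (q := q) one_ne_zero
  simp only [inv_one, neg_mul, one_mul] at this
  exact self_eq_neg.1 this

/-- The infinite `q`-Pochhammer symbol `(a; q)_∞`. -/
noncomputable def qpoch (q a : ℂ) : ℂ := ∏' k : ℕ, (1 - a * q ^ k)

theorem summable_norm_mul_pow {q : ℂ} (h1 : ‖q‖ < 1) (a : ℂ) :
    Summable fun k : ℕ => ‖-(a * q ^ k)‖ := by
  simp only [norm_neg, norm_mul, norm_pow]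
  exact (summable_geometric_of_lt_one (norm_nonneg _) h1).mul_left _

theorem multipliable_qpoch {q : ℂ} (h1 : ‖q‖ < 1) (a : ℂ) :
    Multipliable fun k : ℕ => 1 - a * q ^ k := by
  simp only [sub_eq_add_neg]
  exact multipliable_one_add_of_summable (summable_norm_mul_pow h1 a)

theorem qpoch_ne_zero {q a : ℂ} (h1 : ‖q‖ < 1) (h : ∀ k : ℕ, a * q ^ k ≠ 1) :
    qpoch q a ≠ 0 := by
  unfold qpoch
  simp only [sub_eq_add_neg]
  refine tprod_one_add_ne_zero_of_summable (fun k => ?_) (summable_norm_mul_pow h1 a)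
  rw [← sub_eq_add_neg]
  exact sub_ne_zero.2 (h k).symm

theorem qpoch_eq_mul {q : ℂ} (h1 : ‖q‖ < 1) (a : ℂ) :
    qpoch q a = (1 - a) * qpoch q (a * q) := by
  unfold qpoch
  have := (multipliable_qpoch h1 (a * q))
  rw [tprod_eq_zero_mul']
  · simp only [pow_zero, mul_one]
    congr 1
    refine tprod_congr fun k => ?_
    ring
  · refine this.congr fun k => ?_
    ring

theorem tendsto_qpoch {q : ℂ} (h1 : ‖q‖ < 1) (a : ℂ) :
    Tendsto (fun n => ∏ i ∈ Finset.range n, (1 - a * q ^ i)) atTop (𝓝 (qpoch q a)) :=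
  (multipliable_qpoch h1 a).hasProd.tendsto_prod_nat

theorem continuousAt_qpoch {q : ℂ} (h1 : ‖q‖ < 1) (a : ℂ) : ContinuousAt (qpoch q) a := by
  unfold ContinuousAt qpoch
  simp only [sub_eq_add_neg]
  refine tendsto_tprod_one_add_of_dominated_convergence
    (bound := fun k => (‖a‖ + 1) * ‖q‖ ^ k) ?_ (fun k => ?_) ?_
  · exact (summable_geometric_of_lt_one (norm_nonneg _) h1).mul_left _
  · exact Continuous.tendsto (f := fun x : ℂ => -(x * q ^ k)) (by fun_prop) a
  · have : ∀ᶠ x in 𝓝 a, ‖x‖ < ‖a‖ + 1 := continuous_norm.continuousAt.eventually_lt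
      continuousAt_const (by linarith)
    filter_upwards [this] with x hx k
    simp only [norm_neg, norm_mul, norm_pow]
    gcongr

/-- Reciprocal of the finite `q`-factorial, extended by zero to negative indices. -/
noncomputable def qfactInv (q : ℂ) (k : ℤ) : ℂ :=
  if k < 0 then 0 else (∏ i ∈ Finset.range k.toNat, (1 - q * q ^ i))⁻¹

theorem one_sub_pow_ne_zero {q : ℂ} (h1 : ‖q‖ < 1) (n : ℕ) : 1 - q * q ^ n ≠ 0 := by
  intro h
  have h2 : ‖q * q ^ n‖ = 1 := by rw [← sub_eq_zero.1 h]; simp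
  rw [← pow_succ', norm_pow] at h2
  exact (pow_lt_one₀ (norm_nonneg q) h1 n.succ_ne_zero).ne h2

theorem qfactInv_sub_one {q : ℂ} (h1 : ‖q‖ < 1) (k : ℤ) :
    qfactInv q (k - 1) = (1 - q ^ k) * qfactInv q k := by
  unfold qfactInv
  rcases lt_trichotomy k 0 with h | h | h
  · simp [h, show k - 1 < 0 by omega]
  · simp [h]
  · obtain ⟨n, rfl⟩ : ∃ n : ℕ, k = n + 1 := ⟨(k - 1).toNat, by omega⟩
    rw [if_neg (by omega), if_neg (by omega)]
    have := one_sub_pow_ne_zero h1 n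
    simp only [add_sub_cancel_right, Int.toNat_natCast, Int.toNat_natCast_add_one,
      Finset.prod_range_succ]
    rw [mul_inv, show q ^ ((n : ℤ) + 1) = q * q ^ n by norm_cast; rw [pow_succ']]
    field_simp

theorem exists_qfactInv_bound {q : ℂ} (h1 : ‖q‖ < 1) : ∃ B : ℝ, 0 < B ∧ ∀ k, ‖qfactInv q k‖ ≤ B := by
  have ht : Tendsto (fun n : ℕ => ‖(∏ i ∈ Finset.range n, (1 - q * q ^ i))⁻¹‖) atTop
      (𝓝 ‖(qpoch q q)⁻¹‖) := by
    refine ((tendsto_qpoch h1 q).inv₀ (qpoch_ne_zero h1 fun k => ?_)).norm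
    exact fun h => one_sub_pow_ne_zero h1 k (by rw [h]; ring)
  obtain ⟨B, hB⟩ := ht.bddAbove_range
  refine ⟨max B 1, by positivity, fun k => ?_⟩
  unfold qfactInv
  split_ifs
  · simp
  · exact (hB ⟨_, rfl⟩).trans (le_max_left _ _)

theorem tendsto_qfactInv {q : ℂ} (h1 : ‖q‖ < 1) (m : ℤ) :
    Tendsto (fun n : ℕ => qfactInv q (n + m)) atTop (𝓝 (qpoch q q)⁻¹) := by
  have ht : Tendsto (fun n : ℕ => (∏ i ∈ Finset.range n, (1 - q * q ^ i))⁻¹) atTop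
      (𝓝 (qpoch q q)⁻¹) := by
    refine ((tendsto_qpoch h1 q).inv₀ (qpoch_ne_zero h1 fun k => ?_))
    exact fun h => one_sub_pow_ne_zero h1 k (by rw [h]; ring)
  have h2 : Tendsto (fun n : ℕ => ((n : ℤ) + m).toNat) atTop atTop :=
    tendsto_atTop.2 fun b => by
      filter_upwards [eventually_ge_atTop (b + m.natAbs)] with n hn
      omega
  refine (ht.comp h2).congr' ?_
  filter_upwards [eventually_ge_atTop m.natAbs] with n hn
  simp [qfactInv, show ¬ ((n : ℤ) + m < 0) by omega]

/-- Cauchy's finite form of the Jacobi triple product. -/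
theorem finite_triple_product {q z : ℂ} (h0 : q ≠ 0) (h1 : ‖q‖ < 1) (hz : z ≠ 0) (N : ℕ) :
    HasSum (fun m : ℤ => (∏ i ∈ Finset.range (2 * N), (1 - q * q ^ i)) *
      (qfactInv q (N - m) * qfactInv q (N + m)) * ((-1) ^ m * q ^ tri m * z ^ m))
      (∏ i ∈ Finset.range N, ((1 - z * q ^ i) * (1 - q * z⁻¹ * q ^ i))) := by
  induction N with
  | zero =>
    have := hasSum_single (f := fun m : ℤ => (∏ i ∈ Finset.range (2 * 0), (1 - q * q ^ i)) *
      (qfactInv q ((0 : ℕ) - m) * qfactInv q ((0 : ℕ) + m)) * ((-1) ^ m * q ^ tri m * z ^ m))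
      (0 : ℤ) fun m hm => by
        rcases lt_or_gt_of_ne hm with h | h <;> simp [qfactInv, h]
    simpa [qfactInv, tri] using this
  | succ N ih =>
    rw [Finset.prod_range_succ]
    have e1 := (Equiv.hasSum_iff (Equiv.addRight (-1 : ℤ))).2 ih
    have e2 := (Equiv.hasSum_iff (Equiv.addRight (1 : ℤ))).2 ih
    convert! ((ih.mul_left (1 + q ^ (2 * N + 1))).sub (e1.mul_left (z * q ^ N))).sub
      (e2.mul_left (q ^ (N + 1) * z⁻¹)) using 1
    · ext m
      simp only [Function.comp_apply, Equiv.coe_addRight]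
      have a1 := qfactInv_sub_one h1 (N + 1 - m)
      have a2 := qfactInv_sub_one h1 (N + 1 + m)
      have a3 := qfactInv_sub_one h1 (N - m)
      have a4 := qfactInv_sub_one h1 (N + m)
      rw [show (N : ℤ) + 1 - m - 1 = N - m by ring] at a1
      rw [show (N : ℤ) + 1 + m - 1 = N + m by ring] at a2
      rw [show (N : ℤ) - (m + -1) = N + 1 - m by ring, show (N : ℤ) + (m + 1) = N + 1 + m by ring,
        show (N : ℤ) - (m + 1) = N - m - 1 by ring, show (N : ℤ) + (m + -1) = N + m - 1 by ring,
        a3, a4, a1, a2, show 2 * (N + 1) = 2 * N + 1 + 1 by ring, Finset.prod_range_succ,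
        Finset.prod_range_succ]
      have t1 := tri_add_one m
      have t2 := tri_add_one (m + -1)
      rw [show m + -1 + 1 = m by ring] at t2
      rw [t1, show tri (m + -1) = tri m + -(m + -1) by linarith]
      have hn : (-1 : ℂ) ≠ 0 := by norm_num
      simp only [Nat.cast_add, Nat.cast_one, zpow_add₀ h0, zpow_add₀ hz, zpow_add₀ hn, zpow_sub₀ h0,
        zpow_neg, zpow_one, zpow_natCast]
      have hm : q ^ m ≠ 0 := zpow_ne_zero _ h0
      field_simp
      ring
    · have hz2 : z * z⁻¹ = 1 := mul_inv_cancel₀ hz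
      linear_combination (-(∏ i ∈ Finset.range N, ((1 - z * q ^ i) * (1 - q * z⁻¹ * q ^ i)))
        * q ^ (2 * N + 1)) * (-hz2)

/-- The Jacobi triple product identity. -/
theorem theta_eq_prod {q z : ℂ} (h0 : q ≠ 0) (h1 : ‖q‖ < 1) (hz : z ≠ 0) :
    theta q z = qpoch q q * qpoch q z * qpoch q (q * z⁻¹) := by
  obtain ⟨B, hB, hBk⟩ := exists_qfactInv_bound h1
  have hJ : qpoch q q ≠ 0 :=
    qpoch_ne_zero h1 fun k h => one_sub_pow_ne_zero h1 k (by rw [h]; ring)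
  have hP : Tendsto (fun n : ℕ => ∏ i ∈ Finset.range (2 * n), (1 - q * q ^ i)) atTop
      (𝓝 (qpoch q q)) :=
    (tendsto_qpoch h1 q).comp (tendsto_id.const_mul_atTop' (by norm_num : 0 < 2))
  obtain ⟨A, hA⟩ := hP.norm.bddAbove_range
  have hA' : 0 ≤ A := (norm_nonneg _).trans (hA ⟨0, rfl⟩)
  have key := tendsto_tsum_of_dominated_convergence (𝓕 := atTop)
    (f := fun (N : ℕ) (m : ℤ) => (∏ i ∈ Finset.range (2 * N), (1 - q * q ^ i)) *
      (qfactInv q (N - m) * qfactInv q (N + m)) * ((-1) ^ m * q ^ tri m * z ^ m))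
    (g := fun m => (qpoch q q) * ((qpoch q q)⁻¹ * (qpoch q q)⁻¹) * ((-1) ^ m * q ^ tri m * z ^ m))
    (bound := fun m => A * (B * B) * ‖(-1) ^ m * q ^ tri m * z ^ m‖)
    ((summable_theta h0 h1 hz).norm.mul_left _) (fun m => ?_)
    (Eventually.of_forall fun N m => ?_)
  · have k2 : Tendsto (fun N : ℕ => ∏ i ∈ Finset.range N,
        ((1 - z * q ^ i) * (1 - q * z⁻¹ * q ^ i))) atTop
        (𝓝 (qpoch q z * qpoch q (q * z⁻¹))) := by
      simp_rw [Finset.prod_mul_distrib]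
      exact (tendsto_qpoch h1 _).mul (tendsto_qpoch h1 _)
    have := tendsto_nhds_unique (key.congr fun N => (finite_triple_product h0 h1 hz N).tsum_eq) k2
    rw [tsum_mul_left, mul_inv_cancel_left₀ hJ] at this
    rw [mul_assoc, ← this]
    unfold theta
    field_simp
  · refine (hP.mul ((?_ : Tendsto _ _ _).mul (tendsto_qfactInv h1 m))).mul_const _
    simpa [sub_eq_add_neg] using tendsto_qfactInv h1 (-m)
  · rw [norm_mul, norm_mul, norm_mul]
    gcongr
    · exact hA ⟨N, rfl⟩
    · exact hBk _
    · exact hBk _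

theorem theta_ne_zero {q z : ℂ} (h0 : q ≠ 0) (h1 : ‖q‖ < 1) (hz : z ≠ 0)
    (h : ∀ k : ℤ, z * q ^ k ≠ 1) : theta q z ≠ 0 := by
  rw [theta_eq_prod h0 h1 hz]
  refine mul_ne_zero (mul_ne_zero (qpoch_ne_zero h1 fun k h => one_sub_pow_ne_zero h1 k
    (by rw [h]; ring)) (qpoch_ne_zero h1 fun k => ?_)) (qpoch_ne_zero h1 fun k hk => ?_)
  · exact_mod_cast h k
  · apply h (-(k + 1))
    rw [zpow_neg, zpow_add_one₀ h0, zpow_natCast]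
    field_simp at hk
    have : q ^ k * q ≠ 0 := mul_ne_zero (pow_ne_zero _ h0) h0
    field_simp
    rw [← hk]
    ring

/-- `θ(z) / (1 - z)` tends to `(q; q)_∞ ^ 3` at `z = 1`. -/
theorem tendsto_theta_div {q : ℂ} (h0 : q ≠ 0) (h1 : ‖q‖ < 1) :
    Tendsto (fun z => theta q z / (1 - z)) (𝓝[≠] 1) (𝓝 (qpoch q q ^ 3)) := by
  have : Tendsto (fun z => qpoch q q * qpoch q (z * q) * qpoch q (q * z⁻¹)) (𝓝[≠] 1)
      (𝓝 (qpoch q q * qpoch q (1 * q) * qpoch q (q * 1⁻¹))) := by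
    refine Tendsto.mono_left ?_ nhdsWithin_le_nhds
    refine (Tendsto.mul tendsto_const_nhds ?_).mul ?_
    · exact (continuousAt_qpoch h1 _).tendsto.comp
        (Continuous.tendsto (f := fun z : ℂ => z * q) (by fun_prop) 1)
    · refine (continuousAt_qpoch h1 _).tendsto.comp ?_
      exact (continuousAt_const.mul (continuousAt_inv₀ one_ne_zero)).tendsto
  rw [show qpoch q q ^ 3 = qpoch q q * qpoch q (1 * q) * qpoch q (q * 1⁻¹) by simp; ring]
  refine this.congr' ?_
  have hne : ∀ᶠ z : ℂ in 𝓝[≠] 1, z ≠ 0 :=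
    nhdsWithin_le_nhds (continuousAt_id.eventually_ne one_ne_zero)
  filter_upwards [hne, self_mem_nhdsWithin] with z hz hz1
  have : 1 - z ≠ 0 := sub_ne_zero.2 (Ne.symm hz1)
  rw [theta_eq_prod h0 h1 hz, qpoch_eq_mul h1 z]
  field_simp

/-- Splitting of pairs of integers according to the parity of their sum. -/
def intPairParity : (ℤ × ℤ) ⊕ (ℤ × ℤ) ≃ ℤ × ℤ where
  toFun := Sum.elim (fun p => (p.1 + p.2, p.1 - p.2)) (fun p => (p.1 + p.2, p.1 - p.2 - 1))
  invFun p := if (p.1 + p.2) % 2 = 0 then Sum.inl ((p.1 + p.2) / 2, (p.1 - p.2) / 2)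
    else Sum.inr ((p.1 + p.2 + 1) / 2, (p.1 - p.2 - 1) / 2)
  left_inv := by
    rintro (⟨i, k⟩ | ⟨i, k⟩)
    · refine (if_pos (show (i + k + (i - k)) % 2 = 0 by omega)).trans ?_
      refine congrArg Sum.inl (Prod.ext ?_ ?_)
      · show (i + k + (i - k)) / 2 = i; omega
      · show (i + k - (i - k)) / 2 = k; omega
    · refine (if_neg (show ¬ (i + k + (i - k - 1)) % 2 = 0 by omega)).trans ?_
      refine congrArg Sum.inr (Prod.ext ?_ ?_)
      · show (i + k + (i - k - 1) + 1) / 2 = i; omega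
      · show (i + k - (i - k - 1) - 1) / 2 = k; omega
  right_inv := by
    rintro ⟨m, n⟩
    simp only
    split_ifs with h
    · simp only [Sum.elim_inl]
      congr 1 <;> omega
    · simp only [Sum.elim_inr]
      congr 1 <;> omega

theorem tsum_int_prod_parity {F : ℤ × ℤ → ℂ} (hF : Summable F) :
    ∑' p, F p = ∑' p : ℤ × ℤ, F (p.1 + p.2, p.1 - p.2) +
      ∑' p : ℤ × ℤ, F (p.1 + p.2, p.1 - p.2 - 1) := by
  rw [← intPairParity.tsum_eq]
  have hs := intPairParity.summable_iff.2 hF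
  exact (HasSum.sum (hs.comp_injective Sum.inl_injective).hasSum
    (hs.comp_injective Sum.inr_injective).hasSum).tsum_eq

theorem theta_sq_term_neg (q x : ℂ) (n : ℤ) :
    (-1) ^ n * (q ^ 2) ^ tri n * (-x ^ 2) ^ n = q ^ (2 * tri n) * x ^ (2 * n) := by
  rw [neg_eq_neg_one_mul (x ^ 2), mul_zpow, zpow_mul, zpow_mul, zpow_ofNat, zpow_ofNat]
  have : ((-1 : ℂ) ^ n) * (-1) ^ n = 1 := by rw [← mul_zpow]; simp
  linear_combination ((q ^ 2) ^ tri n * (x ^ 2) ^ n) * this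

theorem theta_sq_term_neg_mul {q : ℂ} (h0 : q ≠ 0) (x : ℂ) (n : ℤ) :
    (-1) ^ n * (q ^ 2) ^ tri n * (-(q * x ^ 2)) ^ n = q ^ (2 * tri n + n) * x ^ (2 * n) := by
  rw [neg_eq_neg_one_mul (q * x ^ 2), mul_zpow, mul_zpow, zpow_add₀ h0, zpow_mul, zpow_mul, zpow_ofNat,
    zpow_ofNat]
  have : ((-1 : ℂ) ^ n) * (-1) ^ n = 1 := by rw [← mul_zpow]; simp
  linear_combination ((q ^ 2) ^ tri n * q ^ n * (x ^ 2) ^ n) * this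

theorem theta_mul_theta {q x y : ℂ} (h0 : q ≠ 0) (h1 : ‖q‖ < 1) (hx : x ≠ 0) (hy : y ≠ 0) :
    theta q (x * y) * theta q (x * y⁻¹) =
      theta (q ^ 2) (-x ^ 2) * theta (q ^ 2) (-(q * y ^ 2)) -
      x * y⁻¹ * theta (q ^ 2) (-(q * x ^ 2)) * theta (q ^ 2) (-y ^ 2) := by
  have h0' : q ^ 2 ≠ 0 := pow_ne_zero _ h0
  have h1' : ‖q ^ 2‖ < 1 := by rw [norm_pow]; exact pow_lt_one₀ (norm_nonneg _) h1 two_ne_zero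
  have s1 := summable_theta h0 h1 (mul_ne_zero hx hy)
  have s2 := summable_theta h0 h1 (mul_ne_zero hx (inv_ne_zero hy))
  have s3 := summable_theta h0' h1' (neg_ne_zero.2 (pow_ne_zero 2 hx))
  have s4 := summable_theta h0' h1' (neg_ne_zero.2 (mul_ne_zero h0 (pow_ne_zero 2 hy)))
  have s5 := summable_theta h0' h1' (neg_ne_zero.2 (mul_ne_zero h0 (pow_ne_zero 2 hx)))
  have s6 := summable_theta h0' h1' (neg_ne_zero.2 (pow_ne_zero 2 hy))
  have hn : (-1 : ℂ) ≠ 0 := by norm_num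
  unfold theta
  rw [tsum_mul_tsum_of_summable_norm s1.norm s2.norm,
    tsum_int_prod_parity (summable_mul_of_summable_norm s1.norm s2.norm),
    tsum_mul_tsum_of_summable_norm s3.norm s4.norm, mul_assoc,
    tsum_mul_tsum_of_summable_norm s5.norm s6.norm, sub_eq_add_neg]
  have aux : ∀ m n i k s : ℤ, m + n = 2 * i → m - n = 2 * k → s = tri m + tri n →
      (-1 : ℂ) ^ m * q ^ tri m * (x * y) ^ m * ((-1) ^ n * q ^ tri n * (x * y⁻¹) ^ n) =
        q ^ s * x ^ (2 * i) * y ^ (2 * k) := by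
    intro m n i k s h1 h2 h3
    have : ((-1 : ℂ) ^ m) * (-1) ^ n = 1 := by
      rw [← zpow_add₀ hn, h1]
      exact (even_two_mul i).neg_one_zpow
    rw [h3, ← h1, ← h2, zpow_add₀ h0, zpow_add₀ hx, zpow_sub₀ hy, mul_zpow, mul_zpow, inv_zpow]
    field_simp
    linear_combination this
  have aux' : ∀ m n i k s : ℤ, m + n = 2 * i + 1 → m - n = 2 * k - 1 → s = tri m + tri n →
      (-1 : ℂ) ^ m * q ^ tri m * (x * y) ^ m * ((-1) ^ n * q ^ tri n * (x * y⁻¹) ^ n) =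
        - (q ^ s * (x ^ (2 * i) * x) * (y ^ (2 * k) * y⁻¹)) := by
    intro m n i k s h1 h2 h3
    have : ((-1 : ℂ) ^ m) * (-1) ^ n = -1 := by
      rw [← zpow_add₀ hn, h1]
      exact Odd.neg_one_zpow ⟨i, rfl⟩
    rw [h3, ← zpow_add_one₀ hx, ← zpow_sub_one₀ hy, ← h1, ← h2, zpow_add₀ h0, zpow_add₀ hx,
      zpow_sub₀ hy, mul_zpow, mul_zpow, inv_zpow]
    field_simp
    linear_combination this
  congr 1
  · refine tsum_congr fun ⟨i, k⟩ => ?_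
    have t1 := two_mul_tri (i + k)
    have t2 := two_mul_tri (i - k)
    have t3 := two_mul_tri i
    have t4 := two_mul_tri k
    simp only
    rw [theta_sq_term_neg, theta_sq_term_neg_mul h0, aux (i + k) (i - k) i k
      (2 * tri i + (2 * tri k + k)) (by ring) (by ring) (by nlinarith), zpow_add₀ h0]
    ring
  · rw [← tsum_mul_left, ← tsum_neg, ← ((Equiv.addRight (1 : ℤ)).prodCongr
      (Equiv.subRight (1 : ℤ))).tsum_eq]
    refine tsum_congr fun ⟨i, k⟩ => ?_
    have t1 := two_mul_tri (i + k)
    have t2 := two_mul_tri (i - k + 1)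
    have t3 := two_mul_tri i
    have t4 := two_mul_tri k
    simp only [Equiv.prodCongr_apply, Prod.map, Equiv.coe_addRight, Equiv.subRight_apply]
    rw [theta_sq_term_neg, theta_sq_term_neg_mul h0, aux' _ _ i k
      ((2 * tri i + i) + 2 * tri k) (by ring) (by ring) ?_, zpow_add₀ h0]
    · ring
    · rw [show i + 1 + (k - 1) = i + k by ring, show i + 1 - (k - 1) - 1 = i - k + 1 by ring]
      nlinarith

/-- The three-term relation for the theta function. -/
theorem theta_three_term {q x y z w : ℂ} (h0 : q ≠ 0) (h1 : ‖q‖ < 1) (hx : x ≠ 0) (hy : y ≠ 0)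
    (hz : z ≠ 0) (hw : w ≠ 0) :
    theta q (x * y) * theta q (x * y⁻¹) * (theta q (z * w) * theta q (z * w⁻¹)) * y -
      theta q (x * z) * theta q (x * z⁻¹) * (theta q (y * w) * theta q (y * w⁻¹)) * z +
      theta q (x * w) * theta q (x * w⁻¹) * (theta q (y * z) * theta q (y * z⁻¹)) * z = 0 := by
  simp only [theta_mul_theta h0 h1, hx, hy, hz, hw, ne_eq, not_false_eq_true]
  field_simp
  ring

theorem norm_lt_one_pow {q : ℂ} (h1 : ‖q‖ < 1) {n : ℕ} (hn : n ≠ 0) : ‖q ^ n‖ < 1 := by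
  rw [norm_pow]
  exact pow_lt_one₀ (norm_nonneg _) h1 hn

theorem qpoch_self_ne_zero {q : ℂ} (h1 : ‖q‖ < 1) : qpoch q q ≠ 0 :=
  qpoch_ne_zero h1 fun k h => one_sub_pow_ne_zero h1 k (by rw [h]; ring)

theorem hasDerivAt_theta {q z : ℂ} (h0 : q ≠ 0) (h1 : ‖q‖ < 1) (hz : z ≠ 0) :
    HasDerivAt (theta q) (deriv (theta q) z) z :=
  (differentiableAt_theta h0 h1 hz).hasDerivAt

theorem deriv_theta_one {q : ℂ} (h0 : q ≠ 0) (h1 : ‖q‖ < 1) :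
    deriv (theta q) 1 = -qpoch q q ^ 3 := by
  have h := (hasDerivAt_iff_tendsto_slope.1 (hasDerivAt_theta h0 h1 one_ne_zero))
  refine tendsto_nhds_unique h ((tendsto_theta_div h0 h1).neg.congr' ?_)
  filter_upwards [self_mem_nhdsWithin] with z hz
  have h1 : 1 - z ≠ 0 := sub_ne_zero.2 (Ne.symm hz)
  have h2 : z - 1 ≠ 0 := sub_ne_zero.2 hz
  rw [slope_def_field, theta_one]
  field_simp
  ring

/-- The logarithmic derivative `z θ'(z) / θ(z)`. -/
noncomputable def thetaLog (q z : ℂ) : ℂ := z * deriv (theta q) z / theta q z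

theorem theta_inv_ne_zero {q z : ℂ} (hz : z ≠ 0) (ht : theta q z ≠ 0) : theta q z⁻¹ ≠ 0 := by
  rw [theta_inv hz]
  exact mul_ne_zero (neg_ne_zero.2 (inv_ne_zero hz)) ht

theorem thetaLog_inv {q z : ℂ} (h0 : q ≠ 0) (h1 : ‖q‖ < 1) (hz : z ≠ 0) (ht : theta q z ≠ 0) :
    thetaLog q z⁻¹ = 1 - thetaLog q z := by
  have d1 : HasDerivAt (fun x => theta q x⁻¹) (deriv (theta q) z⁻¹ * (-(z ^ 2)⁻¹)) z :=
    (hasDerivAt_theta h0 h1 (inv_ne_zero hz)).comp z (hasDerivAt_inv hz)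
  have d2 := ((hasDerivAt_inv hz).neg).mul (hasDerivAt_theta h0 h1 hz)
  have he : (fun x => theta q x⁻¹) =ᶠ[𝓝 z] (-Inv.inv) * theta q := by
    filter_upwards [isOpen_ne.mem_nhds hz] with x hx
    simp [theta_inv hx]
  have := (d1.congr_of_eventuallyEq he.symm).unique d2
  unfold thetaLog
  rw [theta_inv hz]
  simp only [Pi.neg_apply] at this
  field_simp at this ⊢
  linear_combination this

theorem thetaLog_mul_base {q z : ℂ} (h0 : q ≠ 0) (h1 : ‖q‖ < 1) (hz : z ≠ 0)
    (ht : theta q z ≠ 0) : thetaLog q (q * z) = thetaLog q z - 1 := by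
  have d0 : HasDerivAt (fun x : ℂ => q * x) q z := by simpa using (hasDerivAt_id z).const_mul q
  have d1 : HasDerivAt (fun x => theta q (q * x)) (deriv (theta q) (q * z) * q) z :=
    (hasDerivAt_theta h0 h1 (mul_ne_zero h0 hz)).comp z d0
  have d2 := ((hasDerivAt_inv hz).neg).mul (hasDerivAt_theta h0 h1 hz)
  have he : (fun x => theta q (q * x)) =ᶠ[𝓝 z] (-Inv.inv) * theta q := by
    filter_upwards [isOpen_ne.mem_nhds hz] with x hx
    simp [theta_mul_base h0 hx]
  have := (d1.congr_of_eventuallyEq he.symm).unique d2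
  unfold thetaLog
  rw [theta_mul_base h0 hz]
  simp only [Pi.neg_apply] at this
  field_simp at this ⊢
  linear_combination -this

/-- The addition formula for the logarithmic derivative of theta. -/
theorem thetaLog_add {q a b c : ℂ} (h0 : q ≠ 0) (h1 : ‖q‖ < 1) (ha : a ≠ 0) (hb : b ≠ 0)
    (hc : c ≠ 0) (ta : theta q a ≠ 0) (tb : theta q b ≠ 0) (tc : theta q c ≠ 0)
    (tabc : theta q (a * b * c) ≠ 0) :
    thetaLog q a + thetaLog q b + thetaLog q c - thetaLog q (a * b * c) - 1 =
      -(qpoch q q ^ 3 * (theta q (a * b) * theta q (b * c) * theta q (a * c)) /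
        (theta q a * theta q b * theta q c * theta q (a * b * c))) := by
  obtain ⟨w, hw⟩ := IsAlgClosed.exists_pow_nat_eq (a * c) two_pos
  have hw0 : w ≠ 0 := by
    rintro rfl
    exact mul_ne_zero ha hc (by simpa using hw.symm)
  obtain ⟨x, rfl⟩ : ∃ x, a = x * w := ⟨a / w, by field_simp⟩
  have hx : x ≠ 0 := left_ne_zero_of_mul ha
  obtain rfl : c = w / x := by
    rw [eq_div_iff hx]
    exact mul_left_cancel₀ hw0 (by linear_combination -hw)
  obtain ⟨z, rfl⟩ : ∃ z, b = z / w := ⟨b * w, by field_simp⟩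
  have hz : z ≠ 0 := fun h => hb (by simp [h])
  have D : ∀ {p : ℂ} {f : ℂ → ℂ} {f' : ℂ}, HasDerivAt f f' w → f w = p → p ≠ 0 →
      HasDerivAt (fun y => theta q (f y)) (deriv (theta q) p * f') w := by
    intro p f f' hf hp hp0
    subst hp
    exact (hasDerivAt_theta h0 h1 hp0).comp w hf
  have e1 : HasDerivAt (fun y : ℂ => x * y) x w := by simpa using (hasDerivAt_id w).const_mul x
  have e2 : HasDerivAt (fun y : ℂ => x * y⁻¹) (x * -(w ^ 2)⁻¹) w :=
    (hasDerivAt_inv hw0).const_mul x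
  have e3 : HasDerivAt (fun y : ℂ => y * w) w w := by simpa using (hasDerivAt_id w).mul_const w
  have e4 : HasDerivAt (fun y : ℂ => y * w⁻¹) w⁻¹ w := by
    simpa using (hasDerivAt_id w).mul_const w⁻¹
  have e5 : HasDerivAt (fun y : ℂ => y * z) z w := by simpa using (hasDerivAt_id w).mul_const z
  have e6 : HasDerivAt (fun y : ℂ => y * z⁻¹) z⁻¹ w := by
    simpa using (hasDerivAt_id w).mul_const z⁻¹
  have d1 := D e1 rfl (mul_ne_zero hx hw0)
  have d2 := D e2 rfl (mul_ne_zero hx (inv_ne_zero hw0))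
  have d3 := D e3 rfl (mul_ne_zero hw0 hw0)
  have d4 := D e4 (mul_inv_cancel₀ hw0) one_ne_zero
  have d5 := D e5 rfl (mul_ne_zero hw0 hz)
  have d6 := D e6 rfl (mul_ne_zero hw0 (inv_ne_zero hz))
  have dF := ((((d1.mul d2).mul_const (theta q (z * w) * theta q (z * w⁻¹))).mul
    (hasDerivAt_id w)).sub (((d3.mul d4).const_mul (theta q (x * z) * theta q (x * z⁻¹))).mul_const
    z)).add (((d5.mul d6).const_mul (theta q (x * w) * theta q (x * w⁻¹))).mul_const z)
  have hF := dF.congr_of_eventuallyEq (f₁ := fun _ => (0 : ℂ)) (by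
    filter_upwards [isOpen_ne.mem_nhds hw0] with y hy
    simp only [Pi.add_apply, Pi.sub_apply, Pi.mul_apply, id]
    exact (theta_three_term h0 h1 hx hy hz hw0).symm)
  have key := hF.unique (hasDerivAt_const w (0 : ℂ))
  simp only [Pi.mul_apply, mul_inv_cancel₀ hw0, theta_one, deriv_theta_one h0 h1, id] at key
  have b1 : w * z⁻¹ = (z / w)⁻¹ := by field_simp
  have b2 : x * w⁻¹ = (w / x)⁻¹ := by field_simp
  have b3 : x * w * (z / w) * (w / x) = z * w := by field_simp
  have b4 : x * w * (z / w) = x * z := by field_simp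
  have b5 : z / w * (w / x) = (x * z⁻¹)⁻¹ := by field_simp
  have b6 : x * w * (w / x) = w * w := by field_simp
  have hxz : x * z⁻¹ ≠ 0 := mul_ne_zero hx (inv_ne_zero hz)
  have l1 := thetaLog_inv h0 h1 hb tb
  have l2 := thetaLog_inv h0 h1 hc tc
  rw [← b1] at l1
  rw [← b2] at l2
  have t1 := theta_inv (q := q) hb
  have t2 := theta_inv (q := q) hc
  rw [← b1] at t1
  rw [← b2] at t2
  have n1 : theta q (w * z⁻¹) ≠ 0 := b1 ▸ theta_inv_ne_zero hb tb
  have n2 : theta q (x * w⁻¹) ≠ 0 := b2 ▸ theta_inv_ne_zero hc tc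
  rw [b3] at tabc ⊢
  rw [b4, b5, b6, theta_inv hxz]
  have dl : ∀ {p}, p ≠ 0 → theta q p ≠ 0 → deriv (theta q) p = thetaLog q p * theta q p / p := by
    intro p hp0 hp
    unfold thetaLog
    field_simp
  rw [mul_comm z w] at key tabc ⊢
  rw [dl (mul_ne_zero hx hw0) ta, dl (mul_ne_zero hx (inv_ne_zero hw0)) n2,
    dl (mul_ne_zero hw0 hz) tabc, dl (mul_ne_zero hw0 (inv_ne_zero hz)) n1, l1, l2, t1, t2,
    ← div_eq_mul_inv z w] at key
  clear hF dF d1 d2 d3 d4 d5 d6 e1 e2 e3 e4 e5 e6 D dl l1 l2 t1 t2 n1 n2 b1 b2 b3 b4 b5 b6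
  have hJ := qpoch_self_ne_zero h1
  generalize thetaLog q (x * w) = L1 at *
  generalize thetaLog q (z / w) = L2 at *
  generalize thetaLog q (w / x) = L3 at *
  generalize thetaLog q (w * z) = L4 at *
  generalize theta q (x * w) = T1 at *
  generalize theta q (z / w) = T2 at *
  generalize theta q (w / x) = T3 at *
  generalize theta q (w * z) = T4 at *
  generalize theta q (x * z) = T5 at *
  generalize theta q (x * z⁻¹) = T6 at *
  generalize theta q (w * w) = T7 at *
  generalize qpoch q q = J at *
  have hzw : z / w ≠ 0 := hb
  field_simp at key ⊢
  linear_combination -key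

/-- `f` has at worst a removable singularity at `p`. -/
def IsRemovableAt (f : ℂ → ℂ) (p : ℂ) : Prop := ∃ g, AnalyticAt ℂ g p ∧ f =ᶠ[𝓝[≠] p] g

theorem AnalyticAt.isRemovableAt {f : ℂ → ℂ} {p : ℂ} (h : AnalyticAt ℂ f p) : IsRemovableAt f p :=
  ⟨f, h, EventuallyEq.rfl⟩

theorem IsRemovableAt.congr {f g : ℂ → ℂ} {p : ℂ} (h : IsRemovableAt f p)
    (hg : f =ᶠ[𝓝[≠] p] g) : IsRemovableAt g p := by
  obtain ⟨F, hF, he⟩ := h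
  exact ⟨F, hF, hg.symm.trans he⟩

theorem IsRemovableAt.comp_mul {f : ℂ → ℂ} {p a : ℂ} (ha : a ≠ 0) (hf : IsRemovableAt f (a * p)) :
    IsRemovableAt (fun z => f (a * z)) p := by
  obtain ⟨F, hF, he⟩ := hf
  have hc : ContinuousAt (fun z : ℂ => a * z) p := by fun_prop
  refine ⟨fun z => F (a * z), hF.comp (f := fun z => a * z) (by fun_prop), ?_⟩
  have ht : Tendsto (fun z : ℂ => a * z) (𝓝[≠] p) (𝓝[≠] (a * p)) := by
    refine tendsto_nhdsWithin_iff.2 ⟨hc.tendsto.mono_left nhdsWithin_le_nhds, ?_⟩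
    filter_upwards [self_mem_nhdsWithin] with z hz h
    exact hz (mul_left_cancel₀ ha h)
  exact ht.eventually he

/-- The quotient of two analytic functions is removable at a simple zero of the denominator where
the numerator vanishes. -/
theorem isRemovableAt_div {f g : ℂ → ℂ} {p : ℂ} (hf : AnalyticAt ℂ f p) (hg : AnalyticAt ℂ g p)
    (hfp : f p = 0) (hgp : g p = 0) (hg' : deriv g p ≠ 0) : IsRemovableAt (fun z => f z / g z) p := by
  have key : ∀ {f : ℂ → ℂ}, AnalyticAt ℂ f p → AnalyticAt ℂ (dslope f p) p := by
    rintro f ⟨s, hs⟩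
    exact ⟨_, hs.has_fpower_series_dslope_fslope⟩
  refine ⟨fun z => dslope f p z / dslope g p z, (key hf).div (key hg) (by rwa [dslope_same]), ?_⟩
  filter_upwards [self_mem_nhdsWithin] with z hz
  have hz' : z - p ≠ 0 := sub_ne_zero.2 hz
  rw [dslope_of_ne _ hz, dslope_of_ne _ hz, slope_def_field, slope_def_field, hfp, hgp]
  field_simp
  simp

theorem exists_zpow_mul_norm_mem {q : ℂ} (h0 : q ≠ 0) (h1 : ‖q‖ < 1) {z : ℂ} (hz : z ≠ 0) :
    ∃ n : ℤ, ‖q‖ ≤ ‖q ^ n * z‖ ∧ ‖q ^ n * z‖ ≤ 1 := by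
  have hq := norm_pos_iff.2 h0
  obtain ⟨n, hn⟩ := exists_mem_Ioc_zpow (norm_pos_iff.2 hz) ((one_lt_inv₀ hq).2 h1)
  rw [inv_zpow, inv_zpow, Set.mem_Ioc, zpow_add_one₀ hq.ne'] at hn
  have hp := zpow_pos hq n
  refine ⟨n + 1, ?_, ?_⟩
  · rw [norm_mul, norm_zpow, zpow_add_one₀ hq.ne']
    have := (inv_lt_iff_one_lt_mul₀ hp).1 hn.1
    nlinarith
  · rw [norm_mul, norm_zpow, zpow_add_one₀ hq.ne', mul_comm]
    have h2 := hn.2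
    rw [inv_eq_one_div, le_div_iff₀ (by positivity)] at h2
    linarith

/-- Liouville's theorem for multiplicatively periodic functions on the punctured plane. -/
theorem eventually_eq_const_of_periodic {q : ℂ} (h0 : q ≠ 0) (h1 : ‖q‖ < 1) {f : ℂ → ℂ}
    (hper : ∀ z, z ≠ 0 → f (q * z) = f z)
    (hrem : ∀ p, p ≠ 0 → ∃ n : ℤ, IsRemovableAt f (q ^ n * p)) :
    ∃ c, ∀ p, p ≠ 0 → f =ᶠ[𝓝[≠] p] fun _ => c := by
  have hper' : ∀ (n : ℤ) z, z ≠ 0 → f (q ^ n * z) = f z := by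
    intro n
    induction n with
    | zero => simp
    | succ n ih =>
      intro z hz
      rw [zpow_add_one₀ h0, mul_assoc, ih _ (mul_ne_zero h0 hz), hper z hz]
    | pred n ih =>
      intro z hz
      rw [← ih z hz, ← hper _ (mul_ne_zero (zpow_ne_zero _ h0) hz), ← mul_assoc,
        ← zpow_one_add₀ h0]
      ring_nf
  have hne : ∀ p : ℂ, p ≠ 0 → ∀ᶠ z in 𝓝[≠] p, z ≠ 0 := fun p hp =>
    nhdsWithin_le_nhds (isOpen_ne.mem_nhds hp)
  have hrem' : ∀ p, p ≠ 0 → IsRemovableAt f p := by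
    intro p hp
    obtain ⟨n, hn⟩ := hrem p hp
    refine (hn.comp_mul (zpow_ne_zero n h0)).congr ?_
    filter_upwards [hne p hp] with z hz using hper' n z hz
  set F : ℂ → ℂ := fun z => limUnder (𝓝[≠] z) f with hF
  have hFg : ∀ {p : ℂ} {g : ℂ → ℂ}, AnalyticAt ℂ g p → f =ᶠ[𝓝[≠] p] g → F p = g p := by
    intro p g hg he
    exact ((hg.continuousAt.tendsto.mono_left nhdsWithin_le_nhds).congr' he.symm).limUnder_eq
  have hloc : ∀ p, p ≠ 0 → ∃ g, AnalyticAt ℂ g p ∧ f =ᶠ[𝓝[≠] p] g ∧ F =ᶠ[𝓝 p] g := by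
    intro p hp
    obtain ⟨g, hg, he⟩ := hrem' p hp
    refine ⟨g, hg, he, ?_⟩
    have h2 := eventually_eventually_nhdsWithin.2 he
    rw [eventually_nhdsWithin_iff] at h2
    filter_upwards [hg.eventually_analyticAt, h2] with z hz hz2
    by_cases h : z = p
    · subst h
      exact hFg hg he
    · refine hFg hz ?_
      have h3 := hz2 h
      rw [isOpen_compl_singleton.nhdsWithin_eq (show z ∈ ({p}ᶜ : Set ℂ) from h)] at h3
      exact h3.filter_mono nhdsWithin_le_nhds
  have hFd : ∀ p, p ≠ 0 → DifferentiableAt ℂ F p := fun p hp => by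
    obtain ⟨g, hg, -, he⟩ := hloc p hp
    exact hg.differentiableAt.congr_of_eventuallyEq he
  have hFper : ∀ (n : ℤ) z, z ≠ 0 → F (q ^ n * z) = F z := by
    intro n z hz
    have hqz : q ^ n * z ≠ 0 := mul_ne_zero (zpow_ne_zero _ h0) hz
    obtain ⟨g, hg, he⟩ := hrem' _ hqz
    rw [hFg hg he]
    have ha : q ^ n ≠ 0 := zpow_ne_zero n h0
    refine (hFg (g := fun w => g (q ^ n * w)) (hg.comp (f := fun w => q ^ n * w) (by fun_prop))
      ?_).symm
    have ht : Tendsto (fun z : ℂ => q ^ n * z) (𝓝[≠] z) (𝓝[≠] (q ^ n * z)) := by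
      refine tendsto_nhdsWithin_iff.2 ⟨?_, ?_⟩
      · exact (Continuous.tendsto (by fun_prop) z).mono_left nhdsWithin_le_nhds
      · filter_upwards [self_mem_nhdsWithin] with w hw h
        exact hw (mul_left_cancel₀ ha h)
    filter_upwards [ht.eventually he, hne z hz] with w hw hw0
    rw [← hw, hper' n w hw0]
  have hK : IsCompact {z : ℂ | ‖q‖ ≤ ‖z‖ ∧ ‖z‖ ≤ 1} := by
    refine (isCompact_closedBall (0 : ℂ) 1).of_isClosed_subset ?_ fun z hz => by simpa using hz.2
    exact (isClosed_le continuous_const continuous_norm).inter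
      (isClosed_le continuous_norm continuous_const)
  have hFc : ContinuousOn F {z : ℂ | ‖q‖ ≤ ‖z‖ ∧ ‖z‖ ≤ 1} := fun z hz =>
    (hFd z (norm_pos_iff.1 ((norm_pos_iff.2 h0).trans_le hz.1))).continuousAt.continuousWithinAt
  have hb := (hK.image_of_continuousOn hFc).isBounded
  have hd : Differentiable ℂ (F ∘ Complex.exp) := fun z =>
    (hFd _ (Complex.exp_ne_zero z)).comp z Complex.differentiable_exp.differentiableAt
  obtain ⟨c, hc⟩ := hd.exists_const_forall_eq_of_bounded (hb.subset (by
    rintro _ ⟨z, rfl⟩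
    obtain ⟨n, hn⟩ := exists_zpow_mul_norm_mem h0 h1 (Complex.exp_ne_zero z)
    exact ⟨_, hn, hFper n _ (Complex.exp_ne_zero z)⟩))
  refine ⟨c, fun p hp => ?_⟩
  obtain ⟨g, -, h2, h3⟩ := hloc p hp
  filter_upwards [h2, nhdsWithin_le_nhds h3, hne p hp] with z a b hz
  rw [a, ← b, ← Complex.exp_log hz]
  exact hc _

theorem eventually_norm_inv_one_sub_le {q p : ℂ} (h0 : q ≠ 0) (h1 : ‖q‖ < 1) (hp : p ≠ 0) (n₀ : ℤ)
    (hn : ∀ n, n ≠ n₀ → p * q ^ n ≠ 1) :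
    ∃ K : ℝ, 0 ≤ K ∧ ∀ᶠ z in 𝓝 p, ∀ n, n ≠ n₀ → 1 - z * q ^ n ≠ 0 ∧ ‖(1 - z * q ^ n)⁻¹‖ ≤ K := by
  have hq := norm_pos_iff.2 h0
  have hp' := norm_pos_iff.2 hp
  obtain ⟨N, hN⟩ := exists_pow_lt_of_lt_one (show 0 < (4 * ‖p‖)⁻¹ by positivity) h1
  obtain ⟨M, hM⟩ := exists_pow_lt_of_lt_one (show 0 < ‖p‖ / 4 by positivity) h1
  set s : Finset ℤ := (Finset.Icc (-(M : ℤ)) N).erase n₀ with hs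
  refine ⟨2 + ∑ n ∈ s, 2 * ‖(1 - p * q ^ n)⁻¹‖, by positivity, ?_⟩
  have e1 : ∀ᶠ z in 𝓝 p, ‖p‖ / 2 < ‖z‖ ∧ ‖z‖ < 2 * ‖p‖ := by
    have := (continuous_norm (E := ℂ)).tendsto p
    exact (this.eventually_const_lt (by linarith)).and (this.eventually_lt_const (by linarith))
  have e2 : ∀ᶠ z in 𝓝 p, ∀ n ∈ s, ‖1 - p * q ^ n‖ / 2 < ‖1 - z * q ^ n‖ := by
    rw [Finset.eventually_all]
    intro n hns
    have hne : 0 < ‖1 - p * q ^ n‖ :=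
      norm_pos_iff.2 (sub_ne_zero.2 (hn n (Finset.ne_of_mem_erase hns)).symm)
    have : Tendsto (fun z => ‖1 - z * q ^ n‖) (𝓝 p) (𝓝 ‖1 - p * q ^ n‖) :=
      Continuous.tendsto (by fun_prop) p
    exact this.eventually_const_lt (by linarith)
  filter_upwards [e1, e2] with z hz hz2 n hnn
  have hsum : ∀ m ∈ s, 2 * ‖(1 - p * q ^ m)⁻¹‖ ≤ ∑ n ∈ s, 2 * ‖(1 - p * q ^ n)⁻¹‖ := fun m hm =>
    Finset.single_le_sum (f := fun n => 2 * ‖(1 - p * q ^ n)⁻¹‖) (fun _ _ => by positivity) hm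
  have hsum0 : 0 ≤ ∑ n ∈ s, 2 * ‖(1 - p * q ^ n)⁻¹‖ := by positivity
  have aux : ∀ w : ℂ, 1 / 2 ≤ ‖w‖ → w ≠ 0 ∧ ‖w⁻¹‖ ≤ 2 + ∑ n ∈ s, 2 * ‖(1 - p * q ^ n)⁻¹‖ := by
    intro w hw
    refine ⟨norm_pos_iff.1 (by linarith), ?_⟩
    rw [norm_inv]
    have := inv_anti₀ (by norm_num) hw
    linarith
  have hqn : ‖z * q ^ n‖ = ‖z‖ * ‖q‖ ^ n := by rw [norm_mul, norm_zpow]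
  have hqp := zpow_pos hq n
  by_cases hnN : (N : ℤ) < n
  · have h2 : ‖q‖ ^ n ≤ ‖q‖ ^ (N : ℤ) := zpow_le_zpow_right_of_le_one₀ hq h1.le hnN.le
    rw [zpow_natCast] at h2
    have h3 : ‖q‖ ^ n < (4 * ‖p‖)⁻¹ := h2.trans_lt hN
    rw [inv_eq_one_div, lt_div_iff₀ (by positivity)] at h3
    apply aux
    have := norm_sub_norm_le (1 : ℂ) (z * q ^ n)
    rw [norm_one, hqn] at this
    nlinarith
  by_cases hnM : n < -(M : ℤ)
  · have h2 : ‖q‖ ^ (-(M : ℤ)) ≤ ‖q‖ ^ n := zpow_le_zpow_right_of_le_one₀ hq h1.le hnM.le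
    rw [zpow_neg, zpow_natCast] at h2
    have h3 : (‖p‖ / 4)⁻¹ < ‖q‖ ^ n := (inv_strictAnti₀ (by positivity) hM).trans_le h2
    rw [inv_div, div_lt_iff₀ hp'] at h3
    apply aux
    have := norm_sub_norm_le (z * q ^ n) (1 : ℂ)
    rw [norm_one, hqn, norm_sub_rev] at this
    nlinarith
  have hns : n ∈ s := by
    rw [hs, Finset.mem_erase, Finset.mem_Icc]
    exact ⟨hnn, not_lt.1 hnM, not_lt.1 hnN⟩
  have hne : 0 < ‖1 - p * q ^ n‖ := norm_pos_iff.2 (sub_ne_zero.2 (hn n hnn).symm)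
  have h2 := hz2 n hns
  refine ⟨norm_pos_iff.1 (by linarith), ?_⟩
  rw [norm_inv]
  have h3 := inv_anti₀ (by linarith) h2.le
  rw [inv_div] at h3
  have h4 := hsum n hns
  rw [norm_inv] at h4
  rw [div_eq_mul_inv] at h3
  linarith

/-- Local structure of `∑ c n / (1 - z q ^ n)`; the polar term at its pole is zero by convention. -/
theorem exists_analyticAt_appell {q p : ℂ} (h0 : q ≠ 0) (h1 : ‖q‖ < 1) (hp : p ≠ 0) {c : ℤ → ℂ}
    (hc : Summable fun n => ‖c n‖) (n₀ : ℤ) (hn : ∀ n, n ≠ n₀ → p * q ^ n ≠ 1) :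
    ∃ R : ℂ → ℂ, AnalyticAt ℂ R p ∧ ∀ᶠ z in 𝓝 p,
      Summable (fun n : ℤ => c n / (1 - z * q ^ n)) ∧
      ∑' n : ℤ, c n / (1 - z * q ^ n) = c n₀ / (1 - z * q ^ n₀) + R z := by
  obtain ⟨K, hK, he⟩ := eventually_norm_inv_one_sub_le h0 h1 hp n₀ hn
  obtain ⟨U, hU, hUo, hpU⟩ := eventually_nhds_iff.1 he
  set F : ℤ → ℂ → ℂ := fun n z => if n = n₀ then 0 else c n / (1 - z * q ^ n) with hF
  have hb : ∀ n z, z ∈ U → ‖F n z‖ ≤ K * ‖c n‖ := by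
    intro n z hz
    by_cases h : n = n₀
    · simp only [hF, h, if_true, norm_zero]; positivity
    · simp only [hF, h, if_false, div_eq_mul_inv, norm_mul]
      rw [mul_comm]
      exact mul_le_mul_of_nonneg_right (hU z hz n h).2 (norm_nonneg _)
  refine ⟨fun z => ∑' n, F n z, ?_, ?_⟩
  · refine DifferentiableOn.analyticAt (s := U) ?_ (hUo.mem_nhds hpU)
    refine Complex.differentiableOn_tsum_of_summable_norm (hc.mul_left K) ?_ hUo hb
    intro n z hz
    by_cases h : n = n₀
    · simp only [hF, h, if_true]; exact differentiableWithinAt_const _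
    · simp only [hF, h, if_false]
      refine DifferentiableAt.differentiableWithinAt ?_
      exact DifferentiableAt.div (by fun_prop) (by fun_prop) (hU z hz n h).1
  · filter_upwards [hUo.mem_nhds hpU] with z hz
    have hs0 : Summable (fun n => F n z) :=
      Summable.of_norm_bounded (hc.mul_left K) fun n => hb n z hz
    have hs : Summable (fun n : ℤ => c n / (1 - z * q ^ n)) := by
      rw [← (Set.finite_singleton n₀).summable_compl_iff] at hs0 ⊢
      refine hs0.congr fun n => ?_
      have : (n : ℤ) ≠ n₀ := n.2
      simp [hF, this]
    refine ⟨hs, ?_⟩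
    rw [hs.tsum_eq_add_tsum_ite n₀]

theorem analyticAt_appell {q p : ℂ} (h0 : q ≠ 0) (h1 : ‖q‖ < 1) (hp : p ≠ 0) {c : ℤ → ℂ}
    (hc : Summable fun n => ‖c n‖) (hn : ∀ n : ℤ, p * q ^ n ≠ 1) :
    AnalyticAt ℂ (fun z => ∑' n : ℤ, c n / (1 - z * q ^ n)) p := by
  obtain ⟨R, hR, he⟩ := exists_analyticAt_appell h0 h1 hp hc 0 fun n _ => hn n
  have hd : (1 : ℂ) - p * q ^ (0 : ℤ) ≠ 0 := sub_ne_zero.2 (hn 0).symm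
  have : AnalyticAt ℂ (fun z => c 0 / (1 - z * q ^ (0 : ℤ)) + R z) p :=
    (AnalyticAt.div (f := fun _ => c 0) (g := fun z => 1 - z * q ^ (0 : ℤ)) analyticAt_const
      (by fun_prop) hd).add hR
  exact this.congr (he.mono fun z hz => hz.2.symm)

/-- `f` extends analytically over `p` with value `v` there. -/
def HasRemovableValue (f : ℂ → ℂ) (p v : ℂ) : Prop :=
  ∃ g, AnalyticAt ℂ g p ∧ f =ᶠ[𝓝[≠] p] g ∧ g p = v

theorem HasRemovableValue.isRemovableAt {f : ℂ → ℂ} {p v : ℂ} (h : HasRemovableValue f p v) :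
    IsRemovableAt f p := by
  obtain ⟨g, h1, h2, -⟩ := h
  exact ⟨g, h1, h2⟩

theorem AnalyticAt.hasRemovableValue {f : ℂ → ℂ} {p : ℂ} (h : AnalyticAt ℂ f p) :
    HasRemovableValue f p (f p) := ⟨f, h, EventuallyEq.rfl, rfl⟩

theorem HasRemovableValue.add {f g : ℂ → ℂ} {p v w : ℂ} (hf : HasRemovableValue f p v)
    (hg : HasRemovableValue g p w) : HasRemovableValue (fun z => f z + g z) p (v + w) := by
  obtain ⟨F, hF, he, rfl⟩ := hf
  obtain ⟨G, hG, he', rfl⟩ := hg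
  exact ⟨fun z => F z + G z, hF.add hG, he.add he', rfl⟩

theorem HasRemovableValue.mul {f g : ℂ → ℂ} {p v w : ℂ} (hf : HasRemovableValue f p v)
    (hg : HasRemovableValue g p w) : HasRemovableValue (fun z => f z * g z) p (v * w) := by
  obtain ⟨F, hF, he, rfl⟩ := hf
  obtain ⟨G, hG, he', rfl⟩ := hg
  exact ⟨fun z => F z * G z, hF.mul hG, he.mul he', rfl⟩

theorem HasRemovableValue.congr {f g : ℂ → ℂ} {p v : ℂ} (h : HasRemovableValue f p v)
    (hg : ∀ z, g z = f z) : HasRemovableValue g p v := by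
  obtain rfl : g = f := funext hg
  exact h

theorem tendsto_mul_left_punctured {a p : ℂ} (ha : a ≠ 0) :
    Tendsto (fun z : ℂ => a * z) (𝓝[≠] p) (𝓝[≠] (a * p)) := by
  refine tendsto_nhdsWithin_iff.2 ⟨?_, ?_⟩
  · exact (Continuous.tendsto (by fun_prop) p).mono_left nhdsWithin_le_nhds
  · filter_upwards [self_mem_nhdsWithin] with z hz h
    exact hz (mul_left_cancel₀ ha h)

theorem HasRemovableValue.comp_mul {f : ℂ → ℂ} {p a b v : ℂ} (ha : a ≠ 0) (hb : a * p = b)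
    (hf : HasRemovableValue f b v) : HasRemovableValue (fun z => f (a * z)) p v := by
  subst hb
  obtain ⟨F, hF, he, rfl⟩ := hf
  exact ⟨fun z => F (a * z), hF.comp (f := fun z => a * z) (by fun_prop),
    (tendsto_mul_left_punctured ha).eventually he, rfl⟩

theorem HasRemovableValue.eq_of_const {f : ℂ → ℂ} {p v c : ℂ} (h : HasRemovableValue f p v)
    (hc : f =ᶠ[𝓝[≠] p] fun _ => c) : v = c := by
  obtain ⟨g, hg, he, rfl⟩ := h
  refine tendsto_nhds_unique (hg.continuousAt.tendsto.mono_left (nhdsWithin_le_nhds (s := {p}ᶜ)))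
    (tendsto_const_nhds.congr' ?_)
  exact hc.symm.trans he

theorem analyticAt_theta {q z : ℂ} (h0 : q ≠ 0) (h1 : ‖q‖ < 1) (hz : z ≠ 0) :
    AnalyticAt ℂ (theta q) z :=
  DifferentiableOn.analyticAt (s := {0}ᶜ)
    (fun _ hw => (differentiableAt_theta h0 h1 hw).differentiableWithinAt)
    (isOpen_compl_singleton.mem_nhds hz)

/-- The theta function with its zero at one divided out. -/
noncomputable def thetaQuot (q x : ℂ) : ℂ := -dslope (theta q) 1 x

theorem analyticAt_thetaQuot {q : ℂ} (h0 : q ≠ 0) (h1 : ‖q‖ < 1) :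
    AnalyticAt ℂ (thetaQuot q) 1 := by
  obtain ⟨s, hs⟩ := analyticAt_theta h0 h1 one_ne_zero
  exact AnalyticAt.neg ⟨_, hs.has_fpower_series_dslope_fslope⟩

theorem thetaQuot_one {q : ℂ} (h0 : q ≠ 0) (h1 : ‖q‖ < 1) : thetaQuot q 1 = qpoch q q ^ 3 := by
  rw [thetaQuot, dslope_same, deriv_theta_one h0 h1, neg_neg]

theorem theta_eq_mul_thetaQuot (q x : ℂ) : theta q x = (1 - x) * thetaQuot q x := by
  have h := sub_smul_dslope (theta q) 1 x
  rw [theta_one, sub_zero, smul_eq_mul] at h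
  rw [← h, thetaQuot]
  ring

theorem thetaQuot_inv {q x : ℂ} (hx : x ≠ 0) : thetaQuot q x⁻¹ = thetaQuot q x := by
  by_cases h1 : x = 1
  · simp [h1]
  have h := theta_inv (q := q) hx
  rw [theta_eq_mul_thetaQuot, theta_eq_mul_thetaQuot] at h
  have h2 : 1 - x ≠ 0 := sub_ne_zero.2 (Ne.symm h1)
  have hi : x * x⁻¹ = 1 := mul_inv_cancel₀ hx
  have h3 : (1 - x) * (thetaQuot q x⁻¹ - thetaQuot q x) = 0 := by linear_combination -x * h - (thetaQuot q x⁻¹ - (1 - x) * thetaQuot q x) * hi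
  exact sub_eq_zero.1 ((mul_eq_zero.1 h3).resolve_left h2)

theorem deriv_thetaQuot_one {q : ℂ} (h0 : q ≠ 0) (h1 : ‖q‖ < 1) : deriv (thetaQuot q) 1 = 0 := by
  have hd := (analyticAt_thetaQuot h0 h1).differentiableAt.hasDerivAt
  have hd' : HasDerivAt (thetaQuot q) (deriv (thetaQuot q) 1) (1 : ℂ)⁻¹ := by simpa using hd
  have h := hd'.comp (1 : ℂ) (hasDerivAt_inv one_ne_zero)
  have h2 : HasDerivAt (thetaQuot q) (deriv (thetaQuot q) 1 * -(1 ^ 2)⁻¹) 1 := by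
    refine h.congr_of_eventuallyEq ?_
    filter_upwards [isOpen_ne.mem_nhds (one_ne_zero (α := ℂ))] with z hz
    exact (thetaQuot_inv hz).symm
  have := hd.unique h2
  simp only [one_pow, inv_one, mul_neg, mul_one] at this
  exact self_eq_neg.1 this

theorem tendsto_div_theta_sub {q φ' : ℂ} {φ : ℂ → ℂ} (h0 : q ≠ 0) (h1 : ‖q‖ < 1)
    (hφ : HasDerivAt φ φ' 1) (hφ1 : φ 1 = 1) :
    Tendsto (fun x => qpoch q q ^ 3 * φ x / theta q x - 1 / (1 - x)) (𝓝[≠] 1) (𝓝 (-φ')) := by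
  have hJ : qpoch q q ^ 3 ≠ 0 := pow_ne_zero _ (qpoch_self_ne_zero h1)
  have hc := (analyticAt_thetaQuot h0 h1).differentiableAt.hasDerivAt
  rw [deriv_thetaQuot_one h0 h1] at hc
  have h2 := (hφ.const_mul (qpoch q q ^ 3)).sub hc
  have h3 := (hasDerivAt_iff_tendsto_slope.1 h2).neg
  have h4 : Tendsto (fun x => (thetaQuot q x)⁻¹) (𝓝[≠] 1) (𝓝 (qpoch q q ^ 3)⁻¹) := by
    have := hc.continuousAt.tendsto.mono_left (nhdsWithin_le_nhds (s := {1}ᶜ))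
    rw [thetaQuot_one h0 h1] at this
    exact this.inv₀ hJ
  have h5 := h3.mul h4
  have e : -(qpoch q q ^ 3 * φ' - 0) * (qpoch q q ^ 3)⁻¹ = -φ' := by
    linear_combination -φ' * mul_inv_cancel₀ hJ
  rw [e] at h5
  refine h5.congr' ?_
  have h6 : ∀ᶠ x in 𝓝[≠] (1 : ℂ), thetaQuot q x ≠ 0 := by
    refine nhdsWithin_le_nhds (hc.continuousAt.eventually_ne ?_)
    rwa [thetaQuot_one h0 h1]
  filter_upwards [h6, self_mem_nhdsWithin] with x hx hx1
  have hx2 : 1 - x ≠ 0 := sub_ne_zero.2 (Ne.symm hx1)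
  have hx3 : x - 1 ≠ 0 := sub_ne_zero.2 hx1
  rw [theta_eq_mul_thetaQuot q x, slope_def_field]
  simp only [Pi.sub_apply, hφ1, thetaQuot_one h0 h1]
  field_simp
  ring

/-- Coefficients of the Appell sum of level `k`. -/
noncomputable def appellCoeff (k : ℕ) (q w : ℂ) (n : ℤ) : ℂ :=
  (-1) ^ n * q ^ ((k : ℤ) * tri (n + 1)) * w ^ n

/-- The Appell sum of level `k`. -/
noncomputable def appell (k : ℕ) (q w z : ℂ) : ℂ :=
  ∑' n : ℤ, appellCoeff k q w n / (1 - z * q ^ n)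

theorem appellCoeff_eq {k : ℕ} {q w : ℂ} (h0 : q ≠ 0) (n : ℤ) :
    appellCoeff k q w n = (-1) ^ n * (q ^ k) ^ tri n * (q ^ k * w) ^ n := by
  rw [appellCoeff, tri_add_one, mul_add, zpow_add₀ h0, zpow_mul, zpow_mul, zpow_natCast, mul_zpow]
  ring

theorem appellCoeff_zero (k : ℕ) (q w : ℂ) : appellCoeff k q w 0 = 1 := by
  simp [appellCoeff, tri_one]

theorem summable_appellCoeff {k : ℕ} {q w : ℂ} (h0 : q ≠ 0) (h1 : ‖q‖ < 1) (hk : k ≠ 0)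
    (hw : w ≠ 0) : Summable fun n => ‖appellCoeff k q w n‖ := by
  simp_rw [appellCoeff_eq h0]
  exact (summable_theta (pow_ne_zero k h0) (norm_lt_one_pow h1 hk)
    (mul_ne_zero (pow_ne_zero k h0) hw)).norm

theorem analyticAt_appell' {k : ℕ} {q w z : ℂ} (h0 : q ≠ 0) (h1 : ‖q‖ < 1) (hk : k ≠ 0)
    (hw : w ≠ 0) (hz : z ≠ 0) (hn : ∀ n : ℤ, z * q ^ n ≠ 1) : AnalyticAt ℂ (appell k q w) z :=
  analyticAt_appell h0 h1 hz (summable_appellCoeff h0 h1 hk hw) hn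

theorem zpow_ne_one_of_ne_zero {q : ℂ} (h1 : ‖q‖ < 1) {n : ℤ} (hn : n ≠ 0) :
    q ^ n ≠ 1 := by
  intro h
  have h2 := congrArg norm h
  rw [norm_zpow, norm_one] at h2
  exact hn ((zpow_eq_one_iff_right₀ (norm_nonneg q) h1.ne).1 h2)

theorem exists_appell_pole {k : ℕ} {q w : ℂ} (h0 : q ≠ 0) (h1 : ‖q‖ < 1) (hk : k ≠ 0)
    (hw : w ≠ 0) : ∃ R, AnalyticAt ℂ R 1 ∧ ∀ᶠ z in 𝓝 1, appell k q w z = 1 / (1 - z) + R z := by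
  obtain ⟨R, hR, he⟩ := exists_analyticAt_appell h0 h1 one_ne_zero
    (summable_appellCoeff (k := k) h0 h1 hk hw) 0 fun n hn => by
      rw [one_mul]; exact zpow_ne_one_of_ne_zero h1 hn
  refine ⟨R, hR, he.mono fun z hz => ?_⟩
  rw [appell, hz.2, appellCoeff_zero, zpow_zero, mul_one]

theorem hasRemovableValue_theta_mul_appell {k : ℕ} {q w : ℂ} (h0 : q ≠ 0) (h1 : ‖q‖ < 1)
    (hk : k ≠ 0) (hw : w ≠ 0) :
    HasRemovableValue (fun x => theta q x * appell k q w x) 1 (qpoch q q ^ 3) := by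
  obtain ⟨R, hR, he⟩ := exists_appell_pole h0 h1 hk hw
  refine ⟨fun x => thetaQuot q x + theta q x * R x,
    (analyticAt_thetaQuot h0 h1).add ((analyticAt_theta h0 h1 one_ne_zero).mul hR), ?_, ?_⟩
  · filter_upwards [nhdsWithin_le_nhds he, self_mem_nhdsWithin] with x hx hx1
    have hx2 : 1 - x ≠ 0 := sub_ne_zero.2 (Ne.symm hx1)
    rw [hx, mul_add, theta_eq_mul_thetaQuot]
    field_simp
  · simp [theta_one, thetaQuot_one h0 h1]

theorem tsum_appellCoeff_mul {k : ℕ} {q w : ℂ} (h0 : q ≠ 0) (i : ℕ) :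
    ∑' n : ℤ, appellCoeff k q w n * (q ^ n) ^ i / (q ^ n) ^ k = theta (q ^ k) (w * q ^ i) := by
  refine tsum_congr fun n => ?_
  have : (q ^ n) ^ k = (q ^ k) ^ n := by
    rw [← zpow_natCast, ← zpow_natCast, ← zpow_mul, ← zpow_mul, mul_comm]
  have h2 : (q ^ n) ^ i = (q ^ i) ^ n := by
    rw [← zpow_natCast, ← zpow_natCast, ← zpow_mul, ← zpow_mul, mul_comm]
  have h3 : (q ^ k) ^ n ≠ 0 := zpow_ne_zero _ (pow_ne_zero _ h0)
  rw [appellCoeff_eq h0, this, h2, mul_zpow, mul_zpow]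
  field_simp

theorem appell_mul_base {k : ℕ} {q w z : ℂ} (h0 : q ≠ 0) (h1 : ‖q‖ < 1) (hk : k ≠ 0) (hw : w ≠ 0)
    (hz : z ≠ 0) (hn : ∀ n : ℤ, z * q ^ n ≠ 1) :
    appell k q w (q * z) = -w⁻¹ * (z ^ k * appell k q w z +
      ∑ i ∈ Finset.range k, z ^ i * theta (q ^ k) (w * q ^ i)) := by
  have hs : Summable fun n : ℤ => appellCoeff k q w n / (1 - z * q ^ n) := by
    obtain ⟨R, -, he⟩ := exists_analyticAt_appell h0 h1 hz
      (summable_appellCoeff (k := k) h0 h1 hk hw) 0 fun n _ => hn n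
    exact he.self_of_nhds.1
  have hs2 : ∀ i : ℕ, Summable fun n : ℤ => appellCoeff k q w n * (q ^ n) ^ i / (q ^ n) ^ k := by
    intro i
    refine (summable_theta (pow_ne_zero k h0) (norm_lt_one_pow h1 hk)
      (mul_ne_zero hw (pow_ne_zero i h0))).congr fun n => ?_
    have : (q ^ n) ^ k = (q ^ k) ^ n := by
      rw [← zpow_natCast, ← zpow_natCast, ← zpow_mul, ← zpow_mul, mul_comm]
    have h2 : (q ^ n) ^ i = (q ^ i) ^ n := by
      rw [← zpow_natCast, ← zpow_natCast, ← zpow_mul, ← zpow_mul, mul_comm]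
    have h3 : (q ^ k) ^ n ≠ 0 := zpow_ne_zero _ (pow_ne_zero _ h0)
    rw [appellCoeff_eq h0, this, h2, mul_zpow, mul_zpow]
    field_simp
  simp_rw [← tsum_appellCoeff_mul h0]
  rw [appell, appell, ← (Equiv.subRight (1 : ℤ)).tsum_eq fun n : ℤ =>
    appellCoeff k q w n / (1 - q * z * q ^ n)]
  simp_rw [← tsum_mul_left]
  rw [← Summable.tsum_finsetSum fun i _ => (hs2 i).mul_left _,
    ← (hs.mul_left _).tsum_add (summable_sum fun i _ => (hs2 i).mul_left _), ← tsum_mul_left]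
  refine tsum_congr fun n => ?_
  have hd : 1 - z * q ^ n ≠ 0 := sub_ne_zero.2 (hn n).symm
  have hqn : q ^ n ≠ 0 := zpow_ne_zero n h0
  have e1 : q * z * q ^ (n - 1) = z * q ^ n := by rw [zpow_sub_one₀ h0]; field_simp
  have e2 : appellCoeff k q w (n - 1) = -w⁻¹ * (appellCoeff k q w n / (q ^ n) ^ k) := by
    have : (q ^ n) ^ k = q ^ ((k : ℤ) * n) := by
      rw [← zpow_natCast, ← zpow_mul, mul_comm]
    rw [appellCoeff, appellCoeff, sub_add_cancel, tri_add_one n, this, mul_add, zpow_add₀ h0,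
      zpow_sub_one₀ hw, zpow_sub_one₀ (by norm_num : (-1 : ℂ) ≠ 0)]
    have : q ^ ((k : ℤ) * n) ≠ 0 := zpow_ne_zero _ h0
    field_simp
  have e3 : ∑ i ∈ Finset.range k, z ^ i * (appellCoeff k q w n * (q ^ n) ^ i / (q ^ n) ^ k) =
      appellCoeff k q w n / (q ^ n) ^ k * ((1 - (z * q ^ n) ^ k) / (1 - z * q ^ n)) := by
    have := mul_neg_geom_sum (z * q ^ n) k
    rw [← this, mul_div_cancel_left₀ _ hd, Finset.mul_sum]
    refine Finset.sum_congr rfl fun i _ => ?_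
    rw [mul_pow]
    ring
  simp only [Equiv.subRight_apply]
  rw [e1, e2, e3, mul_pow]
  field_simp
  ring

theorem theta_ne_zero_iff {q z : ℂ} (h0 : q ≠ 0) (h1 : ‖q‖ < 1) (hz : z ≠ 0) :
    theta q z ≠ 0 ↔ ∀ n : ℤ, z * q ^ n ≠ 1 := by
  refine ⟨fun h n hn => h ?_, fun h => theta_ne_zero h0 h1 hz h⟩
  have key : ∀ m : ℤ, theta q (q ^ m) = 0 := by
    intro m
    induction m with
    | zero => simp [theta_one]
    | succ m ih =>
      rw [zpow_add_one₀ h0, mul_comm, theta_mul_base h0 (zpow_ne_zero _ h0), ih, mul_zero]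
    | pred m ih =>
      have := theta_mul_base (q := q) h0 (zpow_ne_zero (-(m : ℤ) - 1) h0)
      rw [← zpow_one_add₀ h0, show 1 + (-(m : ℤ) - 1) = -m by ring, ih] at this
      have h2 := zpow_ne_zero (-(m : ℤ) - 1) h0
      simpa [h2] using this.symm
  have : z = q ^ (-n) := by
    rw [zpow_neg]; exact eq_inv_of_mul_eq_one_left hn
  rw [this, key]

theorem appell_one_mul_base {q w z : ℂ} (h0 : q ≠ 0) (h1 : ‖q‖ < 1) (hw : w ≠ 0) (hz : z ≠ 0)
    (hn : ∀ n : ℤ, z * q ^ n ≠ 1) :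
    appell 1 q w (q * z) = -w⁻¹ * (z * appell 1 q w z + theta q w) := by
  simpa using appell_mul_base (k := 1) h0 h1 one_ne_zero hw hz hn

theorem appell_three_mul_base {q w z : ℂ} (h0 : q ≠ 0) (h1 : ‖q‖ < 1) (hw : w ≠ 0) (hz : z ≠ 0)
    (hn : ∀ n : ℤ, z * q ^ n ≠ 1) :
    appell 3 q w (q * z) = -w⁻¹ * (z ^ 3 * appell 3 q w z + (theta (q ^ 3) w +
      z * theta (q ^ 3) (w * q) + z ^ 2 * theta (q ^ 3) (w * q ^ 2))) := by
  simpa [Finset.sum_range_succ] using appell_mul_base (k := 3) h0 h1 (by norm_num) hw hz hn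

theorem appell_one_inv {q w : ℂ} (h0 : q ≠ 0) (hw : w ≠ 0) (hn : ∀ n : ℤ, w * q ^ n ≠ 1) :
    appell 1 q w⁻¹ w⁻¹ = -w * appell 1 q w w := by
  rw [appell, appell, ← (Equiv.neg ℤ).tsum_eq, ← tsum_mul_left]
  refine tsum_congr fun n => ?_
  simp only [Equiv.neg_apply, appellCoeff, Nat.cast_one, one_mul]
  have e1 : q ^ tri (-n + 1) = q ^ tri n := by rw [← tri_one_sub n]; congr 2; ring
  have hq := zpow_ne_zero n h0
  have hd : 1 - w * q ^ n ≠ 0 := sub_ne_zero.2 (hn n).symm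
  have hd2 : 1 - w⁻¹ * (q ^ n)⁻¹ ≠ 0 := by
    intro h
    apply hd
    field_simp at h
    linear_combination -h
  rw [e1, tri_add_one, zpow_add₀ h0, inv_zpow, zpow_neg w, inv_inv, zpow_neg q, zpow_neg (-1 : ℂ),
    ← inv_zpow (-1 : ℂ) n, show (-1 : ℂ)⁻¹ = -1 by norm_num, div_eq_iff hd2]
  field_simp
  ring

theorem theta_eq_zero_iff_exists {q z : ℂ} (h0 : q ≠ 0) (h1 : ‖q‖ < 1) (hz : z ≠ 0) :
    theta q z = 0 ↔ ∃ n : ℤ, q ^ n * z = 1 := by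
  have := (theta_ne_zero_iff h0 h1 hz).not
  push Not at this
  rw [this]
  simp_rw [mul_comm]

theorem appell_one_sum_zero {q z : ℂ} (h0 : q ≠ 0) (h1 : ‖q‖ < 1) (hz : z ≠ 0)
    (tz : theta q z ≠ 0) : theta q z * appell 1 q 1 z = qpoch q q ^ 3 := by
  have t1 := (theta_ne_zero_iff h0 h1 hz).1 tz
  obtain ⟨c, hc⟩ := eventually_eq_const_of_periodic h0 h1
    (f := fun z => theta q z * appell 1 q 1 z) (by
      intro z hz
      rw [theta_mul_base h0 hz]
      by_cases h : theta q z = 0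
      · simp [h]
      rw [appell_one_mul_base h0 h1 one_ne_zero hz ((theta_ne_zero_iff h0 h1 hz).1 h), theta_one]
      field_simp
      ring) (by
      intro p hp
      by_cases h : theta q p = 0
      · obtain ⟨n, hn⟩ := (theta_eq_zero_iff_exists h0 h1 hp).1 h
        exact ⟨n, hn ▸ (hasRemovableValue_theta_mul_appell h0 h1 one_ne_zero one_ne_zero).isRemovableAt⟩
      · refine ⟨0, ?_⟩
        rw [zpow_zero, one_mul]
        exact ((analyticAt_theta h0 h1 hp).mul (analyticAt_appell' h0 h1 one_ne_zero one_ne_zero hp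
          ((theta_ne_zero_iff h0 h1 hp).1 h))).isRemovableAt)
  rw [(hasRemovableValue_theta_mul_appell h0 h1 one_ne_zero one_ne_zero).eq_of_const
    (hc 1 one_ne_zero)]
  exact (((analyticAt_theta h0 h1 hz).mul (analyticAt_appell' h0 h1 one_ne_zero one_ne_zero hz
    t1)).hasRemovableValue).eq_of_const (hc z hz)

/-- Partial fractions for a theta quotient with level one Appell sums. -/
theorem appell_one_add {q s z : ℂ} (h0 : q ≠ 0) (h1 : ‖q‖ < 1) (hs : s ≠ 0) (hz : z ≠ 0)
    (ts : theta q s ≠ 0) (ts2 : theta q (s ^ 2) ≠ 0) (tz : theta q z ≠ 0)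
    (tzs : theta q (s * z) ≠ 0) (tzs' : theta q (s⁻¹ * z) ≠ 0) :
    s * appell 1 q s (s * z) + appell 1 q s⁻¹ (s⁻¹ * z) =
      qpoch q q ^ 3 * theta q (s ^ 2) * theta q z /
        (theta q s * theta q (s * z) * theta q (s⁻¹ * z)) := by
  have hsi := inv_ne_zero hs
  have ts1 := (theta_ne_zero_iff h0 h1 hs).1 ts
  have tsi : theta q s⁻¹ ≠ 0 := theta_inv_ne_zero hs ts
  set B : ℂ → ℂ := fun z => s * appell 1 q s (s * z) + appell 1 q s⁻¹ (s⁻¹ * z) with hB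
  have hBa : ∀ p, p ≠ 0 → theta q (s * p) ≠ 0 → theta q (s⁻¹ * p) ≠ 0 → AnalyticAt ℂ B p := by
    intro p hp h2 h3
    have a1 := analyticAt_appell' (k := 1) h0 h1 one_ne_zero hs (mul_ne_zero hs hp)
      ((theta_ne_zero_iff h0 h1 (mul_ne_zero hs hp)).1 h2)
    have a2 := analyticAt_appell' (k := 1) h0 h1 one_ne_zero hsi (mul_ne_zero hsi hp)
      ((theta_ne_zero_iff h0 h1 (mul_ne_zero hsi hp)).1 h3)
    exact (analyticAt_const.mul (a1.comp (f := fun z => s * z) (by fun_prop))).add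
      (a2.comp (f := fun z => s⁻¹ * z) (by fun_prop))
  have hθa : ∀ a p : ℂ, a ≠ 0 → p ≠ 0 → AnalyticAt ℂ (fun z => theta q (a * z)) p := fun a p ha hp =>
    (analyticAt_theta h0 h1 (mul_ne_zero ha hp)).comp (f := fun z => a * z) (by fun_prop)
  have hB1 : B 1 = 0 := by
    simp only [hB, mul_one]
    rw [appell_one_inv h0 hs ts1]
    ring
  have hss : theta q (s⁻¹ * s⁻¹) ≠ 0 := by
    have := theta_inv_ne_zero (pow_ne_zero 2 hs) ts2
    rwa [sq, mul_inv] at this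
  have hpole1 : HasRemovableValue (fun z => theta q (s * z) * theta q (s⁻¹ * z) / theta q z * B z)
      s⁻¹ (qpoch q q ^ 3 * theta q (s ^ 2) / theta q s) := by
    have a1 := (hasRemovableValue_theta_mul_appell (k := 1) h0 h1 one_ne_zero hs).comp_mul
      (p := s⁻¹) hs (mul_inv_cancel₀ hs)
    have a2 := analyticAt_appell' (k := 1) h0 h1 one_ne_zero hsi (mul_ne_zero hsi hsi)
      ((theta_ne_zero_iff h0 h1 (mul_ne_zero hsi hsi)).1 hss)
    have a2' := a2.comp (f := fun z => s⁻¹ * z) (x := s⁻¹) (by fun_prop)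
    have a3 := (hθa _ _ hsi hsi).div (analyticAt_theta h0 h1 hsi) tsi
    have a4 := ((a1.mul (analyticAt_const (v := s)).hasRemovableValue).mul
      a3.hasRemovableValue).add
      (((hθa s _ hs hsi).mul (a3.mul a2')).hasRemovableValue)
    have e1 : theta q (s⁻¹ * s⁻¹) = -(s ^ 2)⁻¹ * theta q (s ^ 2) := by
      rw [← theta_inv (pow_ne_zero 2 hs), sq, mul_inv]
    have e := a4.congr (g := fun z => theta q (s * z) * theta q (s⁻¹ * z) / theta q z * B z)
      (fun z => by simp only [hB, Pi.mul_apply, Pi.div_apply, Function.comp]; ring)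
    convert e using 1
    simp only [Pi.mul_apply, Pi.div_apply, e1, mul_inv_cancel₀ hs, theta_one, theta_inv hs]
    field_simp
    ring
  have hpole2 : IsRemovableAt (fun z => theta q (s * z) * theta q (s⁻¹ * z) / theta q z * B z) s := by
    have a1 := (hasRemovableValue_theta_mul_appell (k := 1) h0 h1 one_ne_zero hsi).comp_mul
      (p := s) hsi (inv_mul_cancel₀ hs)
    have hss' : theta q (s * s) ≠ 0 := by rwa [← sq]
    have a2 := analyticAt_appell' (k := 1) h0 h1 one_ne_zero hs (mul_ne_zero hs hs)
      ((theta_ne_zero_iff h0 h1 (mul_ne_zero hs hs)).1 hss')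
    have a2' := (analyticAt_const (v := s)).mul (a2.comp (f := fun z => s * z) (x := s) (by fun_prop))
    have a3 := (hθa _ _ hs hs).div (analyticAt_theta h0 h1 hs) ts
    have a4 := (a1.mul a3.hasRemovableValue).add
      (((hθa s⁻¹ _ hsi hs).mul (a3.mul a2')).hasRemovableValue)
    refine (a4.congr fun z => ?_).isRemovableAt
    simp only [hB, Pi.mul_apply, Pi.div_apply, Function.comp]; ring
  obtain ⟨c, hc⟩ := eventually_eq_const_of_periodic h0 h1
    (f := fun z => theta q (s * z) * theta q (s⁻¹ * z) / theta q z * B z) (by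
      intro z hz
      have m1 := mul_ne_zero hs hz
      have m2 := mul_ne_zero hsi hz
      have e1 : s * (q * z) = q * (s * z) := by ring
      have e2 : s⁻¹ * (q * z) = q * (s⁻¹ * z) := by ring
      simp only [hB, e1, e2, theta_mul_base h0 m1, theta_mul_base h0 m2, theta_mul_base h0 hz]
      by_cases h : theta q (s * z) = 0
      · simp [h]
      by_cases h' : theta q (s⁻¹ * z) = 0
      · simp [h']
      rw [appell_one_mul_base h0 h1 hs m1 ((theta_ne_zero_iff h0 h1 m1).1 h),
        appell_one_mul_base h0 h1 hsi m2 ((theta_ne_zero_iff h0 h1 m2).1 h'), theta_inv hs]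
      by_cases h'' : theta q z = 0
      · simp [h'']
      field_simp
      ring) (by
      intro p hp
      have m1 := mul_ne_zero hs hp
      have m2 := mul_ne_zero hsi hp
      by_cases h : theta q (s * p) = 0
      · obtain ⟨n, hn⟩ := (theta_eq_zero_iff_exists h0 h1 m1).1 h
        refine ⟨n, ?_⟩
        rw [show q ^ n * p = s⁻¹ by rw [← mul_assoc, mul_comm _ s, mul_assoc] at hn; exact eq_inv_of_mul_eq_one_right hn]
        exact hpole1.isRemovableAt
      by_cases h' : theta q (s⁻¹ * p) = 0
      · obtain ⟨n, hn⟩ := (theta_eq_zero_iff_exists h0 h1 m2).1 h'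
        refine ⟨n, ?_⟩
        rw [show q ^ n * p = s by field_simp at hn; exact hn]
        exact hpole2
      by_cases h'' : theta q p = 0
      · obtain ⟨n, hn⟩ := (theta_eq_zero_iff_exists h0 h1 hp).1 h''
        refine ⟨n, ?_⟩
        rw [hn]
        have b := isRemovableAt_div (p := 1) (f := fun z => theta q (s * z) * theta q (s⁻¹ * z) * B z)
          (g := theta q) (((hθa s 1 hs one_ne_zero).mul (hθa s⁻¹ 1 hsi one_ne_zero)).mul
            (hBa 1 one_ne_zero (by rwa [mul_one]) (by rwa [mul_one])))
          (analyticAt_theta h0 h1 one_ne_zero) (by simp [hB1]) (theta_one q)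
          (by rw [deriv_theta_one h0 h1]
              exact neg_ne_zero.2 (pow_ne_zero _ (qpoch_self_ne_zero h1)))
        refine b.congr (Eventually.of_forall fun z => ?_)
        simp only []
        ring
      · refine ⟨0, ?_⟩
        rw [zpow_zero, one_mul]
        exact ((((hθa s p hs hp).mul (hθa s⁻¹ p hsi hp)).div (analyticAt_theta h0 h1 hp) h'').mul
          (hBa p hp h h')).isRemovableAt)
  have hz' := ((((hθa s z hs hz).mul (hθa s⁻¹ z hsi hz)).div (analyticAt_theta h0 h1 hz) tz).mul
          (hBa z hz tzs tzs')).hasRemovableValue.eq_of_const (hc z hz)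
  rw [← hpole1.eq_of_const (hc _ hsi)] at hz'
  simp only [Pi.mul_apply, Pi.div_apply] at hz'
  rw [div_mul_eq_mul_div, div_eq_div_iff tz ts] at hz'
  change B z = _
  rw [eq_div_iff (mul_ne_zero (mul_ne_zero ts tzs) tzs')]
  linear_combination hz'

theorem theta_cube_base_ne_zero {q : ℂ} (h0 : q ≠ 0) (h1 : ‖q‖ < 1) : theta (q ^ 3) q ≠ 0 := by
  refine theta_ne_zero (pow_ne_zero 3 h0) (norm_lt_one_pow h1 (by norm_num)) h0 fun k => ?_
  have : q * (q ^ 3) ^ k = q ^ (1 + 3 * k) := by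
    rw [zpow_add₀ h0, zpow_mul, zpow_one]; norm_cast
  rw [this]
  exact zpow_ne_one_of_ne_zero h1 (by omega)

theorem theta_base_mul_inv {q z : ℂ} (h0 : q ≠ 0) (hz : z ≠ 0) :
    theta q (q * z⁻¹) = theta q z := by
  rw [theta_mul_base h0 (inv_ne_zero hz), theta_inv hz]
  field_simp

/-- The coefficient of the central term in the level three identity. -/
noncomputable def quintCoeff (q s : ℂ) : ℂ :=
  (theta (q ^ 3) (s ^ 3 * q) + s * theta (q ^ 3) ((s ^ 3)⁻¹ * q)) / theta (q ^ 3) q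

theorem appell_three_add_aux {q s : ℂ} (h0 : q ≠ 0) (h1 : ‖q‖ < 1) (hs : s ≠ 0)
    (ts : theta q s ≠ 0) (ts2 : theta q (s ^ 2) ≠ 0) :
    quintCoeff q s * theta q s = theta q (s ^ 2) ∧
    ∀ z, z ≠ 0 → theta q z ≠ 0 → theta q (s * z) ≠ 0 → theta q (s⁻¹ * z) ≠ 0 →
    s ^ 3 * appell 3 q (s ^ 3) (s * z) + appell 3 q (s ^ 3)⁻¹ (s⁻¹ * z) -
      s * quintCoeff q s * appell 3 q 1 z =
      qpoch q q ^ 3 * theta q s * theta q (s ^ 2) /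
        (theta q (s⁻¹ * z) * theta q z * theta q (s * z)) := by
  have h30 : (3 : ℕ) ≠ 0 := by norm_num
  have hsi := inv_ne_zero hs
  have hs3 := pow_ne_zero 3 hs
  have hsi3 := inv_ne_zero hs3
  have tsi : theta q s⁻¹ ≠ 0 := theta_inv_ne_zero hs ts
  have hJ : qpoch q q ^ 3 ≠ 0 := pow_ne_zero _ (qpoch_self_ne_zero h1)
  have t3 := theta_cube_base_ne_zero h0 h1
  set y := quintCoeff q s with hy
  have hy' : y * theta (q ^ 3) q = theta (q ^ 3) (s ^ 3 * q) + s * theta (q ^ 3) ((s ^ 3)⁻¹ * q) := by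
    rw [hy, quintCoeff, div_mul_cancel₀ _ t3]
  set B : ℂ → ℂ := fun z => s ^ 3 * appell 3 q (s ^ 3) (s * z) + appell 3 q (s ^ 3)⁻¹ (s⁻¹ * z) -
      s * y * appell 3 q 1 z with hB
  have hθa : ∀ a p : ℂ, a ≠ 0 → p ≠ 0 → AnalyticAt ℂ (fun z => theta q (a * z)) p := fun a p ha hp =>
    (analyticAt_theta h0 h1 (mul_ne_zero ha hp)).comp (f := fun z => a * z) (by fun_prop)
  have hSa : ∀ w a p : ℂ, w ≠ 0 → a ≠ 0 → p ≠ 0 → theta q (a * p) ≠ 0 →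
      AnalyticAt ℂ (fun z => appell 3 q w (a * z)) p := fun w a p hw ha hp h =>
    (analyticAt_appell' h0 h1 h30 hw (mul_ne_zero ha hp)
      ((theta_ne_zero_iff h0 h1 (mul_ne_zero ha hp)).1 h)).comp (f := fun z => a * z) (by fun_prop)
  have hSa1 : ∀ p : ℂ, p ≠ 0 → theta q p ≠ 0 → AnalyticAt ℂ (appell 3 q 1) p := fun p hp h =>
    analyticAt_appell' h0 h1 h30 one_ne_zero hp ((theta_ne_zero_iff h0 h1 hp).1 h)
  have hss' : theta q (s * s) ≠ 0 := by rwa [← sq]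
  have hss : theta q (s⁻¹ * s⁻¹) ≠ 0 := by
    have := theta_inv_ne_zero (pow_ne_zero 2 hs) ts2
    rwa [sq, mul_inv] at this
  set f : ℂ → ℂ := fun z => theta q (s⁻¹ * z) * theta q z * theta q (s * z) * B z with hf
  have hpole1 : HasRemovableValue f 1 (y * theta q s ^ 2 * qpoch q q ^ 3) := by
    have a0 := (hasRemovableValue_theta_mul_appell (k := 3) h0 h1 h30 one_ne_zero)
    have b1 := hθa s 1 hs one_ne_zero
    have b2 := hθa s⁻¹ 1 hsi one_ne_zero
    have b3 := analyticAt_theta h0 h1 one_ne_zero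
    have a1 := a0.mul (((analyticAt_const (v := -s * y)).mul (b1.mul b2)).hasRemovableValue)
    have a2 := ((b1.mul b2).mul (b3.mul (((analyticAt_const (v := s ^ 3)).mul
      (hSa (s ^ 3) s 1 hs3 hs one_ne_zero (by rwa [mul_one]))).add
      (hSa (s ^ 3)⁻¹ s⁻¹ 1 hsi3 hsi one_ne_zero (by rwa [mul_one]))))).hasRemovableValue
    have e := (a1.add a2).congr (g := f) (fun z => by
      simp only [hf, hB, Pi.mul_apply, Pi.add_apply]; ring)
    convert e using 1
    simp only [Pi.mul_apply, Pi.add_apply, theta_one, mul_one, theta_inv hs]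
    field_simp
    ring
  have hpole2 : HasRemovableValue f s (theta q s * theta q (s ^ 2) * qpoch q q ^ 3) := by
    have a0 := (hasRemovableValue_theta_mul_appell (k := 3) h0 h1 h30 hsi3).comp_mul
      (p := s) hsi (inv_mul_cancel₀ hs)
    have b1 := hθa s s hs hs
    have b2 := hθa s⁻¹ s hsi hs
    have b3 := analyticAt_theta h0 h1 hs
    have a1 := a0.mul ((b1.mul b3).hasRemovableValue)
    have a2 := ((b1.mul b3).mul (b2.mul (((analyticAt_const (v := s ^ 3)).mul
      (hSa (s ^ 3) s s hs3 hs hs hss')).add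
      ((analyticAt_const (v := -s * y)).mul (hSa1 s hs ts))))).hasRemovableValue
    have e := (a1.add a2).congr (g := f) (fun z => by
      simp only [hf, hB, Pi.mul_apply, Pi.add_apply]; ring)
    convert e using 1
    simp only [Pi.mul_apply, Pi.add_apply, theta_one, inv_mul_cancel₀ hs, ← sq]
    ring
  have hpole3 : IsRemovableAt f s⁻¹ := by
    have a0 := (hasRemovableValue_theta_mul_appell (k := 3) h0 h1 h30 hs3).comp_mul
      (p := s⁻¹) hs (mul_inv_cancel₀ hs)
    have b1 := hθa s s⁻¹ hs hsi
    have b2 := hθa s⁻¹ s⁻¹ hsi hsi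
    have b3 := analyticAt_theta h0 h1 hsi
    have a1 := a0.mul (((analyticAt_const (v := s ^ 3)).mul (b2.mul b3)).hasRemovableValue)
    have a2 := ((b2.mul b3).mul (b1.mul ((hSa (s ^ 3)⁻¹ s⁻¹ s⁻¹ hsi3 hsi hsi hss).add
      ((analyticAt_const (v := -s * y)).mul (hSa1 s⁻¹ hsi tsi))))).hasRemovableValue
    exact ((a1.add a2).congr (g := f) (fun z => by
      simp only [hf, hB, Pi.mul_apply, Pi.add_apply]; ring)).isRemovableAt
  have han : ∀ p, p ≠ 0 → theta q (s * p) ≠ 0 → theta q (s⁻¹ * p) ≠ 0 → theta q p ≠ 0 →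
      AnalyticAt ℂ f p := by
    intro p hp h h' h''
    have a1 := ((((analyticAt_const (v := s ^ 3)).mul (hSa (s ^ 3) s p hs3 hs hp h)).add
      (hSa (s ^ 3)⁻¹ s⁻¹ p hsi3 hsi hp h')).sub
      ((analyticAt_const (v := s * y)).mul (hSa1 p hp h'')))
    exact (((hθa s⁻¹ p hsi hp).mul (analyticAt_theta h0 h1 hp)).mul (hθa s p hs hp)).mul a1
  obtain ⟨c, hc⟩ := eventually_eq_const_of_periodic h0 h1 (f := f) (by
      intro z hz
      have m1 := mul_ne_zero hs hz
      have m2 := mul_ne_zero hsi hz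
      have e1 : s * (q * z) = q * (s * z) := by ring
      have e2 : s⁻¹ * (q * z) = q * (s⁻¹ * z) := by ring
      simp only [hf, hB, e1, e2, theta_mul_base h0 m1, theta_mul_base h0 m2, theta_mul_base h0 hz]
      by_cases h : theta q (s * z) = 0
      · simp [h]
      by_cases h' : theta q (s⁻¹ * z) = 0
      · simp [h']
      by_cases h'' : theta q z = 0
      · simp [h'']
      rw [appell_three_mul_base h0 h1 hs3 m1 ((theta_ne_zero_iff h0 h1 m1).1 h),
        appell_three_mul_base h0 h1 hsi3 m2 ((theta_ne_zero_iff h0 h1 m2).1 h'),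
        appell_three_mul_base h0 h1 one_ne_zero hz ((theta_ne_zero_iff h0 h1 hz).1 h''),
        theta_inv hs3, theta_one]
      have g1 : theta (q ^ 3) (s ^ 3 * q ^ 2) = theta (q ^ 3) ((s ^ 3)⁻¹ * q) := by
        rw [← theta_base_mul_inv (pow_ne_zero 3 h0) (mul_ne_zero hsi3 h0)]
        congr 1
        field_simp
      have g2 : theta (q ^ 3) ((s ^ 3)⁻¹ * q ^ 2) = theta (q ^ 3) (s ^ 3 * q) := by
        rw [← theta_base_mul_inv (pow_ne_zero 3 h0) (mul_ne_zero hs3 h0)]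
        congr 1
        field_simp
      have g3 : theta (q ^ 3) (1 * q ^ 2) = theta (q ^ 3) q := by
        rw [← theta_base_mul_inv (pow_ne_zero 3 h0) h0]
        congr 1
        field_simp
      rw [g1, g2, g3, one_mul]
      generalize theta q (s * z) = t1 at *
      generalize theta q (s⁻¹ * z) = t2 at *
      generalize appell 3 q (s ^ 3) (s * z) = t4 at *
      generalize appell 3 q (s ^ 3)⁻¹ (s⁻¹ * z) = t5 at *
      generalize appell 3 q 1 z = t6 at *
      generalize theta (q ^ 3) ((s ^ 3)⁻¹ * q) = t7 at *
      generalize theta (q ^ 3) (s ^ 3 * q) = t8 at *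
      generalize theta (q ^ 3) (s ^ 3) = t9 at *
      field_simp
      linear_combination (-s * z * (1 + z)) * hy') (by
      intro p hp
      have m1 := mul_ne_zero hs hp
      have m2 := mul_ne_zero hsi hp
      by_cases h : theta q (s * p) = 0
      · obtain ⟨n, hn⟩ := (theta_eq_zero_iff_exists h0 h1 m1).1 h
        refine ⟨n, ?_⟩
        rw [show q ^ n * p = s⁻¹ by rw [← mul_assoc, mul_comm _ s, mul_assoc] at hn; exact eq_inv_of_mul_eq_one_right hn]
        exact hpole3
      by_cases h' : theta q (s⁻¹ * p) = 0
      · obtain ⟨n, hn⟩ := (theta_eq_zero_iff_exists h0 h1 m2).1 h'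
        refine ⟨n, ?_⟩
        rw [show q ^ n * p = s by field_simp at hn; exact hn]
        exact hpole2.isRemovableAt
      by_cases h'' : theta q p = 0
      · obtain ⟨n, hn⟩ := (theta_eq_zero_iff_exists h0 h1 hp).1 h''
        refine ⟨n, ?_⟩
        rw [hn]
        exact hpole1.isRemovableAt
      · refine ⟨0, ?_⟩
        rw [zpow_zero, one_mul]
        exact (han p hp h h' h'').isRemovableAt)
  have c1 := hpole1.eq_of_const (hc 1 one_ne_zero)
  have c2 := hpole2.eq_of_const (hc s hs)
  refine ⟨?_, fun z hz tz tzs tzs' => ?_⟩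
  · have : (theta q s * qpoch q q ^ 3) * (y * theta q s - theta q (s ^ 2)) = 0 := by
      linear_combination c1 - c2
    exact sub_eq_zero.1 ((mul_eq_zero.1 this).resolve_left (mul_ne_zero ts hJ))
  · have c3 := (han z hz tzs tzs' tz).hasRemovableValue.eq_of_const (hc z hz)
    change B z = _
    rw [eq_div_iff (mul_ne_zero (mul_ne_zero tzs' tz) tzs)]
    simp only [hf] at c3
    linear_combination c3 - c2

/-- The quintuple product identity. -/
theorem quintCoeff_mul_theta {q s : ℂ} (h0 : q ≠ 0) (h1 : ‖q‖ < 1) (hs : s ≠ 0)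
    (ts : theta q s ≠ 0) (ts2 : theta q (s ^ 2) ≠ 0) :
    quintCoeff q s * theta q s = theta q (s ^ 2) :=
  (appell_three_add_aux h0 h1 hs ts ts2).1

/-- Partial fractions for a theta quotient with level three Appell sums. -/
theorem appell_three_add {q s z : ℂ} (h0 : q ≠ 0) (h1 : ‖q‖ < 1) (hs : s ≠ 0) (hz : z ≠ 0)
    (ts : theta q s ≠ 0) (ts2 : theta q (s ^ 2) ≠ 0) (tz : theta q z ≠ 0)
    (tzs : theta q (s * z) ≠ 0) (tzs' : theta q (s⁻¹ * z) ≠ 0) :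
    s ^ 3 * appell 3 q (s ^ 3) (s * z) + appell 3 q (s ^ 3)⁻¹ (s⁻¹ * z) -
      s * quintCoeff q s * appell 3 q 1 z =
      qpoch q q ^ 3 * theta q s * theta q (s ^ 2) /
        (theta q (s⁻¹ * z) * theta q z * theta q (s * z)) :=
  (appell_three_add_aux h0 h1 hs ts ts2).2 z hz tz tzs tzs'

theorem appell_finite_part {k : ℕ} {q w φ' L : ℂ} {φ H : ℂ → ℂ} (h0 : q ≠ 0) (h1 : ‖q‖ < 1)
    (hk : k ≠ 0) (hw : w ≠ 0) (hφ : HasDerivAt φ φ' 1) (hφ1 : φ 1 = 1) (hH : ContinuousAt H 1)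
    (he : ∀ᶠ x in 𝓝[≠] 1, H x + appell k q w x = qpoch q q ^ 3 * φ x / theta q x)
    (hL : L = H 1 + appell k q w 1) : L = -φ' := by
  obtain ⟨R, hR, hRe⟩ := exists_appell_pole (k := k) h0 h1 hk hw
  have h2 := hRe.self_of_nhds
  rw [sub_self, div_zero, zero_add] at h2
  have h3 : Tendsto (fun x => H x + R x) (𝓝[≠] 1) (𝓝 L) := by
    rw [hL, h2]
    exact (hH.tendsto.add hR.continuousAt.tendsto).mono_left nhdsWithin_le_nhds
  refine tendsto_nhds_unique h3 ((tendsto_div_theta_sub h0 h1 hφ hφ1).congr' ?_)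
  filter_upwards [he, nhdsWithin_le_nhds hRe] with x hx hx2
  rw [← hx, hx2]
  ring

theorem hasDerivAt_theta_mul {q a : ℂ} (h0 : q ≠ 0) (h1 : ‖q‖ < 1) (ha : a ≠ 0)
    (ta : theta q a ≠ 0) :
    HasDerivAt (fun x => theta q (a * x)) (thetaLog q a * theta q a) 1 := by
  have h := (hasDerivAt_theta h0 h1 (mul_ne_zero ha one_ne_zero)).comp (1 : ℂ)
    ((hasDerivAt_id (1 : ℂ)).const_mul a)
  refine h.congr_deriv ?_
  rw [thetaLog]
  simp only [mul_one]
  field_simp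

theorem eventually_theta_mul_ne_zero {q a : ℂ} (h0 : q ≠ 0) (h1 : ‖q‖ < 1) (ha : a ≠ 0)
    (ta : theta q a ≠ 0) : ∀ᶠ x in 𝓝[≠] 1, theta q (a * x) ≠ 0 := by
  refine nhdsWithin_le_nhds ((hasDerivAt_theta_mul h0 h1 ha ta).continuousAt.eventually_ne ?_)
  simpa using ta

theorem eventually_theta_ne_zero_punctured {q : ℂ} (h0 : q ≠ 0) (h1 : ‖q‖ < 1) :
    ∀ᶠ x in 𝓝[≠] 1, theta q x ≠ 0 := by
  have h : ∀ᶠ x in 𝓝[≠] 1, thetaQuot q x ≠ 0 := by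
    refine nhdsWithin_le_nhds ((analyticAt_thetaQuot h0 h1).continuousAt.eventually_ne ?_)
    rw [thetaQuot_one h0 h1]
    exact pow_ne_zero _ (qpoch_self_ne_zero h1)
  filter_upwards [h, self_mem_nhdsWithin] with x hx hx1
  rw [theta_eq_mul_thetaQuot]
  exact mul_ne_zero (sub_ne_zero.2 (Ne.symm hx1)) hx

theorem appell_one_self {q s : ℂ} (h0 : q ≠ 0) (h1 : ‖q‖ < 1) (hs : s ≠ 0)
    (ts : theta q s ≠ 0) (ts2 : theta q (s ^ 2) ≠ 0) :
    s * appell 1 q s (s * s) + appell 1 q s⁻¹ 1 = thetaLog q (s ^ 2) - thetaLog q s := by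
  have hs2 := pow_ne_zero 2 hs
  have d1 := hasDerivAt_theta_mul h0 h1 hs ts
  have d2 := hasDerivAt_theta_mul h0 h1 hs2 ts2
  have d := (d1.div d2 (by simpa using ts2)).const_mul (theta q (s ^ 2) / theta q s)
  refine (appell_finite_part (k := 1) (H := fun x => s * appell 1 q s (s ^ 2 * x)) h0 h1 one_ne_zero
    (inv_ne_zero hs) d ?_ ?_ ?_ (by simp [sq])).trans ?_
  · simp only [Pi.div_apply, mul_one]
    field_simp
  · have a := (analyticAt_appell' (k := 1) h0 h1 one_ne_zero hs (mul_ne_zero hs2 one_ne_zero)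
      ((theta_ne_zero_iff h0 h1 (mul_ne_zero hs2 one_ne_zero)).1 (by simpa using ts2))).comp
      (f := fun z => s ^ 2 * z) (by fun_prop)
    exact continuousAt_const.mul a.continuousAt
  · filter_upwards [eventually_theta_mul_ne_zero h0 h1 hs ts,
      eventually_theta_mul_ne_zero h0 h1 hs2 ts2, eventually_theta_ne_zero_punctured h0 h1,
      nhdsWithin_le_nhds (isOpen_ne.mem_nhds (one_ne_zero (α := ℂ)))] with x t1 t2 t3 hx
    have e1 : s * (s * x) = s ^ 2 * x := by ring
    have e2 : s⁻¹ * (s * x) = x := by field_simp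
    have := appell_one_add h0 h1 hs (mul_ne_zero hs hx) ts ts2 t1 (by rwa [e1]) (by rwa [e2])
    rw [e1, e2] at this
    rw [this]
    simp only [Pi.div_apply]
    field_simp
  · simp only [mul_one]
    field_simp
    ring

theorem appell_three_self {q s : ℂ} (h0 : q ≠ 0) (h1 : ‖q‖ < 1) (hs : s ≠ 0)
    (ts : theta q s ≠ 0) (ts2 : theta q (s ^ 2) ≠ 0) :
    s ^ 3 * appell 3 q (s ^ 3) (s * s) + appell 3 q (s ^ 3)⁻¹ 1 -
      s * quintCoeff q s * appell 3 q 1 s = thetaLog q s + thetaLog q (s ^ 2) := by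
  have hs2 := pow_ne_zero 2 hs
  have h30 : (3 : ℕ) ≠ 0 := by norm_num
  have d1 := hasDerivAt_theta_mul h0 h1 hs ts
  have d2 := hasDerivAt_theta_mul h0 h1 hs2 ts2
  have d := ((hasDerivAt_const (1 : ℂ) (theta q s * theta q (s ^ 2))).div (d1.mul d2)
    (by simpa using ⟨ts, ts2⟩))
  refine (appell_finite_part (k := 3) (H := fun x => s ^ 3 * appell 3 q (s ^ 3) (s ^ 2 * x) -
    s * quintCoeff q s * appell 3 q 1 (s * x)) h0 h1 h30
    (inv_ne_zero (pow_ne_zero 3 hs)) d ?_ ?_ ?_ (by simp [sq]; ring)).trans ?_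
  · simp only [Pi.div_apply, Pi.mul_apply, mul_one]
    field_simp
  · have a := (analyticAt_appell' (k := 3) h0 h1 h30 (pow_ne_zero 3 hs) (mul_ne_zero hs2 one_ne_zero)
      ((theta_ne_zero_iff h0 h1 (mul_ne_zero hs2 one_ne_zero)).1 (by simpa using ts2))).comp
      (f := fun z => s ^ 2 * z) (by fun_prop)
    have b := (analyticAt_appell' (k := 3) h0 h1 h30 one_ne_zero (mul_ne_zero hs one_ne_zero)
      ((theta_ne_zero_iff h0 h1 (mul_ne_zero hs one_ne_zero)).1 (by simpa using ts))).comp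
      (f := fun z => s * z) (by fun_prop)
    exact (continuousAt_const.mul a.continuousAt).sub (continuousAt_const.mul b.continuousAt)
  · filter_upwards [eventually_theta_mul_ne_zero h0 h1 hs ts,
      eventually_theta_mul_ne_zero h0 h1 hs2 ts2, eventually_theta_ne_zero_punctured h0 h1,
      nhdsWithin_le_nhds (isOpen_ne.mem_nhds (one_ne_zero (α := ℂ)))] with x t1 t2 t3 hx
    have e1 : s * (s * x) = s ^ 2 * x := by ring
    have e2 : s⁻¹ * (s * x) = x := by field_simp
    have := appell_three_add h0 h1 hs (mul_ne_zero hs hx) ts ts2 t1 (by rwa [e1]) (by rwa [e2])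
    rw [e1, e2] at this
    simp only [Pi.div_apply, Pi.mul_apply]
    have e3 : qpoch q q ^ 3 * (theta q s * theta q (s ^ 2) /
        (theta q (s * x) * theta q (s ^ 2 * x))) / theta q x = qpoch q q ^ 3 * theta q s *
        theta q (s ^ 2) / (theta q x * theta q (s * x) * theta q (s ^ 2 * x)) := by
      field_simp
    rw [e3, ← this]
    ring
  · simp only [mul_one, Pi.mul_apply]
    field_simp
    ring

theorem multiset_prod_map_eq_prod_pow {M : Type*} [CommMonoid M] (w : ℕ → M) (s : Multiset ℕ)
    {n : ℕ} (h : ∀ i ∈ s, i < n) : (s.map w).prod = ∏ i : Fin n, w i ^ s.count (i : ℕ) := by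
  rw [Finset.prod_multiset_map_count, ← Finset.prod_range (fun i => w i ^ s.count i)]
  refine Finset.prod_subset (fun i hi => Finset.mem_range.2 (h i (Multiset.mem_toFinset.1 hi))) ?_
  intro i _ hi
  rw [Multiset.count_eq_zero_of_notMem (fun h => hi (Multiset.mem_toFinset.2 h)), pow_zero]

theorem summable_multiset_prod {w : ℕ → ℝ} {ρ : ℝ} (hw : ∀ k, 0 ≤ w k) (hρ : ρ < 1)
    (hwρ : ∀ k, w k ≤ ρ) (hs : Summable w) :
    Summable fun s : Multiset ℕ => (s.map w).prod := by
  have hnn : ∀ s : Multiset ℕ, 0 ≤ (s.map w).prod := fun s =>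
    Multiset.prod_nonneg fun a ha => by
      obtain ⟨k, -, rfl⟩ := Multiset.mem_map.1 ha
      exact hw k
  refine summable_of_sum_le hnn (c := Real.exp (∑' k, w k * (1 - ρ)⁻¹)) fun S => ?_
  obtain ⟨n, hn⟩ : ∃ n : ℕ, ∀ s ∈ S, ∀ i ∈ s, i < n := by
    refine ⟨S.sup (fun s => s.sup) + 1, fun s hs i hi => Nat.lt_succ_of_le ?_⟩
    exact (Multiset.le_sup hi).trans (Finset.le_sup (f := fun s : Multiset ℕ => s.sup) hs)
  set M := S.sup Multiset.card + 1 with hM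
  have h1 : ∑ s ∈ S, (s.map w).prod ≤ ∑ x ∈ Fintype.piFinset fun _ : Fin n => Finset.range M,
      ∏ i : Fin n, w i ^ x i := by
    have e : ∑ s ∈ S, (s.map w).prod = ∑ s ∈ S, ∏ i : Fin n, w i ^ s.count (i : ℕ) :=
      Finset.sum_congr rfl fun s hs => multiset_prod_map_eq_prod_pow w s (hn s hs)
    rw [e, ← Finset.sum_image (f := fun x : Fin n → ℕ => ∏ i : Fin n, w i ^ x i)
      (g := fun s : Multiset ℕ => fun i : Fin n => s.count (i : ℕ)) ?_]
    · refine Finset.sum_le_sum_of_subset_of_nonneg ?_ fun x _ _ =>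
        Finset.prod_nonneg fun i _ => pow_nonneg (hw _) _
      intro x hx
      obtain ⟨s, hs, rfl⟩ := Finset.mem_image.1 hx
      refine Fintype.mem_piFinset.2 fun i => Finset.mem_range.2 (Nat.lt_succ_of_le ?_)
      exact (Multiset.count_le_card _ _).trans (Finset.le_sup (f := Multiset.card) hs)
    · intro s hs t ht hst
      refine Multiset.ext.2 fun i => ?_
      by_cases hi : i < n
      · exact congrFun hst ⟨i, hi⟩
      · rw [Multiset.count_eq_zero_of_notMem fun h => hi (hn s hs i h),
          Multiset.count_eq_zero_of_notMem fun h => hi (hn t ht i h)]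
  refine h1.trans ?_
  rw [← Finset.prod_univ_sum]
  have h2 : ∀ i : Fin n, ∑ j ∈ Finset.range M, w i ^ j ≤ Real.exp (w i * (1 - ρ)⁻¹) := by
    intro i
    have hlt : w i < 1 := (hwρ _).trans_lt hρ
    have a1 : ∑ j ∈ Finset.range M, w i ^ j ≤ (1 - w i)⁻¹ := by
      rw [← tsum_geometric_of_lt_one (hw _) hlt]
      exact (summable_geometric_of_lt_one (hw _) hlt).sum_le_tsum _ fun j _ => pow_nonneg (hw _) _
    have a2 : (1 - w i)⁻¹ ≤ 1 + w i * (1 - ρ)⁻¹ := by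
      have b1 : (1 - w i)⁻¹ = 1 + w i * (1 - w i)⁻¹ := by
        have : 1 - w i ≠ 0 := by linarith
        field_simp
        ring
      rw [b1]
      have := inv_anti₀ (by linarith [hρ]) (show 1 - ρ ≤ 1 - w i by linarith [hwρ i])
      have := mul_le_mul_of_nonneg_left this (hw i)
      linarith
    have a3 := Real.add_one_le_exp (w i * (1 - ρ)⁻¹)
    linarith
  refine (Finset.prod_le_prod (fun i _ => Finset.sum_nonneg fun j _ => pow_nonneg (hw _) _)
    fun i _ => h2 i).trans ?_
  rw [← Real.exp_sum, Real.exp_le_exp, ← Finset.sum_range (fun i => w i * (1 - ρ)⁻¹)]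
  refine (hs.mul_right _).sum_le_tsum _ fun j _ => mul_nonneg (hw _) ?_
  exact inv_nonneg.2 (by linarith)

/-- A weight on parts dominated by a geometric sequence. -/
structure PartWeight (ρ : ℝ) (w : ℕ → ℂ) : Prop where
  nonneg : 0 ≤ ρ
  lt_one : ρ < 1
  zero : w 0 = 0
  le : ∀ k, k ≠ 0 → ‖w k‖ ≤ ρ ^ k

theorem norm_multiset_prod (w : ℕ → ℂ) (s : Multiset ℕ) :
    ‖(s.map w).prod‖ = (s.map fun k => ‖w k‖).prod := by
  induction s using Multiset.induction_on with
  | empty => simp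
  | cons a s ih => simp [ih]

/-- The sum over all multisets of the product of the weights. -/
noncomputable def partSum (w : ℕ → ℂ) : ℂ := ∑' s : Multiset ℕ, (s.map w).prod

theorem PartWeight.summable {ρ : ℝ} {w : ℕ → ℂ} (h : PartWeight ρ w) :
    Summable fun s : Multiset ℕ => ‖(s.map w).prod‖ := by
  simp_rw [norm_multiset_prod]
  refine summable_multiset_prod (ρ := ρ) (fun _ => norm_nonneg _) h.lt_one ?_ ?_
  · intro k
    by_cases hk : k = 0
    · simp [hk, h.zero, h.nonneg]
    · exact (h.le k hk).trans (pow_le_of_le_one h.nonneg h.lt_one.le hk)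
  · refine Summable.of_nonneg_of_le (fun _ => norm_nonneg _) (fun k => ?_)
      (summable_geometric_of_lt_one h.nonneg h.lt_one)
    by_cases hk : k = 0
    · simp [hk, h.zero]
    · exact h.le k hk

theorem PartWeight.mono {ρ : ℝ} {w w' : ℕ → ℂ} (h : PartWeight ρ w) (hw : ∀ k, ‖w' k‖ ≤ ‖w k‖) :
    PartWeight ρ w' where
  nonneg := h.nonneg
  lt_one := h.lt_one
  zero := norm_le_zero_iff.1 ((hw 0).trans (by rw [h.zero, norm_zero]))
  le := fun k hk => (hw k).trans (h.le k hk)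

/-- Adding a part `k` identifies multisets with the multisets containing `k`. -/
def consEquiv (k : ℕ) : Multiset ℕ ≃ {s : Multiset ℕ // k ∈ s} where
  toFun s := ⟨k ::ₘ s, Multiset.mem_cons_self k s⟩
  invFun s := s.1.erase k
  left_inv s := Multiset.erase_cons_head k s
  right_inv s := Subtype.ext (Multiset.cons_erase s.2)

theorem tsum_multiset_split {f : Multiset ℕ → ℂ} (hf : Summable f) (k : ℕ) :
    ∑' s, f s = ∑' s, f (k ::ₘ s) + ∑' s : Multiset ℕ, if k ∈ s then 0 else f s := by
  have h1 : ∑' s, f (k ::ₘ s) = ∑' s : {s : Multiset ℕ // k ∈ s}, f s :=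
    (consEquiv k).tsum_eq fun s : {s : Multiset ℕ // k ∈ s} => f s
  have h2 : ∑' s : {s : Multiset ℕ // k ∈ s}, f s =
      ∑' s : Multiset ℕ, Set.indicator {s : Multiset ℕ | k ∈ s} f s :=
    tsum_subtype {s : Multiset ℕ | k ∈ s} f
  rw [h1, h2, ← (hf.indicator _).tsum_add]
  · refine tsum_congr fun s => ?_
    by_cases h : k ∈ s <;> simp [h]
  · refine (hf.indicator {s : Multiset ℕ | k ∉ s}).congr fun s => ?_
    by_cases h : k ∈ s <;> simp [h]

theorem PartWeight.one_sub_mul {ρ : ℝ} {w : ℕ → ℂ} (h : PartWeight ρ w) (k : ℕ) :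
    (1 - w k) * partSum w = partSum (Function.update w k 0) := by
  have hs := tsum_multiset_split h.summable.of_norm k
  have e1 : ∑' s : Multiset ℕ, ((k ::ₘ s).map w).prod = w k * partSum w := by
    simp [partSum, tsum_mul_left]
  have e2 : ∀ s : Multiset ℕ, (if k ∈ s then 0 else (s.map w).prod) =
      (s.map (Function.update w k 0)).prod := by
    intro s
    split_ifs with hk
    · refine (Multiset.prod_eq_zero (Multiset.mem_map.2 ⟨k, hk, ?_⟩)).symm
      simp
    · refine congrArg _ (Multiset.map_congr rfl fun i hi => ?_)
      rw [Function.update_of_ne]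
      rintro rfl
      exact hk hi
  rw [e1] at hs
  simp_rw [e2] at hs
  change partSum w = _ + partSum _ at hs
  linear_combination hs

theorem PartWeight.prod_mul {ρ : ℝ} {w : ℕ → ℂ} (h : PartWeight ρ w) (n : ℕ) :
    (∏ k ∈ Finset.range n, (1 - w k)) * partSum w = partSum fun k => if k < n then 0 else w k := by
  induction n with
  | zero => simp
  | succ n ih =>
    have h2 : PartWeight ρ fun k => if k < n then 0 else w k := h.mono fun k => by
      split_ifs <;> simp
    have := h2.one_sub_mul n
    rw [← ih] at this
    simp only [lt_irrefl, if_false] at this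
    rw [Finset.prod_range_succ, mul_comm _ (1 - w n), mul_assoc, this]
    congr 1
    ext k
    by_cases hk : k = n
    · simp [hk]
    · rw [Function.update_of_ne hk]
      have : k < n + 1 ↔ k < n := by omega
      simp [this]

theorem PartWeight.tendsto_prod_mul {ρ : ℝ} {w : ℕ → ℂ} (h : PartWeight ρ w) :
    Tendsto (fun n => (∏ k ∈ Finset.range n, (1 - w k)) * partSum w) atTop (𝓝 1) := by
  simp_rw [h.prod_mul]
  have e : (1 : ℂ) = ∑' s : Multiset ℕ, if s = 0 then 1 else 0 := by rw [tsum_ite_eq]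
  rw [e]
  refine tendsto_tsum_of_dominated_convergence h.summable (fun s => ?_) (Eventually.of_forall ?_)
  · by_cases hs : s = 0
    · simp [hs]
    · obtain ⟨i, hi⟩ := Multiset.exists_mem_of_ne_zero hs
      simp only [hs, if_false]
      refine tendsto_const_nhds.congr' ?_
      filter_upwards [eventually_gt_atTop i] with n hn
      exact (Multiset.prod_eq_zero (Multiset.mem_map.2 ⟨i, hi, by simp [hn]⟩)).symm
  · intro n s
    rw [norm_multiset_prod, norm_multiset_prod]
    refine Multiset.prod_map_le_prod_map₀ _ _ (fun _ _ => norm_nonneg _) fun k _ => ?_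
    split_ifs <;> simp

/-- The rank of a multiset of parts. -/
def msRank (s : Multiset ℕ) : ℤ := (s.sup : ℤ) - (Multiset.card s : ℤ)

/-- The multiset obtained by removing the first column and inserting a new largest part that
exceeds the number of rows by `r`. -/
def dysonMap (r : ℤ) (s : Multiset ℕ) : Multiset ℕ :=
  let M := ((Multiset.card s : ℤ) + r).toNat
  let ρ := (s.map Nat.pred).filter (· ≠ 0)
  if M = 0 then ρ else M ::ₘ ρ

/-- The inverse of `dysonMap`. -/
def dysonInv (r : ℤ) (s : Multiset ℕ) : Multiset ℕ :=
  let ρ := s.erase s.sup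
  ρ.map Nat.succ + Multiset.replicate (((s.sup : ℤ) - r).toNat - Multiset.card ρ) 1

theorem Multiset.sup_mem_of_ne_zero {s : Multiset ℕ} (h : s ≠ 0) : s.sup ∈ s := by
  induction s using Multiset.induction_on with
  | empty => exact absurd rfl h
  | cons a s ih =>
    rw [Multiset.sup_cons]
    by_cases hs : s = 0
    · simp [hs]
    · rcases le_total a s.sup with h1 | h1
      · rw [sup_eq_right.2 h1]
        exact Multiset.mem_cons_of_mem (ih hs)
      · rw [sup_eq_left.2 h1]
        exact Multiset.mem_cons_self _ _

theorem Multiset.filter_map_pred_map_succ {s : Multiset ℕ} (h : 0 ∉ s) :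
    ((s.map Nat.pred).filter (· ≠ 0)).map Nat.succ + Multiset.replicate (s.count 1) 1 = s := by
  induction s using Multiset.induction_on with
  | empty => simp
  | cons a s ih =>
    have h0 : 0 ∉ s := fun h' => h (Multiset.mem_cons_of_mem h')
    have ha : a ≠ 0 := fun h' => h (h' ▸ Multiset.mem_cons_self _ _)
    by_cases h1 : a = 1
    · subst h1
      conv_rhs => rw [← ih h0]
      rw [Multiset.count_cons_self, Multiset.replicate_succ]
      simp
    · conv_rhs => rw [← ih h0]
      obtain ⟨b, rfl⟩ : ∃ b, a = b + 1 := ⟨a - 1, by omega⟩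
      have hb : b ≠ 0 := by omega
      rw [Multiset.count_cons_of_ne (by omega), Multiset.map_cons,
        Multiset.filter_cons_of_pos _ (by simpa using hb), Multiset.map_cons, Multiset.cons_add]
      rfl

theorem Multiset.card_filter_map_pred {s : Multiset ℕ} (h : 0 ∉ s) :
    Multiset.card ((s.map Nat.pred).filter (· ≠ 0)) + s.count 1 = Multiset.card s := by
  conv_rhs => rw [← Multiset.filter_map_pred_map_succ h]
  simp

theorem Multiset.sum_filter_map_pred {s : Multiset ℕ} (h : 0 ∉ s) :
    ((s.map Nat.pred).filter (· ≠ 0)).sum + Multiset.card s = s.sum := by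
  have e : ∀ u : Multiset ℕ, (u.map Nat.succ).sum = u.sum + Multiset.card u := by
    intro u
    induction u using Multiset.induction_on with
    | empty => simp
    | cons a u ih => simp [ih]; ring
  conv_rhs => rw [← Multiset.filter_map_pred_map_succ h]
  rw [Multiset.sum_add, e, ← Multiset.card_filter_map_pred h]
  simp
  ring

theorem Multiset.mem_filter_map_pred {s : Multiset ℕ} {x : ℕ}
    (h : x ∈ (s.map Nat.pred).filter (· ≠ 0)) : x ≠ 0 ∧ x + 1 ≤ s.sup := by
  obtain ⟨h1, h2⟩ := Multiset.mem_filter.1 h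
  obtain ⟨y, hy, rfl⟩ := Multiset.mem_map.1 h1
  refine ⟨h2, ?_⟩
  have := Multiset.le_sup hy
  simp only [Nat.pred_eq_sub_one] at *
  omega

theorem sup_dysonMap {r : ℤ} (hr : r ≤ -2 ∨ 2 ≤ r) {s : Multiset ℕ} (h0 : 0 ∉ s)
    (h : msRank s ≤ r + 1) : 0 ≤ (Multiset.card s : ℤ) + r ∧
      (dysonMap r s).sup = ((Multiset.card s : ℤ) + r).toNat ∧
      (dysonMap r s).erase (dysonMap r s).sup = (s.map Nat.pred).filter (· ≠ 0) := by
  have hM : 0 ≤ (Multiset.card s : ℤ) + r := by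
    unfold msRank at h
    by_cases hs : s = 0
    · subst hs
      simp at h ⊢
      omega
    · have h1 : (0 : ℤ) ≤ (s.sup : ℤ) := by positivity
      rcases hr with hr | hr
      · by_contra hcon
        have hz : s.sup = 0 := by omega
        exact h0 (hz ▸ Multiset.sup_mem_of_ne_zero hs)
      · have : (0 : ℤ) ≤ Multiset.card s := by positivity
        omega
  have hle : ((s.map Nat.pred).filter (· ≠ 0)).sup ≤ ((Multiset.card s : ℤ) + r).toNat := by
    refine Multiset.sup_le.2 fun x hx => ?_
    have := Multiset.mem_filter_map_pred hx
    unfold msRank at h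
    omega
  have key : (dysonMap r s).sup = ((Multiset.card s : ℤ) + r).toNat := by
    unfold dysonMap
    by_cases hM : ((Multiset.card s : ℤ) + r).toNat = 0
    · simp only [hM, if_true]
      rw [hM] at hle
      exact Nat.le_zero.1 hle
    · simp only [hM, if_false]
      rw [Multiset.sup_cons]
      exact sup_eq_left.2 hle
  refine ⟨hM, key, ?_⟩
  rw [key]
  unfold dysonMap
  by_cases hM : ((Multiset.card s : ℤ) + r).toNat = 0
  · simp only [hM, if_true]
    refine Multiset.erase_of_notMem fun h => ?_
    simp at h
  · simp only [hM, if_false]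
    exact Multiset.erase_cons_head _ _

theorem dysonInv_dysonMap {r : ℤ} (hr : r ≤ -2 ∨ 2 ≤ r) {s : Multiset ℕ} (h0 : 0 ∉ s)
    (h : msRank s ≤ r + 1) : dysonInv r (dysonMap r s) = s := by
  obtain ⟨h1, h2, h3⟩ := sup_dysonMap hr h0 h
  unfold dysonInv
  simp only [h3]
  rw [h2, ← Multiset.card_filter_map_pred h0]
  conv_rhs => rw [← Multiset.filter_map_pred_map_succ h0]
  congr 2
  have := Multiset.card_filter_map_pred h0
  omega

theorem dysonMap_spec {r : ℤ} (hr : r ≤ -2 ∨ 2 ≤ r) {s : Multiset ℕ} (h0 : 0 ∉ s)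
    (h : msRank s ≤ r + 1) : 0 ∉ dysonMap r s ∧ r - 1 ≤ msRank (dysonMap r s) ∧
      ((dysonMap r s).sum : ℤ) = s.sum + r := by
  obtain ⟨h1, h2, h3⟩ := sup_dysonMap hr h0 h
  have hc := Multiset.card_filter_map_pred h0
  have hS := Multiset.sum_filter_map_pred h0
  unfold msRank
  rw [h2]
  unfold dysonMap
  by_cases hM : ((Multiset.card s : ℤ) + r).toNat = 0
  · simp only [hM, if_true]
    have hz : (s.map Nat.pred).filter (· ≠ 0) = 0 := by
      rw [dysonMap] at h2
      simp only [hM, if_true] at h2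
      refine Multiset.eq_zero_of_forall_notMem fun x hx => ?_
      have := Multiset.le_sup hx
      have := (Multiset.mem_filter_map_pred hx).1
      omega
    rw [hz] at hc hS ⊢
    simp only [Multiset.card_zero, Multiset.sum_zero] at hc hS ⊢
    refine ⟨Multiset.notMem_zero _, ?_, ?_⟩ <;> omega
  · simp only [hM, if_false]
    refine ⟨?_, ?_, ?_⟩
    · rw [Multiset.mem_cons, not_or]
      exact ⟨fun h => hM h.symm, fun h => by simp at h⟩
    · rw [Multiset.card_cons]
      omega
    · rw [Multiset.sum_cons]
      omega

theorem dysonInv_spec {r : ℤ} (hr : r ≤ -2 ∨ 2 ≤ r) {s : Multiset ℕ} (h0 : 0 ∉ s)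
    (h : r - 1 ≤ msRank s) : 0 ∉ dysonInv r s ∧ msRank (dysonInv r s) ≤ r + 1 ∧
      dysonMap r (dysonInv r s) = s := by
  have hc : Multiset.card (s.erase s.sup) ≤ ((s.sup : ℤ) - r).toNat ∧ 0 ≤ (s.sup : ℤ) - r := by
    unfold msRank at h
    by_cases hs : s = 0
    · subst hs
      simp at h ⊢
      omega
    · rw [Multiset.card_erase_of_mem (Multiset.sup_mem_of_ne_zero hs)]
      have : 0 < Multiset.card s := Multiset.card_pos.2 hs
      simp only [Nat.pred_eq_sub_one]
      omega
  have hle : ∀ x ∈ s.erase s.sup, x ≤ s.sup := fun x hx => Multiset.le_sup (Multiset.mem_of_mem_erase hx)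
  have hcard : Multiset.card (dysonInv r s) = ((s.sup : ℤ) - r).toNat := by
    unfold dysonInv
    simp only [Multiset.card_add, Multiset.card_map, Multiset.card_replicate]
    omega
  have h0' : 0 ∉ s.erase s.sup := fun h => h0 (Multiset.mem_of_mem_erase h)
  refine ⟨?_, ?_, ?_⟩
  · unfold dysonInv
    simp only [Multiset.mem_add, Multiset.mem_map, not_or]
    refine ⟨fun ⟨x, _, hx⟩ => by omega, fun h => ?_⟩
    have := Multiset.eq_of_mem_replicate h
    omega
  · unfold msRank
    have : (dysonInv r s).sup ≤ s.sup + 1 := by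
      refine Multiset.sup_le.2 fun x hx => ?_
      unfold dysonInv at hx
      rcases Multiset.mem_add.1 hx with hx | hx
      · obtain ⟨y, hy, rfl⟩ := Multiset.mem_map.1 hx
        have := hle y hy
        omega
      · have := Multiset.eq_of_mem_replicate hx
        omega
    rw [hcard]
    omega
  · have e : ((Multiset.card (dysonInv r s) : ℤ) + r).toNat = s.sup := by
      rw [hcard]
      omega
    have e2 : ((dysonInv r s).map Nat.pred).filter (· ≠ 0) = s.erase s.sup := by
      unfold dysonInv
      simp only [Multiset.map_add, Multiset.map_map, Multiset.filter_add]
      have a1 : (s.erase s.sup).map (Nat.pred ∘ Nat.succ) = s.erase s.sup := by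
        conv_rhs => rw [← Multiset.map_id (s.erase s.sup)]
        rfl
      have a2 : (s.erase s.sup).filter (· ≠ 0) = s.erase s.sup :=
        Multiset.filter_eq_self.2 fun x hx h => h0' (by rw [← h]; exact hx)
      rw [a1, a2, Multiset.map_replicate]
      rw [Multiset.filter_eq_nil.2, add_zero]
      intro x hx
      have := Multiset.eq_of_mem_replicate hx
      simp at this
      simp [this]
    unfold dysonMap
    simp only [e, e2]
    by_cases hs : s = 0
    · simp [hs]
    · have hm := Multiset.sup_mem_of_ne_zero hs
      have : s.sup ≠ 0 := fun h => h0 (h ▸ hm)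
      simp only [this, if_false]
      exact Multiset.cons_erase hm

/-- Dyson's adjoint, as a bijection between partitions of rank at most `r + 1` and partitions of
rank at least `r - 1`. -/
def dysonEquiv {r : ℤ} (hr : r ≤ -2 ∨ 2 ≤ r) :
    {s : Multiset ℕ // 0 ∉ s ∧ msRank s ≤ r + 1} ≃ {s : Multiset ℕ // 0 ∉ s ∧ r - 1 ≤ msRank s} where
  toFun s := ⟨dysonMap r s, (dysonMap_spec hr s.2.1 s.2.2).1, (dysonMap_spec hr s.2.1 s.2.2).2.1⟩
  invFun s := ⟨dysonInv r s, (dysonInv_spec hr s.2.1 s.2.2).1, (dysonInv_spec hr s.2.1 s.2.2).2.1⟩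
  left_inv s := Subtype.ext (dysonInv_dysonMap hr s.2.1 s.2.2)
  right_inv s := Subtype.ext (dysonInv_spec hr s.2.1 s.2.2).2.2

/-- The weight `z * t ^ k` on parts `k`. -/
noncomputable def partWt (t z : ℂ) (k : ℕ) : ℂ := if k = 0 then 0 else z * t ^ k

theorem partWeight_partWt {t z : ℂ} (h1 : ‖t‖ < 1) (hz : ‖z‖ ≤ 1) :
    PartWeight ‖t‖ (partWt t z) where
  nonneg := norm_nonneg _
  lt_one := h1
  zero := by simp [partWt]
  le := fun k hk => by
    simp only [partWt, hk, if_false, norm_mul, norm_pow]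
    exact mul_le_of_le_one_left (by positivity) hz

theorem prod_map_partWt (t z : ℂ) (s : Multiset ℕ) :
    (s.map (partWt t z)).prod = if 0 ∈ s then 0 else z ^ Multiset.card s * t ^ s.sum := by
  split_ifs with h
  · exact Multiset.prod_eq_zero (Multiset.mem_map.2 ⟨0, h, by simp [partWt]⟩)
  · induction s using Multiset.induction_on with
    | empty => simp
    | cons a s ih =>
      have h0 : 0 ∉ s := fun h' => h (Multiset.mem_cons_of_mem h')
      have ha : a ≠ 0 := fun h' => h (h' ▸ Multiset.mem_cons_self _ _)
      rw [Multiset.map_cons, Multiset.prod_cons, ih h0, partWt, if_neg ha, Multiset.card_cons,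
        Multiset.sum_cons]
      ring

theorem qpoch_mul_partSum {t z : ℂ} (h1 : ‖t‖ < 1) (hz : ‖z‖ ≤ 1) :
    qpoch t (z * t) * partSum (partWt t z) = 1 := by
  have a1 := ((partWeight_partWt h1 hz).tendsto_prod_mul).comp (tendsto_add_atTop_nat 1)
  have a2 := (tendsto_qpoch h1 (z * t)).mul_const (partSum (partWt t z))
  refine tendsto_nhds_unique a2 (a1.congr fun n => ?_)
  simp only [Function.comp]
  rw [Finset.prod_range_succ']
  congr 1
  simp only [partWt, if_true, sub_zero, mul_one]
  refine Finset.prod_congr rfl fun k _ => ?_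
  rw [if_neg (by omega)]
  ring

/-- The sum of `c s * t ^ s.sum` over all multisets `s` of positive integers. -/
noncomputable def genSum (t : ℂ) (c : Multiset ℕ → ℂ) : ℂ :=
  ∑' s : Multiset ℕ, if 0 ∈ s then 0 else c s * t ^ s.sum

theorem summable_norm_pow_sum {t : ℂ} (h1 : ‖t‖ < 1) :
    Summable fun s : Multiset ℕ => if 0 ∈ s then 0 else ‖t‖ ^ s.sum := by
  refine (partWeight_partWt (z := 1) h1 (by simp)).summable.congr fun s => ?_
  rw [prod_map_partWt]
  split_ifs <;> simp

theorem summable_genSum_norm {t : ℂ} (h1 : ‖t‖ < 1) {c : Multiset ℕ → ℂ} (hc : ∀ s, ‖c s‖ ≤ 1) :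
    Summable fun s : Multiset ℕ => ‖if 0 ∈ s then 0 else c s * t ^ s.sum‖ := by
  refine Summable.of_nonneg_of_le (fun _ => norm_nonneg _) (fun s => ?_) (summable_norm_pow_sum h1)
  split_ifs
  · simp
  · rw [norm_mul, norm_pow]
    exact mul_le_of_le_one_left (by positivity) (hc s)

theorem summable_genSum {t : ℂ} (h1 : ‖t‖ < 1) {c : Multiset ℕ → ℂ} (hc : ∀ s, ‖c s‖ ≤ 1) :
    Summable fun s : Multiset ℕ => if 0 ∈ s then 0 else c s * t ^ s.sum :=
  (summable_genSum_norm h1 hc).of_norm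

theorem genSum_add {t : ℂ} (h1 : ‖t‖ < 1) {c c' : Multiset ℕ → ℂ} (hc : ∀ s, ‖c s‖ ≤ 1)
    (hc' : ∀ s, ‖c' s‖ ≤ 1) : genSum t (fun s => c s + c' s) = genSum t c + genSum t c' := by
  unfold genSum
  rw [← (summable_genSum h1 hc).tsum_add (summable_genSum h1 hc')]
  refine tsum_congr fun s => ?_
  split_ifs <;> ring

theorem genSum_congr {t : ℂ} {c c' : Multiset ℕ → ℂ} (h : ∀ s, 0 ∉ s → c s = c' s) :
    genSum t c = genSum t c' := by
  unfold genSum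
  refine tsum_congr fun s => ?_
  split_ifs with hs
  · rfl
  · rw [h s hs]

theorem norm_genSum_le {t : ℂ} (h1 : ‖t‖ < 1) {c : Multiset ℕ → ℂ} (hc : ∀ s, ‖c s‖ ≤ 1) :
    ‖genSum t c‖ ≤ ∑' s : Multiset ℕ, if 0 ∈ s then 0 else ‖t‖ ^ s.sum := by
  refine (norm_tsum_le_tsum_norm (summable_genSum_norm h1 hc)).trans
    ((summable_genSum_norm h1 hc).tsum_le_tsum (fun s => ?_) (summable_norm_pow_sum h1))
  split_ifs
  · simp
  · rw [norm_mul, norm_pow]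
    exact mul_le_of_le_one_left (by positivity) (hc s)

theorem qpoch_mul_genSum_one {t : ℂ} (h1 : ‖t‖ < 1) : qpoch t t * genSum t (fun _ => 1) = 1 := by
  have := qpoch_mul_partSum (z := 1) h1 (by simp)
  rw [one_mul] at this
  refine Eq.trans ?_ this
  unfold genSum partSum
  congr 1
  refine tsum_congr fun s => ?_
  rw [prod_map_partWt]
  simp

/-- Partitions of `n` are multisets of positive integers with sum `n`. -/
def partitionFiberEquiv (n : ℕ) :
    {s : {s : Multiset ℕ // 0 ∉ s} // s.1.sum = n} ≃ Nat.Partition n where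
  toFun s := ⟨s.1.1, fun {i} hi => Nat.pos_of_ne_zero fun h => s.1.2 (h ▸ hi), s.2⟩
  invFun π := ⟨⟨π.parts, fun h => (π.parts_pos h).ne rfl⟩, π.parts_sum⟩
  left_inv _ := rfl
  right_inv _ := rfl

theorem hasSum_genSum {t : ℂ} (h1 : ‖t‖ < 1) {c : Multiset ℕ → ℂ} (hc : ∀ s, ‖c s‖ ≤ 1) :
    HasSum (fun n : ℕ => (∑ π : Nat.Partition n, c π.parts) * t ^ n) (genSum t c) := by
  have a1 : HasSum (fun s : {s : Multiset ℕ // 0 ∉ s} => c s * t ^ s.1.sum) (genSum t c) := by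
    refine (hasSum_subtype_iff_indicator (s := {s : Multiset ℕ | 0 ∉ s})
      (f := fun s => c s * t ^ s.sum)).2 ?_
    refine (summable_genSum h1 hc).hasSum.congr_fun ?_ |> fun h => h
    intro s
    by_cases hs : 0 ∈ s <;> simp [hs]
  have a2 := a1.tsum_fiberwise (fun s => s.1.sum)
  refine a2.congr_fun ?_ |> fun h => h
  intro n
  have e := (partitionFiberEquiv n).symm.tsum_eq
    (fun b : {s : {s : Multiset ℕ // 0 ∉ s} // s.1.sum = n} => c b.1 * t ^ b.1.1.sum)
  refine Eq.trans ?_ e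
  rw [tsum_fintype, Finset.sum_mul]
  refine Finset.sum_congr rfl fun π _ => ?_
  simp only [partitionFiberEquiv, Equiv.coe_fn_symm_mk, π.parts_sum]

open Classical in
/-- The generating function of the partitions satisfying `p`. -/
noncomputable def genSet (t : ℂ) (p : Multiset ℕ → Prop) : ℂ := genSum t fun s => if p s then 1 else 0

theorem norm_ite_one_zero_le (p : Prop) {_ : Decidable p} : ‖(if p then 1 else 0 : ℂ)‖ ≤ 1 := by
  split_ifs <;> simp

open Classical in
theorem genSet_add {t : ℂ} (h1 : ‖t‖ < 1) {p p' p'' : Multiset ℕ → Prop}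
    (h : ∀ s, p'' s ↔ p s ∨ p' s) (h' : ∀ s, ¬(p s ∧ p' s)) :
    genSet t p'' = genSet t p + genSet t p' := by
  unfold genSet
  rw [← genSum_add h1 (fun s => norm_ite_one_zero_le _) (fun s => norm_ite_one_zero_le _)]
  refine genSum_congr fun s _ => ?_
  have := h s
  have := h' s
  by_cases a : p s <;> by_cases b : p' s <;> simp_all

theorem genSet_eq_tsum_subtype (t : ℂ) (p : Multiset ℕ → Prop) :
    genSet t p = ∑' s : {s : Multiset ℕ // 0 ∉ s ∧ p s}, t ^ s.1.sum := by
  refine Eq.trans ?_ (tsum_subtype {s : Multiset ℕ | 0 ∉ s ∧ p s} fun s => t ^ s.sum).symm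
  unfold genSet genSum
  refine tsum_congr fun s => ?_
  by_cases a : 0 ∈ s <;> by_cases b : p s <;> simp [a, b]

theorem genSet_dyson {t : ℂ} (h0 : t ≠ 0) {r : ℤ} (hr : r ≤ -2 ∨ 2 ≤ r) :
    genSet t (fun s => r - 1 ≤ msRank s) = t ^ r * genSet t (fun s => msRank s ≤ r + 1) := by
  rw [genSet_eq_tsum_subtype, genSet_eq_tsum_subtype, ← (dysonEquiv hr).tsum_eq, ← tsum_mul_left]
  refine tsum_congr fun s => ?_
  have := (dysonMap_spec hr s.2.1 s.2.2).2.2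
  change t ^ (dysonMap r s.1).sum = _
  rw [← zpow_natCast, this, zpow_add₀ h0, zpow_natCast, mul_comm]

/-- The series `∑ (-1)^(k-1) t ^ (k * (3 * k - 1) / 2 + m * k)` over `k ≥ 1`. -/
noncomputable def rankSeries (t : ℂ) (m : ℕ) : ℂ :=
  ∑' k : ℕ, (-1) ^ k * t ^ ((3 * k ^ 2 + 5 * k + 2) / 2 + m * (k + 1))

theorem two_mul_rank_exponent (k : ℕ) :
    2 * ((3 * k ^ 2 + 5 * k + 2) / 2) = 3 * k ^ 2 + 5 * k + 2 := by
  refine Nat.mul_div_cancel' ?_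
  have : 3 * k ^ 2 + 5 * k + 2 = k * (k + 1) + 2 * (k ^ 2 + 2 * k + 1) := by ring
  rw [this]
  exact dvd_add (Nat.even_mul_succ_self k).two_dvd ⟨_, rfl⟩

theorem norm_rankSeries_term_le {t : ℂ} (h1 : ‖t‖ < 1) (m k : ℕ) :
    ‖(-1) ^ k * t ^ ((3 * k ^ 2 + 5 * k + 2) / 2 + m * (k + 1))‖ ≤ ‖t‖ ^ (m + k) := by
  rw [norm_mul, norm_pow, norm_neg, norm_one, one_pow, one_mul, norm_pow]
  refine pow_le_pow_of_le_one (norm_nonneg _) h1.le ?_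
  have := two_mul_rank_exponent k
  nlinarith

theorem summable_rankSeries {t : ℂ} (h1 : ‖t‖ < 1) (m : ℕ) :
    Summable fun k : ℕ => ‖(-1) ^ k * t ^ ((3 * k ^ 2 + 5 * k + 2) / 2 + m * (k + 1))‖ := by
  refine Summable.of_nonneg_of_le (fun _ => norm_nonneg _) (norm_rankSeries_term_le h1 m) ?_
  simp_rw [pow_add]
  exact (summable_geometric_of_lt_one (norm_nonneg _) h1).mul_left _

theorem rankSeries_rec {t : ℂ} (h1 : ‖t‖ < 1) (m : ℕ) :
    rankSeries t m = t ^ (m + 1) * (1 - rankSeries t (m + 3)) := by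
  unfold rankSeries
  rw [(summable_rankSeries h1 m).of_norm.tsum_eq_zero_add, mul_sub, ← tsum_mul_left, mul_one,
    sub_eq_add_neg, ← tsum_neg]
  congr 1
  · simp [add_comm]
  · refine tsum_congr fun k => ?_
    have e : (3 * (k + 1) ^ 2 + 5 * (k + 1) + 2) / 2 + m * (k + 1 + 1) =
        (m + 1) + ((3 * k ^ 2 + 5 * k + 2) / 2 + (m + 3) * (k + 1)) := by
      have a := two_mul_rank_exponent k
      have b := two_mul_rank_exponent (k + 1)
      have c : 2 * ((3 * (k + 1) ^ 2 + 5 * (k + 1) + 2) / 2) + 2 * (m * (k + 1 + 1)) =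
        2 * ((m + 1)) + (2 * ((3 * k ^ 2 + 5 * k + 2) / 2) + 2 * ((m + 3) * (k + 1))) := by
        rw [a, b]
        ring
      omega
    rw [e, pow_add t (m + 1)]
    ring

theorem norm_rankSeries_le {t : ℂ} (h1 : ‖t‖ < 1) (m : ℕ) :
    ‖rankSeries t m‖ ≤ ∑' k : ℕ, ‖t‖ ^ k := by
  refine (norm_tsum_le_tsum_norm (summable_rankSeries h1 m)).trans
    ((summable_rankSeries h1 m).tsum_le_tsum (fun k => ?_)
      (summable_geometric_of_lt_one (norm_nonneg _) h1))
  refine (norm_rankSeries_term_le h1 m k).trans ?_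
  exact pow_le_pow_of_le_one (norm_nonneg _) h1.le (by omega)

/-- A bounded solution of the recursion is determined by it. -/
theorem eq_mul_rankSeries {t P : ℂ} (h1 : ‖t‖ < 1) {G : ℕ → ℂ} {B : ℝ} (hB : ∀ m, ‖G m‖ ≤ B)
    (hG : ∀ m, 1 ≤ m → G m = t ^ (m + 1) * (P - G (m + 3))) {m : ℕ} (hm : 1 ≤ m) :
    G m = P * rankSeries t m := by
  set C := B + ‖P‖ * ∑' k : ℕ, ‖t‖ ^ k with hC
  have key : ∀ n : ℕ, ∀ m, 1 ≤ m → ‖G m - P * rankSeries t m‖ ≤ ‖t‖ ^ n * C := by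
    intro n
    induction n with
    | zero =>
      intro m _
      rw [pow_zero, one_mul]
      refine (norm_sub_le _ _).trans (add_le_add (hB m) ?_)
      rw [norm_mul]
      exact mul_le_mul_of_nonneg_left (norm_rankSeries_le h1 m) (norm_nonneg _)
    | succ n ih =>
      intro m hm
      have e : G m - P * rankSeries t m = -t ^ (m + 1) * (G (m + 3) - P * rankSeries t (m + 3)) := by
        rw [hG m hm, rankSeries_rec h1 m]
        ring
      rw [e, norm_mul, norm_neg, norm_pow, pow_succ' ‖t‖ n, mul_assoc]
      exact mul_le_mul (pow_le_of_le_one (norm_nonneg _) h1.le (by omega)) (ih _ (by omega))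
        (norm_nonneg _) (norm_nonneg _)
  have lim : Tendsto (fun n => ‖t‖ ^ n * C) atTop (𝓝 0) := by
    simpa using (tendsto_pow_atTop_nhds_zero_of_lt_one (norm_nonneg _) h1).mul_const C
  have := ge_of_tendsto' lim fun n => key n m hm
  exact sub_eq_zero.1 (norm_le_zero_iff.1 this)

theorem genSet_le_add_genSet {t : ℂ} (h1 : ‖t‖ < 1) (m : ℤ) :
    genSet t (fun s => msRank s ≤ m) = genSum t (fun _ => 1) - genSet t (fun s => m + 1 ≤ msRank s) := by
  have : genSet t (fun _ => True) = _ := genSet_add (p := fun s => msRank s ≤ m)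
    (p' := fun s => m + 1 ≤ msRank s) h1 (fun s => by simp only [true_iff]; omega)
    (fun s => by omega)
  rw [← show genSet t (fun _ => True) = genSum t (fun _ => 1) by simp [genSet], this]
  ring

theorem genSet_rank_ge {t : ℂ} (h0 : t ≠ 0) (h1 : ‖t‖ < 1) {m : ℕ} (hm : 1 ≤ m) :
    genSet t (fun s => (m : ℤ) ≤ msRank s) = genSum t (fun _ => 1) * rankSeries t m := by
  refine eq_mul_rankSeries (G := fun m : ℕ => genSet t (fun s => (m : ℤ) ≤ msRank s)) h1
    (fun m => norm_genSum_le h1 fun s => norm_ite_one_zero_le _) ?_ hm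
  intro m hm
  have := genSet_dyson h0 (r := m + 1) (by omega)
  rw [add_sub_cancel_right, genSet_le_add_genSet h1] at this
  rw [this]
  norm_cast

theorem genSet_rank_le {t : ℂ} (h0 : t ≠ 0) (h1 : ‖t‖ < 1) {m : ℕ} (hm : 1 ≤ m) :
    genSet t (fun s => msRank s ≤ -(m : ℤ)) = genSum t (fun _ => 1) * rankSeries t m := by
  refine eq_mul_rankSeries (G := fun m : ℕ => genSet t (fun s => msRank s ≤ -(m : ℤ))) h1
    (fun m => norm_genSum_le h1 fun s => norm_ite_one_zero_le _) ?_ hm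
  intro m hm
  have := genSet_dyson h0 (r := -m - 1) (by omega)
  have e := genSet_le_add_genSet h1 (t := t) (-((m + 3 : ℕ) : ℤ))
  have e2 : -(m : ℤ) - 1 - 1 = -((m + 3 : ℕ) : ℤ) + 1 := by push_cast; ring
  have e3 : -(m : ℤ) - 1 = -((m + 1 : ℕ) : ℤ) := by push_cast; ring
  rw [e2, sub_add_cancel, e3, zpow_neg, zpow_natCast] at this
  have ht : t ^ (m + 1) ≠ 0 := pow_ne_zero _ h0
  rw [e, this]
  field_simp
  ring

theorem genSet_rank_eq {t : ℂ} (h0 : t ≠ 0) (h1 : ‖t‖ < 1) {m : ℕ} (hm : 1 ≤ m) :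
    genSet t (fun s => msRank s = m) =
      genSum t (fun _ => 1) * (rankSeries t m - rankSeries t (m + 1)) := by
  have := genSet_add (p'' := fun s => (m : ℤ) ≤ msRank s) (p := fun s => msRank s = m)
    (p' := fun s => ((m + 1 : ℕ) : ℤ) ≤ msRank s) h1 (fun s => by push_cast; omega)
    (fun s => by push_cast; omega)
  rw [genSet_rank_ge h0 h1 hm, genSet_rank_ge h0 h1 (by omega)] at this
  linear_combination -this

theorem genSet_rank_eq_neg {t : ℂ} (h0 : t ≠ 0) (h1 : ‖t‖ < 1) {m : ℕ} (hm : 1 ≤ m) :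
    genSet t (fun s => msRank s = -(m : ℤ)) =
      genSum t (fun _ => 1) * (rankSeries t m - rankSeries t (m + 1)) := by
  have := genSet_add (p'' := fun s => msRank s ≤ -(m : ℤ)) (p := fun s => msRank s = -(m : ℤ))
    (p' := fun s => msRank s ≤ -((m + 1 : ℕ) : ℤ)) h1 (fun s => by push_cast; omega)
    (fun s => by push_cast; omega)
  rw [genSet_rank_le h0 h1 hm, genSet_rank_le h0 h1 (by omega)] at this
  linear_combination -this

/-- The Lambert series obtained by summing `rankSeries t (m + 11 * j)` over `j`. -/
noncomputable def rankLambert (t : ℂ) (m : ℕ) : ℂ :=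
  ∑' k : ℕ, (-1) ^ k * t ^ ((3 * k ^ 2 + 5 * k + 2) / 2 + m * (k + 1)) / (1 - t ^ (11 * (k + 1)))

theorem hasSum_rankSeries {t : ℂ} (h1 : ‖t‖ < 1) (m : ℕ) :
    HasSum (fun j : ℕ => rankSeries t (m + 11 * j)) (rankLambert t m) := by
  obtain ⟨f, hf⟩ : ∃ f : ℕ × ℕ → ℂ, ∀ k j, f (k, j) =
    (-1) ^ k * t ^ ((3 * k ^ 2 + 5 * k + 2) / 2 + (m + 11 * j) * (k + 1)) :=
    ⟨fun x => (-1) ^ x.1 * t ^ ((3 * x.1 ^ 2 + 5 * x.1 + 2) / 2 + (m + 11 * x.2) * (x.1 + 1)),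
      fun k j => rfl⟩
  have hs : Summable f := by
    refine Summable.of_norm (Summable.of_nonneg_of_le (fun _ => norm_nonneg _)
      (g := fun x => ‖f x‖) (f := fun x : ℕ × ℕ => ‖t‖ ^ x.1 * ‖t‖ ^ x.2) (fun ⟨k, j⟩ => ?_) ?_)
    · rw [hf]
      refine (norm_rankSeries_term_le h1 _ _).trans ?_
      rw [← pow_add]
      exact pow_le_pow_of_le_one (norm_nonneg _) h1.le (by omega)
    · have := summable_geometric_of_lt_one (norm_nonneg t) h1
      exact this.mul_of_nonneg this (fun _ => by positivity) (fun _ => by positivity)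
  have e1 : ∑' x, f x = rankLambert t m := by
    rw [hs.tsum_prod]
    refine tsum_congr fun k => ?_
    have hk : ‖t ^ (11 * (k + 1))‖ < 1 := by
      rw [norm_pow]
      exact pow_lt_one₀ (norm_nonneg _) h1 (by omega)
    have : ∀ j, f (k, j) = (-1) ^ k * t ^ ((3 * k ^ 2 + 5 * k + 2) / 2 + m * (k + 1)) *
        (t ^ (11 * (k + 1))) ^ j := by
      intro j
      rw [hf, mul_assoc, ← pow_mul, ← pow_add]
      congr 2
      ring
    simp_rw [this]
    rw [tsum_mul_left, tsum_geometric_of_norm_lt_one hk, div_eq_mul_inv]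
  have hsw : HasSum (fun x : ℕ × ℕ => f x.swap) (rankLambert t m) := by
    rw [← e1]
    exact (Equiv.prodComm ℕ ℕ).hasSum_iff.2 hs.hasSum
  refine hsw.prod_fiberwise fun j => ?_
  simp only [Prod.swap_prod_mk, hf]
  exact (summable_rankSeries h1 _).of_norm.hasSum

theorem hasSum_genSet_rank {t : ℂ} (h1 : ‖t‖ < 1) (p : ℤ → Prop) [DecidablePred p] :
    HasSum (fun r : ℤ => if p r then genSet t (fun s => msRank s = r) else 0)
      (genSet t fun s => p (msRank s)) := by
  classical
  have a1 := (summable_genSum h1 (c := fun s => if p (msRank s) then 1 else 0)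
    fun s => norm_ite_one_zero_le _).hasSum.tsum_fiberwise msRank
  have e : genSet t (fun s => p (msRank s)) = genSum t (fun s => if p (msRank s) then 1 else 0) := by
    unfold genSet
    exact genSum_congr fun s _ => by congr
  rw [e]
  refine a1.congr_fun ?_ |> fun h => h
  intro r
  refine Eq.trans ?_ (tsum_subtype (msRank ⁻¹' {r}) fun s =>
    if 0 ∈ s then 0 else (if p (msRank s) then 1 else 0) * t ^ s.sum).symm
  unfold genSet genSum
  by_cases hp : p r
  · rw [if_pos hp]
    refine tsum_congr fun s => ?_
    by_cases hr : msRank s = r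
    · simp [hr, hp]
    · simp [hr]
  · rw [if_neg hp, ← tsum_zero]
    refine tsum_congr fun s => ?_
    by_cases hr : msRank s = r
    · simp [hr, hp]
    · simp [hr]

theorem genSet_rank_mod {t : ℂ} (h0 : t ≠ 0) (h1 : ‖t‖ < 1) {a b : ℕ} (ha : 1 ≤ a) (hb : 1 ≤ b)
    (hab : a + b = 11) :
    qpoch t t * genSet t (fun s => msRank s % 11 = (a : ℤ)) =
      rankLambert t a - rankLambert t (a + 1) + (rankLambert t b - rankLambert t (b + 1)) := by
  set P := genSum t fun _ => 1 with hP
  have hPE : qpoch t t * P = 1 := qpoch_mul_genSum_one h1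
  have a1 := hasSum_genSet_rank h1 (t := t) (fun r : ℤ => r % 11 = (a : ℤ))
  have hinj : Function.Injective (fun j : ℤ => (a : ℤ) + 11 * j) := fun x y h => by
    simp only at h
    omega
  rw [← hinj.hasSum_iff] at a1
  swap
  · intro r hr
    rw [if_neg]
    intro h
    exact hr ⟨r / 11, by simp only; omega⟩
  have b1 : HasSum (fun n : ℕ => P * (rankSeries t (a + 11 * n) - rankSeries t (a + 1 + 11 * n)))
      (P * (rankLambert t a - rankLambert t (a + 1))) :=
    ((hasSum_rankSeries h1 a).sub (hasSum_rankSeries h1 (a + 1))).mul_left P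
  have b2 : HasSum (fun n : ℕ => P * (rankSeries t (b + 11 * n) - rankSeries t (b + 1 + 11 * n)))
      (P * (rankLambert t b - rankLambert t (b + 1))) :=
    ((hasSum_rankSeries h1 b).sub (hasSum_rankSeries h1 (b + 1))).mul_left P
  have key := a1.unique (HasSum.of_nat_of_neg_add_one (f := fun j : ℤ =>
    if ((a : ℤ) + 11 * j) % 11 = (a : ℤ) then genSet t (fun s => msRank s = (a : ℤ) + 11 * j) else 0)
    (b1.congr_fun (fun n => ?_)) (b2.congr_fun (fun n => ?_)))
  · rw [key]
    linear_combination (rankLambert t a - rankLambert t (a + 1) +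
      (rankLambert t b - rankLambert t (b + 1))) * hPE
  · rw [if_pos (by omega)]
    have := genSet_rank_eq h0 h1 (m := a + 11 * n) (by omega)
    push_cast at this
    rw [this]
    congr 3
    ring
  · rw [if_pos (by omega)]
    have := genSet_rank_eq_neg h0 h1 (m := b + 11 * n) (by omega)
    have e : -((b + 11 * n : ℕ) : ℤ) = (a : ℤ) + 11 * -((n : ℤ) + 1) := by push_cast; omega
    rw [e] at this
    rw [this]
    congr 3
    ring

theorem genSet_rank_mod_zero {t : ℂ} (h1 : ‖t‖ < 1) :
    genSum t (fun _ => 1) = genSet t (fun s => msRank s % 11 = 0) +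
      ∑ a ∈ Finset.range 10, genSet t (fun s => msRank s % 11 = ((a + 1 : ℕ) : ℤ)) := by
  have key : ∀ n : ℕ, genSet t (fun s => msRank s % 11 < ((n + 1 : ℕ) : ℤ)) =
      genSet t (fun s => msRank s % 11 = 0) +
      ∑ a ∈ Finset.range n, genSet t (fun s => msRank s % 11 = ((a + 1 : ℕ) : ℤ)) := by
    intro n
    induction n with
    | zero =>
      simp only [Finset.range_zero, Finset.sum_empty, add_zero]
      congr 1
      ext s
      push_cast
      omega
    | succ n ih =>
      rw [Finset.sum_range_succ, ← add_assoc, ← ih]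
      exact genSet_add h1 (fun s => by push_cast; omega) (fun s => by push_cast; omega)
  rw [← key 10]
  unfold genSet
  refine genSum_congr fun s _ => ?_
  rw [if_pos]
  push_cast
  omega

/-- The bilateral series `∑ (-1)^k t^(d k(k+1)/2 + b k) / (1 - t^(11 k))` over `k ≠ 0`. -/
noncomputable def lambertSum (d : ℕ) (b : ℤ) (t : ℂ) : ℂ :=
  ∑' k : ℤ, appellCoeff d t (t ^ b) k / (1 - t ^ (11 * k))

theorem summable_rankLambert {t : ℂ} (h1 : ‖t‖ < 1) (m : ℕ) :
    Summable fun k : ℕ => (-1) ^ k * t ^ ((3 * k ^ 2 + 5 * k + 2) / 2 + m * (k + 1)) /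
      (1 - t ^ (11 * (k + 1))) := by
  refine Summable.of_norm (Summable.of_nonneg_of_le (fun _ => norm_nonneg _) (fun k => ?_)
    ((summable_rankSeries h1 m).mul_right ((1 - ‖t‖)⁻¹)))
  rw [norm_div, div_eq_mul_inv]
  refine mul_le_mul_of_nonneg_left (inv_anti₀ (by linarith) ?_) (norm_nonneg _)
  refine le_trans ?_ (norm_sub_norm_le _ _)
  rw [norm_one, norm_pow]
  have := pow_le_of_le_one (norm_nonneg t) h1.le (show 11 * (k + 1) ≠ 0 by omega)
  linarith

theorem lambertSum_three {t : ℂ} (h0 : t ≠ 0) (h1 : ‖t‖ < 1) {a b : ℕ} (hab : a + b = 12) :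
    lambertSum 3 ((a : ℤ) - 2) t = rankLambert t b - rankLambert t a := by
  have A : HasSum (fun k : ℕ => appellCoeff 3 t (t ^ ((a : ℤ) - 2)) ((k : ℤ) + 1) /
      (1 - t ^ (11 * ((k : ℤ) + 1)))) (-rankLambert t a) := by
    refine (summable_rankLambert h1 a).hasSum.neg.congr_fun fun k => ?_
    have e := two_mul_rank_exponent k
    have e' : (2 * (((3 * k ^ 2 + 5 * k + 2) / 2 : ℕ) : ℤ)) = 3 * (k : ℤ) ^ 2 + 5 * k + 2 := by
      exact_mod_cast e
    have e2 := two_mul_tri ((k : ℤ) + 1 + 1)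
    have e3 : ((3 : ℕ) : ℤ) * tri ((k : ℤ) + 1 + 1) + ((a : ℤ) - 2) * ((k : ℤ) + 1) =
        (((3 * k ^ 2 + 5 * k + 2) / 2 + a * (k + 1) : ℕ) : ℤ) := by
      push_cast at e' ⊢
      linarith
    unfold appellCoeff
    rw [← zpow_mul, mul_assoc, ← zpow_add₀ h0, e3, zpow_natCast, zpow_add_one₀ (by norm_num), zpow_natCast]
    have e4 : t ^ (11 * ((k : ℤ) + 1)) = t ^ (11 * (k + 1)) := by norm_cast
    rw [e4]
    ring
  have B : HasSum (fun k : ℕ => appellCoeff 3 t (t ^ ((a : ℤ) - 2)) (-((k : ℤ) + 1)) /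
      (1 - t ^ (11 * -((k : ℤ) + 1)))) (rankLambert t b) := by
    refine (summable_rankLambert h1 b).hasSum.congr_fun fun k => ?_
    have e := two_mul_rank_exponent k
    have e' : (2 * (((3 * k ^ 2 + 5 * k + 2) / 2 : ℕ) : ℤ)) = 3 * (k : ℤ) ^ 2 + 5 * k + 2 := by
      exact_mod_cast e
    have e2 := two_mul_tri (-((k : ℤ) + 1) + 1)
    have hb : (b : ℤ) = 12 - a := by omega
    have e3 : ((3 : ℕ) : ℤ) * tri (-((k : ℤ) + 1) + 1) + ((a : ℤ) - 2) * (-((k : ℤ) + 1)) =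
        (((3 * k ^ 2 + 5 * k + 2) / 2 + b * (k + 1) : ℕ) : ℤ) + -(11 * (k + 1) : ℕ) := by
      push_cast at e' ⊢
      rw [hb]
      linarith
    unfold appellCoeff
    rw [← zpow_mul, mul_assoc, ← zpow_add₀ h0, e3, zpow_add₀ h0, zpow_natCast, zpow_neg,
      zpow_neg, zpow_natCast, zpow_add_one₀ (by norm_num), zpow_natCast]
    have e4 : t ^ (11 * -((k : ℤ) + 1)) = (t ^ (11 * (k + 1)))⁻¹ := by
      rw [mul_neg, zpow_neg]
      norm_cast
    rw [e4]
    have n1 : t ^ (11 * (k + 1)) ≠ 0 := pow_ne_zero _ h0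
    have n2 : t ^ (11 * (k + 1)) - 1 ≠ 0 := by
      have := one_sub_pow_ne_zero h1 (11 * k + 10)
      exact fun h => this (by rw [← pow_succ']; linear_combination -h)
    have n3 : 1 - t ^ (11 * (k + 1)) ≠ 0 := fun h => n2 (by linear_combination -h)
    have n4 : ((-1 : ℂ) ^ k) * ((-1 : ℂ) ^ k) = 1 := by rw [← mul_pow]; simp
    have n5 : ((-1 : ℂ) ^ k) ≠ 0 := pow_ne_zero _ (by norm_num)
    rw [show 1 - (t ^ (11 * (k + 1)))⁻¹ = -((1 - t ^ (11 * (k + 1))) * (t ^ (11 * (k + 1)))⁻¹) by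
      field_simp; ring]
    have n6 : (((-1 : ℂ) ^ k) * (-1))⁻¹ = -(-1) ^ k := by
      field_simp
      linear_combination n4
    rw [n6]
    field_simp
  have h := HasSum.of_add_one_of_neg_add_one (f := fun k : ℤ => appellCoeff 3 t (t ^ ((a : ℤ) - 2)) k /
      (1 - t ^ (11 * k))) A B
  unfold lambertSum
  rw [h.tsum_eq]
  simp
  ring

/-- The coefficients `(a; q)_i / (q; q)_i`. -/
noncomputable def qbinCoeff (q a : ℂ) (i : ℕ) : ℂ :=
  (∏ k ∈ Finset.range i, (1 - a * q ^ k)) / ∏ k ∈ Finset.range i, (1 - q * q ^ k)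

theorem exists_norm_qbinCoeff_le {q : ℂ} (h1 : ‖q‖ < 1) (a : ℂ) :
    ∃ B, ∀ i, ‖qbinCoeff q a i‖ ≤ B := by
  have hq : qpoch q q ≠ 0 := qpoch_self_ne_zero h1
  have := ((tendsto_qpoch h1 a).div (tendsto_qpoch h1 q) hq).norm.bddAbove_range
  obtain ⟨B, hB⟩ := this
  exact ⟨B, fun i => hB ⟨i, rfl⟩⟩

theorem qbinCoeff_succ {q : ℂ} (h1 : ‖q‖ < 1) (a : ℂ) (i : ℕ) :
    qbinCoeff q a (i + 1) * (1 - q ^ (i + 1)) = qbinCoeff q a i * (1 - a * q ^ i) := by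
  unfold qbinCoeff
  rw [Finset.prod_range_succ, Finset.prod_range_succ, pow_succ]
  have h2 : 1 - q ^ i * q ≠ 0 := by
    rw [mul_comm]
    exact one_sub_pow_ne_zero h1 i
  rw [mul_comm q]
  have h3 : ∏ k ∈ Finset.range i, (1 - q * q ^ k) ≠ 0 :=
    Finset.prod_ne_zero_iff.2 fun k _ => one_sub_pow_ne_zero h1 k
  field_simp

theorem summable_qbinCoeff {q x : ℂ} (h1 : ‖q‖ < 1) (hx : ‖x‖ < 1) (a : ℂ) :
    Summable fun i : ℕ => qbinCoeff q a i * x ^ i := by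
  obtain ⟨B, hB⟩ := exists_norm_qbinCoeff_le h1 a
  refine Summable.of_norm_bounded (g := fun i => B * ‖x‖ ^ i)
    ((summable_geometric_of_lt_one (norm_nonneg _) hx).mul_left B) fun i => ?_
  rw [norm_mul, norm_pow]
  exact mul_le_mul_of_nonneg_right (hB i) (by positivity)

theorem qbinomial_step {q x : ℂ} (h1 : ‖q‖ < 1) (hx : ‖x‖ < 1) (a : ℂ) :
    (1 - x) * ∑' i : ℕ, qbinCoeff q a i * x ^ i =
      (1 - a * x) * ∑' i : ℕ, qbinCoeff q a i * (x * q) ^ i := by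
  have hxq : ‖x * q‖ < 1 := by
    rw [norm_mul]
    exact mul_lt_one_of_nonneg_of_lt_one_left (norm_nonneg _) hx h1.le
  have s1 := summable_qbinCoeff h1 hx a
  have s2 := summable_qbinCoeff h1 hxq a
  have e : ∑' i : ℕ, qbinCoeff q a i * x ^ i - ∑' i : ℕ, qbinCoeff q a i * (x * q) ^ i =
      x * (∑' i : ℕ, qbinCoeff q a i * x ^ i - a * ∑' i : ℕ, qbinCoeff q a i * (x * q) ^ i) := by
    rw [← s1.tsum_sub s2, (s1.sub s2).tsum_eq_zero_add, ← tsum_mul_left, ← s1.tsum_sub (s2.mul_left a),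
      ← tsum_mul_left]
    simp only [pow_zero, mul_one, sub_self, zero_add]
    refine tsum_congr fun i => ?_
    have := qbinCoeff_succ h1 a i
    rw [mul_pow, mul_pow]
    linear_combination x ^ (i + 1) * this
  linear_combination e

/-- The `q`-binomial theorem. -/
theorem qbinomial {q x : ℂ} (h1 : ‖q‖ < 1) (hx : ‖x‖ < 1) (a : ℂ) :
    qpoch q x * ∑' i : ℕ, qbinCoeff q a i * x ^ i = qpoch q (a * x) := by
  have hn : ∀ n : ℕ, ‖x * q ^ n‖ < 1 := fun n => by
    rw [norm_mul, norm_pow]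
    exact mul_lt_one_of_nonneg_of_lt_one_left (norm_nonneg _) hx (pow_le_one₀ (norm_nonneg _) h1.le)
  have key : ∀ n : ℕ, (∏ k ∈ Finset.range n, (1 - x * q ^ k)) * ∑' i : ℕ, qbinCoeff q a i * x ^ i =
      (∏ k ∈ Finset.range n, (1 - a * x * q ^ k)) * ∑' i : ℕ, qbinCoeff q a i * (x * q ^ n) ^ i := by
    intro n
    induction n with
    | zero => simp
    | succ n ih =>
      rw [Finset.prod_range_succ, mul_right_comm, ih, Finset.prod_range_succ]
      have := qbinomial_step h1 (hn n) a
      rw [mul_assoc x, ← pow_succ] at this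
      linear_combination (∏ k ∈ Finset.range n, (1 - a * x * q ^ k)) * this
  have lim : Tendsto (fun n : ℕ => ∑' i : ℕ, qbinCoeff q a i * (x * q ^ n) ^ i) atTop (𝓝 1) := by
    have e : (1 : ℂ) = ∑' i : ℕ, if i = 0 then 1 else 0 := by rw [tsum_ite_eq]
    rw [e]
    obtain ⟨B, hB⟩ := exists_norm_qbinCoeff_le h1 a
    refine tendsto_tsum_of_dominated_convergence (bound := fun i => B * ‖x‖ ^ i)
      ((summable_geometric_of_lt_one (norm_nonneg _) hx).mul_left B) (fun i => ?_)
      (Eventually.of_forall fun n i => ?_)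
    · by_cases hi : i = 0
      · simp [hi, qbinCoeff]
      · simp only [hi, if_false]
        have := ((tendsto_pow_atTop_nhds_zero_of_norm_lt_one h1).const_mul x).pow i
        simpa [hi] using this.const_mul (qbinCoeff q a i)
    · rw [norm_mul, norm_pow, norm_mul, norm_pow]
      have hB0 : 0 ≤ B := (norm_nonneg _).trans (hB 0)
      refine mul_le_mul (hB i) (pow_le_pow_left₀ (by positivity) ?_ i) (by positivity) hB0
      exact mul_le_of_le_one_right (norm_nonneg _) (pow_le_one₀ (norm_nonneg _) h1.le)
  have := (tendsto_qpoch h1 (a * x)).mul lim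
  rw [mul_one] at this
  exact tendsto_nhds_unique ((tendsto_qpoch h1 x).mul_const _) (this.congr fun n => (key n).symm)

theorem partSum_zero {w : ℕ → ℂ} (hw : ∀ k, w k = 0) : partSum w = 1 := by
  unfold partSum
  rw [tsum_eq_single 0]
  · simp
  · intro s hs
    obtain ⟨i, hi⟩ := Multiset.exists_mem_of_ne_zero hs
    exact Multiset.prod_eq_zero (Multiset.mem_map.2 ⟨i, hi, hw i⟩)

/-- The crank of a multiset of parts. -/
def msCrank (s : Multiset ℕ) : ℤ :=
  if s.count 1 = 0 then (s.sup : ℤ)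
  else ((s.filter fun x => s.count 1 < x).card : ℤ) - (s.count 1 : ℤ)

theorem norm_zpow_eq_one {z : ℂ} (hz : ‖z‖ = 1) (n : ℤ) : ‖z ^ n‖ = 1 := by
  rw [norm_zpow, hz, one_zpow]

/-- The partitions with largest part `m + 1`. -/
def consSupEquiv (m : ℕ) : {s : Multiset ℕ // s.sup ≤ m + 1} ≃ {s : Multiset ℕ // s.sup = m + 1} where
  toFun s := ⟨(m + 1) ::ₘ s, by rw [Multiset.sup_cons]; exact sup_eq_left.2 s.2⟩
  invFun s := ⟨s.1.erase (m + 1), (Multiset.sup_mono (Multiset.erase_subset _ _)).trans s.2.le⟩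
  left_inv s := Subtype.ext (Multiset.erase_cons_head _ _)
  right_inv s := Subtype.ext (Multiset.cons_erase (by
    have h : s.1 ≠ 0 := fun h => by
      have := s.2
      rw [h] at this
      simp at this
    have := Multiset.sup_mem_of_ne_zero h
    rwa [s.2] at this))

theorem genSum_pow_sup {t z : ℂ} (h1 : ‖t‖ < 1) (hz : ‖z‖ = 1) :
    genSum t (fun s => z ^ s.sup) = partSum (partWt t z) := by
  have hc : ∀ s : Multiset ℕ, ‖z ^ s.sup‖ ≤ 1 := fun s => by rw [norm_pow, hz, one_pow]
  have hzt : ‖z * t‖ < 1 := by rwa [norm_mul, hz, one_mul]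
  have a1 := (summable_genSum h1 hc).hasSum.tsum_fiberwise (fun s : Multiset ℕ => s.sup)
  have a2 : HasSum (fun m : ℕ => qbinCoeff t 0 m * (z * t) ^ m) (genSum t fun s => z ^ s.sup) := by
    refine a1.congr_fun ?_ |> fun h => h
    intro m
    have hw : PartWeight ‖t‖ fun k => if k < m + 1 then partWt t 1 k else 0 :=
      (partWeight_partWt (z := 1) h1 (by simp)).mono fun k => by split_ifs <;> simp
    have hm : (∏ k ∈ Finset.range m, (1 - t * t ^ k)) *
        partSum (fun k => if k < m + 1 then partWt t 1 k else 0) = 1 := by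
      have := hw.prod_mul (m + 1)
      rw [partSum_zero (w := fun k => if k < m + 1 then 0 else if k < m + 1 then partWt t 1 k else 0)
        (fun k => by split_ifs <;> rfl)] at this
      refine Eq.trans ?_ this
      rw [Finset.prod_range_succ']
      congr 1
      simp only [Nat.zero_lt_succ, if_true, partWt, sub_zero, mul_one]
      refine Finset.prod_congr rfl fun k hk => ?_
      have := Finset.mem_range.1 hk
      rw [if_pos (by omega), if_neg (by omega)]
      ring
    have hle : partSum (fun k => if k < m + 1 then partWt t 1 k else 0) =
        ∑' s : {s : Multiset ℕ // s.sup ≤ m}, if 0 ∈ s.1 then 0 else t ^ s.1.sum := by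
      refine Eq.trans ?_ (tsum_subtype {s : Multiset ℕ | s.sup ≤ m} fun s =>
        if 0 ∈ s then 0 else t ^ s.sum).symm
      refine tsum_congr fun s => ?_
      by_cases hs : s.sup ≤ m
      · rw [Set.indicator_of_mem (show s ∈ {s : Multiset ℕ | s.sup ≤ m} from hs)]
        have := prod_map_partWt t 1 s
        simp only [one_pow, one_mul] at this
        rw [← this]
        refine congrArg _ (Multiset.map_congr rfl fun k hk => ?_)
        rw [if_pos (Nat.lt_succ_of_le ((Multiset.le_sup hk).trans hs))]
      · rw [Set.indicator_of_notMem (show s ∉ {s : Multiset ℕ | s.sup ≤ m} from hs)]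
        have h0 : s ≠ 0 := fun h => by simp [h] at hs
        refine Multiset.prod_eq_zero (Multiset.mem_map.2 ⟨s.sup, Multiset.sup_mem_of_ne_zero h0, ?_⟩)
        rw [if_neg (by omega)]
    have hq : qbinCoeff t 0 m = partSum (fun k => if k < m + 1 then partWt t 1 k else 0) := by
      unfold qbinCoeff
      simp only [zero_mul, sub_zero, Finset.prod_const_one]
      exact (eq_one_div_of_mul_eq_one_right hm).symm
    rw [hq]
    cases m with
    | zero =>
      rw [partSum_zero (fun k => by by_cases hk : k = 0 <;> simp [partWt, hk])]
      have : ∀ s : ((fun s : Multiset ℕ => s.sup) ⁻¹' {0} : Set (Multiset ℕ)),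
          (if 0 ∈ s.1 then 0 else z ^ s.1.sup * t ^ s.1.sum) = if s = ⟨0, rfl⟩ then 1 else 0 := by
        rintro ⟨s, hs⟩
        by_cases h : s = 0
        · subst h
          simp
        · have hm := Multiset.sup_mem_of_ne_zero h
          have hs' : s.sup = 0 := hs
          rw [hs'] at hm
          rw [if_pos hm, if_neg (fun h' => h (congrArg Subtype.val h'))]
      rw [tsum_congr this, tsum_ite_eq]
      simp
    | succ m =>
      rw [hle, ← tsum_mul_right]
      refine Eq.trans ?_ ((consSupEquiv m).tsum_eq fun s : {s : Multiset ℕ // s.sup = m + 1} =>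
        if 0 ∈ s.1 then 0 else z ^ s.1.sup * t ^ s.1.sum)
      refine tsum_congr fun s => ?_
      rw [(consSupEquiv m s).2]
      simp only [consSupEquiv, Equiv.coe_fn_mk, Multiset.mem_cons, Multiset.sum_cons]
      by_cases h0 : 0 ∈ s.1
      · simp [h0]
      · rw [if_neg h0, if_neg (by simpa using h0)]
        rw [pow_add]
        ring
  have b := qbinomial h1 hzt 0
  rw [a2.tsum_eq, zero_mul] at b
  have c := qpoch_mul_partSum h1 hz.le
  have d : qpoch t (0 : ℂ) = 1 := by simp [qpoch]
  have hne : qpoch t (z * t) ≠ 0 := fun h => by simp [h] at c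
  exact mul_left_cancel₀ hne (by rw [b, c, d])

/-- Multisets with `i` ones correspond to multisets without ones. -/
def onesEquiv (i : ℕ) : {s : Multiset ℕ // 1 ∉ s} ≃ {s : Multiset ℕ // s.count 1 = i} where
  toFun s := ⟨s.1 + Multiset.replicate i 1, by
    rw [Multiset.count_add, Multiset.count_eq_zero_of_notMem s.2, Multiset.count_replicate_self,
      zero_add]⟩
  invFun s := ⟨s.1.filter (· ≠ 1), fun h => (Multiset.mem_filter.1 h).2 rfl⟩
  left_inv s := Subtype.ext (by
    simp only [Multiset.filter_add]
    have a1 : s.1.filter (· ≠ 1) = s.1 :=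
      Multiset.filter_eq_self.2 fun x hx h => s.2 (by subst h; exact hx)
    have a2 : (Multiset.replicate i 1).filter (· ≠ 1) = 0 :=
      Multiset.filter_eq_nil.2 fun x hx h => h (Multiset.eq_of_mem_replicate hx)
    rw [a1, a2, add_zero])
  right_inv s := Subtype.ext (by
    change s.1.filter (· ≠ 1) + Multiset.replicate i 1 = s.1
    conv_rhs => rw [← Multiset.filter_add_not (· ≠ 1) s.1]
    congr 1
    have e : s.1.filter (fun x => ¬ x ≠ 1) = s.1.filter (Eq 1) :=
      Multiset.filter_congr fun x _ => by simp [eq_comm]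
    rw [e, Multiset.filter_eq, s.2])

theorem tsum_split_ones {t : ℂ} {c : Multiset ℕ → ℂ} (h1 : ‖t‖ < 1) (hc : ∀ s, ‖c s‖ ≤ 1) :
    HasSum (fun i : ℕ => ∑' s : Multiset ℕ, if 0 ∈ s ∨ 1 ∈ s then 0 else
      c (s + Multiset.replicate i 1) * t ^ (s.sum + i)) (genSum t c) := by
  refine ((summable_genSum h1 hc).hasSum.tsum_fiberwise (fun s => s.count 1)).congr_fun ?_
    |> fun h => h
  intro i
  have e := (onesEquiv i).tsum_eq fun s : {s : Multiset ℕ // s.count 1 = i} =>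
    if 0 ∈ s.1 then 0 else c s.1 * t ^ s.1.sum
  refine Eq.trans ?_ e
  refine Eq.trans ?_ (tsum_subtype {s : Multiset ℕ | 1 ∉ s} fun s =>
    if 0 ∈ s + Multiset.replicate i 1 then 0 else c (s + Multiset.replicate i 1) *
      t ^ (s + Multiset.replicate i 1).sum).symm
  refine tsum_congr fun s => ?_
  have h0 : 0 ∈ s + Multiset.replicate i 1 ↔ 0 ∈ s := by
    simp [Multiset.mem_replicate]
  by_cases hs : 1 ∈ s
  · simp [hs]
  · rw [Set.indicator_of_mem (show s ∈ {s : Multiset ℕ | 1 ∉ s} from hs)]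
    by_cases h : 0 ∈ s
    · rw [if_pos (h0.2 h), if_pos (Or.inl h)]
    · rw [if_neg (fun h' => h (h0.1 h')), if_neg (by tauto)]
      simp

theorem crank_no_ones {t z : ℂ} (h1 : ‖t‖ < 1) (hz : ‖z‖ = 1) :
    (∑' s : Multiset ℕ, if 0 ∈ s ∨ 1 ∈ s then 0 else z ^ s.sup * t ^ s.sum) =
      (1 - t) * partSum (partWt t z) - (z - 1) * t := by
  have hc : ∀ s : Multiset ℕ, ‖z ^ s.sup‖ ≤ 1 := fun s => by rw [norm_pow, hz, one_pow]
  have hs := summable_genSum h1 hc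
  have a := tsum_multiset_split hs 1
  have e1 : ∑' s : Multiset ℕ, (if 0 ∈ 1 ::ₘ s then 0 else z ^ (1 ::ₘ s).sup * t ^ (1 ::ₘ s).sum) =
      t * genSum t (fun s => z ^ s.sup) + (z - 1) * t := by
    have b : ∀ s : Multiset ℕ,
        (if 0 ∈ 1 ::ₘ s then 0 else z ^ (1 ::ₘ s).sup * t ^ (1 ::ₘ s).sum) =
        t * (if 0 ∈ s then 0 else z ^ s.sup * t ^ s.sum) + if s = 0 then (z - 1) * t else 0 := by
      intro s
      by_cases h0 : s = 0
      · subst h0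
        simp
        ring
      · rw [if_neg h0, add_zero]
        by_cases h : 0 ∈ s
        · simp [h]
        · rw [if_neg (by simpa using h), if_neg h]
          have hm := Multiset.sup_mem_of_ne_zero h0
          have : 1 ≤ s.sup := Nat.one_le_iff_ne_zero.2 fun h' => h (h' ▸ hm)
          rw [Multiset.sup_cons, sup_eq_right.2 this, Multiset.sum_cons, pow_add]
          ring
    rw [tsum_congr b, (hs.mul_left t).tsum_add (summable_of_hasFiniteSupport
      ((Set.finite_singleton (0 : Multiset ℕ)).subset fun s hs => by
        by_contra h
        exact hs (if_neg h))), tsum_ite_eq, tsum_mul_left]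
    rfl
  have e2 : ∑' s : Multiset ℕ, (if 1 ∈ s then 0 else if 0 ∈ s then 0 else z ^ s.sup * t ^ s.sum) =
      ∑' s : Multiset ℕ, if 0 ∈ s ∨ 1 ∈ s then 0 else z ^ s.sup * t ^ s.sum := by
    refine tsum_congr fun s => ?_
    by_cases h : 0 ∈ s <;> by_cases h' : 1 ∈ s <;> simp [h, h']
  rw [e1, e2] at a
  have a' : genSum t (fun s => z ^ s.sup) = _ := a
  rw [genSum_pow_sup h1 hz] at a'
  linear_combination -a'

theorem crank_ones {t z : ℂ} (h1 : ‖t‖ < 1) (hz : ‖z‖ = 1) (i : ℕ) :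
    (∑' s : Multiset ℕ, if 0 ∈ s ∨ 1 ∈ s then 0 else
      z ^ (s.filter fun x => i + 1 < x).card * t ^ s.sum) =
      (1 - t) * (qbinCoeff t (z * t) (i + 1) * partSum (partWt t z)) := by
  set w : ℕ → ℂ := fun k => if k ≤ 1 then 0 else if k ≤ i + 1 then t ^ k else z * t ^ k with hw
  have e : ∀ s : Multiset ℕ, (if 0 ∈ s ∨ 1 ∈ s then 0 else
      z ^ (s.filter fun x => i + 1 < x).card * t ^ s.sum) = (s.map w).prod := by
    intro s
    by_cases h : 0 ∈ s ∨ 1 ∈ s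
    · rw [if_pos h]
      rcases h with h | h
      · exact (Multiset.prod_eq_zero (Multiset.mem_map.2 ⟨0, h, by simp [hw]⟩)).symm
      · exact (Multiset.prod_eq_zero (Multiset.mem_map.2 ⟨1, h, by simp [hw]⟩)).symm
    · rw [if_neg h]
      induction s using Multiset.induction_on with
      | empty => simp
      | cons a s ih =>
        simp only [Multiset.mem_cons, not_or] at h
        obtain ⟨⟨ha, h0⟩, ha', h0'⟩ := h
        rw [Multiset.map_cons, Multiset.prod_cons, ← ih (by tauto), Multiset.sum_cons, pow_add]
        have ha1 : ¬ a ≤ 1 := by omega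
        by_cases hai : a ≤ i + 1
        · rw [Multiset.filter_cons_of_neg _ (by omega)]
          simp only [hw, ha1, hai, if_false, if_true]
          ring
        · rw [Multiset.filter_cons_of_pos _ (by omega), Multiset.card_cons]
          simp only [hw, ha1, hai, if_false]
          ring
  rw [tsum_congr e]
  change partSum w = _
  have hP := partWeight_partWt h1 hz.le
  have hW : PartWeight ‖t‖ w :=
    { nonneg := norm_nonneg _
      lt_one := h1
      zero := by simp [hw]
      le := fun k hk => by
        simp only [hw]
        split_ifs <;> simp [hz] }
  have p1 := hP.prod_mul (i + 2)
  have p2 := hW.prod_mul (i + 2)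
  have p3 : (fun k => if k < i + 2 then 0 else partWt t z k) = fun k => if k < i + 2 then 0 else w k := by
    funext k
    split_ifs with hk
    · rfl
    · simp only [partWt, hw]
      rw [if_neg (by omega), if_neg (by omega), if_neg (by omega)]
  rw [p3, ← p2, Finset.prod_range_succ', Finset.prod_range_succ' _ (i + 1)] at p1
  simp only [partWt, if_true, sub_zero, mul_one, hw, Nat.zero_le] at p1
  have p4 : ∏ k ∈ Finset.range (i + 1), (1 - if k + 1 = 0 then 0 else z * t ^ (k + 1)) =
      ∏ k ∈ Finset.range (i + 1), (1 - z * t * t ^ k) := by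
    refine Finset.prod_congr rfl fun k _ => ?_
    rw [if_neg (by omega)]
    ring
  have p5 : (1 - t) * ∏ k ∈ Finset.range (i + 1),
      (1 - if k + 1 ≤ 1 then 0 else if k + 1 ≤ i + 1 then t ^ (k + 1) else z * t ^ (k + 1)) =
      ∏ k ∈ Finset.range (i + 1), (1 - t * t ^ k) := by
    rw [Finset.prod_range_succ', Finset.prod_range_succ' _ i]
    simp only [zero_add, le_refl, if_true, sub_zero, mul_one, pow_zero]
    rw [mul_comm]
    congr 1
    refine Finset.prod_congr rfl fun k hk => ?_
    have := Finset.mem_range.1 hk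
    rw [if_neg (by omega), if_pos (by omega)]
    ring
  rw [p4] at p1
  unfold qbinCoeff
  have h3 : ∏ k ∈ Finset.range (i + 1), (1 - t * t ^ k) ≠ 0 :=
    Finset.prod_ne_zero_iff.2 fun k _ => one_sub_pow_ne_zero h1 k
  rw [div_mul_eq_mul_div, p1, mul_div_assoc', eq_div_iff h3, ← p5]
  ring

/-- The generating function of the crank, corrected at `n = 1`. -/
theorem crank_genSum {t z : ℂ} (h1 : ‖t‖ < 1) (hz : ‖z‖ = 1) :
    (genSum t (fun s => z ^ msCrank s) + (z - 1) * t) * (qpoch t (z * t) * qpoch t (t * z⁻¹)) =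
      qpoch t t := by
  have hz0 : z ≠ 0 := norm_ne_zero_iff.1 (by rw [hz]; exact one_ne_zero)
  have hx : ‖t * z⁻¹‖ < 1 := by rwa [norm_mul, norm_inv, hz, inv_one, mul_one]
  set H := partSum (partWt t z) with hH
  have a := tsum_split_ones h1 (c := fun s => z ^ msCrank s) fun s => (norm_zpow_eq_one hz _).le
  have e : ∀ i : ℕ, (∑' s : Multiset ℕ, if 0 ∈ s ∨ 1 ∈ s then 0 else
      z ^ msCrank (s + Multiset.replicate i 1) * t ^ (s.sum + i)) =
      (1 - t) * (qbinCoeff t (z * t) i * (t * z⁻¹) ^ i) * H - if i = 0 then (z - 1) * t else 0 := by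
    intro i
    cases i with
    | zero =>
      have := crank_no_ones h1 hz
      rw [if_pos rfl]
      simp only [qbinCoeff, Finset.range_zero, Finset.prod_empty, div_one, pow_zero, mul_one]
      rw [← this]
      refine tsum_congr fun s => ?_
      by_cases h : 0 ∈ s ∨ 1 ∈ s
      · rw [if_pos h, if_pos h]
      · rw [if_neg h, if_neg h]
        have hc : s.count 1 = 0 := Multiset.count_eq_zero_of_notMem fun h' => h (Or.inr h')
        simp [msCrank, hc]
    | succ i =>
      rw [if_neg (by omega), sub_zero]
      have := crank_ones h1 hz i
      have e2 : (1 - t) * (qbinCoeff t (z * t) (i + 1) * (t * z⁻¹) ^ (i + 1)) * H =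
          (t * z⁻¹) ^ (i + 1) * ((1 - t) * (qbinCoeff t (z * t) (i + 1) * H)) := by ring
      rw [e2, ← this, ← tsum_mul_left]
      refine tsum_congr fun s => ?_
      by_cases h : 0 ∈ s ∨ 1 ∈ s
      · rw [if_pos h, if_pos h, mul_zero]
      · rw [if_neg h, if_neg h]
        have hc : s.count 1 = 0 := Multiset.count_eq_zero_of_notMem fun h' => h (Or.inr h')
        have hcr : msCrank (s + Multiset.replicate (i + 1) 1) =
            ((s.filter fun x => i + 1 < x).card : ℤ) - (i + 1 : ℕ) := by
          have hf : (Multiset.replicate (i + 1) 1).filter (fun x => i + 1 < x) = 0 :=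
            Multiset.filter_eq_nil.2 fun x hx => by
              have := Multiset.eq_of_mem_replicate hx
              omega
          unfold msCrank
          rw [Multiset.count_add, hc, Multiset.count_replicate_self, zero_add, if_neg (by omega),
            Multiset.filter_add, hf, add_zero]
        rw [hcr, zpow_sub₀ hz0, zpow_natCast, zpow_natCast, pow_add t, mul_pow, inv_pow]
        ring
  have hs := summable_qbinCoeff h1 hx (z * t)
  have b : HasSum (fun i : ℕ => (1 - t) * (qbinCoeff t (z * t) i * (t * z⁻¹) ^ i) * H -
      if i = 0 then (z - 1) * t else 0)
      ((1 - t) * (∑' i : ℕ, qbinCoeff t (z * t) i * (t * z⁻¹) ^ i) * H - (z - 1) * t) :=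
    ((hs.hasSum.mul_left (1 - t)).mul_right H).sub (hasSum_ite_eq 0 _)
  have key := a.unique (b.congr_fun e)
  have q1 := qbinomial h1 hx (z * t)
  have q2 := qpoch_mul_partSum h1 hz.le
  rw [show z * t * (t * z⁻¹) = t * t by field_simp] at q1
  have q3 := qpoch_eq_mul h1 t
  rw [key]
  linear_combination (1 - t) * qpoch t (t * z⁻¹) *
    (∑' i : ℕ, qbinCoeff t (z * t) i * (t * z⁻¹) ^ i) * q2 + (1 - t) * q1 - q3

theorem norm_eq_one_of_pow_eq_one' {z : ℂ} {n : ℕ} (hn : n ≠ 0) (hz : z ^ n = 1) : ‖z‖ = 1 := by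
  have : ‖z‖ ^ n = 1 := by rw [← norm_pow, hz, norm_one]
  exact (pow_eq_one_iff_of_nonneg (norm_nonneg _) hn).1 this

theorem summable_lambertSum {d : ℕ} (hd : 0 < d) {t : ℂ} (h0 : t ≠ 0) (h1 : ‖t‖ < 1) (b : ℤ) :
    Summable fun k : ℤ => appellCoeff d t (t ^ b) k / (1 - t ^ (11 * k)) := by
  have ht0 : 0 < ‖t‖ := norm_pos_iff.2 h0
  have hs := summable_appellCoeff h0 h1 hd.ne' (zpow_ne_zero b h0)
  refine Summable.of_norm_bounded (hs.mul_right (1 - ‖t‖)⁻¹) fun k => ?_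
  rw [norm_div, div_eq_mul_inv]
  refine mul_le_mul_of_nonneg_left ?_ (norm_nonneg _)
  have hpos : 0 < 1 - ‖t‖ := by linarith
  rcases lt_trichotomy k 0 with hk | rfl | hk
  · refine inv_anti₀ hpos ?_
    have a : 1 ≤ ‖t‖ * ‖t‖ ^ (11 * k) := by
      rw [← zpow_one_add₀ ht0.ne']
      exact one_le_zpow_of_nonpos₀ ht0 h1.le (by omega)
    have b : 1 ≤ ‖t‖ ^ (11 * k) := one_le_zpow_of_nonpos₀ ht0 h1.le (by omega)
    have c := norm_sub_norm_le (t ^ (11 * k)) 1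
    rw [norm_sub_rev, norm_zpow, norm_one] at c
    nlinarith
  · simpa using hpos.le
  · refine inv_anti₀ hpos ?_
    have a : ‖t‖ ^ (11 * k) ≤ ‖t‖ := by
      have := zpow_right_anti₀ ht0 h1.le (show (1 : ℤ) ≤ 11 * k by omega)
      simpa using this
    have c := norm_sub_norm_le 1 (t ^ (11 * k))
    rw [norm_zpow, norm_one] at c
    linarith

theorem appell_one_eq_lambert {t z : ℂ} (h0 : t ≠ 0) (h1 : ‖t‖ < 1) (hz : z ^ 11 = 1) (hz1 : z ≠ 1) :
    appell 1 t 1 z = (1 - z)⁻¹ + ∑ c ∈ Finset.range 11, z ^ c * lambertSum 1 c t := by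
  have hz0 : z ≠ 0 := by
    rintro rfl
    simp at hz
  have e : ∀ k : ℤ, appellCoeff 1 t 1 k / (1 - z * t ^ k) = (if k = 0 then (1 - z)⁻¹ else 0) +
      ∑ c ∈ Finset.range 11, z ^ c * (appellCoeff 1 t (t ^ (c : ℤ)) k / (1 - t ^ (11 * k))) := by
    intro k
    by_cases hk : k = 0
    · subst hk
      simp [appellCoeff, tri]
    · rw [if_neg hk, zero_add]
      have hy : t ^ (11 * k) ≠ 1 := zpow_ne_one_of_ne_zero h1 (by omega)
      have hy' : 1 - t ^ (11 * k) ≠ 0 := fun h => hy (by linear_combination -h)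
      have hg : (∑ c ∈ Finset.range 11, (z * t ^ k) ^ c) * (1 - z * t ^ k) = 1 - t ^ (11 * k) := by
        rw [geom_sum_mul_neg, mul_pow, hz, one_mul, ← zpow_natCast, ← zpow_mul, mul_comm k]
        rfl
      have hn : 1 - z * t ^ k ≠ 0 := fun h => hy' (by rw [← hg, h, mul_zero])
      rw [div_eq_iff hn, Finset.sum_mul]
      have a : ∀ c ∈ Finset.range 11, z ^ c * (appellCoeff 1 t (t ^ (c : ℤ)) k / (1 - t ^ (11 * k))) *
          (1 - z * t ^ k) = appellCoeff 1 t 1 k / (1 - t ^ (11 * k)) * ((z * t ^ k) ^ c * (1 - z * t ^ k)) := by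
        intro c _
        unfold appellCoeff
        have hc : (t ^ (c : ℤ)) ^ k = (t ^ k) ^ c := by
          rw [← zpow_natCast (t ^ k), ← zpow_mul, ← zpow_mul, mul_comm]
        rw [one_zpow, hc, mul_pow]
        ring
      rw [Finset.sum_congr rfl a, ← Finset.mul_sum, ← Finset.sum_mul, hg, div_mul_cancel₀ _ hy']
  unfold appell
  rw [tsum_congr e, Summable.tsum_add, tsum_ite_eq, Summable.tsum_finsetSum]
  · simp_rw [tsum_mul_left]
    rfl
  · exact fun c _ => (summable_lambertSum one_pos h0 h1 c).mul_left _
  · exact (hasSum_ite_eq (0 : ℤ) _).summable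
  · exact summable_sum fun c _ => (summable_lambertSum one_pos h0 h1 c).mul_left _

theorem lambertSum_reflect {d : ℕ} {t : ℂ} (h0 : t ≠ 0) (h1 : ‖t‖ < 1) (b : ℤ) :
    lambertSum d (11 - d - b) t = -lambertSum d b t := by
  unfold lambertSum
  rw [← (Equiv.neg ℤ).tsum_eq, ← tsum_neg]
  refine tsum_congr fun k => ?_
  simp only [Equiv.neg_apply]
  by_cases hk : k = 0
  · simp [hk]
  have hy : t ^ (11 * k) ≠ 1 := zpow_ne_one_of_ne_zero h1 (by omega)
  have hy' : 1 - t ^ (11 * k) ≠ 0 := fun h => hy (by linear_combination -h)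
  have e : 1 - t ^ (11 * -k) = -((1 - t ^ (11 * k)) * (t ^ (11 * k))⁻¹) := by
    rw [mul_neg, zpow_neg]
    field_simp
    ring
  have e2 : t ^ ((d : ℤ) * tri (-k + 1)) * t ^ ((11 - (d : ℤ) - b) * -k) =
      t ^ ((d : ℤ) * tri (k + 1)) * t ^ (b * k) * (t ^ (11 * k))⁻¹ := by
    rw [← zpow_neg, ← zpow_add₀ h0, ← zpow_add₀ h0, ← zpow_add₀ h0]
    congr 1
    have a := two_mul_tri (-k + 1)
    have b' := two_mul_tri (k + 1)
    have c : tri (-k + 1) = tri (k + 1) - k := by linarith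
    rw [c]
    ring
  have e3 : (-1 : ℂ) ^ (-k) = (-1) ^ k := by
    rw [zpow_neg, ← inv_zpow]
    norm_num
  unfold appellCoeff
  rw [e, e3, ← zpow_mul, ← zpow_mul, mul_assoc, e2, div_eq_iff, ← neg_div, div_mul_eq_mul_div, eq_div_iff hy']
  · ring
  · exact neg_ne_zero.2 (mul_ne_zero hy' (inv_ne_zero (zpow_ne_zero _ h0)))

theorem qpoch_mul_crank {t z : ℂ} (h0 : t ≠ 0) (h1 : ‖t‖ < 1) (hz : z ^ 11 = 1) :
    qpoch t t * (genSum t (fun s => z ^ msCrank s) + (z - 1) * t) =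
      1 + (1 - z) * ∑ c ∈ Finset.range 11, z ^ c * lambertSum 1 c t := by
  have hn := norm_eq_one_of_pow_eq_one' (by norm_num) hz
  have hz0 : z ≠ 0 := norm_ne_zero_iff.1 (by rw [hn]; exact one_ne_zero)
  have a := crank_genSum h1 hn
  have hE : qpoch t t ≠ 0 := qpoch_self_ne_zero h1
  by_cases h : z = 1
  · subst h
    simp only [one_mul, inv_one, mul_one, sub_self, zero_mul, add_zero] at a ⊢
    refine mul_right_cancel₀ hE ?_
    linear_combination a
  · have tz : theta t z ≠ 0 := by
      rw [theta_ne_zero_iff h0 h1 hz0]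
      intro n hn'
      have h2 : ‖t‖ ^ n = 1 := by
        rw [← norm_zpow, ← one_mul ‖t ^ n‖, ← hn, ← norm_mul, hn', norm_one, hn]
      by_cases hn0 : n = 0
      · rw [hn0, zpow_zero, mul_one] at hn'
        exact h hn'
      · exact zpow_ne_one_of_ne_zero (q := (‖t‖ : ℂ)) (by simpa using h1) hn0
          (by exact_mod_cast h2)
    have b := appell_one_sum_zero h0 h1 hz0 tz
    have c := theta_eq_prod h0 h1 hz0
    rw [qpoch_eq_mul h1 z] at c
    have hz1 : 1 - z ≠ 0 := fun h' => h (by linear_combination -h')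
    have e : 1 + (1 - z) * ∑ c ∈ Finset.range 11, z ^ c * lambertSum 1 c t =
        (1 - z) * appell 1 t 1 z := by
      rw [appell_one_eq_lambert h0 h1 hz h]
      field_simp
    rw [e]
    have hp : qpoch t (z * t) * qpoch t (t * z⁻¹) ≠ 0 := fun h' => by
      rw [h', mul_zero] at a
      exact hE a.symm
    rw [c] at b
    refine mul_right_cancel₀ hp (mul_left_cancel₀ hE ?_)
    linear_combination qpoch t t * qpoch t t * a - b

theorem msCrank_mod_sum {t z : ℂ} (h1 : ‖t‖ < 1) (hz : z ^ 11 = 1) :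
    genSum t (fun s => z ^ msCrank s) =
      ∑ a ∈ Finset.range 11, genSet t (fun s => msCrank s % 11 = (a : ℤ)) * z ^ a := by
  classical
  have hz0 : z ≠ 0 := by
    rintro rfl
    simp at hz
  unfold genSet genSum
  simp_rw [← tsum_mul_right]
  refine Eq.trans ?_ (Summable.tsum_finsetSum fun a _ =>
    (summable_genSum h1 fun s => norm_ite_one_zero_le _).mul_right _)
  refine tsum_congr fun s => ?_
  by_cases h : 0 ∈ s
  · simp [h]
  · simp only [h, if_false]
    set m := (msCrank s % 11).toNat with hm
    have hlt : m < 11 := by omega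
    rw [Finset.sum_eq_single m]
    · rw [if_pos (by omega), one_mul, mul_comm]
      congr 1
      conv_lhs => rw [← Int.emod_add_mul_ediv (msCrank s) 11, zpow_add₀ hz0, zpow_mul]
      rw [show z ^ (11 : ℤ) = 1 by exact_mod_cast hz, one_zpow, mul_one, ← zpow_natCast]
      congr 1
      omega
    · intro a ha hne
      rw [if_neg (by omega)]
      ring
    · intro h'
      exact absurd (Finset.mem_range.2 hlt) h'

theorem eq_of_sum_roots_of_unity {X : ℕ → ℂ}
    (h : ∀ z : ℂ, z ^ 11 = 1 → ∑ a ∈ Finset.range 11, X a * z ^ a = 0) {a : ℕ} (ha : a < 11) :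
    X a = 0 := by
  set p : Polynomial ℂ := ∑ a ∈ Finset.range 11, Polynomial.C (X a) * Polynomial.X ^ a with hp
  have hζ := Complex.isPrimitiveRoot_exp 11 (by norm_num)
  set ζ := Complex.exp (2 * Real.pi * Complex.I / (11 : ℕ)) with hζ'
  have hdeg : p.natDegree < 11 := by
    refine Nat.lt_succ_of_le (Polynomial.natDegree_sum_le_of_forall_le _ _ fun a ha => ?_)
    refine (Polynomial.natDegree_C_mul_X_pow_le _ _).trans ?_
    have := Finset.mem_range.1 ha
    omega
  have h0 : p = 0 := by
    refine Polynomial.eq_zero_of_natDegree_lt_card_of_eval_eq_zero p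
      (f := fun i : Fin 11 => ζ ^ (i : ℕ)) (fun i j hij => ?_) (fun i => ?_) (by simpa using hdeg)
    · exact Fin.ext (hζ.pow_inj i.2 j.2 hij)
    · rw [hp, Polynomial.eval_finsetSum]
      have := h (ζ ^ (i : ℕ)) (by rw [← pow_mul, mul_comm, pow_mul, hζ.pow_eq_one, one_pow])
      simpa using this
  have := congrArg (fun r => Polynomial.coeff r a) h0
  simpa [hp, Polynomial.finsetSum_coeff, Polynomial.coeff_C_mul, Polynomial.coeff_X_pow, ha] using this

/-- The generating functions of the corrected crank residue classes `0` and `2`. -/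
theorem genSet_crank_mod {t : ℂ} (h0 : t ≠ 0) (h1 : ‖t‖ < 1) :
    qpoch t t * (genSet t (fun s => msCrank s % 11 = 0) - t) = 1 + 2 * lambertSum 1 0 t ∧
    qpoch t t * genSet t (fun s => msCrank s % 11 = 2) = lambertSum 1 2 t - lambertSum 1 1 t := by
  set X : ℕ → ℂ := fun a => qpoch t t * (genSet t (fun s => msCrank s % 11 = (a : ℤ)) +
    (if a = 1 then t else 0) - (if a = 0 then t else 0)) - (lambertSum 1 a t -
    lambertSum 1 ((a : ℤ) - 1) t + if a = 0 then 1 + lambertSum 1 (-1) t - lambertSum 1 10 t else 0) with hX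
  have key : ∀ a, a < 11 → X a = 0 := fun a ha => eq_of_sum_roots_of_unity (fun z hz => by
    have e1 := qpoch_mul_crank h0 h1 hz
    rw [msCrank_mod_sum h1 hz] at e1
    simp only [Finset.sum_range_succ, Finset.range_zero, Finset.sum_empty, hX] at e1 ⊢
    push_cast at e1 ⊢
    norm_num at e1 ⊢
    linear_combination e1 - lambertSum 1 10 t * hz) ha
  have r := lambertSum_reflect (d := 1) h0 h1 (t := t) 0
  have k0 := key 0 (by norm_num)
  have k2 := key 2 (by norm_num)
  simp only [hX] at k0 k2
  norm_num at k0 k2 r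
  simp only [← Int.dvd_iff_emod_eq_zero]
  constructor
  · linear_combination k0 - r
  · linear_combination k2

theorem hasSum_genSet {t : ℂ} (h1 : ‖t‖ < 1) (p : Multiset ℕ → Prop) [DecidablePred p] :
    HasSum (fun n : ℕ => ((Finset.univ.filter fun π : Nat.Partition n => p π.parts).card : ℂ) * t ^ n)
      (genSet t p) := by
  classical
  have e : genSet t p = genSum t fun s => if p s then 1 else 0 :=
    genSum_congr fun s _ => by congr
  rw [e]
  refine (hasSum_genSum h1 fun s => norm_ite_one_zero_le (p s)).congr_fun ?_ |> fun h => h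
  intro n
  rw [Finset.sum_boole]

theorem hasSum_rankCount {t : ℂ} (h1 : ‖t‖ < 1) (a : ℤ) :
    HasSum (fun n : ℕ => (rankCount a 11 n : ℂ) * t ^ n)
      (genSet t fun s => msRank s % 11 = a % 11) := by
  exact hasSum_genSet h1 fun s => msRank s % 11 = a % 11

theorem crankCount_of_ne_one {a : ℤ} {n : ℕ} (hn : n ≠ 1) :
    crankCount a n =
      ((Finset.univ.filter fun π : Nat.Partition n => msCrank π.parts % 11 = a % 11).card : ℤ) := by
  rw [crankCount, if_neg hn]
  rfl

theorem card_filter_msCrank_one {a : ℤ} (ha : a ≠ 10) :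
    (Finset.univ.filter fun π : Nat.Partition 1 => msCrank π.parts % 11 = a).card = 0 := by
  rw [Finset.card_eq_zero, Finset.filter_eq_empty_iff]
  intro π _ h
  rw [Subsingleton.elim π default] at h
  exact ha (h ▸ by decide)

theorem hasSum_crankCount_two {t : ℂ} (h1 : ‖t‖ < 1) :
    HasSum (fun n : ℕ => (crankCount 2 n : ℂ) * t ^ n) (genSet t fun s => msCrank s % 11 = 2) := by
  refine (hasSum_genSet h1 _).congr_fun ?_ |> fun h => h
  intro n
  congr 1
  by_cases hn : n = 1
  · subst hn
    rw [card_filter_msCrank_one (by norm_num), show crankCount 2 1 = 0 by decide]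
    simp
  · rw [crankCount_of_ne_one hn, Int.cast_natCast]
    norm_num

theorem hasSum_crankCount_zero {t : ℂ} (h1 : ‖t‖ < 1) :
    HasSum (fun n : ℕ => (crankCount 0 n : ℂ) * t ^ n)
      (genSet t (fun s => msCrank s % 11 = 0) - t) := by
  refine ((hasSum_genSet h1 (fun s => msCrank s % 11 = 0)).sub
    (hasSum_ite_eq 1 t)).congr_fun ?_ |> fun h => h
  intro n
  by_cases hn : n = 1
  · subst hn
    rw [card_filter_msCrank_one (by norm_num), show crankCount 0 1 = -1 by decide]
    simp
  · rw [crankCount_of_ne_one hn, Int.cast_natCast, if_neg hn, sub_zero]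
    norm_num

/-- An integer combination of the rank and crank counts of `n` modulo `11`. -/
def rankCrankComb (c : Fin 7 → ℤ) (n : ℕ) : ℤ :=
  c 0 * rankCount 0 11 n + c 1 * rankCount 1 11 n + c 2 * rankCount 2 11 n +
    c 3 * rankCount 3 11 n + c 4 * rankCount 4 11 n + c 5 * rankCount 5 11 n +
    c 6 * (crankCount 0 n - crankCount 2 n)

theorem lambertSum_three_one {t : ℂ} (h0 : t ≠ 0) (h1 : ‖t‖ < 1) :
    lambertSum 3 1 t = lambertSum 3 12 t - t⁻¹ * theta (t ^ 3) t - 1 := by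
  have h3 := pow_ne_zero 3 h0
  have e : ∀ k : ℤ, appellCoeff 3 t (t ^ (1 : ℤ)) k / (1 - t ^ (11 * k)) =
      appellCoeff 3 t (t ^ (12 : ℤ)) k / (1 - t ^ (11 * k)) +
      (appellCoeff 3 t t k - if k = 0 then 1 else 0) := by
    intro k
    by_cases hk : k = 0
    · subst hk
      simp [appellCoeff, tri]
    have hy : t ^ (11 * k) ≠ 1 := zpow_ne_one_of_ne_zero h1 (by omega)
    have hy' : 1 - t ^ (11 * k) ≠ 0 := fun h => hy (by linear_combination -h)
    rw [if_neg hk, sub_zero, div_eq_iff hy', add_mul, div_mul_cancel₀ _ hy', zpow_one]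
    have e2 : t ^ (12 * k) = t ^ k * t ^ (11 * k) := by
      rw [← zpow_add₀ h0]
      congr 1
      ring
    unfold appellCoeff
    rw [← zpow_mul, e2]
    ring
  have hs : Summable fun k => appellCoeff 3 t t k :=
    (summable_appellCoeff h0 h1 (by norm_num) h0).of_norm
  have hs1 : Summable fun k : ℤ => (if k = 0 then 1 else 0 : ℂ) := (hasSum_ite_eq (0 : ℤ) _).summable
  have hth : ∑' k, appellCoeff 3 t t k = -t⁻¹ * theta (t ^ 3) t := by
    rw [← theta_mul_base h3 h0]
    unfold theta
    exact tsum_congr fun k => appellCoeff_eq h0 k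
  unfold lambertSum
  rw [tsum_congr e, Summable.tsum_add (summable_lambertSum (by norm_num) h0 h1 _) (hs.sub hs1),
    hs.tsum_sub hs1, tsum_ite_eq, hth]
  ring

theorem qpoch_mul_genSet_rank {t : ℂ} (h0 : t ≠ 0) (h1 : ‖t‖ < 1) {a : ℕ} (ha : 1 ≤ a) (ha' : a ≤ 10) :
    qpoch t t * genSet t (fun s => msRank s % 11 = (a : ℤ)) =
      lambertSum 3 ((a : ℤ) - 1) t - lambertSum 3 ((a : ℤ) - 2) t := by
  obtain ⟨b, hb⟩ : ∃ b, a + b = 11 := ⟨11 - a, by omega⟩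
  have e1 := lambertSum_three h0 h1 (a := a) (b := b + 1) (by omega)
  have e2 := lambertSum_three h0 h1 (a := a + 1) (b := b) (by omega)
  rw [genSet_rank_mod h0 h1 ha (by omega) hb, e1]
  rw [show ((a + 1 : ℕ) : ℤ) - 2 = (a : ℤ) - 1 by push_cast; ring] at e2
  rw [e2]
  ring

theorem qpoch_mul_genSet_rank_zero {t : ℂ} (h0 : t ≠ 0) (h1 : ‖t‖ < 1) :
    qpoch t t * genSet t (fun s => msRank s % 11 = 0) = 1 - 2 * lambertSum 3 9 t := by
  have a := genSet_rank_mod_zero h1 (t := t)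
  have b := qpoch_mul_genSum_one h1 (t := t)
  have r := lambertSum_reflect (d := 3) h0 h1 (-1) (t := t)
  rw [a, mul_add, Finset.mul_sum, Finset.sum_congr rfl fun a ha =>
    qpoch_mul_genSet_rank h0 h1 (by omega) (by have := Finset.mem_range.1 ha; omega)] at b
  simp only [Finset.sum_range_succ, Finset.range_zero, Finset.sum_empty] at b
  norm_num at b r
  simp only [← Int.dvd_iff_emod_eq_zero]
  linear_combination b + r

/-- The generating function of a combination of ranks and cranks, in terms of Lambert series. -/
theorem hasSum_rankCrankComb {t : ℂ} (h0 : t ≠ 0) (h1 : ‖t‖ < 1) (c : Fin 7 → ℤ) :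
    HasSum (fun n => (rankCrankComb c n : ℂ) * t ^ n) ((qpoch t t)⁻¹ *
      (c 0 * (1 - 2 * lambertSum 3 9 t) + c 1 * (lambertSum 3 0 t + lambertSum 3 9 t) +
       c 2 * (lambertSum 3 12 t - t⁻¹ * theta (t ^ 3) t - 1 - lambertSum 3 0 t) +
       c 3 * (-lambertSum 3 6 t - lambertSum 3 12 t + t⁻¹ * theta (t ^ 3) t + 1) +
       c 4 * (lambertSum 3 3 t + lambertSum 3 6 t) + c 5 * (-lambertSum 3 3 t) +
       c 6 * (1 + 2 * lambertSum 1 0 t + lambertSum 1 1 t - lambertSum 1 2 t))) := by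
  have hE := qpoch_self_ne_zero h1 (q := t)
  have s9 := lambertSum_reflect (d := 3) h0 h1 (-1) (t := t)
  have s6 := lambertSum_reflect (d := 3) h0 h1 2 (t := t)
  have s4 := lambertSum_reflect (d := 3) h0 h1 4 (t := t)
  have s1 := lambertSum_three_one h0 h1
  have q0 := qpoch_mul_genSet_rank_zero h0 h1
  have q1 := qpoch_mul_genSet_rank h0 h1 (a := 1) (by norm_num) (by norm_num)
  have q2 := qpoch_mul_genSet_rank h0 h1 (a := 2) (by norm_num) (by norm_num)
  have q3 := qpoch_mul_genSet_rank h0 h1 (a := 3) (by norm_num) (by norm_num)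
  have q4 := qpoch_mul_genSet_rank h0 h1 (a := 4) (by norm_num) (by norm_num)
  have q5 := qpoch_mul_genSet_rank h0 h1 (a := 5) (by norm_num) (by norm_num)
  obtain ⟨c0, c2⟩ := genSet_crank_mod h0 h1
  have H := (((((((hasSum_rankCount h1 0).mul_left (c 0 : ℂ)).add
    ((hasSum_rankCount h1 1).mul_left (c 1 : ℂ))).add
    ((hasSum_rankCount h1 2).mul_left (c 2 : ℂ))).add
    ((hasSum_rankCount h1 3).mul_left (c 3 : ℂ))).add
    ((hasSum_rankCount h1 4).mul_left (c 4 : ℂ))).add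
    ((hasSum_rankCount h1 5).mul_left (c 5 : ℂ))).add
    (((hasSum_crankCount_zero h1).sub (hasSum_crankCount_two h1)).mul_left (c 6 : ℂ))
  refine Eq.subst (motive := fun x => HasSum _ x) ?_ (H.congr_fun fun n => ?_)
  · symm
    rw [inv_mul_eq_iff_eq_mul₀ hE]
    push_cast at q1 q2 q3 q4 q5
    norm_num only at q1 q2 q3 q4 q5 s9 s6 s4 ⊢
    linear_combination -c 0 * q0 - c 1 * q1 - c 2 * q2 - c 3 * q3 - c 4 * q4 - c 5 * q5 -
      c 6 * (c0 - c2) + c 1 * s9 - (c 2 - c 3) * s1 -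
      (c 3 - c 4) * s6 - c 5 / 2 * s4
  · unfold rankCrankComb
    push_cast
    ring

theorem sum_range_eleven_of_periodic {T : ℤ → ℂ} (hT : ∀ c, T (c + 11) = T c) (r : ℤ) :
    ∑ c ∈ Finset.range 11, T c = T r + ∑ a ∈ Finset.range 5, (T (r + (a + 1)) + T (r - (a + 1))) := by
  have step : ∀ m : ℤ, ∑ c ∈ Finset.range 11, T (m + 1 + c) = ∑ c ∈ Finset.range 11, T (m + c) := by
    intro m
    have h := hT m
    rw [Finset.sum_range_succ, Finset.sum_range_succ' _ 10]
    push_cast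
    rw [show m + 1 + 10 = m + 11 by ring, add_zero, h]
    congr 1
    exact Finset.sum_congr rfl fun c _ => by rw [add_right_comm, add_assoc]
  have all : ∀ m : ℤ, ∑ c ∈ Finset.range 11, T (m + c) = ∑ c ∈ Finset.range 11, T c := by
    intro m
    induction m using Int.induction_on with
    | zero => simp
    | succ n ih => rw [step, ih]
    | pred n ih => rw [← ih, ← step (-(n : ℤ) - 1), sub_add_cancel]
  rw [← all (r - 5)]
  simp only [Finset.sum_range_succ, Finset.range_zero, Finset.sum_empty]
  push_cast
  ring_nf

theorem tsum_int_eq_sum_residues {f : ℤ → ℂ} (hf : Summable f) (r : ℤ) :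
    ∑' k, f k = ∑' n, f (11 * n + r) + ∑ a ∈ Finset.range 5,
      (∑' n, f (11 * n + (r + (a + 1))) + ∑' n, f (11 * n + (r - (a + 1)))) := by
  refine Eq.trans ?_ (sum_range_eleven_of_periodic (T := fun c => ∑' n, f (11 * n + c)) (fun c => ?_) r)
  · have hs : Summable fun p : ℤ × Fin 11 => f ((Int.divModEquiv 11).symm p) :=
      (Int.divModEquiv 11).symm.summable_iff.2 hf
    rw [← (Int.divModEquiv 11).symm.tsum_eq, hs.tsum_prod,
      ← Summable.tsum_comm (f := fun n c => f ((Int.divModEquiv 11).symm (n, c))) hs, tsum_fintype,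
      Finset.sum_range]
    refine Finset.sum_congr rfl fun c _ => tsum_congr fun n => ?_
    simp [Int.divModEquiv, mul_comm]
  · rw [← (Equiv.addRight (1 : ℤ)).tsum_eq fun n => f (11 * n + c)]
    refine tsum_congr fun n => ?_
    simp only [Equiv.coe_addRight]
    ring_nf

/-- The exponent `a(11-a)/2`. -/
def brkExp (a : ℤ) : ℤ := a * (11 - a) / 2

theorem two_mul_brkExp (a : ℤ) : 2 * brkExp a = a * (11 - a) := by
  unfold brkExp
  refine Int.mul_ediv_cancel' ?_
  rcases Int.even_or_odd' a with ⟨k, rfl | rfl⟩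
  · exact ⟨k * (11 - 2 * k), by ring⟩
  · exact ⟨(2 * k + 1) * (5 - k), by ring⟩

/-- The normalised theta value `t ^ (-a * (11 - a) / 2) * θ (t ^ (11 * a))`. -/
noncomputable def brk (t : ℂ) (a : ℤ) : ℂ := t ^ (-brkExp a) * theta (t ^ 121) (t ^ (11 * a))

theorem theta_eq_brk {t : ℂ} (h0 : t ≠ 0) (a : ℤ) :
    theta (t ^ 121) (t ^ (11 * a)) = t ^ brkExp a * brk t a := by
  rw [brk, ← mul_assoc, ← zpow_add₀ h0, add_neg_cancel, zpow_zero, one_mul]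

theorem brk_neg {t : ℂ} (h0 : t ≠ 0) (a : ℤ) : brk t (-a) = -brk t a := by
  have e : -brkExp (-a) + -(11 * a) = -brkExp a := by
    have h := two_mul_brkExp a
    have h' := two_mul_brkExp (-a)
    nlinarith
  rw [brk, mul_neg, zpow_neg t (11 * a), theta_inv (zpow_ne_zero _ h0), ← zpow_neg, brk, ← e,
    zpow_add₀ h0]
  ring

theorem brk_add_eleven {t : ℂ} (h0 : t ≠ 0) (a : ℤ) : brk t (a + 11) = -brk t a := by
  have e : -brkExp (a + 11) + -(11 * a) = -brkExp a := by
    have h := two_mul_brkExp a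
    have h' := two_mul_brkExp (a + 11)
    nlinarith
  have e2 : t ^ (11 * (a + 11)) = t ^ 121 * t ^ (11 * a) := by
    rw [mul_add, zpow_add₀ h0, mul_comm]
    norm_cast
  rw [brk, e2, theta_mul_base (pow_ne_zero _ h0) (zpow_ne_zero _ h0), ← zpow_neg, brk, ← e,
    zpow_add₀ h0]
  ring

theorem brk_reflect {t : ℂ} (h0 : t ≠ 0) (a : ℤ) : brk t (11 - a) = brk t a := by
  rw [show 11 - a = -a + 11 by ring, brk_add_eleven h0, brk_neg h0, neg_neg]

theorem norm_pow_121_lt_one {t : ℂ} (h1 : ‖t‖ < 1) : ‖t ^ 121‖ < 1 :=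
  norm_lt_one_pow h1 (by norm_num)

theorem theta_pow_ne_zero {t : ℂ} (h0 : t ≠ 0) (h1 : ‖t‖ < 1) {a : ℤ} (ha : ¬11 ∣ a) :
    theta (t ^ 121) (t ^ (11 * a)) ≠ 0 := by
  refine theta_ne_zero (pow_ne_zero _ h0) (norm_pow_121_lt_one h1) (zpow_ne_zero _ h0) fun k => ?_
  have : t ^ (11 * a) * (t ^ 121) ^ k = t ^ (11 * a + 121 * k) := by
    rw [zpow_add₀ h0, zpow_mul t 121]
    norm_cast
  rw [this]
  exact zpow_ne_one_of_ne_zero h1 (by omega)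

theorem brk_ne_zero {t : ℂ} (h0 : t ≠ 0) (h1 : ‖t‖ < 1) {a : ℤ} (ha : ¬11 ∣ a) : brk t a ≠ 0 :=
  mul_ne_zero (zpow_ne_zero _ h0) (theta_pow_ne_zero h0 h1 ha)

/-- The normalised logarithmic derivative of `theta` at `t ^ (11 * a)`. -/
noncomputable def brkLog (t : ℂ) (a : ℤ) : ℂ := thetaLog (t ^ 121) (t ^ (11 * a)) - 1 / 2 + a / 11

theorem brkLog_reflect {t : ℂ} (h0 : t ≠ 0) (h1 : ‖t‖ < 1) {a : ℤ} (ha : ¬11 ∣ a) :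
    brkLog t (11 - a) = -brkLog t a := by
  have hN := pow_ne_zero 121 h0
  have hs := zpow_ne_zero (11 * a) h0
  have ht := theta_pow_ne_zero h0 h1 ha
  have e2 : t ^ (11 * (11 - a)) = t ^ 121 * (t ^ (11 * a))⁻¹ := by
    rw [mul_sub, zpow_sub₀ h0, div_eq_mul_inv]
    norm_cast
  unfold brkLog
  rw [e2, thetaLog_mul_base hN (norm_pow_121_lt_one h1) (inv_ne_zero hs) (theta_inv_ne_zero hs ht),
    thetaLog_inv hN (norm_pow_121_lt_one h1) hs ht]
  push_cast
  ring

theorem brkLog_add {t : ℂ} (h0 : t ≠ 0) (h1 : ‖t‖ < 1) {a b c : ℤ} (ha : ¬11 ∣ a) (hb : ¬11 ∣ b)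
    (hc : ¬11 ∣ c) (habc : ¬11 ∣ a + b + c) :
    brkLog t a + brkLog t b + brkLog t c - brkLog t (a + b + c) =
      -(qpoch (t ^ 121) (t ^ 121) ^ 3 * (brk t (a + b) * brk t (b + c) * brk t (a + c)) /
        (brk t a * brk t b * brk t c * brk t (a + b + c))) := by
  have hN := pow_ne_zero 121 h0
  have z : ∀ n : ℤ, t ^ n ≠ 0 := fun n => zpow_ne_zero n h0
  have e3 : t ^ (11 * a) * t ^ (11 * b) * t ^ (11 * c) = t ^ (11 * (a + b + c)) := by
    rw [← zpow_add₀ h0, ← zpow_add₀ h0]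
    ring_nf
  have e2 : ∀ a b : ℤ, t ^ (11 * a) * t ^ (11 * b) = t ^ (11 * (a + b)) := by
    intro a b
    rw [← zpow_add₀ h0]
    ring_nf
  have h := thetaLog_add hN (norm_pow_121_lt_one h1) (z (11 * a)) (z (11 * b)) (z (11 * c))
    (theta_pow_ne_zero h0 h1 ha) (theta_pow_ne_zero h0 h1 hb) (theta_pow_ne_zero h0 h1 hc)
    (by rw [e3]; exact theta_pow_ne_zero h0 h1 habc)
  rw [e3, e2, e2, e2] at h
  simp only [theta_eq_brk h0] at h
  have ex : t ^ brkExp (a + b) * t ^ brkExp (b + c) * t ^ brkExp (a + c) =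
      t ^ brkExp a * t ^ brkExp b * t ^ brkExp c * t ^ brkExp (a + b + c) := by
    simp only [← zpow_add₀ h0]
    congr 1
    have q1 := two_mul_brkExp a
    have q2 := two_mul_brkExp b
    have q3 := two_mul_brkExp c
    have q4 := two_mul_brkExp (a + b)
    have q5 := two_mul_brkExp (b + c)
    have q6 := two_mul_brkExp (a + c)
    have q7 := two_mul_brkExp (a + b + c)
    linarith
  have ne1 := brk_ne_zero h0 h1 ha
  have ne2 := brk_ne_zero h0 h1 hb
  have ne3 := brk_ne_zero h0 h1 hc
  have ne4 := brk_ne_zero h0 h1 habc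
  have hr : t ^ brkExp (a + b) * brk t (a + b) * (t ^ brkExp (b + c) * brk t (b + c)) *
      (t ^ brkExp (a + c) * brk t (a + c)) = (t ^ brkExp a * t ^ brkExp b * t ^ brkExp c *
      t ^ brkExp (a + b + c)) * (brk t (a + b) * brk t (b + c) * brk t (a + c)) := by
    rw [← ex]
    ring
  have hr2 : t ^ brkExp a * brk t a * (t ^ brkExp b * brk t b) * (t ^ brkExp c * brk t c) *
      (t ^ brkExp (a + b + c) * brk t (a + b + c)) = (t ^ brkExp a * t ^ brkExp b * t ^ brkExp c *
      t ^ brkExp (a + b + c)) * (brk t a * brk t b * brk t c * brk t (a + b + c)) := by ring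
  have hu : t ^ brkExp a * t ^ brkExp b * t ^ brkExp c * t ^ brkExp (a + b + c) ≠ 0 := by
    have := z
    simp only [← zpow_add₀ h0]
    exact z _
  rw [hr, hr2, mul_left_comm, mul_div_mul_left _ _ hu] at h
  unfold brkLog
  push_cast
  linear_combination h

theorem qpoch_eq_prod_residues {q : ℂ} (h1 : ‖q‖ < 1) (a : ℂ) {m : ℕ} (hm : m ≠ 0) :
    qpoch q a = ∏ i ∈ Finset.range m, qpoch (q ^ m) (a * q ^ i) := by
  have fin : ∀ n, ∏ k ∈ Finset.range (m * n), (1 - a * q ^ k) =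
      ∏ i ∈ Finset.range m, ∏ k ∈ Finset.range n, (1 - a * q ^ i * (q ^ m) ^ k) := by
    intro n
    induction n with
    | zero => simp
    | succ n ih =>
      rw [mul_add, mul_one, Finset.prod_range_add, ih, ← Finset.prod_mul_distrib]
      refine Finset.prod_congr rfl fun i _ => ?_
      rw [Finset.prod_range_succ]
      ring
  have l1 := (tendsto_qpoch h1 a).comp (tendsto_id.const_mul_atTop' (Nat.pos_of_ne_zero hm))
  have l2 := tendsto_finsetProd (Finset.range m) fun i _ =>
    tendsto_qpoch (norm_lt_one_pow h1 hm) (a * q ^ i)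
  refine tendsto_nhds_unique l1 (l2.congr fun n => ?_)
  simp [fin]

/-- Euler's pentagonal number theorem. -/
theorem theta_cube_self {q : ℂ} (h0 : q ≠ 0) (h1 : ‖q‖ < 1) : theta (q ^ 3) q = qpoch q q := by
  rw [theta_eq_prod (pow_ne_zero 3 h0) (norm_lt_one_pow h1 (by norm_num)) h0,
    qpoch_eq_prod_residues h1 q (m := 3) (by norm_num)]
  simp only [Finset.prod_range_succ, Finset.range_zero, Finset.prod_empty]
  have e : q ^ 3 * q⁻¹ = q * q := by field_simp
  rw [e]
  ring_nf

/-- The normalised form of Euler's product at `t`, relative to its value at `t^121`. -/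
noncomputable def eulerRatio (t : ℂ) : ℂ :=
  1 + ∑ a ∈ Finset.range 5, (-1) ^ (a + 1) * (brk t (2 * (a + 1)) / brk t (a + 1))

theorem tri_eleven (n c : ℤ) : tri (11 * n + c + 1) = 121 * tri (n + 1) + 11 * n * (c - 5) + tri (c + 1) := by
  have a := two_mul_tri (11 * n + c + 1)
  have b := two_mul_tri (n + 1)
  have d := two_mul_tri (c + 1)
  nlinarith

theorem neg_one_zpow_eleven (n c : ℤ) : (-1 : ℂ) ^ (11 * n + c) = (-1) ^ n * (-1) ^ c := by
  rw [zpow_add₀ (by norm_num), zpow_mul]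
  norm_num

theorem tsum_lambert_residue (d : ℕ) {t : ℂ} (h0 : t ≠ 0) (b c : ℤ) :
    ∑' n : ℤ, appellCoeff d t (t ^ b) (11 * n + c) / (1 - t ^ (11 * (11 * n + c))) =
      (-1) ^ c * t ^ (d * tri (c + 1) + b * c) *
        appell d (t ^ 121) (t ^ (11 * (d * (c - 5) + b))) (t ^ (11 * c)) := by
  unfold appell
  rw [← tsum_mul_left]
  refine tsum_congr fun n => ?_
  have e1 : t ^ (11 * (11 * n + c)) = t ^ (11 * c) * (t ^ 121) ^ n := by
    have : (t ^ 121) ^ n = t ^ (121 * n) := by rw [zpow_mul]; norm_cast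
    rw [this, ← zpow_add₀ h0]
    ring_nf
  rw [e1, mul_div_assoc']
  congr 1
  unfold appellCoeff
  have e2 : (t ^ 121 : ℂ) = t ^ (121 : ℤ) := by norm_cast
  rw [neg_one_zpow_eleven, e2, ← zpow_mul, ← zpow_mul, ← zpow_mul, tri_eleven]
  have e3 : t ^ ((d : ℤ) * (121 * tri (n + 1) + 11 * n * (c - 5) + tri (c + 1))) * t ^ (b * (11 * n + c)) =
      t ^ (d * tri (c + 1) + b * c) * (t ^ (121 * (d * tri (n + 1))) *
        t ^ (11 * (d * (c - 5) + b) * n)) := by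
    simp only [← zpow_add₀ h0]
    ring_nf
  linear_combination ((-1) ^ n * (-1) ^ c) * e3

theorem tsum_theta_residue {t : ℂ} (h0 : t ≠ 0) (c : ℤ) :
    ∑' n : ℤ, ((-1 : ℂ) ^ (11 * n + (c + 2)) * (t ^ 3) ^ tri (11 * n + (c + 2)) * t ^ (11 * n + (c + 2))) =
      (-1) ^ c * t ^ (3 * tri (c + 2) + c + 2) *
        theta ((t ^ 121) ^ 3) (t ^ 121 * ((t ^ (11 * c)) ^ 3)⁻¹) := by
  have hN : t ^ 121 ≠ 0 := pow_ne_zero _ h0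
  have e : t ^ 121 * ((t ^ (11 * c)) ^ 3)⁻¹ = (t ^ 121) ^ 3 * ((t ^ (11 * c)) ^ 3 * (t ^ 121) ^ 2)⁻¹ := by
    have := zpow_ne_zero (11 * c) h0
    field_simp
  rw [e, theta_base_mul_inv (pow_ne_zero _ hN) (mul_ne_zero (pow_ne_zero _ (zpow_ne_zero _ h0))
    (pow_ne_zero _ hN))]
  unfold theta
  rw [← tsum_mul_left]
  refine tsum_congr fun n => ?_
  have e2 : ∀ k : ℕ, (t ^ k : ℂ) = t ^ (k : ℤ) := fun k => (zpow_natCast t k).symm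
  have e4 : tri (11 * n + (c + 2)) = 121 * tri n + 55 * n + 11 * n * c + 22 * n + tri (c + 2) := by
    have a := two_mul_tri (11 * n + (c + 2))
    have b := two_mul_tri n
    have d := two_mul_tri (c + 2)
    nlinarith
  have e5 : ((-1 : ℂ)) ^ (11 * n + (c + 2)) = (-1) ^ n * (-1) ^ c := by
    rw [neg_one_zpow_eleven, zpow_add₀ (by norm_num)]
    norm_num
  have e6 : (t ^ 3) ^ tri (11 * n + (c + 2)) * t ^ (11 * n + (c + 2)) =
      t ^ (3 * tri (c + 2) + c + 2) * (((t ^ 121) ^ 3) ^ tri n * ((t ^ (11 * c)) ^ 3 * (t ^ 121) ^ 2) ^ n) := by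
    rw [← zpow_natCast (t ^ (11 * c)), ← pow_mul t, ← pow_mul t, e2, e2, e2, mul_zpow, ← zpow_mul,
      ← zpow_mul, ← zpow_mul, ← zpow_mul, ← zpow_mul, e4]
    simp only [← zpow_add₀ h0]
    push_cast
    ring_nf
  rw [e5]
  linear_combination ((-1) ^ n * (-1) ^ c) * e6

theorem qpoch_dissection {t : ℂ} (h0 : t ≠ 0) (h1 : ‖t‖ < 1) :
    qpoch t t = t ^ 5 * qpoch (t ^ 121) (t ^ 121) * eulerRatio t := by
  have hN : t ^ 121 ≠ 0 := pow_ne_zero _ h0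
  have hN1 := norm_pow_121_lt_one h1
  rw [← theta_cube_self h0 h1, ← theta_cube_self hN hN1]
  have hs := summable_theta (pow_ne_zero 3 h0) (norm_lt_one_pow h1 (by norm_num : 3 ≠ 0)) h0
  rw [theta, tsum_int_eq_sum_residues hs 2]
  have base := tsum_theta_residue h0 0
  simp only [zero_add, mul_zero, zpow_zero, one_pow, inv_one, mul_one, one_mul] at base
  rw [base, eulerRatio, mul_add, Finset.mul_sum, mul_one]
  refine congrArg₂ _ ?_ (Finset.sum_congr rfl fun a ha => ?_)
  · have : 3 * tri 2 + 0 + 2 = 5 := by decide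
    rw [this]
    norm_cast
  · have ha5 := Finset.mem_range.1 ha
    obtain ⟨k, hk⟩ : ∃ k : ℤ, k = (a : ℤ) + 1 := ⟨_, rfl⟩
    have hk1 : ¬11 ∣ k := by omega
    have hk2 : ¬11 ∣ 2 * k := by omega
    have e1 := tsum_theta_residue h0 k
    have e2 := tsum_theta_residue h0 (-k)
    rw [show (2 : ℤ) + (a + 1) = k + 2 by omega, show (2 : ℤ) - (a + 1) = -k + 2 by omega, e1, e2, ← hk]
    set s := t ^ (11 * k) with hs
    have hs0 : s ≠ 0 := zpow_ne_zero _ h0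
    have hsn : t ^ (11 * -k) = s⁻¹ := by rw [mul_neg, zpow_neg]
    have hs2 : s ^ 2 = t ^ (11 * (2 * k)) := by
      rw [hs, ← zpow_natCast, ← zpow_mul]
      push_cast
      ring_nf
    have hth := theta_pow_ne_zero h0 h1 hk1
    have Q := quintCoeff_mul_theta hN hN1 hs0 hth (by rw [hs2]; exact theta_pow_ne_zero h0 h1 hk2)
    rw [hs2, theta_eq_brk h0, hs, theta_eq_brk h0, ← hs] at Q
    have hb := brk_ne_zero h0 h1 hk1
    have hj := theta_cube_base_ne_zero hN hN1
    rw [quintCoeff, div_mul_eq_mul_div, div_eq_iff hj] at Q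
    have x1 : t ^ (3 * tri (k + 2) + k + 2) = t ^ (3 * tri (-k + 2) + -k + 2) * s := by
      rw [hs, ← zpow_add₀ h0]
      congr 1
      have a := two_mul_tri (k + 2)
      have b := two_mul_tri (-k + 2)
      nlinarith
    have x2 : t ^ (3 * tri (-k + 2) + -k + 2) * t ^ brkExp (2 * k) = t ^ 5 * t ^ brkExp k := by
      rw [← zpow_natCast t 5, ← zpow_add₀ h0, ← zpow_add₀ h0]
      congr 1
      have a := two_mul_tri (-k + 2)
      have b := two_mul_brkExp k
      have c := two_mul_brkExp (2 * k)
      push_cast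
      nlinarith
    have sg : (-1 : ℂ) ^ (-k) = (-1) ^ k := by
      rw [zpow_neg, ← inv_zpow]
      norm_num
    have sg2 : (-1 : ℂ) ^ (a + 1) = (-1) ^ k := by
      rw [hk]
      norm_cast
    rw [hsn, sg, sg2, inv_pow, inv_inv, x1]
    have hz := zpow_ne_zero (brkExp k) h0
    refine mul_right_cancel₀ (mul_ne_zero hz hb) ?_
    have hbb : brk t (2 * k) / brk t k * brk t k = brk t (2 * k) := div_mul_cancel₀ _ hb
    rw [mul_comm (s ^ 3), mul_comm (s ^ 3)⁻¹] at Q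
    linear_combination ((-1) ^ k * t ^ (3 * tri (-k + 2) + -k + 2)) * Q +
      (-1) ^ k * brk t (2 * k) * theta ((t ^ 121) ^ 3) (t ^ 121) * x2 -
      t ^ 5 * theta ((t ^ 121) ^ 3) (t ^ 121) * (-1) ^ k * t ^ brkExp k * hbb

theorem brk_zero (t : ℂ) : brk t 0 = 0 := by
  rw [brk, mul_zero, zpow_zero, theta_one, mul_zero]

theorem neg_one_zpow_add_sub (r k : ℤ) : (-1 : ℂ) ^ (r - k) = (-1) ^ (r + k) := by
  rw [sub_eq_add_neg, zpow_add₀ (by norm_num), zpow_add₀ (by norm_num), zpow_neg, ← inv_zpow]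
  norm_num

theorem lambertSum_eq_residues {d : ℕ} (hd : 0 < d) {t : ℂ} (h0 : t ≠ 0) (h1 : ‖t‖ < 1) (r : ℤ) :
    lambertSum d (d * (5 - r)) t =
      (-1) ^ r * t ^ (d * tri (r + 1) + d * (5 - r) * r) * appell d (t ^ 121) 1 (t ^ (11 * r)) +
      ∑ a ∈ Finset.range 5, (-1) ^ (r + (a + 1)) *
        t ^ (d * tri (r - (a + 1) + 1) + d * (5 - r) * (r - (a + 1))) *
        ((t ^ (11 * (a + 1) : ℤ)) ^ d * appell d (t ^ 121) ((t ^ (11 * (a + 1) : ℤ)) ^ d)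
            (t ^ (11 * (a + 1) : ℤ) * t ^ (11 * r)) +
          appell d (t ^ 121) (((t ^ (11 * (a + 1) : ℤ)) ^ d)⁻¹)
            ((t ^ (11 * (a + 1) : ℤ))⁻¹ * t ^ (11 * r))) := by
  rw [lambertSum, tsum_int_eq_sum_residues (summable_lambertSum hd h0 h1 _) r,
    tsum_lambert_residue d h0]
  refine congrArg₂ _ ?_ (Finset.sum_congr rfl fun a _ => ?_)
  · rw [show (11 : ℤ) * (d * (r - 5) + d * (5 - r)) = 0 by ring, zpow_zero]
  · obtain ⟨k, hk⟩ : ∃ k : ℤ, k = (a : ℤ) + 1 := ⟨_, rfl⟩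
    rw [← hk, tsum_lambert_residue d h0, tsum_lambert_residue d h0, neg_one_zpow_add_sub]
    have e1 : t ^ (11 * (d * (r + k - 5) + d * (5 - r))) = (t ^ (11 * k)) ^ d := by
      rw [← zpow_natCast, ← zpow_mul]
      ring_nf
    have e2 : t ^ (11 * (d * (r - k - 5) + d * (5 - r))) = ((t ^ (11 * k)) ^ d)⁻¹ := by
      rw [← zpow_natCast, ← zpow_mul, ← zpow_neg]
      ring_nf
    have e3 : t ^ (11 * (r + k)) = t ^ (11 * k) * t ^ (11 * r) := by
      rw [← zpow_add₀ h0]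
      ring_nf
    have e4 : t ^ (11 * (r - k)) = (t ^ (11 * k))⁻¹ * t ^ (11 * r) := by
      rw [← zpow_neg, ← zpow_add₀ h0]
      ring_nf
    have e5 : t ^ (d * tri (r + k + 1) + d * (5 - r) * (r + k)) =
        t ^ (d * tri (r - k + 1) + d * (5 - r) * (r - k)) * (t ^ (11 * k)) ^ d := by
      rw [← zpow_natCast, ← zpow_mul, ← zpow_add₀ h0]
      congr 1
      have a := two_mul_tri (r + k + 1)
      have b := two_mul_tri (r - k + 1)
      have e : tri (r + k + 1) = tri (r - k + 1) + 2 * r * k + k := by nlinarith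
      rw [e]
      ring
    rw [e1, e2, e3, e4, e5]
    ring

theorem brkExp_sub (r k : ℤ) :
    tri (r - k + 1) + (5 - r) * (r - k) + brkExp (2 * k) + brkExp r =
      brkExp k + brkExp (r + k) + brkExp (r - k) := by
  have a := two_mul_tri (r - k + 1)
  have b := two_mul_brkExp (2 * k)
  have c := two_mul_brkExp r
  have d := two_mul_brkExp k
  have e := two_mul_brkExp (r + k)
  have f := two_mul_brkExp (r - k)
  nlinarith

theorem lambertSum_one_dissection {t : ℂ} (h0 : t ≠ 0) (h1 : ‖t‖ < 1) {r : ℤ} (hr : 1 ≤ r) (hr5 : r ≤ 5) :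
    lambertSum 1 (5 - r) t = brkLog t (2 * r) - brkLog t r - r / 11 +
      (-1) ^ r * (qpoch (t ^ 121) (t ^ 121) ^ 3 * ((brk t r)⁻¹ + ∑ a ∈ Finset.range 5, (-1) ^ (a + 1) *
        (brk t (2 * (a + 1)) * brk t r / (brk t (a + 1) * brk t (r + (a + 1)) * brk t (r - (a + 1)))))) := by
  have hN : t ^ 121 ≠ 0 := pow_ne_zero _ h0
  have hN1 := norm_pow_121_lt_one h1
  have z : ∀ n : ℤ, t ^ n ≠ 0 := fun n => zpow_ne_zero n h0
  have hr11 : ¬11 ∣ r := by omega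
  have tr := theta_pow_ne_zero h0 h1 hr11
  have main := lambertSum_eq_residues one_pos h0 h1 r (t := t)
  simp only [Nat.cast_one, one_mul] at main
  rw [main]
  have c0 : (-1) ^ r * t ^ (tri (r + 1) + (5 - r) * r) * appell 1 (t ^ 121) 1 (t ^ (11 * r)) =
      (-1) ^ r * (qpoch (t ^ 121) (t ^ 121) ^ 3 * (brk t r)⁻¹) := by
    have h := appell_one_sum_zero hN hN1 (z _) tr
    rw [theta_eq_brk h0] at h
    have hb := brk_ne_zero h0 h1 hr11
    have e : tri (r + 1) + (5 - r) * r = brkExp r := by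
      have a := two_mul_tri (r + 1)
      have b := two_mul_brkExp r
      nlinarith
    rw [e, ← h]
    field_simp
  have c1 : brkLog t (2 * r) - brkLog t r - r / 11 = ∑ a ∈ Finset.range 5,
      if (a : ℤ) + 1 = r then brkLog t (2 * r) - brkLog t r - r / 11 else 0 := by
    obtain ⟨n, hn⟩ : ∃ n : ℕ, r = n + 1 := ⟨(r - 1).toNat, by omega⟩
    rw [Finset.sum_eq_single n, if_pos hn.symm]
    · intro b _ hb
      rw [if_neg (by omega)]
    · intro hn'
      exact absurd (Finset.mem_range.2 (by omega)) hn'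
  rw [c0, c1, mul_add, mul_add, Finset.mul_sum, Finset.mul_sum, add_left_comm, ← Finset.sum_add_distrib]
  congr 1
  refine Finset.sum_congr rfl fun a ha => ?_
  have ha5 := Finset.mem_range.1 ha
  have sg : (-1 : ℂ) ^ (a + 1) = (-1) ^ ((a : ℤ) + 1) := by norm_cast
  obtain ⟨k, hk⟩ : ∃ k : ℤ, k = (a : ℤ) + 1 := ⟨_, rfl⟩
  rw [sg, ← hk]
  have ka : ¬11 ∣ k := by omega
  have k2 : ¬11 ∣ 2 * k := by omega
  have kr : ¬11 ∣ r + k := by omega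
  have ts := theta_pow_ne_zero h0 h1 ka
  have e2 : (t ^ (11 * k)) ^ 2 = t ^ (11 * (2 * k)) := by
    rw [← zpow_natCast, ← zpow_mul]
    push_cast
    ring_nf
  have ts2 := theta_pow_ne_zero h0 h1 k2
  simp only [pow_one]
  by_cases hkr : k = r
  · subst hkr
    rw [if_pos rfl, sub_self, brk_zero, mul_zero, mul_zero, div_zero, mul_zero, mul_zero, mul_zero, add_zero,
      inv_mul_cancel₀ (z _), appell_one_self hN hN1 (z _) ts (by rw [e2]; exact ts2), zero_add, tri_one,
      add_zero, zpow_zero, mul_one, zpow_add₀ (by norm_num), ← mul_zpow, e2, brkLog, brkLog]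
    push_cast
    norm_num
    ring
  · rw [if_neg hkr, zero_add]
    have kd : ¬11 ∣ r - k := by omega
    have e3 : t ^ (11 * k) * t ^ (11 * r) = t ^ (11 * (r + k)) := by
      rw [← zpow_add₀ h0]
      ring_nf
    have e4 : (t ^ (11 * k))⁻¹ * t ^ (11 * r) = t ^ (11 * (r - k)) := by
      rw [← zpow_neg, ← zpow_add₀ h0]
      ring_nf
    have h := appell_one_add hN hN1 (z (11 * k)) (z (11 * r)) ts (by rw [e2]; exact ts2) tr
      (by rw [e3]; exact theta_pow_ne_zero h0 h1 kr) (by rw [e4]; exact theta_pow_ne_zero h0 h1 kd)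
    rw [h, e2, e3, e4]
    simp only [theta_eq_brk h0]
    have b1 := brk_ne_zero h0 h1 ka
    have b2 := brk_ne_zero h0 h1 kr
    have b3 := brk_ne_zero h0 h1 kd
    have ex : t ^ (tri (r - k + 1) + (5 - r) * (r - k)) * (t ^ brkExp (2 * k) * t ^ brkExp r) =
        t ^ brkExp k * t ^ brkExp (r + k) * t ^ brkExp (r - k) := by
      simp only [← zpow_add₀ h0]
      rw [← brkExp_sub]
      ring_nf
    have z1 := z (brkExp k)
    have z2 := z (brkExp (r + k))
    have z3 := z (brkExp (r - k))
    rw [zpow_add₀ (by norm_num : (-1 : ℂ) ≠ 0)]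
    generalize t ^ brkExp k = u1 at *
    generalize t ^ brkExp (r + k) = u2 at *
    generalize t ^ brkExp (r - k) = u3 at *
    generalize brk t k = v1 at *
    generalize brk t (r + k) = v2 at *
    generalize brk t (r - k) = v3 at *
    rw [mul_div_assoc', mul_div_assoc', mul_div_assoc', mul_div_assoc', div_eq_div_iff
      (by positivity) (by positivity)]
    linear_combination ((-1) ^ r * (-1) ^ k * qpoch (t ^ 121) (t ^ 121) ^ 3 * brk t (2 * k) * brk t r *
      v1 * v2 * v3) * ex

theorem lambertSum_three_dissection {t : ℂ} (h0 : t ≠ 0) (h1 : ‖t‖ < 1) {r : ℤ} (hr : 1 ≤ r) (hr5 : r ≤ 5) :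
    lambertSum 3 (3 * (5 - r)) t = brkLog t (2 * r) + brkLog t r + 1 - 3 * r / 11 +
      (-1) ^ r * t ^ (3 * brkExp r) * appell 3 (t ^ 121) 1 (t ^ (11 * r)) * eulerRatio t +
      (-1) ^ r * (qpoch (t ^ 121) (t ^ 121) ^ 3 * ∑ a ∈ Finset.range 5, (-1) ^ (a + 1) *
        (brk t (a + 1) * brk t (2 * (a + 1)) / (brk t (r - (a + 1)) * brk t r * brk t (r + (a + 1))))) := by
  have hN : t ^ 121 ≠ 0 := pow_ne_zero _ h0
  have hN1 := norm_pow_121_lt_one h1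
  have z : ∀ n : ℤ, t ^ n ≠ 0 := fun n => zpow_ne_zero n h0
  have hr11 : ¬11 ∣ r := by omega
  have tr := theta_pow_ne_zero h0 h1 hr11
  have main := lambertSum_eq_residues three_pos h0 h1 r (t := t)
  rw [Nat.cast_ofNat] at main
  rw [main]
  have c0 : 3 * tri (r + 1) + 3 * (5 - r) * r = 3 * brkExp r := by
    have a := two_mul_tri (r + 1)
    have b := two_mul_brkExp r
    nlinarith
  have c1 : brkLog t (2 * r) + brkLog t r + 1 - 3 * r / 11 = ∑ a ∈ Finset.range 5,
      if (a : ℤ) + 1 = r then brkLog t (2 * r) + brkLog t r + 1 - 3 * r / 11 else 0 := by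
    obtain ⟨n, hn⟩ : ∃ n : ℕ, r = n + 1 := ⟨(r - 1).toNat, by omega⟩
    rw [Finset.sum_eq_single n, if_pos hn.symm]
    · intro b _ hb
      rw [if_neg (by omega)]
    · intro hn'
      exact absurd (Finset.mem_range.2 (by omega)) hn'
  rw [c0, c1, eulerRatio, mul_add, mul_one, Finset.mul_sum, Finset.mul_sum, Finset.mul_sum,
    add_left_comm, add_assoc, ← Finset.sum_add_distrib, ← Finset.sum_add_distrib]
  congr 1
  refine Finset.sum_congr rfl fun a ha => ?_
  have ha5 := Finset.mem_range.1 ha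
  have sg : (-1 : ℂ) ^ (a + 1) = (-1) ^ ((a : ℤ) + 1) := by norm_cast
  obtain ⟨k, hk⟩ : ∃ k : ℤ, k = (a : ℤ) + 1 := ⟨_, rfl⟩
  rw [sg, ← hk]
  have ka : ¬11 ∣ k := by omega
  have k2 : ¬11 ∣ 2 * k := by omega
  have kr : ¬11 ∣ r + k := by omega
  have ts := theta_pow_ne_zero h0 h1 ka
  have e2 : (t ^ (11 * k)) ^ 2 = t ^ (11 * (2 * k)) := by
    rw [← zpow_natCast, ← zpow_mul]
    push_cast
    ring_nf
  have ts2 := theta_pow_ne_zero h0 h1 k2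
  have b1 := brk_ne_zero h0 h1 ka
  have z1 := z (brkExp k)
  have hq : quintCoeff (t ^ 121) (t ^ (11 * k)) =
      t ^ brkExp (2 * k) * brk t (2 * k) / (t ^ brkExp k * brk t k) := by
    have := quintCoeff_mul_theta hN hN1 (z _) ts (by rw [e2]; exact ts2)
    rw [e2, theta_eq_brk h0, theta_eq_brk h0] at this
    rw [eq_div_iff (mul_ne_zero z1 b1), this]
  have ex1 : t ^ (3 * tri (r - k + 1) + 3 * (5 - r) * (r - k)) * t ^ (11 * k) * t ^ brkExp (2 * k) =
      t ^ (3 * brkExp r) * t ^ brkExp k := by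
    simp only [← zpow_add₀ h0]
    congr 1
    have a := two_mul_tri (r - k + 1)
    have b := two_mul_brkExp (2 * k)
    have c := two_mul_brkExp r
    have d := two_mul_brkExp k
    nlinarith
  by_cases hkr : k = r
  · subst hkr
    rw [if_pos rfl, sub_self, brk_zero, zero_mul, zero_mul, div_zero, mul_zero, mul_zero, mul_zero, add_zero,
      inv_mul_cancel₀ (z _)]
    have h := appell_three_self hN hN1 (z _) ts (by rw [e2]; exact ts2)
    rw [hq, e2] at h
    have hsg : (-1 : ℂ) ^ (k + k) = 1 := by
      rw [zpow_add₀ (by norm_num), ← mul_zpow]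
      norm_num
    have hsg' : (-1 : ℂ) ^ k * (-1) ^ k = 1 := by
      rw [← mul_zpow]
      norm_num
    rw [sub_self, zero_add, tri_one, mul_zero, mul_zero, add_zero, zpow_zero, one_mul] at ex1
    rw [sub_eq_iff_eq_add.1 h, hsg, zero_add, tri_one, mul_zero, zpow_zero,
      brkLog, brkLog]
    generalize brk t k = v1 at *
    generalize t ^ brkExp k = u1 at *
    have e5 : t ^ (11 * k) * (t ^ brkExp (2 * k) * brk t (2 * k) / (u1 * v1)) =
        t ^ (3 * brkExp k) * (brk t (2 * k) / v1) := by
      rw [mul_div_assoc', mul_div_assoc', div_eq_div_iff (mul_ne_zero z1 b1) b1]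
      linear_combination (brk t (2 * k) * v1) * ex1
    rw [e5]
    push_cast
    linear_combination (-(t ^ (3 * brkExp k) * (brk t (2 * k) / v1)) *
      appell 3 (t ^ 121) 1 (t ^ (11 * k))) * hsg'
  · rw [if_neg hkr, zero_add]
    have kd : ¬11 ∣ r - k := by omega
    have e3 : t ^ (11 * k) * t ^ (11 * r) = t ^ (11 * (r + k)) := by
      rw [← zpow_add₀ h0]
      ring_nf
    have e4 : (t ^ (11 * k))⁻¹ * t ^ (11 * r) = t ^ (11 * (r - k)) := by
      rw [← zpow_neg, ← zpow_add₀ h0]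
      ring_nf
    have h := appell_three_add hN hN1 (z (11 * k)) (z (11 * r)) ts (by rw [e2]; exact ts2) tr
      (by rw [e3]; exact theta_pow_ne_zero h0 h1 kr) (by rw [e4]; exact theta_pow_ne_zero h0 h1 kd)
    rw [sub_eq_iff_eq_add.1 h, hq, e2, e3, e4]
    simp only [theta_eq_brk h0]
    have b2 := brk_ne_zero h0 h1 kr
    have b3 := brk_ne_zero h0 h1 kd
    have b4 := brk_ne_zero h0 h1 hr11
    have ex : t ^ (3 * tri (r - k + 1) + 3 * (5 - r) * (r - k)) * (t ^ brkExp k * t ^ brkExp (2 * k)) =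
        t ^ brkExp (r - k) * t ^ brkExp r * t ^ brkExp (r + k) := by
      simp only [← zpow_add₀ h0]
      congr 1
      have a := two_mul_tri (r - k + 1)
      have b := two_mul_brkExp (2 * k)
      have c := two_mul_brkExp r
      have d := two_mul_brkExp k
      have e := two_mul_brkExp (r + k)
      have f := two_mul_brkExp (r - k)
      nlinarith
    have z2 := z (brkExp (r + k))
    have z3 := z (brkExp (r - k))
    have z4 := z (brkExp r)
    rw [zpow_add₀ (by norm_num : (-1 : ℂ) ≠ 0)]
    generalize t ^ (3 * brkExp r) = w at *
    generalize t ^ brkExp k = u1 at *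
    generalize t ^ brkExp (r + k) = u2 at *
    generalize t ^ brkExp (r - k) = u3 at *
    generalize t ^ brkExp r = u4 at *
    generalize brk t k = v1 at *
    generalize brk t (r + k) = v2 at *
    generalize brk t (r - k) = v3 at *
    generalize brk t r = v4 at *
    generalize t ^ (3 * tri (r - k + 1) + 3 * (5 - r) * (r - k)) = T at *
    have p1 : T * (t ^ (11 * k) * (t ^ brkExp (2 * k) * brk t (2 * k) / (u1 * v1))) = w * (brk t (2 * k) / v1) := by
      rw [mul_div_assoc', mul_div_assoc', mul_div_assoc', div_eq_div_iff (mul_ne_zero z1 b1) b1]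
      linear_combination (brk t (2 * k) * v1) * ex1
    have p2 : T * (qpoch (t ^ 121) (t ^ 121) ^ 3 * (u1 * v1) * (t ^ brkExp (2 * k) * brk t (2 * k)) /
        (u3 * v3 * (u4 * v4) * (u2 * v2))) =
        qpoch (t ^ 121) (t ^ 121) ^ 3 * (v1 * brk t (2 * k) / (v3 * v4 * v2)) := by
      rw [mul_div_assoc', mul_div_assoc', div_eq_div_iff (by positivity) (by positivity)]
      linear_combination (qpoch (t ^ 121) (t ^ 121) ^ 3 * v1 * brk t (2 * k) * v2 * v3 * v4) * ex
    linear_combination ((-1) ^ r * (-1) ^ k * appell 3 (t ^ 121) 1 (t ^ (11 * r))) * p1 + (-1) ^ r * (-1) ^ k * p2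

theorem brk_three_term {t : ℂ} (h0 : t ≠ 0) (h1 : ‖t‖ < 1) (x y z w : ℤ) :
    brk t (x + y) * brk t (x - y) * (brk t (z + w) * brk t (z - w)) -
      brk t (x + z) * brk t (x - z) * (brk t (y + w) * brk t (y - w)) +
      brk t (x + w) * brk t (x - w) * (brk t (y + z) * brk t (y - z)) = 0 := by
  have hz : ∀ n : ℤ, t ^ n ≠ 0 := fun n => zpow_ne_zero n h0
  have h := theta_three_term (pow_ne_zero 121 h0) (norm_pow_121_lt_one h1)
    (hz (11 * x)) (hz (11 * y)) (hz (11 * z)) (hz (11 * w))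
  have e1 : ∀ a b : ℤ, t ^ (11 * a) * t ^ (11 * b) = t ^ (11 * (a + b)) := fun a b => by
    rw [← zpow_add₀ h0]
    ring_nf
  have e2 : ∀ a b : ℤ, t ^ (11 * a) * (t ^ (11 * b))⁻¹ = t ^ (11 * (a - b)) := fun a b => by
    rw [← zpow_neg, ← zpow_add₀ h0]
    ring_nf
  simp only [e1, e2, theta_eq_brk h0] at h
  have f : ∀ a b c d e : ℤ, t ^ brkExp (a + b) * t ^ brkExp (a - b) * (t ^ brkExp (c + d) * t ^ brkExp (c - d)) *
      t ^ (11 * e) = t ^ (11 * (a + c + e) - (a ^ 2 + b ^ 2 + c ^ 2 + d ^ 2)) := fun a b c d e => by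
    simp only [← zpow_add₀ h0]
    congr 1
    have h1 := two_mul_brkExp (a + b)
    have h2 := two_mul_brkExp (a - b)
    have h3 := two_mul_brkExp (c + d)
    have h4 := two_mul_brkExp (c - d)
    nlinarith
  have f1 := f x y z w y
  have f2 := f x z y w z
  have f3 := f x w y z z
  have e3 : 11 * (x + z + y) - (x ^ 2 + y ^ 2 + z ^ 2 + w ^ 2) = 11 * (x + y + z) - (x ^ 2 + z ^ 2 + y ^ 2 + w ^ 2) := by
    ring
  have e4 : 11 * (x + y + z) - (x ^ 2 + w ^ 2 + y ^ 2 + z ^ 2) = 11 * (x + y + z) - (x ^ 2 + z ^ 2 + y ^ 2 + w ^ 2) := by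
    ring
  rw [e3] at f1
  rw [e4] at f3
  refine (mul_eq_zero.1 (?_ : t ^ (11 * (x + y + z) - (x ^ 2 + z ^ 2 + y ^ 2 + w ^ 2)) * _ = 0)).resolve_left (hz _)
  linear_combination h - (brk t (x + y) * brk t (x - y) * (brk t (z + w) * brk t (z - w))) * f1 +
    (brk t (x + z) * brk t (x - z) * (brk t (y + w) * brk t (y - w))) * f2 -
    (brk t (x + w) * brk t (x - w) * (brk t (y + z) * brk t (y - z))) * f3

theorem brk_six {t : ℂ} (h0 : t ≠ 0) : brk t 6 = brk t 5 := brk_reflect h0 5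
theorem brk_seven {t : ℂ} (h0 : t ≠ 0) : brk t 7 = brk t 4 := brk_reflect h0 4
theorem brk_eight {t : ℂ} (h0 : t ≠ 0) : brk t 8 = brk t 3 := brk_reflect h0 3
theorem brk_nine {t : ℂ} (h0 : t ≠ 0) : brk t 9 = brk t 2 := brk_reflect h0 2
theorem brk_ten {t : ℂ} (h0 : t ≠ 0) : brk t 10 = brk t 1 := brk_reflect h0 1

theorem brk_relation_one {t : ℂ} (h0 : t ≠ 0) (h1 : ‖t‖ < 1) :
    brk t 5 * brk t 2 * brk t 1 ^ 2 - brk t 5 * brk t 3 * brk t 2 ^ 2 + brk t 1 * brk t 3 * brk t 4 ^ 2 = 0 := by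
  have h := brk_three_term h0 h1 4 2 1 0
  norm_num [brk_six h0] at h
  linear_combination h

theorem brk_relation_two {t : ℂ} (h0 : t ≠ 0) (h1 : ‖t‖ < 1) :
    brk t 4 * brk t 3 * brk t 1 ^ 2 - brk t 5 * brk t 4 * brk t 2 ^ 2 + brk t 5 ^ 2 * brk t 3 * brk t 1 = 0 := by
  have h := brk_three_term h0 h1 5 2 1 0
  norm_num [brk_six h0, brk_seven h0] at h
  linear_combination h

theorem brk_relation_three {t : ℂ} (h0 : t ≠ 0) (h1 : ‖t‖ < 1) :
    brk t 5 * brk t 1 ^ 3 - brk t 4 * brk t 2 ^ 3 + brk t 3 ^ 3 * brk t 1 = 0 := by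
  have h := brk_three_term h0 h1 3 2 1 0
  norm_num at h
  linear_combination h

theorem eulerRatio_eq {t : ℂ} (h0 : t ≠ 0) : eulerRatio t =
    1 - brk t 2 / brk t 1 + brk t 4 / brk t 2 - brk t 5 / brk t 3 + brk t 3 / brk t 4 - brk t 1 / brk t 5 := by
  rw [eulerRatio]
  norm_num [Finset.sum_range_succ, brk_six h0, brk_eight h0, brk_ten h0]
  ring

/-- The theta quotients in the dissection of the level three Lambert series. -/
noncomputable def rankQuot (t : ℂ) (r : ℤ) : ℂ :=
  ∑ a ∈ Finset.range 5, (-1) ^ (a + 1) *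
    (brk t (a + 1) * brk t (2 * (a + 1)) / (brk t (r - (a + 1)) * brk t r * brk t (r + (a + 1))))

/-- The theta quotients in the dissection of the level one Lambert series. -/
noncomputable def crankQuot (t : ℂ) (r : ℤ) : ℂ :=
  (brk t r)⁻¹ + ∑ a ∈ Finset.range 5, (-1) ^ (a + 1) *
    (brk t (2 * (a + 1)) * brk t r / (brk t (a + 1) * brk t (r + (a + 1)) * brk t (r - (a + 1))))

/-- The mock theta part of the dissection of the level three Lambert series. -/
noncomputable def rankMock (t : ℂ) (r : ℤ) : ℂ :=
  (-1) ^ r * t ^ (3 * brkExp r) * appell 3 (t ^ 121) 1 (t ^ (11 * r))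

/-- The theta part of the generating function of a combination of rank and crank counts, where `l` expresses
the logarithmic derivatives through theta quotients. -/
noncomputable def thetaPart (c : Fin 7 → ℤ) (l : Fin 5 → ℤ) (t : ℂ) : ℂ :=
  -(c 2 - c 3) * rankQuot t 1 + (-2 * c 0 + c 1) * rankQuot t 2 - (-c 3 + c 4) * rankQuot t 3 +
    (c 4 - c 5) * rankQuot t 4 - (c 1 - c 2) * rankQuot t 5 +
    c 6 * (-2 * crankQuot t 5 + crankQuot t 4 + crankQuot t 3) -
    (l 0 * (brk t 2 ^ 3 / (brk t 1 ^ 3 * brk t 3)) +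
      l 1 * (brk t 2 * brk t 4 ^ 2 / (brk t 1 ^ 2 * brk t 3 * brk t 5)) +
      l 2 * (brk t 2 * brk t 5 / (brk t 1 ^ 2 * brk t 4)) +
      l 3 * (brk t 3 ^ 2 / (brk t 1 ^ 2 * brk t 4)) +
      l 4 * (brk t 3 ^ 2 * brk t 4 / (brk t 1 * brk t 2 ^ 2 * brk t 5)))

theorem hasSum_rankCrankComb_dissection {t : ℂ} (h0 : t ≠ 0) (h1 : ‖t‖ < 1) (c : Fin 7 → ℤ) (l : Fin 5 → ℤ)
    (hc : c 0 + c 1 + c 2 + c 3 + c 4 + c 5 = 0)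
    (l1 : 3 * l 0 + 2 * l 1 + 2 * l 2 + 2 * l 3 + l 4 = 2 * c 2 - c 3 - c 1 - 2 * c 6)
    (l2 : l 3 + 2 * l 4 = c 2 - c 3 - 2 * c 0 + c 1)
    (l3 : -l 0 + l 1 = -c 3 + c 5)
    (l4 : l 2 - l 3 = -2 * c 0 + c 1 + c 4 - c 5 - c 6)
    (l5 : -l 1 + l 2 - l 4 = c 3 - c 4 + c 1 - c 2 - c 6) :
    HasSum (fun n => (rankCrankComb c n : ℂ) * t ^ n)
      (qpoch (t ^ 121) (t ^ 121) ^ 2 * (t ^ 5)⁻¹ * (thetaPart c l t / eulerRatio t) + (c 3 - c 2) * t⁻¹ +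
        ((c 2 - c 3) * rankMock t 1 + (-2 * c 0 + c 1) * rankMock t 2 + (-c 3 + c 4) * rankMock t 3 +
          (c 4 - c 5) * rankMock t 4 + (c 1 - c 2) * rankMock t 5) * (t ^ 5 * qpoch (t ^ 121) (t ^ 121))⁻¹) := by
  convert hasSum_rankCrankComb h0 h1 c using 1
  have hE := qpoch_dissection h0 h1
  have hE0 := qpoch_self_ne_zero h1
  have hJ := qpoch_self_ne_zero (norm_pow_121_lt_one h1)
  have hp : ∀ m : ℤ, 1 ≤ m → m ≤ 10 → ¬11 ∣ m := fun m h h' => by omega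
  have q1 := lambertSum_three_dissection h0 h1 (r := 1) (by norm_num) (by norm_num)
  have q2 := lambertSum_three_dissection h0 h1 (r := 2) (by norm_num) (by norm_num)
  have q3 := lambertSum_three_dissection h0 h1 (r := 3) (by norm_num) (by norm_num)
  have q4 := lambertSum_three_dissection h0 h1 (r := 4) (by norm_num) (by norm_num)
  have q5 := lambertSum_three_dissection h0 h1 (r := 5) (by norm_num) (by norm_num)
  have k3 := lambertSum_one_dissection h0 h1 (r := 3) (by norm_num) (by norm_num)
  have k4 := lambertSum_one_dissection h0 h1 (r := 4) (by norm_num) (by norm_num)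
  have k5 := lambertSum_one_dissection h0 h1 (r := 5) (by norm_num) (by norm_num)
  rw [← rankQuot, ← rankMock] at q1 q2 q3 q4 q5
  rw [← crankQuot] at k3 k4 k5
  have r6 := brkLog_reflect h0 h1 (hp 5 (by norm_num) (by norm_num))
  have r8 := brkLog_reflect h0 h1 (hp 3 (by norm_num) (by norm_num))
  have r10 := brkLog_reflect h0 h1 (hp 1 (by norm_num) (by norm_num))
  have a0 := brkLog_add h0 h1 (hp 1 (by norm_num) (by norm_num)) (hp 1 (by norm_num) (by norm_num))
    (hp 1 (by norm_num) (by norm_num)) (hp (1 + 1 + 1) (by norm_num) (by norm_num))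
  have a1 := brkLog_add h0 h1 (hp 1 (by norm_num) (by norm_num)) (hp 1 (by norm_num) (by norm_num))
    (hp 3 (by norm_num) (by norm_num)) (hp (1 + 1 + 3) (by norm_num) (by norm_num))
  have a2 := brkLog_add h0 h1 (hp 1 (by norm_num) (by norm_num)) (hp 1 (by norm_num) (by norm_num))
    (hp 4 (by norm_num) (by norm_num)) (hp (1 + 1 + 4) (by norm_num) (by norm_num))
  have a3 := brkLog_add h0 h1 (hp 1 (by norm_num) (by norm_num)) (hp 1 (by norm_num) (by norm_num))
    (hp 2 (by norm_num) (by norm_num)) (hp (1 + 1 + 2) (by norm_num) (by norm_num))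
  have a4 := brkLog_add h0 h1 (hp 1 (by norm_num) (by norm_num)) (hp 2 (by norm_num) (by norm_num))
    (hp 2 (by norm_num) (by norm_num)) (hp (1 + 2 + 2) (by norm_num) (by norm_num))
  norm_num [brk_six h0] at q1 q2 q3 q4 q5 k3 k4 k5 r6 r8 r10 a0 a1 a2 a3 a4
  have b2 := brk_ne_zero h0 h1 (hp 2 (by norm_num) (by norm_num))
  have b5 := brk_ne_zero h0 h1 (hp 5 (by norm_num) (by norm_num))
  have b1 := brk_ne_zero h0 h1 (hp 1 (by norm_num) (by norm_num))
  have b3 := brk_ne_zero h0 h1 (hp 3 (by norm_num) (by norm_num))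
  have b4 := brk_ne_zero h0 h1 (hp 4 (by norm_num) (by norm_num))
  have v0 : brk t 2 * brk t 2 * brk t 2 / (brk t 1 * brk t 1 * brk t 1 * brk t 3) =
    brk t 2 ^ 3 / (brk t 1 ^ 3 * brk t 3) := by ring
  have v1 : brk t 2 * brk t 4 * brk t 4 / (brk t 1 * brk t 1 * brk t 3 * brk t 5) =
    brk t 2 * brk t 4 ^ 2 / (brk t 1 ^ 2 * brk t 3 * brk t 5) := by ring
  have v2 : brk t 2 * brk t 5 * brk t 5 / (brk t 1 * brk t 1 * brk t 4 * brk t 5) =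
    brk t 2 * brk t 5 / (brk t 1 ^ 2 * brk t 4) := by field_simp
  have v3 : brk t 2 * brk t 3 * brk t 3 / (brk t 1 * brk t 1 * brk t 2 * brk t 4) =
    brk t 3 ^ 2 / (brk t 1 ^ 2 * brk t 4) := by field_simp
  have v4 : brk t 3 * brk t 4 * brk t 3 / (brk t 1 * brk t 2 * brk t 2 * brk t 5) =
    brk t 3 ^ 2 * brk t 4 / (brk t 1 * brk t 2 ^ 2 * brk t 5) := by ring
  rw [mul_div_assoc, v0] at a0
  rw [mul_div_assoc, v1] at a1
  rw [mul_div_assoc, v2] at a2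
  rw [mul_div_assoc, v3] at a3
  rw [mul_div_assoc, v4] at a4
  have m0 := congrArg (Int.cast : ℤ → ℂ) hc
  have m1 := congrArg (Int.cast : ℤ → ℂ) l1
  have m2 := congrArg (Int.cast : ℤ → ℂ) l2
  have m3 := congrArg (Int.cast : ℤ → ℂ) l3
  have m4 := congrArg (Int.cast : ℤ → ℂ) l4
  have m5 := congrArg (Int.cast : ℤ → ℂ) l5
  push_cast at m0 m1 m2 m3 m4 m5
  have he : eulerRatio t ≠ 0 := fun h => hE0 (by rw [hE, h, mul_zero])
  have main : qpoch (t ^ 121) (t ^ 121) ^ 3 * thetaPart c l t +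
      ((c 2 - c 3) * rankMock t 1 + (-2 * c 0 + c 1) * rankMock t 2 + (-c 3 + c 4) * rankMock t 3 +
          (c 4 - c 5) * rankMock t 4 + (c 1 - c 2) * rankMock t 5) * eulerRatio t =
      c 0*(1-2*lambertSum 3 9 t) + c 1*(lambertSum 3 0 t + lambertSum 3 9 t) + c 2*(lambertSum 3 12 t - 1 -
        lambertSum 3 0 t) + c 3*(-lambertSum 3 6 t - lambertSum 3 12 t + 1) +
        c 4*(lambertSum 3 3 t + lambertSum 3 6 t) + c 5*(-lambertSum 3 3 t) +
        c 6*(1 + 2*lambertSum 1 0 t + lambertSum 1 1 t - lambertSum 1 2 t) := by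
    rw [q1, q2, q3, q4, q5, k3, k4, k5, thetaPart, r6, r8, r10]
    rw [r6] at a2
    linear_combination (-l 0 : ℂ) * a0 - l 1 * a1 - l 2 * a2 - l 3 * a3 - l 4 * a4 + brkLog t 1 * m1 +
      brkLog t 2 * m2 + brkLog t 3 * m3 + brkLog t 4 * m4 + brkLog t 5 * m5 - 1 / 11 * m0
  rw [theta_cube_self h0 h1, eq_inv_mul_iff_mul_eq₀ hE0]
  trans (qpoch (t ^ 121) (t ^ 121) ^ 3 * thetaPart c l t + (c 3 - c 2) * t⁻¹ * qpoch t t +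
      ((c 2 - c 3) * rankMock t 1 + (-2 * c 0 + c 1) * rankMock t 2 + (-c 3 + c 4) * rankMock t 3 +
          (c 4 - c 5) * rankMock t 4 + (c 1 - c 2) * rankMock t 5) * eulerRatio t)
  · rw [hE]
    field_simp
  · linear_combination main

/-- The abscissa of the point on the curve `y ^ 2 + (x ^ 2 + 1) * y + x = 0`. -/
noncomputable def curveX (t : ℂ) : ℂ := brk t 1 ^ 2 / (brk t 2 * brk t 3)

/-- The ordinate of the point on the curve `y ^ 2 + (x ^ 2 + 1) * y + x = 0`. -/
noncomputable def curveY (t : ℂ) : ℂ := -(brk t 1 * brk t 3 * brk t 5 / (brk t 2 ^ 2 * brk t 4))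

/-- The ratio of theta functions in which dissections are expanded. -/
noncomputable def thetaRatio (t : ℂ) : ℂ := brk t 2 / brk t 1

theorem brk_ne_zero_aux {t : ℂ} (h0 : t ≠ 0) (h1 : ‖t‖ < 1) :
    brk t 1 ≠ 0 ∧ brk t 2 ≠ 0 ∧ brk t 3 ≠ 0 ∧ brk t 4 ≠ 0 ∧ brk t 5 ≠ 0 := by
  refine ⟨?_, ?_, ?_, ?_, ?_⟩ <;> exact brk_ne_zero h0 h1 (by norm_num)

theorem one_sub_curveX {t : ℂ} (h0 : t ≠ 0) (h1 : ‖t‖ < 1) :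
    1 - curveX t = brk t 1 * brk t 4 ^ 2 / (brk t 2 ^ 2 * brk t 5) := by
  obtain ⟨b1, b2, b3, b4, b5⟩ := brk_ne_zero_aux h0 h1
  rw [curveX]
  field_simp
  linear_combination -brk_relation_one h0 h1

theorem one_add_curveY {t : ℂ} (h0 : t ≠ 0) (h1 : ‖t‖ < 1) :
    1 + curveY t = brk t 1 ^ 2 * brk t 3 / (brk t 2 ^ 2 * brk t 5) := by
  obtain ⟨b1, b2, b3, b4, b5⟩ := brk_ne_zero_aux h0 h1
  rw [curveY]
  field_simp
  linear_combination -brk_relation_two h0 h1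

theorem curve_equation {t : ℂ} (h0 : t ≠ 0) (h1 : ‖t‖ < 1) :
    curveY t ^ 2 + (curveX t ^ 2 + 1) * curveY t + curveX t = 0 := by
  have h : curveY t * (1 + curveY t) = -(curveX t * (1 + curveX t * curveY t)) := by
    obtain ⟨b1, b2, b3, b4, b5⟩ := brk_ne_zero_aux h0 h1
    rw [one_add_curveY h0 h1, curveX, curveY]
    field_simp
    linear_combination -brk_relation_three h0 h1
  linear_combination h

theorem curve_units_ne_zero {t : ℂ} (h0 : t ≠ 0) (h1 : ‖t‖ < 1) :
    curveX t ≠ 0 ∧ curveY t ≠ 0 ∧ thetaRatio t ≠ 0 ∧ 1 - curveX t ≠ 0 ∧ 1 + curveY t ≠ 0 := by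
  rw [one_sub_curveX h0 h1, one_add_curveY h0 h1, curveX, curveY, thetaRatio, neg_ne_zero]
  obtain ⟨b1, b2, b3, b4, b5⟩ := brk_ne_zero_aux h0 h1
  exact ⟨div_ne_zero (pow_ne_zero _ b1) (mul_ne_zero b2 b3), div_ne_zero (mul_ne_zero (mul_ne_zero b1 b3) b5)
    (mul_ne_zero (pow_ne_zero _ b2) b4), div_ne_zero b2 b1, div_ne_zero (mul_ne_zero b1 (pow_ne_zero _ b4))
    (mul_ne_zero (pow_ne_zero _ b2) b5), div_ne_zero (mul_ne_zero (pow_ne_zero _ b1) b3)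
    (mul_ne_zero (pow_ne_zero _ b2) b5)⟩

theorem thetaRatio_pow_eleven {t : ℂ} (h0 : t ≠ 0) (h1 : ‖t‖ < 1) :
    thetaRatio t ^ 11 * (curveX t ^ 3 * curveY t ^ 2 * (1 - curveX t) * (1 + curveY t)) = 1 := by
  obtain ⟨b1, b2, b3, b4, b5⟩ := brk_ne_zero_aux h0 h1
  rw [one_sub_curveX h0 h1, one_add_curveY h0 h1, curveX, curveY, thetaRatio]
  field_simp

theorem rankQuot_one {t : ℂ} (h0 : t ≠ 0) (h1 : ‖t‖ < 1) :
    rankQuot t 1 * brk t 1 =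
    -(curveY t * thetaRatio t) - curveX t ^ 2 * curveY t * (1 + curveY t) * thetaRatio t ^ 6 + curveX t ^
      2 * curveY t * (1 - curveX t) * thetaRatio t ^ 7 + curveX t ^ 2 * curveY t * (1 - curveX t) * (1 +
      curveY t) * thetaRatio t ^ 8 := by
  obtain ⟨b1, b2, b3, b4, b5⟩ := brk_ne_zero_aux h0 h1
  rw [rankQuot]
  simp only [one_sub_curveX h0 h1, one_add_curveY h0 h1]
  simp only [curveX, curveY, thetaRatio]
  norm_num [Finset.sum_range_succ, brk_neg h0, brk_zero, brk_six h0, brk_seven h0, brk_eight h0, brk_nine h0,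
    brk_ten h0]
  field_simp
  ring

theorem rankQuot_two {t : ℂ} (h0 : t ≠ 0) (h1 : ‖t‖ < 1) :
    rankQuot t 2 * brk t 1 =
    -(curveX t * thetaRatio t) - curveX t ^ 2 * curveY t * thetaRatio t ^ 3 + curveX t * curveY t * (1 -
      curveX t) * (1 + curveY t) * thetaRatio t ^ 5 + curveX t ^ 2 * curveY t ^ 2 * (1 - curveX t) * (1 +
      curveY t) * thetaRatio t ^ 9 := by
  obtain ⟨b1, b2, b3, b4, b5⟩ := brk_ne_zero_aux h0 h1
  rw [rankQuot]
  simp only [one_sub_curveX h0 h1, one_add_curveY h0 h1]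
  simp only [curveX, curveY, thetaRatio]
  norm_num [Finset.sum_range_succ, brk_neg h0, brk_zero, brk_six h0, brk_seven h0, brk_eight h0, brk_nine h0,
    brk_ten h0]
  field_simp
  ring

theorem rankQuot_three {t : ℂ} (h0 : t ≠ 0) (h1 : ‖t‖ < 1) :
    rankQuot t 3 * brk t 1 =
    -(1) + curveX t ^ 3 * curveY t * (1 + curveY t) * thetaRatio t ^ 7 + curveX t ^ 4 * curveY t ^ 2 * (1
      - curveX t) * thetaRatio t ^ 9 - curveX t ^ 3 * curveY t * (1 - curveX t) * (1 + curveY t) *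
      thetaRatio t ^ 10 := by
  obtain ⟨b1, b2, b3, b4, b5⟩ := brk_ne_zero_aux h0 h1
  rw [rankQuot]
  simp only [one_sub_curveX h0 h1, one_add_curveY h0 h1]
  simp only [curveX, curveY, thetaRatio]
  norm_num [Finset.sum_range_succ, brk_neg h0, brk_zero, brk_six h0, brk_seven h0, brk_eight h0, brk_nine h0,
    brk_ten h0]
  field_simp
  ring

theorem rankQuot_four {t : ℂ} (h0 : t ≠ 0) (h1 : ‖t‖ < 1) :
    rankQuot t 4 * brk t 1 =
    curveX t * (1 + curveY t) / (curveY t * (1 - curveX t)) - curveX t * curveY t * thetaRatio t ^ 2 +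
      curveX t * (1 + curveY t) * thetaRatio t ^ 3 - curveX t ^ 2 * curveY t ^ 2 * (1 + curveY t) *
      thetaRatio t ^ 8 := by
  obtain ⟨b1, b2, b3, b4, b5⟩ := brk_ne_zero_aux h0 h1
  rw [rankQuot]
  simp only [one_sub_curveX h0 h1, one_add_curveY h0 h1]
  simp only [curveX, curveY, thetaRatio]
  norm_num [Finset.sum_range_succ, brk_neg h0, brk_zero, brk_six h0, brk_seven h0, brk_eight h0, brk_nine h0,
    brk_ten h0]
  field_simp
  ring

theorem rankQuot_five {t : ℂ} (h0 : t ≠ 0) (h1 : ‖t‖ < 1) :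
    rankQuot t 5 * brk t 1 =
    curveX t * (1 + curveY t) ^ 2 * thetaRatio t ^ 2 / (curveY t * (1 - curveX t)) + curveX t ^ 2 * (1 +
      curveY t) * thetaRatio t ^ 5 - curveX t * curveY t * (1 - curveX t) * (1 + curveY t) * thetaRatio t
      ^ 6 - curveX t ^ 3 * curveY t ^ 2 * (1 - curveX t) * (1 + curveY t) * thetaRatio t ^ 10 := by
  obtain ⟨b1, b2, b3, b4, b5⟩ := brk_ne_zero_aux h0 h1
  rw [rankQuot]
  simp only [one_sub_curveX h0 h1, one_add_curveY h0 h1]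
  simp only [curveX, curveY, thetaRatio]
  norm_num [Finset.sum_range_succ, brk_neg h0, brk_zero, brk_six h0, brk_seven h0, brk_eight h0, brk_nine h0,
    brk_ten h0]
  field_simp
  ring

theorem crankQuot_three {t : ℂ} (h0 : t ≠ 0) (h1 : ‖t‖ < 1) :
    crankQuot t 3 * brk t 1 =
    curveX t * thetaRatio t + curveX t * (1 + curveY t) * thetaRatio t ^ 2 + curveX t * curveY t * (1 +
      curveY t) * thetaRatio t ^ 5 - curveX t * curveY t * (1 - curveX t) * (1 + curveY t) * thetaRatio t
      ^ 6 - curveX t ^ 2 * curveY t ^ 2 * (1 + curveY t) ^ 2 * thetaRatio t ^ 10 := by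
  obtain ⟨b1, b2, b3, b4, b5⟩ := brk_ne_zero_aux h0 h1
  rw [crankQuot]
  simp only [one_sub_curveX h0 h1, one_add_curveY h0 h1]
  simp only [curveX, curveY, thetaRatio]
  norm_num [Finset.sum_range_succ, brk_neg h0, brk_zero, brk_six h0, brk_seven h0, brk_eight h0, brk_nine h0,
    brk_ten h0]
  field_simp
  ring

theorem crankQuot_four {t : ℂ} (h0 : t ≠ 0) (h1 : ‖t‖ < 1) :
    crankQuot t 4 * brk t 1 =
    (1 - curveX t) - curveX t ^ 2 * curveY t * (1 + curveY t) * thetaRatio t ^ 6 - curveX t ^ 2 * curveY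
      t * (1 - curveX t) * (1 + curveY t) * thetaRatio t ^ 7 - curveX t ^ 3 * curveY t ^ 2 * (1 - curveX
      t) * thetaRatio t ^ 9 + curveX t ^ 3 * curveY t * (1 - curveX t) * (1 + curveY t) * thetaRatio t ^
      10 := by
  obtain ⟨b1, b2, b3, b4, b5⟩ := brk_ne_zero_aux h0 h1
  rw [crankQuot]
  simp only [one_sub_curveX h0 h1, one_add_curveY h0 h1]
  simp only [curveX, curveY, thetaRatio]
  norm_num [Finset.sum_range_succ, brk_neg h0, brk_zero, brk_six h0, brk_seven h0, brk_eight h0, brk_nine h0,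
    brk_ten h0]
  field_simp
  ring

theorem crankQuot_five {t : ℂ} (h0 : t ≠ 0) (h1 : ‖t‖ < 1) :
    crankQuot t 5 * brk t 1 =
    -(curveY t * thetaRatio t) + curveX t * (1 + curveY t) * thetaRatio t ^ 3 - curveX t ^ 3 * curveY t ^
      2 * (1 - curveX t) * thetaRatio t ^ 6 / (1 + curveY t) + curveX t ^ 2 * curveY t * (1 + curveY t) *
      thetaRatio t ^ 7 + curveX t ^ 3 * curveY t ^ 2 * (1 - curveX t) * thetaRatio t ^ 8 := by
  obtain ⟨b1, b2, b3, b4, b5⟩ := brk_ne_zero_aux h0 h1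
  rw [crankQuot]
  simp only [one_sub_curveX h0 h1, one_add_curveY h0 h1]
  simp only [curveX, curveY, thetaRatio]
  norm_num [Finset.sum_range_succ, brk_neg h0, brk_zero, brk_six h0, brk_seven h0, brk_eight h0, brk_nine h0,
    brk_ten h0]
  field_simp
  ring

theorem eulerRatio_eq_thetaRatio {t : ℂ} (h0 : t ≠ 0) (h1 : ‖t‖ < 1) :
    eulerRatio t =
    1 - thetaRatio t - curveX t * (1 + curveY t) * thetaRatio t ^ 3 - curveX t * curveY t * (1 - curveX
      t) * thetaRatio t ^ 4 - curveX t * curveY t * (1 + curveY t) * thetaRatio t ^ 5 - curveX t ^ 3 *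
      curveY t ^ 2 * (1 - curveX t) * thetaRatio t ^ 9 := by
  obtain ⟨b1, b2, b3, b4, b5⟩ := brk_ne_zero_aux h0 h1
  rw [eulerRatio_eq h0]
  simp only [one_sub_curveX h0 h1, one_add_curveY h0 h1]
  simp only [curveX, curveY, thetaRatio]
  field_simp
  ring

/-- The polynomial on the curve `y ^ 2 + (x ^ 2 + 1) * y + x = 0` whose fifth power is divisible by
`eulerRatio`. -/
def curveDisc (x y : ℂ) : ℂ := 1 + 4 * x - x ^ 2 + 2 * y + x * y

set_option maxHeartbeats 4000000 in
/-- The coefficients of the cofactor of `eulerRatio` in the fifth power of `curveDisc`, as a polynomial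
in `thetaRatio`. -/
def invCoeff (x y : ℂ) : ℕ → ℂ
  | 0 => y * (1 + y) *
      (11 - 187 * x + 759 * x ^ 2 - 1650 * x ^ 3 + 2277 * x ^ 4 - 2046 * x ^ 5 + 902 * x ^ 6 - 330 * x ^ 7 + 44
      * x ^ 8 + 99 * x ^ 9 + 11 * x ^ 10 - 242 * x * y + 726 * x ^ 2 * y - 726 * x ^ 3 * y + 121 * x ^ 4 * y +
      242 * x ^ 5 * y - 484 * x ^ 6 * y + 242 * x ^ 7 * y)
  | 1 => y * (1 + y) *
      (-1 + 64 * x - 504 * x ^ 2 + 1325 * x ^ 3 - 1719 * x ^ 4 + 1176 * x ^ 5 - 586 * x ^ 6 + 294 * x ^ 7 - 17 *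
      x ^ 8 - 94 * x ^ 9 - 22 * x ^ 10 - 3 * y + 6 * x * y - 360 * x ^ 2 * y + 1136 * x ^ 3 * y - 1521 * x ^ 4 *
      y + 1343 * x ^ 5 * y - 873 * x ^ 6 * y + 333 * x ^ 7 * y - 155 * x ^ 8 * y + 7 * x ^ 9 * y)
  | 2 => x * y * (1 + y) *
      (-15 + 190 * x - 927 * x ^ 2 + 1835 * x ^ 3 - 1992 * x ^ 4 + 1668 * x ^ 5 - 1112 * x ^ 6 + 241 * x ^ 7 +
      31 * x ^ 8 + 42 * x ^ 9 - 45 * y + 178 * x * y - 571 * x ^ 2 * y + 749 * x ^ 3 * y + 186 * x ^ 4 * y -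
      1041 * x ^ 5 * y + 809 * x ^ 6 * y - 406 * x ^ 7 * y + 106 * x ^ 8 * y - 5 * x ^ 9 * y)
  | 3 => y * (1 + y) ^ 2 *
      (-5 * x - 168 * x ^ 2 + 606 * x ^ 3 - 1201 * x ^ 4 + 1655 * x ^ 5 - 1251 * x ^ 6 + 776 * x ^ 7 - 166 * x ^
      8 - 70 * x ^ 9 - 59 * x ^ 10 - x ^ 11 - 7 * y - 82 * x * y + 163 * x ^ 2 * y - 18 * x ^ 3 * y + 22 * x ^ 4
      * y - 323 * x ^ 5 * y + 805 * x ^ 6 * y - 452 * x ^ 7 * y + 34 * x ^ 8 * y - 4 * x ^ 9 * y)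
  | 4 => x * y ^ 2 * (1 - x) *
      (-22 + 270 * x - 1231 * x ^ 2 + 2485 * x ^ 3 - 2780 * x ^ 4 + 2009 * x ^ 5 - 1017 * x ^ 6 + 436 * x ^ 7 -
      114 * x ^ 8 + 80 * x ^ 9 + 3 * x ^ 10 - 22 * y + 249 * x * y - 927 * x ^ 2 * y + 1434 * x ^ 3 * y - 942 *
      x ^ 4 * y - 180 * x ^ 5 * y + 610 * x ^ 6 * y - 339 * x ^ 7 * y + 312 * x ^ 8 * y - 71 * x ^ 9 * y + 2 * x
      ^ 10 * y)
  | 5 => x * y * (1 + y) ^ 2 *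
      (-25 * x + 49 * x ^ 2 - 434 * x ^ 3 + 1357 * x ^ 4 - 1989 * x ^ 5 + 1559 * x ^ 6 - 449 * x ^ 7 + 112 * x ^
      8 - 106 * x ^ 9 - 7 * x ^ 10 - 22 * y - 31 * x * y + 194 * x ^ 2 * y - 145 * x ^ 3 * y - 563 * x ^ 4 * y +
      1333 * x ^ 5 * y - 1262 * x ^ 6 * y + 824 * x ^ 7 * y - 321 * x ^ 8 * y + 63 * x ^ 9 * y - x ^ 10 * y)
  | 6 => x ^ 2 * y ^ 2 * (1 + y) * (1 - x) *
      (30 - 292 * x + 1106 * x ^ 2 - 1789 * x ^ 3 + 1311 * x ^ 4 - 553 * x ^ 5 + 2 * x ^ 6 - 64 * x ^ 7 + 114 *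
      x ^ 8 + 15 * x ^ 9 + 35 * y - 191 * x * y + 746 * x ^ 2 * y - 1124 * x ^ 3 * y + 783 * x ^ 4 * y - 745 * x
      ^ 5 * y + 571 * x ^ 6 * y - 277 * x ^ 7 * y + 41 * x ^ 8 * y - x ^ 9 * y)
  | 7 => x ^ 2 * y ^ 2 * (1 + y) * (1 - x) *
      (-5 + 122 * x - 639 * x ^ 2 + 1565 * x ^ 3 - 2006 * x ^ 4 + 1414 * x ^ 5 - 708 * x ^ 6 + 271 * x ^ 7 - 129
      * x ^ 8 - 30 * x ^ 9 - 4 * y + 151 * x * y - 458 * x ^ 2 * y + 543 * x ^ 3 * y - 26 * x ^ 4 * y - 501 * x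
      ^ 5 * y + 618 * x ^ 6 * y - 645 * x ^ 7 * y + 204 * x ^ 8 * y - 42 * x ^ 9 * y)
  | 8 => x ^ 3 * y ^ 2 * (1 + y) * (1 - x) *
      (-42 + 345 * x - 1049 * x ^ 2 + 1596 * x ^ 3 - 984 * x ^ 4 - 53 * x ^ 5 + 94 * x ^ 6 - 71 * x ^ 7 + 67 * x
      ^ 8 + x ^ 9 - 27 * y + 373 * x * y - 1051 * x ^ 2 * y + 1336 * x ^ 3 * y - 929 * x ^ 4 * y + 768 * x ^ 5 *
      y - 916 * x ^ 6 * y + 522 * x ^ 7 * y - 207 * x ^ 8 * y + 30 * x ^ 9 * y)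
  | 9 => x ^ 3 * y ^ 2 * (1 + y) * (1 - x) *
      (7 - 151 * x + 789 * x ^ 2 - 1597 * x ^ 3 + 1693 * x ^ 4 - 1104 * x ^ 5 + 802 * x ^ 6 - 595 * x ^ 7 + 119
      * x ^ 8 - 24 * x ^ 9 + 10 * y - 75 * x * y + 452 * x ^ 2 * y - 692 * x ^ 3 * y - 23 * x ^ 4 * y + 1214 * x
      ^ 5 * y - 1259 * x ^ 6 * y + 727 * x ^ 7 * y - 576 * x ^ 8 * y + 182 * x ^ 9 * y - 22 * x ^ 10 * y)
  | 10 => x ^ 3 * y ^ 2 * (1 + y) ^ 2 * (1 - x) *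
      (-1 + 86 * x - 383 * x ^ 2 + 1006 * x ^ 3 - 1422 * x ^ 4 + 1242 * x ^ 5 - 696 * x ^ 6 + 239 * x ^ 7 + 71 *
      x ^ 8 + 5 * x ^ 9 + 41 * y - 5 * x * y - 151 * x ^ 2 * y - 19 * x ^ 3 * y + 503 * x ^ 4 * y - 956 * x ^ 5
      * y + 1074 * x ^ 6 * y - 470 * x ^ 7 * y + 175 * x ^ 8 * y - 15 * x ^ 9 * y)
  | _ => 0

set_option maxHeartbeats 4000000 in
theorem invCoeff_mul_zero {x y : ℂ} (hC : y ^ 2 + (x ^ 2 + 1) * y + x = 0) :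
    (invCoeff x y 0) * (x ^ 3 * y ^ 2 * (1 - x) * (1 + y)) + (-(invCoeff x y 10) - x * (1 + y) * invCoeff x y 8
    - x * y * (1 - x) * invCoeff x y 7 - x * y * (1 + y) * invCoeff x y 6 - x ^ 3 * y ^ 2 * (1 - x) * invCoeff x
    y 2) = curveDisc x y ^ 5 * (x ^ 3 * y ^ 2 * (1 - x) * (1 + y)) := by
  simp only [invCoeff, curveDisc]
  linear_combination (x ^ 3 * y ^ 2 * (1 - x) * (1 + y)) * (-64 - 117 * x - 517 * x ^ 2 - 984 * x ^ 3 - 122 *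
    x ^ 4 + 1559 * x ^ 5 - 893 * x ^ 6 + 155 * x ^ 7 - 92 * x ^ 8 - 67 * y - 379 * x * y - 1464 * x ^ 2 * y -
    412 * x ^ 3 * y - 139 * x ^ 4 * y + 1396 * x ^ 5 * y - 1094 * x ^ 6 * y + 447 * x ^ 7 * y - 56 * x ^ 8 * y -
    48 * y ^ 2 - 400 * x * y ^ 2 - 568 * x ^ 2 * y ^ 2 - 240 * x ^ 3 * y ^ 2 + 45 * x ^ 4 * y ^ 2 + 61 * x ^ 5 *
    y ^ 2 + 15 * x ^ 6 * y ^ 2 + x ^ 7 * y ^ 2 - 32 * y ^ 3 - 80 * x * y ^ 3 - 80 * x ^ 2 * y ^ 3 - 40 * x ^ 3 *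
    y ^ 3 - 10 * x ^ 4 * y ^ 3 - x ^ 5 * y ^ 3) * hC

set_option maxHeartbeats 4000000 in
theorem invCoeff_mul_one {x y : ℂ} (hC : y ^ 2 + (x ^ 2 + 1) * y + x = 0) :
    (invCoeff x y 1 - invCoeff x y 0) * (x ^ 3 * y ^ 2 * (1 - x) * (1 + y)) + (-(x * (1 + y) * invCoeff x y 9) -
    x * y * (1 - x) * invCoeff x y 8 - x * y * (1 + y) * invCoeff x y 7 - x ^ 3 * y ^ 2 * (1 - x) * invCoeff x y
    3) = 0 := by
  simp only [invCoeff]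
  linear_combination (x ^ 3 * y ^ 2 * (1 - x) * (1 + y)) * (-7 + 151 * x - 789 * x ^ 2 + 1597 * x ^ 3 - 1693 *
    x ^ 4 + 1104 * x ^ 5 - 802 * x ^ 6 + 595 * x ^ 7 - 119 * x ^ 8 + 24 * x ^ 9 + 8 * y + 179 * x * y - 791 * x
    ^ 2 * y + 1337 * x ^ 3 * y - 1638 * x ^ 4 * y + 1925 * x ^ 5 * y - 1812 * x ^ 6 * y + 1188 * x ^ 7 * y - 393
    * x ^ 8 * y + 53 * x ^ 9 * y) * hC

set_option maxHeartbeats 4000000 in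
theorem invCoeff_mul_two {x y : ℂ} (hC : y ^ 2 + (x ^ 2 + 1) * y + x = 0) :
    (invCoeff x y 2 - invCoeff x y 1) * (x ^ 3 * y ^ 2 * (1 - x) * (1 + y)) + (-(x * (1 + y) * invCoeff x y 10)
    - x * y * (1 - x) * invCoeff x y 9 - x * y * (1 + y) * invCoeff x y 8 - x ^ 3 * y ^ 2 * (1 - x) * invCoeff x
    y 4) = 0 := by
  simp only [invCoeff]
  linear_combination (x ^ 3 * y ^ 2 * (1 - x)) * (1 - 86 * x + 383 * x ^ 2 - 1006 * x ^ 3 + 1422 * x ^ 4 -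
    1242 * x ^ 5 + 696 * x ^ 6 - 239 * x ^ 7 - 71 * x ^ 8 - 5 * x ^ 9 + 4 * y - 130 * x * y + 249 * x ^ 2 * y -
    460 * x ^ 3 * y + 537 * x ^ 4 * y + 216 * x ^ 5 * y - 911 * x ^ 6 * y + 854 * x ^ 7 * y - 800 * x ^ 8 * y +
    277 * x ^ 9 * y - 19 * x ^ 10 * y + 3 * y ^ 2 - 65 * x * y ^ 2 + 170 * x ^ 2 * y ^ 2 - 505 * x ^ 3 * y ^ 2 +
    953 * x ^ 4 * y ^ 2 - 731 * x ^ 5 * y ^ 2 + 20 * x ^ 6 * y ^ 2 + 318 * x ^ 7 * y ^ 2 - 303 * x ^ 8 * y ^ 2 +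
    131 * x ^ 9 * y ^ 2 - 20 * x ^ 10 * y ^ 2) * hC

set_option maxHeartbeats 4000000 in
theorem invCoeff_mul_three {x y : ℂ} (hC : y ^ 2 + (x ^ 2 + 1) * y + x = 0) :
    (invCoeff x y 3 - invCoeff x y 2 - x * (1 + y) * invCoeff x y 0) * (x ^ 3 * y ^ 2 * (1 - x) * (1 + y)) +
    (-(x * y * (1 - x) * invCoeff x y 10) - x * y * (1 + y) * invCoeff x y 9 - x ^ 3 * y ^ 2 * (1 - x) *
    invCoeff x y 5) = 0 := by
  simp only [invCoeff]
  linear_combination (x ^ 3 * y ^ 2 * (1 - x) * (1 + y)) * (-7 * y - 82 * x * y + 405 * x ^ 2 * y - 744 * x ^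
    3 * y + 748 * x ^ 4 * y - 444 * x ^ 5 * y + 563 * x ^ 6 * y + 32 * x ^ 7 * y - 208 * x ^ 8 * y - 4 * x ^ 9 *
    y - 7 * y ^ 2 - 82 * x * y ^ 2 + 405 * x ^ 2 * y ^ 2 - 744 * x ^ 3 * y ^ 2 + 748 * x ^ 4 * y ^ 2 - 444 * x ^
    5 * y ^ 2 + 563 * x ^ 6 * y ^ 2 + 32 * x ^ 7 * y ^ 2 - 208 * x ^ 8 * y ^ 2 - 4 * x ^ 9 * y ^ 2) * hC

set_option maxHeartbeats 4000000 in
theorem invCoeff_mul_four {x y : ℂ} (hC : y ^ 2 + (x ^ 2 + 1) * y + x = 0) :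
    (invCoeff x y 4 - invCoeff x y 3 - x * (1 + y) * invCoeff x y 1 - x * y * (1 - x) * invCoeff x y 0) * (x ^ 3
    * y ^ 2 * (1 - x) * (1 + y)) + (-(x * y * (1 + y) * invCoeff x y 10) - x ^ 3 * y ^ 2 * (1 - x) * invCoeff x
    y 6) = 0 := by
  simp only [invCoeff]
  linear_combination (x ^ 3 * y ^ 2 * (1 - x) * (1 + y)) * (7 * y + 18 * x * y + 281 * x ^ 2 * y - 1130 * x ^
    3 * y + 1486 * x ^ 4 * y - 1167 * x ^ 5 * y + 506 * x ^ 6 * y - 367 * x ^ 7 * y + 16 * x ^ 8 * y + 148 * x ^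
    9 * y + 23 * x ^ 10 * y + 7 * y ^ 2 + 44 * x * y ^ 2 + 78 * x ^ 2 * y ^ 2 - 439 * x ^ 3 * y ^ 2 + 313 * x ^
    4 * y ^ 2 + 494 * x ^ 5 * y ^ 2 - 1313 * x ^ 6 * y ^ 2 + 977 * x ^ 7 * y ^ 2 - 623 * x ^ 8 * y ^ 2 + 226 * x
    ^ 9 * y ^ 2 + 8 * x ^ 10 * y ^ 2) * hC

set_option maxHeartbeats 4000000 in
theorem invCoeff_mul_five {x y : ℂ} (hC : y ^ 2 + (x ^ 2 + 1) * y + x = 0) :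
    (invCoeff x y 5 - invCoeff x y 4 - x * (1 + y) * invCoeff x y 2 - x * y * (1 - x) * invCoeff x y 1 - x * y *
    (1 + y) * invCoeff x y 0) * (x ^ 3 * y ^ 2 * (1 - x) * (1 + y)) + (-(x ^ 3 * y ^ 2 * (1 - x) * invCoeff x y
    7)) = 0 := by
  simp only [invCoeff]
  linear_combination (x ^ 3 * y ^ 2 * (1 - x) * (1 + y)) * (-10 * x * y - 141 * x ^ 2 * y + 493 * x ^ 3 * y -
    478 * x ^ 4 * y + 3 * x ^ 5 * y - 109 * x ^ 6 * y + 663 * x ^ 7 * y - 129 * x ^ 8 * y - 137 * x ^ 9 * y - 49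
    * x ^ 10 * y - 30 * x * y ^ 2 + 434 * x ^ 2 * y ^ 2 - 1103 * x ^ 3 * y ^ 2 + 1064 * x ^ 4 * y ^ 2 - 327 * x
    ^ 5 * y ^ 2 - 639 * x ^ 6 * y ^ 2 + 1698 * x ^ 7 * y ^ 2 - 861 * x ^ 8 * y ^ 2 + 45 * x ^ 9 * y ^ 2 - 62 * x
    ^ 10 * y ^ 2 + 242 * x ^ 2 * y ^ 3 - 726 * x ^ 3 * y ^ 3 + 726 * x ^ 4 * y ^ 3 - 121 * x ^ 5 * y ^ 3 - 242 *
    x ^ 6 * y ^ 3 + 484 * x ^ 7 * y ^ 3 - 242 * x ^ 8 * y ^ 3) * hC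

set_option maxHeartbeats 4000000 in
theorem invCoeff_mul_six {x y : ℂ} (hC : y ^ 2 + (x ^ 2 + 1) * y + x = 0) :
    (invCoeff x y 6 - invCoeff x y 5 - x * (1 + y) * invCoeff x y 3 - x * y * (1 - x) * invCoeff x y 2 - x * y *
    (1 + y) * invCoeff x y 1) * (x ^ 3 * y ^ 2 * (1 - x) * (1 + y)) + (-(x ^ 3 * y ^ 2 * (1 - x) * invCoeff x y
    8)) = 0 := by
  simp only [invCoeff]
  linear_combination (x ^ 3 * y ^ 2 * (1 - x) * (1 + y)) * (30 * x * y + 119 * x ^ 2 * y - 172 * x ^ 3 * y -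
    156 * x ^ 4 * y + 334 * x ^ 5 * y - 308 * x ^ 6 * y - 327 * x ^ 7 * y + 54 * x ^ 8 * y + 176 * x ^ 9 * y +
    66 * x ^ 10 * y + x ^ 11 * y + 40 * x * y ^ 2 + 210 * x ^ 2 * y ^ 2 + 53 * x ^ 3 * y ^ 2 - 1276 * x ^ 4 * y
    ^ 2 + 1573 * x ^ 5 * y ^ 2 - 1273 * x ^ 6 * y ^ 2 + 562 * x ^ 7 * y ^ 2 - 837 * x ^ 8 * y ^ 2 + 890 * x ^ 9
    * y ^ 2 - 211 * x ^ 10 * y ^ 2 + 30 * x ^ 11 * y ^ 2 + 10 * x * y ^ 3 + 76 * x ^ 2 * y ^ 3 + 197 * x ^ 3 * y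
    ^ 3 - 1118 * x ^ 4 * y ^ 3 + 1499 * x ^ 5 * y ^ 3 - 1020 * x ^ 6 * y ^ 3 + 68 * x ^ 7 * y ^ 3 + 119 * x ^ 8
    * y ^ 3 + 121 * x ^ 9 * y ^ 3 - 3 * x ^ 10 * y ^ 3) * hC

set_option maxHeartbeats 4000000 in
theorem invCoeff_mul_seven {x y : ℂ} (hC : y ^ 2 + (x ^ 2 + 1) * y + x = 0) :
    (invCoeff x y 7 - invCoeff x y 6 - x * (1 + y) * invCoeff x y 4 - x * y * (1 - x) * invCoeff x y 3 - x * y *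
    (1 + y) * invCoeff x y 2) * (x ^ 3 * y ^ 2 * (1 - x) * (1 + y)) + (-(x ^ 3 * y ^ 2 * (1 - x) * invCoeff x y
    9)) = 0 := by
  simp only [invCoeff]
  linear_combination (x ^ 3 * y ^ 2 * (1 - x) * (1 + y)) * (7 * x * y ^ 2 + 123 * x ^ 2 * y ^ 2 - 347 * x ^ 3
    * y ^ 2 + 415 * x ^ 4 * y ^ 2 + 116 * x ^ 5 * y ^ 2 - 1557 * x ^ 6 * y ^ 2 + 2231 * x ^ 7 * y ^ 2 - 1613 * x
    ^ 8 * y ^ 2 + 1242 * x ^ 9 * y ^ 2 - 763 * x ^ 10 * y ^ 2 + 207 * x ^ 11 * y ^ 2 - 22 * x ^ 12 * y ^ 2 + 7 *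
    x * y ^ 3 + 120 * x ^ 2 * y ^ 3 - 423 * x ^ 3 * y ^ 3 + 752 * x ^ 4 * y ^ 3 - 789 * x ^ 5 * y ^ 3 + 159 * x
    ^ 6 * y ^ 3 - 87 * x ^ 7 * y ^ 3 + 448 * x ^ 8 * y ^ 3 - 80 * x ^ 9 * y ^ 3 - 68 * x ^ 10 * y ^ 3 + x ^ 11 *
    y ^ 3) * hC

set_option maxHeartbeats 4000000 in
theorem invCoeff_mul_eight {x y : ℂ} (hC : y ^ 2 + (x ^ 2 + 1) * y + x = 0) :
    (invCoeff x y 8 - invCoeff x y 7 - x * (1 + y) * invCoeff x y 5 - x * y * (1 - x) * invCoeff x y 4 - x * y *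
    (1 + y) * invCoeff x y 3) * (x ^ 3 * y ^ 2 * (1 - x) * (1 + y)) + (-(x ^ 3 * y ^ 2 * (1 - x) * invCoeff x y
    10)) = 0 := by
  simp only [invCoeff]
  linear_combination (x ^ 3 * y ^ 2 * (1 - x) * (1 + y)) * (25 * x ^ 2 * y - 49 * x ^ 3 * y + 434 * x ^ 4 * y
    - 1357 * x ^ 5 * y + 1989 * x ^ 6 * y - 1559 * x ^ 7 * y + 449 * x ^ 8 * y - 112 * x ^ 9 * y + 106 * x ^ 10
    * y + 7 * x ^ 11 * y + 7 * x * y ^ 2 + 155 * x ^ 2 * y ^ 2 - 345 * x ^ 3 * y ^ 2 + 925 * x ^ 4 * y ^ 2 -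
    2759 * x ^ 5 * y ^ 2 + 5229 * x ^ 6 * y ^ 2 - 6240 * x ^ 7 * y ^ 2 + 3466 * x ^ 8 * y ^ 2 - 1200 * x ^ 9 * y
    ^ 2 + 626 * x ^ 10 * y ^ 2 - 113 * x ^ 11 * y ^ 2 - 3 * x ^ 12 * y ^ 2 + 14 * x * y ^ 3 + 191 * x ^ 2 * y ^
    3 - 134 * x ^ 3 * y ^ 3 - 846 * x ^ 4 * y ^ 3 + 1465 * x ^ 5 * y ^ 3 - 464 * x ^ 6 * y ^ 3 - 1670 * x ^ 7 *
    y ^ 3 + 1067 * x ^ 8 * y ^ 3 + 79 * x ^ 9 * y ^ 3 - 53 * x ^ 10 * y ^ 3 + 30 * x ^ 11 * y ^ 3 - 2 * x ^ 12 *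
    y ^ 3 + 7 * x * y ^ 4 + 82 * x ^ 2 * y ^ 4 - 163 * x ^ 3 * y ^ 4 + 18 * x ^ 4 * y ^ 4 - 22 * x ^ 5 * y ^ 4 +
    323 * x ^ 6 * y ^ 4 - 805 * x ^ 7 * y ^ 4 + 452 * x ^ 8 * y ^ 4 - 34 * x ^ 9 * y ^ 4 + 4 * x ^ 10 * y ^ 4) *
    hC

set_option maxHeartbeats 4000000 in
theorem invCoeff_mul_nine {x y : ℂ} (hC : y ^ 2 + (x ^ 2 + 1) * y + x = 0) :
    (invCoeff x y 9 - invCoeff x y 8 - x * (1 + y) * invCoeff x y 6 - x * y * (1 - x) * invCoeff x y 5 - x * y *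
    (1 + y) * invCoeff x y 4 - x ^ 3 * y ^ 2 * (1 - x) * invCoeff x y 0) * (x ^ 3 * y ^ 2 * (1 - x) * (1 + y)) = 0 := by
  simp only [invCoeff]
  linear_combination (x ^ 3 * y ^ 2 * (1 - x) * (1 + y)) * (44 * x ^ 2 * y ^ 2 - 297 * x ^ 3 * y ^ 2 + 1419 *
    x ^ 4 * y ^ 2 - 3927 * x ^ 5 * y ^ 2 + 6116 * x ^ 6 * y ^ 2 - 5412 * x ^ 7 * y ^ 2 + 3212 * x ^ 8 * y ^ 2 -
    1727 * x ^ 9 * y ^ 2 + 616 * x ^ 10 * y ^ 2 - 77 * x ^ 11 * y ^ 2 + 33 * x ^ 12 * y ^ 2 + 44 * x ^ 2 * y ^ 3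
    - 297 * x ^ 3 * y ^ 3 + 1419 * x ^ 4 * y ^ 3 - 3927 * x ^ 5 * y ^ 3 + 6116 * x ^ 6 * y ^ 3 - 5412 * x ^ 7 *
    y ^ 3 + 3212 * x ^ 8 * y ^ 3 - 1727 * x ^ 9 * y ^ 3 + 616 * x ^ 10 * y ^ 3 - 77 * x ^ 11 * y ^ 3 + 33 * x ^
    12 * y ^ 3) * hC

set_option maxHeartbeats 4000000 in
theorem invCoeff_mul_ten {x y : ℂ} (hC : y ^ 2 + (x ^ 2 + 1) * y + x = 0) :
    (invCoeff x y 10 - invCoeff x y 9 - x * (1 + y) * invCoeff x y 7 - x * y * (1 - x) * invCoeff x y 6 - x * y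
    * (1 + y) * invCoeff x y 5 - x ^ 3 * y ^ 2 * (1 - x) * invCoeff x y 1) * (x ^ 3 * y ^ 2 * (1 - x) * (1 + y)) = 0 := by
  simp only [invCoeff]
  linear_combination (x ^ 3 * y ^ 2 * (1 - x) * (1 + y)) * (22 * x ^ 2 * y ^ 2 + 69 * x ^ 3 * y ^ 2 - 214 * x
    ^ 4 * y ^ 2 + 214 * x ^ 5 * y ^ 2 - 158 * x ^ 6 * y ^ 2 + 482 * x ^ 7 * y ^ 2 - 1273 * x ^ 8 * y ^ 2 + 1241
    * x ^ 9 * y ^ 2 - 376 * x ^ 10 * y ^ 2 - 15 * x ^ 11 * y ^ 2 - 59 * x ^ 12 * y ^ 2 + 44 * x ^ 2 * y ^ 3 +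
    100 * x ^ 3 * y ^ 3 - 408 * x ^ 4 * y ^ 3 + 359 * x ^ 5 * y ^ 3 + 405 * x ^ 6 * y ^ 3 - 851 * x ^ 7 * y ^ 3
    - 11 * x ^ 8 * y ^ 3 + 417 * x ^ 9 * y ^ 3 - 55 * x ^ 10 * y ^ 3 - 78 * x ^ 11 * y ^ 3 - 58 * x ^ 12 * y ^ 3
    + 22 * x ^ 2 * y ^ 4 + 31 * x ^ 3 * y ^ 4 - 194 * x ^ 4 * y ^ 4 + 145 * x ^ 5 * y ^ 4 + 563 * x ^ 6 * y ^ 4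
    - 1333 * x ^ 7 * y ^ 4 + 1262 * x ^ 8 * y ^ 4 - 824 * x ^ 9 * y ^ 4 + 321 * x ^ 10 * y ^ 4 - 63 * x ^ 11 * y
    ^ 4 + x ^ 12 * y ^ 4) * hC

set_option maxHeartbeats 4000000 in
theorem mul_sum_invCoeff {x y d : ℂ} (hC : y ^ 2 + (x ^ 2 + 1) * y + x = 0)
    (hd : d ^ 11 * (x ^ 3 * y ^ 2 * (1 - x) * (1 + y)) = 1) :
    (1 - d - x * (1 + y) * d ^ 3 - x * y * (1 - x) * d ^ 4 - x * y * (1 + y) * d ^ 5 - x ^ 3 * y ^ 2 * (1 - x) * d ^ 9) *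
      ∑ k ∈ Finset.range 11, invCoeff x y k * d ^ k = curveDisc x y ^ 5 := by
  simp only [Finset.sum_range_succ, Finset.sum_range_zero]
  linear_combination d ^ 11 * invCoeff_mul_zero hC + d ^ 12 * invCoeff_mul_one hC + d ^ 13 * invCoeff_mul_two
    hC + d ^ 14 * invCoeff_mul_three hC + d ^ 15 * invCoeff_mul_four hC + d ^ 16 * invCoeff_mul_five hC + d ^ 17
    * invCoeff_mul_six hC + d ^ 18 * invCoeff_mul_seven hC + d ^ 19 * invCoeff_mul_eight hC + d ^ 20 *
    invCoeff_mul_nine hC + d ^ 21 * invCoeff_mul_ten hC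
     - ((invCoeff x y 0) * d ^ 0 + (invCoeff x y 1 - invCoeff x y 0) * d ^ 1 + (invCoeff x y 2 - invCoeff x y 1)
    * d ^ 2 + (invCoeff x y 3 - invCoeff x y 2 - x * (1 + y) * invCoeff x y 0) * d ^ 3 + (invCoeff x y 4 -
    invCoeff x y 3 - x * (1 + y) * invCoeff x y 1 - x * y * (1 - x) * invCoeff x y 0) * d ^ 4 + (invCoeff x y 5
    - invCoeff x y 4 - x * (1 + y) * invCoeff x y 2 - x * y * (1 - x) * invCoeff x y 1 - x * y * (1 + y) *
    invCoeff x y 0) * d ^ 5 + (invCoeff x y 6 - invCoeff x y 5 - x * (1 + y) * invCoeff x y 3 - x * y * (1 - x)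
    * invCoeff x y 2 - x * y * (1 + y) * invCoeff x y 1) * d ^ 6 + (invCoeff x y 7 - invCoeff x y 6 - x * (1 +
    y) * invCoeff x y 4 - x * y * (1 - x) * invCoeff x y 3 - x * y * (1 + y) * invCoeff x y 2) * d ^ 7 +
    (invCoeff x y 8 - invCoeff x y 7 - x * (1 + y) * invCoeff x y 5 - x * y * (1 - x) * invCoeff x y 4 - x * y *
    (1 + y) * invCoeff x y 3) * d ^ 8 + (invCoeff x y 9 - invCoeff x y 8 - x * (1 + y) * invCoeff x y 6 - x * y
    * (1 - x) * invCoeff x y 5 - x * y * (1 + y) * invCoeff x y 4 - x ^ 3 * y ^ 2 * (1 - x) * invCoeff x y 0) *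
    d ^ 9 + (invCoeff x y 10 - invCoeff x y 9 - x * (1 + y) * invCoeff x y 7 - x * y * (1 - x) * invCoeff x y 6
    - x * y * (1 + y) * invCoeff x y 5 - x ^ 3 * y ^ 2 * (1 - x) * invCoeff x y 1) * d ^ 10 - curveDisc x y ^ 5)
    * hd

/-- The coefficients of `thetaPart` as a polynomial in `thetaRatio`. -/
def thetaCoeff (c : Fin 7 → ℤ) (l : Fin 5 → ℤ) (x y : ℂ) : ℕ → ℂ
  | 0 =>
      ((-c 3 + c 4)) * (y * (1 + y) * (1 - x)) + (c 6) * (y * (1 + y) * (1 - x) ^ 2) + ((c 4 - c 5)) * (x * (1 +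
      y) ^ 2)
  | 1 =>
      ((c 2 - c 3) + 2 * c 6) * (y ^ 2 * (1 + y) * (1 - x)) + (-(-2 * c 0 + c 1) + c 6) * (x * y * (1 + y) * (1
      - x))
  | 2 =>
      (-(c 1 - c 2)) * (x * (1 + y) ^ 3) + (c 6) * (x * y * (1 + y) ^ 2 * (1 - x)) + (-(c 4 - c 5)) * (x * y ^ 2
      * (1 + y) * (1 - x))
  | 3 =>
      ((c 4 - c 5) - 2 * c 6) * (x * y * (1 + y) ^ 2 * (1 - x)) + (-(-2 * c 0 + c 1)) * (x ^ 2 * y ^ 2 * (1 + y)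
      * (1 - x))
  | 4 =>
      (l 3) * (y ^ 2 * (1 + y) ^ 2 * (1 - x)) + (l 4) * (y ^ 2 * (1 + y) ^ 2 * (1 - x) ^ 2) + (-l 0) * (x * y *
      (1 + y) * (1 - x)) + (-l 1) * (x * y * (1 + y) * (1 - x) ^ 2) + (l 2) * (x * y ^ 2 * (1 + y) * (1 - x))
  | 5 =>
      (c 6) * (x * y ^ 2 * (1 + y) ^ 2 * (1 - x)) + ((-2 * c 0 + c 1)) * (x * y ^ 2 * (1 + y) ^ 2 * (1 - x) ^ 2)
      + (-(c 1 - c 2)) * (x ^ 2 * y * (1 + y) ^ 2 * (1 - x))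
  | 6 =>
      ((c 1 - c 2) - c 6) * (x * y ^ 2 * (1 + y) ^ 2 * (1 - x) ^ 2) + ((c 2 - c 3) - c 6) * (x ^ 2 * y ^ 2 * (1
      + y) ^ 2 * (1 - x)) + (2 * c 6) * (x ^ 3 * y ^ 3 * (1 - x) ^ 2)
  | 7 =>
      (-(c 2 - c 3)) * (x ^ 2 * y ^ 2 * (1 + y) * (1 - x) ^ 2) + (-2 * c 6) * (x ^ 2 * y ^ 2 * (1 + y) ^ 2 * (1
      - x)) + (-c 6) * (x ^ 2 * y ^ 2 * (1 + y) ^ 2 * (1 - x) ^ 2) + (-(-c 3 + c 4)) * (x ^ 3 * y ^ 2 * (1 + y)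
      ^ 2 * (1 - x))
  | 8 =>
      (-(c 2 - c 3)) * (x ^ 2 * y ^ 2 * (1 + y) ^ 2 * (1 - x) ^ 2) + (-(c 4 - c 5)) * (x ^ 2 * y ^ 3 * (1 + y) ^
      2 * (1 - x)) + (-2 * c 6) * (x ^ 3 * y ^ 3 * (1 + y) * (1 - x) ^ 2)
  | 9 =>
      ((-2 * c 0 + c 1)) * (x ^ 2 * y ^ 3 * (1 + y) ^ 2 * (1 - x) ^ 2) + (-c 6) * (x ^ 3 * y ^ 3 * (1 + y) * (1
      - x) ^ 2) + (-(-c 3 + c 4)) * (x ^ 4 * y ^ 3 * (1 + y) * (1 - x) ^ 2)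
  | 10 =>
      (-c 6) * (x ^ 2 * y ^ 3 * (1 + y) ^ 3 * (1 - x)) + ((-c 3 + c 4) + c 6) * (x ^ 3 * y ^ 2 * (1 + y) ^ 2 *
      (1 - x) ^ 2) + ((c 1 - c 2)) * (x ^ 3 * y ^ 3 * (1 + y) ^ 2 * (1 - x) ^ 2)
  | _ => 0

set_option maxHeartbeats 4000000 in
theorem thetaPart_mul {t : ℂ} (h0 : t ≠ 0) (h1 : ‖t‖ < 1) (c : Fin 7 → ℤ) (l : Fin 5 → ℤ) :
    thetaPart c l t * brk t 1 * (curveY t * (1 - curveX t) * (1 + curveY t)) =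
      ∑ j ∈ Finset.range 11, thetaCoeff c l (curveX t) (curveY t) j * thetaRatio t ^ j := by
  obtain ⟨hx, hy, hd, hg, hh⟩ := curve_units_ne_zero h0 h1
  have s0 : brk t 2 ^ 3 / (brk t 1 ^ 3 * brk t 3) * brk t 1 =
      curveX t * thetaRatio t ^ 4 := by
    obtain ⟨b1, b2, b3, b4, b5⟩ := brk_ne_zero_aux h0 h1
    simp only [curveX, thetaRatio]
    field_simp
  have s1 : brk t 2 * brk t 4 ^ 2 / (brk t 1 ^ 2 * brk t 3 * brk t 5) * brk t 1 =
      curveX t * (1 - curveX t) * thetaRatio t ^ 4 := by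
    obtain ⟨b1, b2, b3, b4, b5⟩ := brk_ne_zero_aux h0 h1
    simp only [one_sub_curveX h0 h1]
    simp only [curveX, thetaRatio]
    field_simp
  have s2 : brk t 2 * brk t 5 / (brk t 1 ^ 2 * brk t 4) * brk t 1 =
      -(curveX t * curveY t * thetaRatio t ^ 4) := by
    obtain ⟨b1, b2, b3, b4, b5⟩ := brk_ne_zero_aux h0 h1
    simp only [curveX, curveY, thetaRatio]
    field_simp
  have s3 : brk t 3 ^ 2 / (brk t 1 ^ 2 * brk t 4) * brk t 1 =
      -(curveY t * (1 + curveY t) * thetaRatio t ^ 4) := by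
    obtain ⟨b1, b2, b3, b4, b5⟩ := brk_ne_zero_aux h0 h1
    simp only [one_add_curveY h0 h1]
    simp only [curveY, thetaRatio]
    field_simp
  have s4 : brk t 3 ^ 2 * brk t 4 / (brk t 1 * brk t 2 ^ 2 * brk t 5) * brk t 1 =
      -(curveY t * (1 - curveX t) * (1 + curveY t) * thetaRatio t ^ 4) := by
    obtain ⟨b1, b2, b3, b4, b5⟩ := brk_ne_zero_aux h0 h1
    simp only [one_sub_curveX h0 h1, one_add_curveY h0 h1]
    simp only [curveY, thetaRatio]
    field_simp
  simp only [Finset.sum_range_succ, Finset.sum_range_zero, thetaCoeff, thetaPart]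
  have r1 := rankQuot_one h0 h1
  have r2 := rankQuot_two h0 h1
  have r3 := rankQuot_three h0 h1
  have r4 := rankQuot_four h0 h1
  have r5 := rankQuot_five h0 h1
  have k3 := crankQuot_three h0 h1
  have k4 := crankQuot_four h0 h1
  have k5 := crankQuot_five h0 h1
  generalize rankQuot t 1 = R1 at *
  generalize rankQuot t 2 = R2 at *
  generalize rankQuot t 3 = R3 at *
  generalize rankQuot t 4 = R4 at *
  generalize rankQuot t 5 = R5 at *
  generalize crankQuot t 3 = K3 at *
  generalize crankQuot t 4 = K4 at *
  generalize crankQuot t 5 = K5 at *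
  generalize brk t 2 ^ 3 / (brk t 1 ^ 3 * brk t 3) = X0 at *
  generalize brk t 2 * brk t 4 ^ 2 / (brk t 1 ^ 2 * brk t 3 * brk t 5) = X1 at *
  generalize brk t 2 * brk t 5 / (brk t 1 ^ 2 * brk t 4) = X2 at *
  generalize brk t 3 ^ 2 / (brk t 1 ^ 2 * brk t 4) = X3 at *
  generalize brk t 3 ^ 2 * brk t 4 / (brk t 1 * brk t 2 ^ 2 * brk t 5) = X4 at *
  generalize curveX t = x at *
  generalize curveY t = y at *
  generalize thetaRatio t = d at *
  generalize brk t 1 = b at *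
  have i1 : y * (1 - x) * (y * (1 - x))⁻¹ = 1 := mul_inv_cancel₀ (mul_ne_zero hy hg)
  have i2 : (1 + y) * (1 + y)⁻¹ = 1 := mul_inv_cancel₀ hh
  rw [div_eq_mul_inv] at r4 r5 k5
  linear_combination (y * (1 - x) * (1 + y)) * (-(c 2 - c 3) * r1 + (-2 * c 0 + c 1) * r2 - (-c 3 + c 4) * r3 +
      (c 4 - c 5) * r4 - (c 1 - c 2) * r5 + c 6 * (-2 * k5 + k4 + k3) -
      (l 0 * s0 + l 1 * s1 + l 2 * s2 + l 3 * s3 + l 4 * s4)) + (c 4 - c 5) * x * (1 + y) ^ 2 * i1 -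
    (c 1 - c 2) * x * (1 + y) ^ 3 * d ^ 2 * i1 +
    2 * c 6 * x ^ 3 * y ^ 3 * (1 - x) ^ 2 * d ^ 6 * i2

set_option maxHeartbeats 4000000 in
theorem thetaCoeff_mul_invCoeff_one {x y : ℂ} (hC : y ^ 2 + (x ^ 2 + 1) * y + x = 0) :
    (∑ j ∈ Finset.range 6, thetaCoeff ![-2, 0, 3, 0, 1, -2, 0] ![2, 0, 2, -5, 6] x y j * invCoeff x y (5 - j)) *
        (x ^ 3 * y ^ 2 * (1 - x) * (1 + y)) +
      ∑ j ∈ Finset.range 5, thetaCoeff ![-2, 0, 3, 0, 1, -2, 0] ![2, 0, 2, -5, 6] x y (j + 6) * invCoeff x y (10 - j) =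
    -11 * curveDisc x y ^ 4 * (x ^ 3 * y * (1 + y) ^ 3 * (1 - x)) * (x ^ 3 * y ^ 2 * (1 - x) * (1 + y)) := by
  simp only [Finset.sum_range_succ, Finset.sum_range_zero, thetaCoeff, invCoeff, curveDisc, Matrix.cons_val,
    Int.cast_neg, Int.cast_ofNat, Int.cast_one, Int.cast_zero, Nat.reduceSub, Nat.reduceAdd, zero_add, Nat.sub_zero]
  linear_combination (-15 * x ^ 4 * y ^ 3 - 553 * x ^ 5 * y ^ 3 + 2698 * x ^ 6 * y ^ 3 - 6199 * x ^ 7 * y ^ 3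
    + 14381 * x ^ 8 * y ^ 3 - 21550 * x ^ 9 * y ^ 3 + 15185 * x ^ 10 * y ^ 3 - 2492 * x ^ 11 * y ^ 3 - 2517 * x
    ^ 12 * y ^ 3 + 754 * x ^ 13 * y ^ 3 + 273 * x ^ 14 * y ^ 3 + 35 * x ^ 15 * y ^ 3 - x ^ 3 * y ^ 4 - 132 * x ^
    4 * y ^ 4 - 2844 * x ^ 5 * y ^ 4 + 13749 * x ^ 6 * y ^ 4 - 27795 * x ^ 7 * y ^ 4 + 61565 * x ^ 8 * y ^ 4 -
    92157 * x ^ 9 * y ^ 4 + 54415 * x ^ 10 * y ^ 4 + 13708 * x ^ 11 * y ^ 4 - 33429 * x ^ 12 * y ^ 4 + 14311 * x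
    ^ 13 * y ^ 4 - 2178 * x ^ 14 * y ^ 4 + 850 * x ^ 15 * y ^ 4 - 62 * x ^ 16 * y ^ 4 - 6 * x ^ 3 * y ^ 5 - 348
    * x ^ 4 * y ^ 5 - 5905 * x ^ 5 * y ^ 5 + 32935 * x ^ 6 * y ^ 5 - 72898 * x ^ 7 * y ^ 5 + 151971 * x ^ 8 * y
    ^ 5 - 218792 * x ^ 9 * y ^ 5 + 136634 * x ^ 10 * y ^ 5 + 17009 * x ^ 11 * y ^ 5 - 68126 * x ^ 12 * y ^ 5 +
    30334 * x ^ 13 * y ^ 5 - 3990 * x ^ 14 * y ^ 5 + 1318 * x ^ 15 * y ^ 5 - 136 * x ^ 16 * y ^ 5 - 12 * x ^ 3 *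
    y ^ 6 - 330 * x ^ 4 * y ^ 6 - 6926 * x ^ 5 * y ^ 6 + 45638 * x ^ 6 * y ^ 6 - 115085 * x ^ 7 * y ^ 6 + 223607
    * x ^ 8 * y ^ 6 - 299127 * x ^ 9 * y ^ 6 + 204301 * x ^ 10 * y ^ 6 - 25862 * x ^ 11 * y ^ 6 - 48758 * x ^ 12
    * y ^ 6 + 22870 * x ^ 13 * y ^ 6 - 426 * x ^ 14 * y ^ 6 + 196 * x ^ 15 * y ^ 6 - 86 * x ^ 16 * y ^ 6 - 10 *
    x ^ 3 * y ^ 7 - 69 * x ^ 4 * y ^ 7 - 4748 * x ^ 5 * y ^ 7 + 34153 * x ^ 6 * y ^ 7 - 91661 * x ^ 7 * y ^ 7 +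
    165392 * x ^ 8 * y ^ 7 - 202844 * x ^ 9 * y ^ 7 + 140534 * x ^ 10 * y ^ 7 - 35393 * x ^ 11 * y ^ 7 - 14258 *
    x ^ 12 * y ^ 7 + 8212 * x ^ 13 * y ^ 7 + 1041 * x ^ 14 * y ^ 7 - 337 * x ^ 15 * y ^ 7 - 12 * x ^ 16 * y ^ 7
    - 3 * x ^ 3 * y ^ 8 + 30 * x ^ 4 * y ^ 8 - 1436 * x ^ 5 * y ^ 8 + 10575 * x ^ 6 * y ^ 8 - 27878 * x ^ 7 * y
    ^ 8 + 46308 * x ^ 8 * y ^ 8 - 51990 * x ^ 9 * y ^ 8 + 33736 * x ^ 10 * y ^ 8 - 8656 * x ^ 11 * y ^ 8 - 2703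
    * x ^ 12 * y ^ 8 + 2119 * x ^ 13 * y ^ 8 - 72 * x ^ 14 * y ^ 8 - 30 * x ^ 15 * y ^ 8 + 176 * x ^ 6 * y ^ 9 -
    264 * x ^ 8 * y ^ 9 - 88 * x ^ 9 * y ^ 9 + 99 * x ^ 10 * y ^ 9 + 66 * x ^ 11 * y ^ 9 + 11 * x ^ 12 * y ^ 9)
    * hC

set_option maxHeartbeats 4000000 in
theorem thetaCoeff_mul_invCoeff_two {x y : ℂ} (hC : y ^ 2 + (x ^ 2 + 1) * y + x = 0) :
    (∑ j ∈ Finset.range 6, thetaCoeff ![0, 2, -2, 2, -3, 1, 2] ![-3, -4, 0, 4, -3] x y j * invCoeff x y (5 - j)) *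
        (x ^ 3 * y ^ 2 * (1 - x) * (1 + y)) +
      ∑ j ∈ Finset.range 5, thetaCoeff ![0, 2, -2, 2, -3, 1, 2] ![-3, -4, 0, 4, -3] x y (j + 6) * invCoeff x y (10 - j) =
    11 * curveDisc x y ^ 4 * (x ^ 3 * y ^ 2 * (1 + y) ^ 2 * (1 - x) ^ 2) * (x ^ 3 * y ^ 2 * (1 - x) * (1 + y)) := by
  simp only [Finset.sum_range_succ, Finset.sum_range_zero, thetaCoeff, invCoeff, curveDisc, Matrix.cons_val,
    Int.cast_neg, Int.cast_ofNat, Int.cast_one, Int.cast_zero, Nat.reduceSub, Nat.reduceAdd, zero_add, Nat.sub_zero]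
  linear_combination (20 * x ^ 4 * y ^ 3 + 752 * x ^ 5 * y ^ 3 - 3392 * x ^ 6 * y ^ 3 + 9160 * x ^ 7 * y ^ 3 -
    18588 * x ^ 8 * y ^ 3 + 25008 * x ^ 9 * y ^ 3 - 22300 * x ^ 10 * y ^ 3 + 11800 * x ^ 11 * y ^ 3 - 2628 * x ^
    12 * y ^ 3 + 828 * x ^ 13 * y ^ 3 - 628 * x ^ 14 * y ^ 3 - 32 * x ^ 15 * y ^ 3 - x ^ 3 * y ^ 4 + 275 * x ^ 4
    * y ^ 4 + 2212 * x ^ 5 * y ^ 4 - 11212 * x ^ 6 * y ^ 4 + 32273 * x ^ 7 * y ^ 4 - 75157 * x ^ 8 * y ^ 4 +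
    110590 * x ^ 9 * y ^ 4 - 94392 * x ^ 10 * y ^ 4 + 38261 * x ^ 11 * y ^ 4 - 4055 * x ^ 12 * y ^ 4 + 6877 * x
    ^ 13 * y ^ 4 - 5943 * x ^ 14 * y ^ 4 + 204 * x ^ 15 * y ^ 4 + 68 * x ^ 16 * y ^ 4 - 6 * x ^ 3 * y ^ 5 + 638
    * x ^ 4 * y ^ 5 + 1452 * x ^ 5 * y ^ 5 - 9924 * x ^ 6 * y ^ 5 + 35212 * x ^ 7 * y ^ 5 - 105452 * x ^ 8 * y ^
    5 + 168952 * x ^ 9 * y ^ 5 - 121700 * x ^ 10 * y ^ 5 - 3016 * x ^ 11 * y ^ 5 + 51734 * x ^ 12 * y ^ 5 -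
    13943 * x ^ 13 * y ^ 5 - 2398 * x ^ 14 * y ^ 5 - 1921 * x ^ 15 * y ^ 5 + 372 * x ^ 16 * y ^ 5 - 12 * x ^ 3 *
    y ^ 6 + 450 * x ^ 4 * y ^ 6 - 1617 * x ^ 5 * y ^ 6 + 4543 * x ^ 6 * y ^ 6 + 2480 * x ^ 7 * y ^ 6 - 56171 * x
    ^ 8 * y ^ 6 + 115955 * x ^ 9 * y ^ 6 - 67136 * x ^ 10 * y ^ 6 - 62231 * x ^ 11 * y ^ 6 + 100986 * x ^ 12 * y
    ^ 6 - 42781 * x ^ 13 * y ^ 6 + 9588 * x ^ 14 * y ^ 6 - 4594 * x ^ 15 * y ^ 6 + 540 * x ^ 16 * y ^ 6 - 10 * x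
    ^ 3 * y ^ 7 - 14 * x ^ 4 * y ^ 7 - 2502 * x ^ 5 * y ^ 7 + 10794 * x ^ 6 * y ^ 7 - 17208 * x ^ 7 * y ^ 7 -
    3410 * x ^ 8 * y ^ 7 + 42198 * x ^ 9 * y ^ 7 - 35427 * x ^ 10 * y ^ 7 - 21337 * x ^ 11 * y ^ 7 + 43745 * x ^
    12 * y ^ 7 - 20354 * x ^ 13 * y ^ 7 + 5738 * x ^ 14 * y ^ 7 - 2449 * x ^ 15 * y ^ 7 + 236 * x ^ 16 * y ^ 7 -
    3 * x ^ 3 * y ^ 8 - 81 * x ^ 4 * y ^ 8 - 893 * x ^ 5 * y ^ 8 + 3971 * x ^ 6 * y ^ 8 - 7413 * x ^ 7 * y ^ 8 +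
    4142 * x ^ 8 * y ^ 8 + 9437 * x ^ 9 * y ^ 8 - 18086 * x ^ 10 * y ^ 8 + 11450 * x ^ 11 * y ^ 8 - 4025 * x ^
    12 * y ^ 8 + 2446 * x ^ 13 * y ^ 8 - 933 * x ^ 14 * y ^ 8 - 12 * x ^ 15 * y ^ 8 - 176 * x ^ 6 * y ^ 9 + 176
    * x ^ 7 * y ^ 9 + 264 * x ^ 8 * y ^ 9 - 176 * x ^ 9 * y ^ 9 - 187 * x ^ 10 * y ^ 9 + 33 * x ^ 11 * y ^ 9 +
    55 * x ^ 12 * y ^ 9 + 11 * x ^ 13 * y ^ 9) * hC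

set_option maxHeartbeats 4000000 in
theorem thetaCoeff_mul_invCoeff_three {x y : ℂ} (hC : y ^ 2 + (x ^ 2 + 1) * y + x = 0) :
    (∑ j ∈ Finset.range 6, thetaCoeff ![3, -1, 2, -1, 0, -3, -1] ![4, 2, -3, 0, -2] x y j * invCoeff x y (5 - j)) *
        (x ^ 3 * y ^ 2 * (1 - x) * (1 + y)) +
      ∑ j ∈ Finset.range 5, thetaCoeff ![3, -1, 2, -1, 0, -3, -1] ![4, 2, -3, 0, -2] x y (j + 6) * invCoeff x y (10 - j) =
    -11 * curveDisc x y ^ 4 * (x ^ 3 * y ^ 3 * (1 + y) * (1 - x) ^ 2) * (x ^ 3 * y ^ 2 * (1 - x) * (1 + y)) := by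
  simp only [Finset.sum_range_succ, Finset.sum_range_zero, thetaCoeff, invCoeff, curveDisc, Matrix.cons_val,
    Int.cast_neg, Int.cast_ofNat, Int.cast_one, Int.cast_zero, Nat.reduceSub, Nat.reduceAdd, zero_add, Nat.sub_zero]
  linear_combination (-15 * x ^ 4 * y ^ 3 - 564 * x ^ 5 * y ^ 3 + 2544 * x ^ 6 * y ^ 3 - 6870 * x ^ 7 * y ^ 3
    + 13941 * x ^ 8 * y ^ 3 - 18756 * x ^ 9 * y ^ 3 + 16725 * x ^ 10 * y ^ 3 - 8850 * x ^ 11 * y ^ 3 + 1971 * x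
    ^ 12 * y ^ 3 - 621 * x ^ 13 * y ^ 3 + 471 * x ^ 14 * y ^ 3 + 24 * x ^ 15 * y ^ 3 + 2 * x ^ 3 * y ^ 4 - 308 *
    x ^ 4 * y ^ 4 - 360 * x ^ 5 * y ^ 4 + 2357 * x ^ 6 * y ^ 4 - 9347 * x ^ 7 * y ^ 4 + 31284 * x ^ 8 * y ^ 4 -
    51738 * x ^ 9 * y ^ 4 + 45604 * x ^ 10 * y ^ 4 - 17357 * x ^ 11 * y ^ 4 - 1157 * x ^ 12 * y ^ 4 - 1200 * x ^
    13 * y ^ 4 + 1800 * x ^ 14 * y ^ 4 + 482 * x ^ 15 * y ^ 4 - 62 * x ^ 16 * y ^ 4 + 12 * x ^ 3 * y ^ 5 - 853 *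
    x ^ 4 * y ^ 5 + 5101 * x ^ 5 * y ^ 5 - 26318 * x ^ 6 * y ^ 5 + 65374 * x ^ 7 * y ^ 5 - 75884 * x ^ 8 * y ^ 5
    + 50970 * x ^ 9 * y ^ 5 - 40866 * x ^ 10 * y ^ 5 + 54694 * x ^ 11 * y ^ 5 - 46130 * x ^ 12 * y ^ 5 + 14848 *
    x ^ 13 * y ^ 5 - 3541 * x ^ 14 * y ^ 5 + 2817 * x ^ 15 * y ^ 5 - 224 * x ^ 16 * y ^ 5 + 24 * x ^ 3 * y ^ 6 -
    830 * x ^ 4 * y ^ 6 + 11522 * x ^ 5 * y ^ 6 - 64585 * x ^ 6 * y ^ 6 + 170579 * x ^ 7 * y ^ 6 - 244163 * x ^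
    8 * y ^ 6 + 222259 * x ^ 9 * y ^ 6 - 164209 * x ^ 10 * y ^ 6 + 122120 * x ^ 11 * y ^ 6 - 72869 * x ^ 12 * y
    ^ 6 + 25360 * x ^ 13 * y ^ 6 - 9270 * x ^ 14 * y ^ 6 + 4324 * x ^ 15 * y ^ 6 - 262 * x ^ 16 * y ^ 6 + 20 * x
    ^ 3 * y ^ 7 - 258 * x ^ 4 * y ^ 7 + 9121 * x ^ 5 * y ^ 7 - 53332 * x ^ 6 * y ^ 7 + 141822 * x ^ 7 * y ^ 7 -
    205507 * x ^ 8 * y ^ 7 + 178612 * x ^ 9 * y ^ 7 - 106842 * x ^ 10 * y ^ 7 + 54947 * x ^ 11 * y ^ 7 - 21886 *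
    x ^ 12 * y ^ 7 + 4470 * x ^ 13 * y ^ 7 - 3072 * x ^ 14 * y ^ 7 + 2005 * x ^ 15 * y ^ 7 - 100 * x ^ 16 * y ^
    7 + 6 * x ^ 3 * y ^ 8 + 12 * x ^ 4 * y ^ 8 + 2496 * x ^ 5 * y ^ 8 - 14702 * x ^ 6 * y ^ 8 + 38918 * x ^ 7 *
    y ^ 8 - 54835 * x ^ 8 * y ^ 8 + 40481 * x ^ 9 * y ^ 8 - 12191 * x ^ 10 * y ^ 8 - 4005 * x ^ 11 * y ^ 8 +
    7926 * x ^ 12 * y ^ 8 - 5474 * x ^ 13 * y ^ 8 + 1328 * x ^ 14 * y ^ 8 + 40 * x ^ 15 * y ^ 8 + 176 * x ^ 6 *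
    y ^ 9 - 176 * x ^ 7 * y ^ 9 - 264 * x ^ 8 * y ^ 9 + 176 * x ^ 9 * y ^ 9 + 187 * x ^ 10 * y ^ 9 - 33 * x ^ 11
    * y ^ 9 - 55 * x ^ 12 * y ^ 9 - 11 * x ^ 13 * y ^ 9) * hC

set_option maxHeartbeats 4000000 in
theorem thetaCoeff_mul_invCoeff_four {x y : ℂ} (hC : y ^ 2 + (x ^ 2 + 1) * y + x = 0) :
    (∑ j ∈ Finset.range 6, thetaCoeff ![2, 1, -4, 1, 3, -3, 1] ![2, -2, -2, -4, -2] x y j * invCoeff x y (5 - j)) *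
        (x ^ 3 * y ^ 2 * (1 - x) * (1 + y)) +
      ∑ j ∈ Finset.range 5, thetaCoeff ![2, 1, -4, 1, 3, -3, 1] ![2, -2, -2, -4, -2] x y (j + 6) * invCoeff x y (10 - j) =
    11 * curveDisc x y ^ 4 * (x ^ 3 * y ^ 2 * (1 + y) ^ 2 * (1 - x)) * (x ^ 3 * y ^ 2 * (1 - x) * (1 + y)) := by
  simp only [Finset.sum_range_succ, Finset.sum_range_zero, thetaCoeff, invCoeff, curveDisc, Matrix.cons_val,
    Int.cast_neg, Int.cast_ofNat, Int.cast_one, Nat.reduceSub, Nat.reduceAdd, zero_add, Nat.sub_zero]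
  linear_combination (25 * x ^ 4 * y ^ 3 + 665 * x ^ 5 * y ^ 3 - 3426 * x ^ 6 * y ^ 3 + 6137 * x ^ 7 * y ^ 3 -
    3534 * x ^ 8 * y ^ 3 - 5546 * x ^ 9 * y ^ 3 + 11153 * x ^ 10 * y ^ 3 - 7338 * x ^ 11 * y ^ 3 + 2886 * x ^ 12
    * y ^ 3 - 1363 * x ^ 13 * y ^ 3 + 304 * x ^ 14 * y ^ 3 + 37 * x ^ 15 * y ^ 3 + 6 * x ^ 3 * y ^ 4 - 209 * x ^
    4 * y ^ 4 + 5941 * x ^ 5 * y ^ 4 - 24932 * x ^ 6 * y ^ 4 + 40043 * x ^ 7 * y ^ 4 - 20686 * x ^ 8 * y ^ 4 -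
    37667 * x ^ 9 * y ^ 4 + 83453 * x ^ 10 * y ^ 4 - 74575 * x ^ 11 * y ^ 4 + 45839 * x ^ 12 * y ^ 4 - 24749 * x
    ^ 13 * y ^ 4 + 9343 * x ^ 14 * y ^ 4 - 1859 * x ^ 15 * y ^ 4 + 52 * x ^ 16 * y ^ 4 + 36 * x ^ 3 * y ^ 5 -
    741 * x ^ 4 * y ^ 5 + 16938 * x ^ 5 * y ^ 5 - 71722 * x ^ 6 * y ^ 5 + 125187 * x ^ 7 * y ^ 5 - 109162 * x ^
    8 * y ^ 5 + 10338 * x ^ 9 * y ^ 5 + 89066 * x ^ 10 * y ^ 5 - 108200 * x ^ 11 * y ^ 5 + 83213 * x ^ 12 * y ^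
    5 - 50478 * x ^ 13 * y ^ 5 + 19566 * x ^ 14 * y ^ 5 - 4165 * x ^ 15 * y ^ 5 + 124 * x ^ 16 * y ^ 5 + 72 * x
    ^ 3 * y ^ 6 - 798 * x ^ 4 * y ^ 6 + 22447 * x ^ 5 * y ^ 6 - 101760 * x ^ 6 * y ^ 6 + 196515 * x ^ 7 * y ^ 6
    - 227102 * x ^ 8 * y ^ 6 + 169989 * x ^ 9 * y ^ 6 - 75696 * x ^ 10 * y ^ 6 + 9118 * x ^ 11 * y ^ 6 + 27245 *
    x ^ 12 * y ^ 6 - 29955 * x ^ 13 * y ^ 6 + 12403 * x ^ 14 * y ^ 6 - 2570 * x ^ 15 * y ^ 6 + 92 * x ^ 16 * y ^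
    6 + 60 * x ^ 3 * y ^ 7 - 334 * x ^ 4 * y ^ 7 + 14519 * x ^ 5 * y ^ 7 - 71128 * x ^ 6 * y ^ 7 + 146956 * x ^
    7 * y ^ 7 - 191528 * x ^ 8 * y ^ 7 + 186114 * x ^ 9 * y ^ 7 - 140642 * x ^ 10 * y ^ 7 + 81160 * x ^ 11 * y ^
    7 - 26234 * x ^ 12 * y ^ 7 - 657 * x ^ 13 * y ^ 7 + 1960 * x ^ 14 * y ^ 7 - 266 * x ^ 15 * y ^ 7 + 20 * x ^
    16 * y ^ 7 + 18 * x ^ 3 * y ^ 8 - 43 * x ^ 4 * y ^ 8 + 3734 * x ^ 5 * y ^ 8 - 19760 * x ^ 6 * y ^ 8 + 41722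
    * x ^ 7 * y ^ 8 - 56172 * x ^ 8 * y ^ 8 + 58672 * x ^ 9 * y ^ 8 - 48279 * x ^ 10 * y ^ 8 + 31013 * x ^ 11 *
    y ^ 8 - 13230 * x ^ 12 * y ^ 8 + 2206 * x ^ 13 * y ^ 8 + 84 * x ^ 14 * y ^ 8 + 35 * x ^ 15 * y ^ 8 - 176 * x
    ^ 6 * y ^ 9 + 264 * x ^ 8 * y ^ 9 + 88 * x ^ 9 * y ^ 9 - 99 * x ^ 10 * y ^ 9 - 66 * x ^ 11 * y ^ 9 - 11 * x
    ^ 12 * y ^ 9) * hC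

set_option maxHeartbeats 4000000 in
theorem thetaCoeff_mul_invCoeff_five {x y : ℂ} (hC : y ^ 2 + (x ^ 2 + 1) * y + x = 0) :
    (∑ j ∈ Finset.range 6, thetaCoeff ![1, 3, 1, -8, -5, 8, 3] ![-11, 5, -1, 14, -2] x y j * invCoeff x y (5 - j)) *
        (x ^ 3 * y ^ 2 * (1 - x) * (1 + y)) +
      ∑ j ∈ Finset.range 5, thetaCoeff ![1, 3, 1, -8, -5, 8, 3] ![-11, 5, -1, 14, -2] x y (j + 6) * invCoeff x y (10 - j) =
    -11 * curveDisc x y ^ 4 * (x ^ 2 * y * (1 + y) ^ 4) * (x ^ 3 * y ^ 2 * (1 - x) * (1 + y)) := by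
  simp only [Finset.sum_range_succ, Finset.sum_range_zero, thetaCoeff, invCoeff, curveDisc, Matrix.cons_val,
    Int.cast_neg, Int.cast_ofNat, Int.cast_one, Nat.reduceSub, Nat.reduceAdd, zero_add, Nat.sub_zero]
  linear_combination (21 * x ^ 4 * y ^ 3 + 816 * x ^ 5 * y ^ 3 - 1674 * x ^ 6 * y ^ 3 + 11169 * x ^ 7 * y ^ 3
    - 30513 * x ^ 8 * y ^ 3 + 46252 * x ^ 9 * y ^ 3 - 46878 * x ^ 10 * y ^ 3 + 26800 * x ^ 11 * y ^ 3 - 7298 * x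
    ^ 12 * y ^ 3 + 2801 * x ^ 13 * y ^ 3 - 1403 * x ^ 14 * y ^ 3 - 93 * x ^ 15 * y ^ 3 - 12 * x ^ 3 * y ^ 4 +
    649 * x ^ 4 * y ^ 4 - 2663 * x ^ 5 * y ^ 4 + 17464 * x ^ 6 * y ^ 4 + 18428 * x ^ 7 * y ^ 4 - 135950 * x ^ 8
    * y ^ 4 + 260842 * x ^ 9 * y ^ 4 - 304288 * x ^ 10 * y ^ 4 + 221065 * x ^ 11 * y ^ 4 - 114504 * x ^ 12 * y ^
    4 + 56686 * x ^ 13 * y ^ 4 - 19183 * x ^ 14 * y ^ 4 + 1784 * x ^ 15 * y ^ 4 - 318 * x ^ 16 * y ^ 4 - 72 * x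
    ^ 3 * y ^ 5 + 1417 * x ^ 4 * y ^ 5 - 13344 * x ^ 5 * y ^ 5 + 73746 * x ^ 6 * y ^ 5 - 18269 * x ^ 7 * y ^ 5 -
    230594 * x ^ 8 * y ^ 5 + 492998 * x ^ 9 * y ^ 5 - 575543 * x ^ 10 * y ^ 5 + 404823 * x ^ 11 * y ^ 5 - 209470
    * x ^ 12 * y ^ 5 + 106429 * x ^ 13 * y ^ 5 - 33700 * x ^ 14 * y ^ 5 + 2075 * x ^ 15 * y ^ 5 - 496 * x ^ 16 *
    y ^ 5 - 144 * x ^ 3 * y ^ 6 + 906 * x ^ 4 * y ^ 6 - 19890 * x ^ 5 * y ^ 6 + 121501 * x ^ 6 * y ^ 6 - 99299 *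
    x ^ 7 * y ^ 6 - 122217 * x ^ 8 * y ^ 6 + 334111 * x ^ 9 * y ^ 6 - 382094 * x ^ 10 * y ^ 6 + 218746 * x ^ 11
    * y ^ 6 - 82389 * x ^ 12 * y ^ 6 + 47863 * x ^ 13 * y ^ 6 - 15435 * x ^ 14 * y ^ 6 - 1621 * x ^ 15 * y ^ 6 -
    38 * x ^ 16 * y ^ 6 - 120 * x ^ 3 * y ^ 7 + 52 * x ^ 4 * y ^ 7 - 13776 * x ^ 5 * y ^ 7 + 101926 * x ^ 6 * y
    ^ 7 - 126188 * x ^ 7 * y ^ 7 + 54133 * x ^ 8 * y ^ 7 + 610 * x ^ 9 * y ^ 7 - 20123 * x ^ 10 * y ^ 7 - 26596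
    * x ^ 11 * y ^ 7 + 42117 * x ^ 12 * y ^ 7 - 10822 * x ^ 13 * y ^ 7 + 513 * x ^ 14 * y ^ 7 - 1866 * x ^ 15 *
    y ^ 7 + 140 * x ^ 16 * y ^ 7 - 36 * x ^ 3 * y ^ 8 - 65 * x ^ 4 * y ^ 8 - 2871 * x ^ 5 * y ^ 8 + 37145 * x ^
    6 * y ^ 8 - 52769 * x ^ 7 * y ^ 8 + 49037 * x ^ 8 * y ^ 8 - 55896 * x ^ 9 * y ^ 8 + 44025 * x ^ 10 * y ^ 8 -
    34663 * x ^ 11 * y ^ 8 + 22253 * x ^ 12 * y ^ 8 - 6141 * x ^ 13 * y ^ 8 + 28 * x ^ 14 * y ^ 8 - 47 * x ^ 15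
    * y ^ 8 + 1056 * x ^ 5 * y ^ 9 + 2288 * x ^ 6 * y ^ 9 - 440 * x ^ 7 * y ^ 9 - 2332 * x ^ 8 * y ^ 9 - 880 * x
    ^ 9 * y ^ 9 + 176 * x ^ 10 * y ^ 9 + 121 * x ^ 11 * y ^ 9 + 11 * x ^ 12 * y ^ 9 + 176 * x ^ 5 * y ^ 10 + 176
    * x ^ 6 * y ^ 10 - 88 * x ^ 7 * y ^ 10 - 176 * x ^ 8 * y ^ 10 - 77 * x ^ 9 * y ^ 10 - 11 * x ^ 10 * y ^ 10)
    * hC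

theorem qpoch_sq {s : ℂ} (h1 : ‖s‖ < 1) (a : ℂ) :
    qpoch (s ^ 2) (a ^ 2) =
      qpoch (s ^ 2) a * qpoch (s ^ 2) (-a) * (qpoch (s ^ 2) (s * a) * qpoch (s ^ 2) (-(s * a))) := by
  have h : qpoch (s ^ 2) (a ^ 2) = qpoch s a * qpoch s (-a) := by
    unfold qpoch
    rw [← Multipliable.tprod_mul (multipliable_qpoch h1 a) (multipliable_qpoch h1 (-a))]
    exact tprod_congr fun k => by ring
  rw [h, qpoch_eq_prod_residues h1 a two_ne_zero, qpoch_eq_prod_residues h1 (-a) two_ne_zero]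
  simp only [Finset.prod_range_succ, Finset.prod_range_zero, pow_zero, pow_one, mul_one, one_mul,
    mul_comm s a, neg_mul]
  ring

theorem norm_sq_lt_one {s : ℂ} (h1 : ‖s‖ < 1) : ‖s ^ 2‖ < 1 := norm_lt_one_pow h1 two_ne_zero

theorem theta_duplication {s α : ℂ} (h0 : s ≠ 0) (h1 : ‖s‖ < 1) (hα : α ≠ 0) :
    theta (s ^ 2) α * (theta (s ^ 2) (-α) * theta (s ^ 2) (s * α) * theta (s ^ 2) (-(s * α))) =
      qpoch (s ^ 2) (s ^ 2) ^ 3 * theta (s ^ 2) (α ^ 2) := by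
  have h2 := norm_sq_lt_one h1
  have h0' : s ^ 2 ≠ 0 := pow_ne_zero _ h0
  have e1 : s ^ 2 * (α ^ 2)⁻¹ = (s * α⁻¹) ^ 2 := by ring
  have e2 : s ^ 2 * (s * α)⁻¹ = s * α⁻¹ := by field_simp
  have e3 : s ^ 2 * (-(s * α))⁻¹ = -(s * α⁻¹) := by field_simp
  have e4 : s ^ 2 * (-α)⁻¹ = -(s * (s * α⁻¹)) := by field_simp
  have e5 : s ^ 2 * α⁻¹ = s * (s * α⁻¹) := by ring
  rw [theta_eq_prod h0' h2 hα, theta_eq_prod h0' h2 (neg_ne_zero.2 hα),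
    theta_eq_prod h0' h2 (mul_ne_zero h0 hα), theta_eq_prod h0' h2 (neg_ne_zero.2 (mul_ne_zero h0 hα)),
    theta_eq_prod h0' h2 (pow_ne_zero 2 hα), e1, e2, e3, e4, e5, qpoch_sq h1 α, qpoch_sq h1 (s * α⁻¹)]
  ring

theorem theta_neg_one_mul {s : ℂ} (h0 : s ≠ 0) (h1 : ‖s‖ < 1) :
    theta (s ^ 2) (-1) * theta (s ^ 2) s * theta (s ^ 2) (-s) = 2 * qpoch (s ^ 2) (s ^ 2) ^ 3 := by
  have h2 := norm_sq_lt_one h1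
  have h0' : s ^ 2 ≠ 0 := pow_ne_zero _ h0
  have e1 : s ^ 2 * s⁻¹ = s := by field_simp
  have e2 : s ^ 2 * (-s)⁻¹ = -s := by field_simp
  have e3 : s ^ 2 * (-1 : ℂ)⁻¹ = -(s ^ 2) := by norm_num
  have hs := qpoch_sq h1 s
  have hn := qpoch_eq_mul h2 (-1)
  have h := qpoch_self_ne_zero h2
  have e : qpoch (s ^ 2) s * qpoch (s ^ 2) (-s) * qpoch (s ^ 2) (-(s ^ 2)) = 1 := by
    rw [← sq s] at hs
    refine mul_left_cancel₀ h ?_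
    linear_combination -hs
  rw [theta_eq_prod h0' h2 (neg_ne_zero.2 one_ne_zero), theta_eq_prod h0' h2 h0,
    theta_eq_prod h0' h2 (neg_ne_zero.2 h0), e1, e2, e3, hn]
  rw [neg_one_mul]
  linear_combination 2 * qpoch (s ^ 2) (s ^ 2) ^ 3 * (qpoch (s ^ 2) s * qpoch (s ^ 2) (-s) *
    qpoch (s ^ 2) (-(s ^ 2)) + 1) * e

/-- A theta quotient which is a difference of values of the Weierstrass function. -/
noncomputable def weierDiff (q α w : ℂ) : ℂ :=
  theta q (α * w) * theta q (α * w⁻¹) * w / (theta q α ^ 2 * theta q w ^ 2)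

theorem weierDiff_add {q α β w : ℂ} (h0 : q ≠ 0) (h1 : ‖q‖ < 1) (hα : theta q α ≠ 0) (hβ : theta q β ≠ 0)
    (hw : theta q w ≠ 0) (α0 : α ≠ 0) (β0 : β ≠ 0) (w0 : w ≠ 0) :
    weierDiff q α w = weierDiff q α β + weierDiff q β w := by
  have h := theta_three_term h0 h1 α0 β0 w0 one_ne_zero
  simp only [inv_one, mul_one] at h
  rw [weierDiff, weierDiff, weierDiff]
  generalize theta q (α * w) = a1 at *
  generalize theta q (α * w⁻¹) = a2 at *
  generalize theta q (α * β) = a3 at *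
  generalize theta q (α * β⁻¹) = a4 at *
  generalize theta q (β * w) = a5 at *
  generalize theta q (β * w⁻¹) = a6 at *
  field_simp
  linear_combination -h

theorem theta_half_ne_zero {s : ℂ} (h0 : s ≠ 0) (h1 : ‖s‖ < 1) :
    theta (s ^ 2) (-1) ≠ 0 ∧ theta (s ^ 2) s ≠ 0 ∧ theta (s ^ 2) (-s) ≠ 0 := by
  have h : theta (s ^ 2) (-1) * theta (s ^ 2) s * theta (s ^ 2) (-s) ≠ 0 := by
    rw [theta_neg_one_mul h0 h1]
    exact mul_ne_zero two_ne_zero (pow_ne_zero _ (qpoch_self_ne_zero (norm_sq_lt_one h1)))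
  simpa [and_assoc] using h

theorem weierDiff_half_prod {s α : ℂ} (h0 : s ≠ 0) (h1 : ‖s‖ < 1) (α0 : α ≠ 0) (hα : theta (s ^ 2) α ≠ 0) :
    weierDiff (s ^ 2) α (-1) * weierDiff (s ^ 2) α s * weierDiff (s ^ 2) α (-s) =
      -(α ^ 2 * theta (s ^ 2) (α ^ 2) ^ 2 / (4 * theta (s ^ 2) α ^ 8)) := by
  have hd := theta_duplication h0 h1 α0
  have hT := theta_neg_one_mul h0 h1
  obtain ⟨n1, n2, n3⟩ := theta_half_ne_zero h0 h1
  have h0' : s ^ 2 ≠ 0 := pow_ne_zero _ h0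
  have hC := qpoch_self_ne_zero (norm_sq_lt_one h1)
  have e2 : theta (s ^ 2) (α * s⁻¹) = -(α / s) * theta (s ^ 2) (s * α) := by
    have h := theta_mul_base h0' (mul_ne_zero α0 (inv_ne_zero h0))
    rw [show s ^ 2 * (α * s⁻¹) = s * α by field_simp] at h
    rw [h]; field_simp
  have e3 : theta (s ^ 2) (α * (-s)⁻¹) = (α / s) * theta (s ^ 2) (-(s * α)) := by
    have h := theta_mul_base h0' (mul_ne_zero α0 (inv_ne_zero (neg_ne_zero.2 h0)))
    rw [show s ^ 2 * (α * (-s)⁻¹) = -(s * α) by field_simp] at h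
    rw [h]; field_simp
  rw [weierDiff, weierDiff, weierDiff, e2, e3, show α * (-1)⁻¹ = -α by norm_num,
    show α * -1 = -α by ring, show α * -s = -(s * α) by ring, mul_comm α s]
  generalize theta (s ^ 2) (-1) = a at *
  generalize theta (s ^ 2) s = b at *
  generalize theta (s ^ 2) (-s) = c at *
  generalize theta (s ^ 2) (-α) = u at *
  generalize theta (s ^ 2) (s * α) = v at *
  generalize theta (s ^ 2) (-(s * α)) = w at *
  generalize theta (s ^ 2) (α ^ 2) = z at *
  generalize theta (s ^ 2) α = f at *
  generalize qpoch (s ^ 2) (s ^ 2) = C at *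
  have h4 : (a * b * c) ^ 2 * z ^ 2 = 4 * (f * (u * v * w)) ^ 2 := by rw [hT, hd]; ring
  field_simp
  linear_combination h4

theorem weierDiff_half_disc {s α : ℂ} (h0 : s ≠ 0) (h1 : ‖s‖ < 1) (α0 : α ≠ 0) (hα : theta (s ^ 2) α ≠ 0) :
    ((weierDiff (s ^ 2) α s - weierDiff (s ^ 2) α (-1)) * (weierDiff (s ^ 2) α (-s) - weierDiff (s ^ 2) α (-1)) *
      (weierDiff (s ^ 2) α s - weierDiff (s ^ 2) α (-s))) ^ 2 =
      s ^ 2 / (16 * qpoch (s ^ 2) (s ^ 2) ^ 12) := by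
  have hT := theta_neg_one_mul h0 h1
  obtain ⟨n1, n2, n3⟩ := theta_half_ne_zero h0 h1
  have h0' : s ^ 2 ≠ 0 := pow_ne_zero _ h0
  have h2 := norm_sq_lt_one h1
  have hC := qpoch_self_ne_zero h2
  have m1 : (-1 : ℂ) ≠ 0 := neg_ne_zero.2 one_ne_zero
  have ms : -s ≠ 0 := neg_ne_zero.2 h0
  have i1 := theta_inv (q := s ^ 2) h0
  have i2 := theta_inv (q := s ^ 2) ms
  have i3 := theta_mul_base h0' m1
  have d1 := weierDiff_add h0' h2 hα n1 n2 α0 m1 h0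
  have d2 := weierDiff_add h0' h2 hα n1 n3 α0 m1 ms
  have d3 := weierDiff_add h0' h2 hα n3 n2 α0 ms h0
  rw [show weierDiff (s ^ 2) α s - weierDiff (s ^ 2) α (-1) = weierDiff (s ^ 2) (-1) s by rw [d1]; ring,
    show weierDiff (s ^ 2) α (-s) - weierDiff (s ^ 2) α (-1) = weierDiff (s ^ 2) (-1) (-s) by rw [d2]; ring,
    show weierDiff (s ^ 2) α s - weierDiff (s ^ 2) α (-s) = weierDiff (s ^ 2) (-s) s by rw [d3]; ring,
    weierDiff, weierDiff, weierDiff, show -1 * s = -s by ring, show -1 * s⁻¹ = (-s)⁻¹ by field_simp,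
    show -1 * -s = s by ring, show -1 * (-s)⁻¹ = s⁻¹ by field_simp, show -s * s = s ^ 2 * -1 by ring,
    show -s * s⁻¹ = -1 by field_simp, i1, i2, i3]
  generalize theta (s ^ 2) (-1) = a at *
  generalize theta (s ^ 2) s = b at *
  generalize theta (s ^ 2) (-s) = c at *
  generalize qpoch (s ^ 2) (s ^ 2) = C at *
  have h4 : (a * b * c) ^ 4 = 16 * C ^ 12 := by rw [hT]; ring
  rw [← h4]
  field_simp

theorem cubic_disc_of_values {b c e₁ e₂ e₃ : ℂ} (hb : b ≠ 0) (hc : c ≠ 0) (hbc : b - c ≠ 0)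
    (h₀ : 4 * (e₁ * e₂ * e₃) = b ^ 2) (h₁ : 4 * ((b + e₁) * (b + e₂) * (b + e₃)) = (b * c) ^ 2)
    (h₂ : 4 * ((c + e₁) * (c + e₂) * (c + e₃)) = (b - c - c ^ 2) ^ 2) :
    16 * ((e₂ - e₁) * (e₃ - e₁) * (e₂ - e₃)) ^ 2 =
      b ^ 3 * (b + 16 * b ^ 2 - c - 20 * b * c + 3 * c ^ 2 - 8 * b * c ^ 2 - 3 * c ^ 3 + c ^ 4) := by
  have k₁ : 4 * b ^ 2 + 4 * (e₁ + e₂ + e₃) * b + 4 * (e₁ * e₂ + e₁ * e₃ + e₂ * e₃) + b - b * c ^ 2 = 0 :=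
    mul_left_cancel₀ hb (by linear_combination h₁ - h₀)
  have k₂ : 4 * c ^ 2 + 4 * (e₁ + e₂ + e₃) * c + 4 * (e₁ * e₂ + e₁ * e₃ + e₂ * e₃) -
      (c + c ^ 3 - 2 * b - 2 * b * c + 2 * c ^ 2) = 0 :=
    mul_left_cancel₀ hc (by linear_combination h₂ - h₀)
  have s₁ : e₁ + e₂ + e₃ = ((1 - c) ^ 2 - 4 * b) / 4 :=
    mul_left_cancel₀ hbc (by linear_combination (k₁ - k₂) / 4)
  have s₂ : e₁ * e₂ + e₁ * e₃ + e₂ * e₃ = -(b * (1 - c)) / 2 := by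
    linear_combination k₁ / 4 - b * s₁
  have s₃ : e₁ * e₂ * e₃ = b ^ 2 / 4 := by linear_combination h₀ / 4
  have h : ((e₂ - e₁) * (e₃ - e₁) * (e₂ - e₃)) ^ 2 =
      (e₁ + e₂ + e₃) ^ 2 * (e₁ * e₂ + e₁ * e₃ + e₂ * e₃) ^ 2 - 4 * (e₁ * e₂ + e₁ * e₃ + e₂ * e₃) ^ 3 -
        4 * (e₁ + e₂ + e₃) ^ 3 * (e₁ * e₂ * e₃) +
        18 * (e₁ + e₂ + e₃) * (e₁ * e₂ + e₁ * e₃ + e₂ * e₃) * (e₁ * e₂ * e₃) - 27 * (e₁ * e₂ * e₃) ^ 2 := by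
    ring
  rw [h, s₁, s₂, s₃]
  ring

set_option maxHeartbeats 4000000 in
theorem tate_disc {x y b c : ℂ} (hC : y ^ 2 + (x ^ 2 + 1) * y + x = 0) (hb : b = -(y ^ 2 * (1 + y) * (1 - x)))
    (hc : c = x * y * (1 - x)) :
    b ^ 3 * (b + 16 * b ^ 2 - c - 20 * b * c + 3 * c ^ 2 - 8 * b * c ^ 2 - 3 * c ^ 3 + c ^ 4) =
      x ^ 4 * y ^ 7 * (1 + y) ^ 7 * (1 - x) ^ 2 * curveDisc x y := by
  subst hb hc
  rw [curveDisc]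
  linear_combination (y ^ 7 - 4 * x * y ^ 7 + 6 * x ^ 2 * y ^ 7 - 5 * x ^ 3 * y ^ 7 - x ^ 4 * y ^ 7 + 8 * x ^
    5 * y ^ 7 - 6 * x ^ 6 * y ^ 7 + x ^ 7 * y ^ 7 + 3 * y ^ 8 - 16 * x * y ^ 8 + 38 * x ^ 2 * y ^ 8 - 55 * x ^ 3
    * y ^ 8 + 19 * x ^ 4 * y ^ 8 + 48 * x ^ 5 * y ^ 8 - 49 * x ^ 6 * y ^ 8 + 13 * x ^ 7 * y ^ 8 - x ^ 8 * y ^ 8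
    - 13 * y ^ 9 + 56 * x * y ^ 9 - 74 * x ^ 2 * y ^ 9 - 7 * x ^ 3 * y ^ 9 + 16 * x ^ 4 * y ^ 9 + 119 * x ^ 5 *
    y ^ 9 - 141 * x ^ 6 * y ^ 9 + 53 * x ^ 7 * y ^ 9 - 10 * x ^ 8 * y ^ 9 + x ^ 9 * y ^ 9 - 63 * y ^ 10 + 304 *
    x * y ^ 10 - 550 * x ^ 2 * y ^ 10 + 419 * x ^ 3 * y ^ 10 - 158 * x ^ 4 * y ^ 10 + 168 * x ^ 5 * y ^ 10 - 189
    * x ^ 6 * y ^ 10 + 90 * x ^ 7 * y ^ 10 - 24 * x ^ 8 * y ^ 10 + 3 * x ^ 9 * y ^ 10 - 96 * y ^ 11 + 476 * x *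
    y ^ 11 - 916 * x ^ 2 * y ^ 11 + 824 * x ^ 3 * y ^ 11 - 365 * x ^ 4 * y ^ 11 + 150 * x ^ 5 * y ^ 11 - 121 * x
    ^ 6 * y ^ 11 + 67 * x ^ 7 * y ^ 11 - 22 * x ^ 8 * y ^ 11 + 3 * x ^ 9 * y ^ 11 - 64 * y ^ 12 + 320 * x * y ^
    12 - 632 * x ^ 2 * y ^ 12 + 608 * x ^ 3 * y ^ 12 - 293 * x ^ 4 * y ^ 12 + 80 * x ^ 5 * y ^ 12 - 30 * x ^ 6 *
    y ^ 12 + 17 * x ^ 7 * y ^ 12 - 7 * x ^ 8 * y ^ 12 + x ^ 9 * y ^ 12 - 16 * y ^ 13 + 80 * x * y ^ 13 - 160 * x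
    ^ 2 * y ^ 13 + 160 * x ^ 3 * y ^ 13 - 82 * x ^ 4 * y ^ 13 + 19 * x ^ 5 * y ^ 13 - x ^ 7 * y ^ 13) * hC

theorem theta_zpow_ne_zero {t : ℂ} (h0 : t ≠ 0) (h1 : ‖t‖ < 1) {a : ℤ} (ha : ¬11 ∣ a) :
    theta (t ^ 121) (t ^ (11 * a)) ≠ 0 := by
  rw [theta_eq_brk h0]
  exact mul_ne_zero (zpow_ne_zero _ h0) (brk_ne_zero h0 h1 ha)

theorem weierDiff_brk {t : ℂ} (h0 : t ≠ 0) (h1 : ‖t‖ < 1) {a b : ℤ} (ha : ¬11 ∣ a) (hb : ¬11 ∣ b) :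
    weierDiff (t ^ 121) (t ^ (11 * a)) (t ^ (11 * b)) =
      brk t (a + b) * brk t (a - b) / (brk t a ^ 2 * brk t b ^ 2) := by
  have na := brk_ne_zero h0 h1 ha
  have nb := brk_ne_zero h0 h1 hb
  have e : t ^ brkExp (a + b) * t ^ brkExp (a - b) * t ^ (11 * b) =
      (t ^ brkExp a) ^ 2 * (t ^ brkExp b) ^ 2 := by
    rw [← zpow_natCast, ← zpow_natCast, ← zpow_mul, ← zpow_mul, ← zpow_add₀ h0, ← zpow_add₀ h0,
      ← zpow_add₀ h0]
    congr 1
    have h1 := two_mul_brkExp (a + b)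
    have h2 := two_mul_brkExp (a - b)
    have h3 := two_mul_brkExp a
    have h4 := two_mul_brkExp b
    push_cast
    nlinarith
  have ta := zpow_ne_zero (brkExp a) h0
  have tb := zpow_ne_zero (brkExp b) h0
  rw [weierDiff, ← zpow_neg, ← zpow_add₀ h0, ← zpow_add₀ h0, ← mul_neg, ← mul_add, ← mul_add, ← sub_eq_add_neg,
    theta_eq_brk h0, theta_eq_brk h0, theta_eq_brk h0, theta_eq_brk h0, div_eq_div_iff (by positivity) (by positivity)]
  linear_combination brk t (a + b) * brk t (a - b) * brk t a ^ 2 * brk t b ^ 2 * e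

theorem weierDiff_half_prod_brk {s t : ℂ} (h0 : t ≠ 0) (h1 : ‖t‖ < 1) (hs : s ^ 2 = t ^ 121) {a : ℤ} (ha : ¬11 ∣ a) :
    weierDiff (t ^ 121) (t ^ (11 * a)) (-1) * weierDiff (t ^ 121) (t ^ (11 * a)) s *
        weierDiff (t ^ 121) (t ^ (11 * a)) (-s) = -(brk t (2 * a) ^ 2 / (4 * brk t a ^ 8)) := by
  have s0 : s ≠ 0 := by
    rintro rfl
    exact pow_ne_zero 121 h0 (by rw [← hs]; norm_num)
  have s1 : ‖s‖ < 1 := by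
    have h := norm_pow_121_lt_one h1
    rw [← hs, norm_pow] at h
    exact (sq_lt_one_iff₀ (norm_nonneg _)).1 h
  have na := brk_ne_zero h0 h1 ha
  have h := weierDiff_half_prod s0 s1 (zpow_ne_zero (11 * a) h0) (by rw [hs]; exact theta_zpow_ne_zero h0 h1 ha)
  rw [hs] at h
  have e : (t ^ (11 * a)) ^ 2 * (t ^ brkExp (2 * a)) ^ 2 = (t ^ brkExp a) ^ 8 := by
    rw [← zpow_natCast, ← zpow_natCast, ← zpow_natCast, ← zpow_mul, ← zpow_mul, ← zpow_mul, ← zpow_add₀ h0]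
    congr 1
    have h1 := two_mul_brkExp (2 * a)
    have h3 := two_mul_brkExp a
    push_cast
    nlinarith
  have ta := zpow_ne_zero (brkExp a) h0
  rw [h, theta_eq_brk h0, ← zpow_natCast (t ^ (11 * a)) 2, ← zpow_mul,
    show 11 * a * ((2 : ℕ) : ℤ) = 11 * (2 * a) by push_cast; ring, theta_eq_brk h0,
    show 11 * (2 * a) = 11 * a * ((2 : ℕ) : ℤ) by push_cast; ring, zpow_mul, zpow_natCast, mul_pow, mul_pow,
    ← mul_assoc, e]
  field_simp

theorem curveDisc_eq {t : ℂ} (h0 : t ≠ 0) (h1 : ‖t‖ < 1) :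
    curveDisc (curveX t) (curveY t) = -(t ^ 121 * (brk t 1 ^ 5 * brk t 3 ^ 2 * brk t 4 ^ 3 * brk t 5 ^ 2) /
      qpoch (t ^ 121) (t ^ 121) ^ 12) := by
  obtain ⟨s, hs⟩ := IsAlgClosed.exists_pow_nat_eq (t ^ 121) two_pos
  have s0 : s ≠ 0 := by
    rintro rfl
    exact pow_ne_zero 121 h0 (by rw [← hs]; norm_num)
  have s1 : ‖s‖ < 1 := by
    have h := norm_pow_121_lt_one h1
    rw [← hs, norm_pow] at h
    exact (sq_lt_one_iff₀ (norm_nonneg _)).1 h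
  have g1 : ¬(11 : ℤ) ∣ 1 := by norm_num
  have g2 : ¬(11 : ℤ) ∣ 2 := by norm_num
  have g3 : ¬(11 : ℤ) ∣ 3 := by norm_num
  obtain ⟨n1, n2, n3⟩ := theta_half_ne_zero s0 s1
  rw [hs] at n1 n2 n3
  have hq := norm_pow_121_lt_one h1
  have hq0 : t ^ 121 ≠ 0 := pow_ne_zero _ h0
  have hC := qpoch_self_ne_zero hq
  have shift : ∀ a : ℤ, ¬11 ∣ a → ∀ w : ℂ, w ≠ 0 → theta (t ^ 121) w ≠ 0 →
      weierDiff (t ^ 121) (t ^ (11 * a)) w = brk t (a + 1) * brk t (a - 1) / (brk t a ^ 2 * brk t 1 ^ 2) +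
        weierDiff (t ^ 121) (t ^ (11 * (1 : ℤ))) w := fun a ha w hw hw' => by
    rw [weierDiff_add hq0 hq (theta_zpow_ne_zero h0 h1 ha) (theta_zpow_ne_zero h0 h1 g1) hw'
      (zpow_ne_zero _ h0) (zpow_ne_zero (11 * (1 : ℤ)) h0) hw, weierDiff_brk h0 h1 ha g1]
  have m1 : (-1 : ℂ) ≠ 0 := neg_ne_zero.2 one_ne_zero
  have ms : -s ≠ 0 := neg_ne_zero.2 s0
  have p1 := weierDiff_half_prod_brk h0 h1 hs g1
  have p2 := weierDiff_half_prod_brk h0 h1 hs g2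
  have p3 := weierDiff_half_prod_brk h0 h1 hs g3
  rw [shift 2 g2 _ m1 n1, shift 2 g2 _ s0 n2, shift 2 g2 _ ms n3] at p2
  rw [shift 3 g3 _ m1 n1, shift 3 g3 _ s0 n2, shift 3 g3 _ ms n3] at p3
  have hd := weierDiff_half_disc s0 s1 (zpow_ne_zero (11 * (1 : ℤ)) h0)
    (by rw [hs]; exact theta_zpow_ne_zero h0 h1 g1)
  rw [hs] at hd
  norm_num [brk_six h0] at p1 p2 p3
  norm_num at hd
  generalize weierDiff (t ^ 121) (t ^ 11) (-1) = e1 at *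
  generalize weierDiff (t ^ 121) (t ^ 11) s = e2 at *
  generalize weierDiff (t ^ 121) (t ^ 11) (-s) = e3 at *
  have hcv := curve_equation h0 h1
  obtain ⟨hx, hy, -, hg, hh⟩ := curve_units_ne_zero h0 h1
  have hX := one_sub_curveX h0 h1
  have hY := one_add_curveY h0 h1
  obtain ⟨b1, b2, b3, b4, b5⟩ := brk_ne_zero_aux h0 h1
  set b : ℂ := -(curveY t ^ 2 * (1 + curveY t) * (1 - curveX t)) with hb
  set c : ℂ := curveX t * curveY t * (1 - curveX t) with hc
  have vb : b = -(brk t 3 ^ 3 * brk t 1 ^ 5 / brk t 2 ^ 8) := by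
    rw [hb, hX, hY, curveY]
    field_simp
  have vc : c = -(brk t 4 * brk t 1 ^ 4 / brk t 2 ^ 5) := by
    rw [hc, hX, curveX, curveY]
    field_simp
  have vbc : b - c = curveX t ^ 2 * curveY t ^ 2 * (1 - curveX t) := by
    rw [hb, hc]
    linear_combination -curveY t * (1 - curveX t) * hcv
  have vbc' : b - c - c ^ 2 = curveX t ^ 3 * curveY t ^ 2 * (1 - curveX t) := by
    rw [vbc, hc]
    ring
  have vbc'' : b - c - c ^ 2 = brk t 5 * brk t 1 ^ 9 / (brk t 2 ^ 9 * brk t 3) := by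
    rw [vbc', hX, curveX, curveY]
    field_simp
  have hT := tate_disc hcv hb hc
  have nb : b ≠ 0 := neg_ne_zero.2 (mul_ne_zero (mul_ne_zero (pow_ne_zero 2 hy) hh) hg)
  have nc : c ≠ 0 := mul_ne_zero (mul_ne_zero hx hy) hg
  have nbc : b - c ≠ 0 := by
    rw [vbc]
    exact mul_ne_zero (mul_ne_zero (pow_ne_zero 2 hx) (pow_ne_zero 2 hy)) hg
  have hm : curveX t ^ 4 * curveY t ^ 7 * (1 + curveY t) ^ 7 * (1 - curveX t) ^ 2 =
      -(brk t 1 ^ 31 * brk t 3 ^ 10 / (brk t 2 ^ 36 * brk t 4 ^ 3 * brk t 5 ^ 2)) := by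
    rw [hX, hY, curveX, curveY]
    field_simp
  set u : ℂ := -(brk t 1 ^ 6 * brk t 3 ^ 2 / brk t 2 ^ 6) with hu
  have r0 : 4 * (u * e1 * (u * e2) * (u * e3)) = b ^ 2 := by
    rw [show 4 * (u * e1 * (u * e2) * (u * e3)) = 4 * u ^ 3 * (e1 * e2 * e3) by ring, p1, vb, hu]
    field_simp
  have r1 : 4 * ((b + u * e1) * (b + u * e2) * (b + u * e3)) = (b * c) ^ 2 := by
    have hf : b = u * (brk t 3 * brk t 1 / (brk t 2 ^ 2 * brk t 1 ^ 2)) := by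
      rw [vb, hu]
      field_simp
    calc _ = 4 * u ^ 3 * ((brk t 3 * brk t 1 / (brk t 2 ^ 2 * brk t 1 ^ 2) + e1) *
          (brk t 3 * brk t 1 / (brk t 2 ^ 2 * brk t 1 ^ 2) + e2) *
          (brk t 3 * brk t 1 / (brk t 2 ^ 2 * brk t 1 ^ 2) + e3)) := by
          rw [hf]
          ring
      _ = _ := by
          rw [p2, vb, vc, hu]
          field_simp
  have r2 : 4 * ((c + u * e1) * (c + u * e2) * (c + u * e3)) = (b - c - c ^ 2) ^ 2 := by
    have hf : c = u * (brk t 4 * brk t 2 / (brk t 3 ^ 2 * brk t 1 ^ 2)) := by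
      rw [vc, hu]
      field_simp
    calc _ = 4 * u ^ 3 * ((brk t 4 * brk t 2 / (brk t 3 ^ 2 * brk t 1 ^ 2) + e1) *
          (brk t 4 * brk t 2 / (brk t 3 ^ 2 * brk t 1 ^ 2) + e2) *
          (brk t 4 * brk t 2 / (brk t 3 ^ 2 * brk t 1 ^ 2) + e3)) := by
          rw [hf]
          ring
      _ = _ := by
          rw [p3, vbc'', hu]
          field_simp
  have hK := cubic_disc_of_values nb nc nbc r0 r1 r2
  rw [hT, hm, show 16 * ((u * e2 - u * e1) * (u * e3 - u * e1) * (u * e2 - u * e3)) ^ 2 =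
    16 * u ^ 6 * ((e2 - e1) * (e3 - e1) * (e2 - e3)) ^ 2 by ring, hd, hu] at hK
  generalize curveDisc (curveX t) (curveY t) = Ψ at *
  field_simp at hK ⊢
  linear_combination hK

theorem sum_primitiveRoot_pow {n : ℕ} {ζ : ℂ} (hζ : IsPrimitiveRoot ζ n) (m : ℕ) :
    ∑ i ∈ Finset.range n, (ζ ^ i) ^ m = if n ∣ m then (n : ℂ) else 0 := by
  split_ifs with h
  · rw [Finset.sum_congr rfl fun i _ => by
      rw [← pow_mul, mul_comm, pow_mul, (hζ.pow_eq_one_iff_dvd m).2 h, one_pow]]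
    simp
  · have h1 : ζ ^ m ≠ 1 := fun e => h ((hζ.pow_eq_one_iff_dvd m).1 e)
    have h2 : ∑ i ∈ Finset.range n, (ζ ^ i) ^ m = ∑ i ∈ Finset.range n, (ζ ^ m) ^ i :=
      Finset.sum_congr rfl fun i _ => by rw [← pow_mul, mul_comm, pow_mul]
    rw [h2, geom_sum_eq h1, ← pow_mul, mul_comm, pow_mul, hζ.pow_eq_one, one_pow, sub_self, zero_div]

theorem hasSum_residue_of_hasSum {f : ℕ → ℂ} {S : ℂ → ℂ} {t ζ : ℂ} {m r s : ℕ} (hm : m ≠ 0) (hζ : IsPrimitiveRoot ζ m)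
    (hr : r < m) (hs : m ∣ r + s)
    (h : ∀ i ∈ Finset.range m, HasSum (fun n => f n * (ζ ^ i * t) ^ n) (S (ζ ^ i))) :
    HasSum (fun n => f (m * n + r) * t ^ (m * n + r)) ((∑ i ∈ Finset.range m, (ζ ^ i) ^ s * S (ζ ^ i)) / m) := by
  have hm' : (m : ℂ) ≠ 0 := Nat.cast_ne_zero.2 hm
  have h1 := (hasSum_sum fun i hi => (h i hi).mul_left ((ζ ^ i) ^ s)).div_const (m : ℂ)
  have h2 : ∀ n, (∑ i ∈ Finset.range m, (ζ ^ i) ^ s * (f n * (ζ ^ i * t) ^ n)) / (m : ℂ) =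
      if m ∣ n + s then f n * t ^ n else 0 := fun n => by
    have e : ∑ i ∈ Finset.range m, (ζ ^ i) ^ s * (f n * (ζ ^ i * t) ^ n) =
        f n * t ^ n * ∑ i ∈ Finset.range m, (ζ ^ i) ^ (n + s) := by
      rw [Finset.mul_sum]
      exact Finset.sum_congr rfl fun i _ => by rw [mul_pow, pow_add]; ring
    rw [e, sum_primitiveRoot_pow hζ]
    split_ifs
    · rw [mul_div_assoc, div_self hm', mul_one]
    · rw [mul_zero, zero_div]
  simp only [h2] at h1
  have hinj : Function.Injective fun n : ℕ => m * n + r := fun a b hab =>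
    Nat.eq_of_mul_eq_mul_left (Nat.pos_of_ne_zero hm) (Nat.add_right_cancel hab)
  rw [← hinj.hasSum_iff] at h1
  · refine h1.congr_fun fun n => ?_
    rw [Function.comp_apply, if_pos (by rw [add_assoc]; exact (dvd_mul_right m n).add hs)]
  · intro n hn
    refine if_neg fun hd => hn ⟨n / m, ?_⟩
    have h3 : n ≡ r [MOD m] := Nat.ModEq.add_right_cancel' s
      ((Nat.modEq_zero_iff_dvd.2 hd).trans (Nat.modEq_zero_iff_dvd.2 hs).symm)
    have h4 : n % m = r := by rw [h3, Nat.mod_eq_of_lt hr]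
    show m * (n / m) + r = n
    rw [← h4, Nat.div_add_mod]

theorem brk_root_mul {t w : ℂ} (hw : w ^ 11 = 1) (a : ℤ) : brk (w * t) a = w ^ (-brkExp a) * brk t a := by
  have e1 : (w * t) ^ 121 = t ^ 121 := by
    rw [mul_pow, show 121 = 11 * 11 by norm_num, pow_mul w, hw, one_pow, one_mul]
  have e2 : (w * t) ^ (11 * a) = t ^ (11 * a) := by
    rw [mul_zpow, zpow_mul w, show w ^ (11 : ℤ) = w ^ 11 by norm_cast, hw, one_zpow, one_mul]
  rw [brk, e1, e2, mul_zpow, mul_assoc, brk]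

theorem rankMock_root_mul {t w : ℂ} (hw : w ^ 11 = 1) (r : ℤ) :
    rankMock (w * t) r = w ^ (3 * brkExp r) * rankMock t r := by
  have e1 : (w * t) ^ 121 = t ^ 121 := by
    rw [mul_pow, show 121 = 11 * 11 by norm_num, pow_mul w, hw, one_pow, one_mul]
  have e2 : (w * t) ^ (11 * r) = t ^ (11 * r) := by
    rw [mul_zpow, zpow_mul w, show w ^ (11 : ℤ) = w ^ 11 by norm_cast, hw, one_zpow, one_mul]
  rw [rankMock, e1, e2, mul_zpow, rankMock]
  ring

theorem curve_root_mul {t w : ℂ} (hw : w ^ 11 = 1) :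
    brk (w * t) 1 = w ^ 6 * brk t 1 ∧ curveX (w * t) = curveX t ∧ curveY (w * t) = curveY t ∧
      thetaRatio (w * t) = w ^ 7 * thetaRatio t := by
  have w0 : w ≠ 0 := by
    rintro rfl
    norm_num at hw
  have e : ∀ k n : ℤ, ∀ m : ℕ, k = 11 * n + m → w ^ k = w ^ m := by
    rintro k n m rfl
    rw [zpow_add₀ w0, zpow_mul, show w ^ (11 : ℤ) = w ^ 11 by norm_cast, hw, one_zpow, one_mul, zpow_natCast]
  have b1 : brk (w * t) 1 = w ^ 6 * brk t 1 := by
    rw [brk_root_mul hw, e (-brkExp 1) (-1) 6 (by decide)]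
  have b2 : brk (w * t) 2 = w ^ 2 * brk t 2 := by
    rw [brk_root_mul hw, e (-brkExp 2) (-1) 2 (by decide)]
  have b3 : brk (w * t) 3 = w ^ 10 * brk t 3 := by
    rw [brk_root_mul hw, e (-brkExp 3) (-2) 10 (by decide)]
  have b4 : brk (w * t) 4 = w ^ 8 * brk t 4 := by
    rw [brk_root_mul hw, e (-brkExp 4) (-2) 8 (by decide)]
  have b5 : brk (w * t) 5 = w ^ 7 * brk t 5 := by
    rw [brk_root_mul hw, e (-brkExp 5) (-2) 7 (by decide)]
  refine ⟨b1, ?_, ?_, ?_⟩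
  · rw [curveX, b1, b2, b3, curveX, show (w ^ 6 * brk t 1) ^ 2 = w ^ 12 * brk t 1 ^ 2 by ring,
      show w ^ 2 * brk t 2 * (w ^ 10 * brk t 3) = w ^ 12 * (brk t 2 * brk t 3) by ring,
      mul_div_mul_left _ _ (pow_ne_zero _ w0)]
  · rw [curveY, b1, b2, b3, b4, b5, curveY,
      show w ^ 6 * brk t 1 * (w ^ 10 * brk t 3) * (w ^ 7 * brk t 5) = w ^ 11 * (w ^ 12 * (brk t 1 * brk t 3 * brk t 5)) by ring,
      show (w ^ 2 * brk t 2) ^ 2 * (w ^ 8 * brk t 4) = w ^ 12 * (brk t 2 ^ 2 * brk t 4) by ring, hw, one_mul,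
      mul_div_mul_left _ _ (pow_ne_zero _ w0)]
  · rw [thetaRatio, b1, b2, thetaRatio]
    have h7 : w ^ 2 = w ^ 6 * w ^ 7 := by rw [← pow_add, show 6 + 7 = 11 + 2 by rfl, pow_add, hw, one_mul]
    rw [h7, mul_assoc, mul_div_mul_left _ _ (pow_ne_zero _ w0), mul_div_assoc]

theorem sum_mul_sum_extract {ζ d p : ℂ} (hζ : IsPrimitiveRoot ζ 11) (A P : ℕ → ℂ) (hp : d ^ 11 * p = 1) :
    (∑ i ∈ Finset.range 11, (ζ ^ i) ^ 9 * ((∑ j ∈ Finset.range 11, A j * ((ζ ^ i) ^ 7 * d) ^ j) *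
      ∑ k ∈ Finset.range 11, P k * ((ζ ^ i) ^ 7 * d) ^ k)) * p =
      11 * d ^ 5 * ((∑ j ∈ Finset.range 6, A j * P (5 - j)) * p + ∑ j ∈ Finset.range 5, A (j + 6) * P (10 - j)) := by
  have e : ∀ i, (ζ ^ i) ^ 9 * ((∑ j ∈ Finset.range 11, A j * ((ζ ^ i) ^ 7 * d) ^ j) *
      ∑ k ∈ Finset.range 11, P k * ((ζ ^ i) ^ 7 * d) ^ k) =
      ∑ j ∈ Finset.range 11, ∑ k ∈ Finset.range 11, A j * P k * d ^ (j + k) * (ζ ^ i) ^ (9 + 7 * (j + k)) := fun i => by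
    rw [Finset.sum_mul_sum, Finset.mul_sum]
    refine Finset.sum_congr rfl fun j _ => ?_
    rw [Finset.mul_sum]
    refine Finset.sum_congr rfl fun k _ => ?_
    rw [mul_pow, mul_pow, ← pow_mul, ← pow_mul (ζ ^ i), pow_add (ζ ^ i) 9, mul_add, pow_add (ζ ^ i), pow_add d]
    ring
  simp only [e]
  rw [Finset.sum_comm]
  have e2 : ∀ j, ∑ i ∈ Finset.range 11, ∑ k ∈ Finset.range 11, A j * P k * d ^ (j + k) * (ζ ^ i) ^ (9 + 7 * (j + k)) =
      ∑ k ∈ Finset.range 11, A j * P k * d ^ (j + k) * if 11 ∣ 9 + 7 * (j + k) then 11 else 0 := fun j => by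
    rw [Finset.sum_comm]
    refine Finset.sum_congr rfl fun k _ => ?_
    rw [← Finset.mul_sum, sum_primitiveRoot_pow hζ]
    norm_num
  simp only [e2]
  simp [Finset.sum_range_succ]
  linear_combination 11 * d ^ 5 * (A 6 * P 10 + A 7 * P 9 + A 8 * P 8 + A 9 * P 7 + A 10 * P 6) * hp

theorem dissection_root_mul {t w : ℂ} (h0 : t ≠ 0) (h1 : ‖t‖ < 1) (hw : w ^ 11 = 1) (c : Fin 7 → ℤ) (l : Fin 5 → ℤ)
    (a b₁ b₂ b₃ b₄ b₅ j : ℂ) (hΨ : curveDisc (curveX t) (curveY t) ≠ 0) :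
    w ^ 9 * (j ^ 2 * ((w * t) ^ 5)⁻¹ * (thetaPart c l (w * t) / eulerRatio (w * t)) + a * (w * t)⁻¹ +
      (b₁ * rankMock (w * t) 1 + b₂ * rankMock (w * t) 2 + b₃ * rankMock (w * t) 3 + b₄ * rankMock (w * t) 4 +
        b₅ * rankMock (w * t) 5) * ((w * t) ^ 5 * j)⁻¹) =
    j ^ 2 * (t ^ 5)⁻¹ * (brk t 1 * (curveY t * (1 - curveX t) * (1 + curveY t)) *
        curveDisc (curveX t) (curveY t) ^ 5)⁻¹ *
      (w ^ 9 * ((∑ j ∈ Finset.range 11, thetaCoeff c l (curveX t) (curveY t) j * (w ^ 7 * thetaRatio t) ^ j) *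
        ∑ k ∈ Finset.range 11, invCoeff (curveX t) (curveY t) k * (w ^ 7 * thetaRatio t) ^ k)) +
    (w ^ 8 * (a * t⁻¹) + (w ^ 30 * (b₁ * rankMock t 1) + w ^ 42 * (b₂ * rankMock t 2) + w ^ 51 * (b₃ * rankMock t 3) +
        w ^ 57 * (b₄ * rankMock t 4) + w ^ 60 * (b₅ * rankMock t 5)) * (t ^ 5 * j)⁻¹) := by
  have w0 : w ≠ 0 := by
    rintro rfl
    norm_num at hw
  have i1 : w ^ 9 * w⁻¹ = w ^ 8 := by field_simp
  have i5 : (w ^ 5)⁻¹ = w ^ 6 := by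
    exact inv_eq_of_mul_eq_one_right (by rw [← pow_add, hw])
  have h0' : w * t ≠ 0 := mul_ne_zero w0 h0
  have h1' : ‖w * t‖ < 1 := by
    rw [norm_mul, (Complex.norm_eq_one_of_pow_eq_one hw (by norm_num) : ‖w‖ = 1), one_mul]
    exact h1
  obtain ⟨hb, hX, hY, hD⟩ := curve_root_mul (t := t) hw
  have hP := thetaPart_mul h0' h1' c l
  have hI := mul_sum_invCoeff (curve_equation h0' h1') (thetaRatio_pow_eleven h0' h1')
  rw [← eulerRatio_eq_thetaRatio h0' h1'] at hI
  rw [hX, hY, hD, hb] at hP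
  rw [hX, hY, hD] at hI
  obtain ⟨hx, hy, hd, hg, hh⟩ := curve_units_ne_zero h0 h1
  have b1 := (brk_ne_zero_aux h0 h1).1
  have hE : eulerRatio (w * t) ≠ 0 := fun h => pow_ne_zero 5 hΨ (by rw [← hI, h, zero_mul])
  have hU : curveY t * (1 - curveX t) * (1 + curveY t) ≠ 0 := mul_ne_zero (mul_ne_zero hy hg) hh
  have hmain : thetaPart c l (w * t) / eulerRatio (w * t) * w ^ 6 =
      (brk t 1 * (curveY t * (1 - curveX t) * (1 + curveY t)) * curveDisc (curveX t) (curveY t) ^ 5)⁻¹ *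
      ((∑ j ∈ Finset.range 11, thetaCoeff c l (curveX t) (curveY t) j * (w ^ 7 * thetaRatio t) ^ j) *
        ∑ k ∈ Finset.range 11, invCoeff (curveX t) (curveY t) k * (w ^ 7 * thetaRatio t) ^ k) := by
    rw [← hP, ← hI]
    generalize (∑ k ∈ Finset.range 11, invCoeff (curveX t) (curveY t) k * (w ^ 7 * thetaRatio t) ^ k) = T at *
    have hT : T ≠ 0 := fun h => pow_ne_zero 5 hΨ (by rw [← hI, h, mul_zero])
    field_simp
  rw [rankMock_root_mul hw, rankMock_root_mul hw, rankMock_root_mul hw, rankMock_root_mul hw, rankMock_root_mul hw,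
    mul_pow w t 5, mul_inv, mul_assoc (w ^ 5), mul_inv (w ^ 5), i5, mul_inv w,
    show 3 * brkExp 1 = ((15 : ℕ) : ℤ) by decide, show 3 * brkExp 2 = ((27 : ℕ) : ℤ) by decide,
    show 3 * brkExp 3 = ((36 : ℕ) : ℤ) by decide, show 3 * brkExp 4 = ((42 : ℕ) : ℤ) by decide,
    show 3 * brkExp 5 = ((45 : ℕ) : ℤ) by decide]
  simp only [zpow_natCast]
  linear_combination w ^ 9 * j ^ 2 * (t ^ 5)⁻¹ * hmain + a * t⁻¹ * i1

theorem hasSum_rankCrankComb_residue {t : ℂ} (h0 : t ≠ 0) (h1 : ‖t‖ < 1) (c : Fin 7 → ℤ) (l : Fin 5 → ℤ)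
    (hc : c 0 + c 1 + c 2 + c 3 + c 4 + c 5 = 0)
    (l1 : 3 * l 0 + 2 * l 1 + 2 * l 2 + 2 * l 3 + l 4 = 2 * c 2 - c 3 - c 1 - 2 * c 6)
    (l2 : l 3 + 2 * l 4 = c 2 - c 3 - 2 * c 0 + c 1)
    (l3 : -l 0 + l 1 = -c 3 + c 5)
    (l4 : l 2 - l 3 = -2 * c 0 + c 1 + c 4 - c 5 - c 6)
    (l5 : -l 1 + l 2 - l 4 = c 3 - c 4 + c 1 - c 2 - c 6)
    {E p : ℂ} (hp : p = curveX t ^ 3 * curveY t ^ 2 * (1 - curveX t) * (1 + curveY t))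
    (hE : (∑ j ∈ Finset.range 6, thetaCoeff c l (curveX t) (curveY t) j * invCoeff (curveX t) (curveY t) (5 - j)) * p +
      ∑ j ∈ Finset.range 5, thetaCoeff c l (curveX t) (curveY t) (j + 6) * invCoeff (curveX t) (curveY t) (10 - j) =
        E * p) :
    HasSum (fun n => (rankCrankComb c (11 * n + 2) : ℂ) * t ^ (11 * n + 2))
      (qpoch (t ^ 121) (t ^ 121) ^ 2 * (t ^ 5)⁻¹ * (brk t 1 * (curveY t * (1 - curveX t) * (1 + curveY t)) *
        curveDisc (curveX t) (curveY t) ^ 5)⁻¹ * (thetaRatio t ^ 5 * E)) := by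
  have hζ : IsPrimitiveRoot (Complex.exp (2 * Real.pi * Complex.I / 11)) 11 := by
    exact_mod_cast Complex.isPrimitiveRoot_exp 11 (by norm_num)
  generalize Complex.exp (2 * Real.pi * Complex.I / 11) = ζ at hζ
  have hw : ∀ i, (ζ ^ i) ^ 11 = 1 := fun i => by rw [← pow_mul, mul_comm, pow_mul, hζ.pow_eq_one, one_pow]
  have ht : ∀ i, (ζ ^ i * t) ^ 121 = t ^ 121 := fun i => by
    rw [mul_pow, show 121 = 11 * 11 by norm_num, pow_mul (ζ ^ i), hw, one_pow, one_mul]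
  have hζ0 : ζ ≠ 0 := hζ.ne_zero (by norm_num)
  have hΨ : curveDisc (curveX t) (curveY t) ≠ 0 := by
    obtain ⟨b1, -, b3, b4, b5⟩ := brk_ne_zero_aux h0 h1
    have hJ := qpoch_self_ne_zero (norm_pow_121_lt_one h1)
    rw [curveDisc_eq h0 h1]
    exact neg_ne_zero.2 (div_ne_zero (mul_ne_zero (pow_ne_zero _ h0) (mul_ne_zero (mul_ne_zero (mul_ne_zero
      (pow_ne_zero _ b1) (pow_ne_zero _ b3)) (pow_ne_zero _ b4)) (pow_ne_zero _ b5))) (pow_ne_zero _ hJ))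
  have hr := hasSum_residue_of_hasSum (f := fun n => (rankCrankComb c n : ℂ)) (t := t) (r := 2) (s := 9)
    (S := fun w => qpoch (t ^ 121) (t ^ 121) ^ 2 * ((w * t) ^ 5)⁻¹ *
      (thetaPart c l (w * t) / eulerRatio (w * t)) + (c 3 - c 2) * (w * t)⁻¹ +
        ((c 2 - c 3) * rankMock (w * t) 1 + (-2 * c 0 + c 1) * rankMock (w * t) 2 + (-c 3 + c 4) * rankMock (w * t) 3 +
          (c 4 - c 5) * rankMock (w * t) 4 + (c 1 - c 2) * rankMock (w * t) 5) *
            ((w * t) ^ 5 * qpoch (t ^ 121) (t ^ 121))⁻¹) (by norm_num) hζ (by norm_num) (by norm_num) fun i _ => by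
    have h := hasSum_rankCrankComb_dissection (t := ζ ^ i * t) (mul_ne_zero (pow_ne_zero _ hζ0) h0)
      (by rw [norm_mul, Complex.norm_eq_one_of_pow_eq_one (hw i) (by norm_num), one_mul]; exact h1) c l hc l1 l2 l3 l4 l5
    rw [ht i] at h
    exact h
  convert hr using 1
  rw [Finset.sum_congr rfl fun i _ => dissection_root_mul h0 h1 (hw i) c l _ _ _ _ _ _ _ hΨ]
  simp only [Finset.sum_add_distrib, ← Finset.sum_mul, ← Finset.mul_sum, sum_primitiveRoot_pow hζ]
  norm_num
  have hD := thetaRatio_pow_eleven h0 h1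
  rw [← hp] at hD
  have hp0 : p ≠ 0 := fun h => by
    rw [h, mul_zero] at hD
    exact zero_ne_one hD
  have hx := sum_mul_sum_extract hζ (thetaCoeff c l (curveX t) (curveY t)) (invCoeff (curveX t) (curveY t)) hD
  rw [hE, ← mul_assoc] at hx
  rw [mul_right_cancel₀ hp0 hx]
  ring

/-- On `(0, 1)` the function is the sum of a power series with nonnegative coefficients. -/
def HasNonnegSeries (F : ℝ → ℂ) : Prop :=
  ∃ a : ℕ → ℝ, (∀ n, 0 ≤ a n) ∧ ∀ x ∈ Set.Ioo (0 : ℝ) 1, HasSum (fun n => ((a n * x ^ n : ℝ) : ℂ)) (F x)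

namespace HasNonnegSeries

theorem congr {F G : ℝ → ℂ} (hF : HasNonnegSeries F) (h : ∀ x ∈ Set.Ioo (0 : ℝ) 1, F x = G x) :
    HasNonnegSeries G := by
  obtain ⟨a, ha, hs⟩ := hF
  exact ⟨a, ha, fun x hx => h x hx ▸ hs x hx⟩

theorem const_mul_pow {c : ℝ} (hc : 0 ≤ c) (m : ℕ) : HasNonnegSeries fun x => (c : ℂ) * (x : ℂ) ^ m := by
  refine ⟨fun n => if n = m then c else 0, fun n => by dsimp only; split_ifs <;> simp [hc], fun x _ => ?_⟩
  refine (hasSum_ite_eq m ((c : ℂ) * (x : ℂ) ^ m)).congr_fun fun n => ?_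
  dsimp only
  split_ifs with h
  · rw [h]
    push_cast
    rfl
  · simp

theorem one_div_one_sub_pow {m : ℕ} (hm : m ≠ 0) : HasNonnegSeries fun x => (1 - (x : ℂ) ^ m)⁻¹ := by
  refine ⟨fun n => if m ∣ n then 1 else 0, fun n => by dsimp only; split_ifs <;> simp, fun x hx => ?_⟩
  have hinj : Function.Injective fun n : ℕ => m * n := fun a b hab =>
    Nat.eq_of_mul_eq_mul_left (Nat.pos_of_ne_zero hm) hab
  rw [← hinj.hasSum_iff]
  · refine (hasSum_geometric_of_norm_lt_one (ξ := (x : ℂ) ^ m) ?_).congr_fun fun n => ?_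
    · refine norm_lt_one_pow ?_ hm
      rw [Complex.norm_real, Real.norm_of_nonneg hx.1.le]
      exact hx.2
    · simp [pow_mul]
  · intro n hn
    have hd : ¬m ∣ n := fun ⟨k, hk⟩ => hn ⟨k, hk.symm⟩
    simp [hd]

theorem add {F G : ℝ → ℂ} (hF : HasNonnegSeries F) (hG : HasNonnegSeries G) :
    HasNonnegSeries fun x => F x + G x := by
  obtain ⟨a, ha, hs⟩ := hF
  obtain ⟨b, hb, ht⟩ := hG
  refine ⟨fun n => a n + b n, fun n => add_nonneg (ha n) (hb n), fun x hx => ?_⟩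
  refine ((hs x hx).add (ht x hx)).congr_fun fun n => ?_
  push_cast
  ring

theorem mul {F G : ℝ → ℂ} (hF : HasNonnegSeries F) (hG : HasNonnegSeries G) :
    HasNonnegSeries fun x => F x * G x := by
  obtain ⟨a, ha, hs⟩ := hF
  obtain ⟨b, hb, ht⟩ := hG
  refine ⟨fun n => ∑ k ∈ Finset.range (n + 1), a k * b (n - k),
    fun n => Finset.sum_nonneg fun k _ => mul_nonneg (ha k) (hb _), fun x hx => ?_⟩
  dsimp only
  rw [← (hs x hx).tsum_eq, ← (ht x hx).tsum_eq]
  refine (hasSum_sum_range_mul_of_summable_norm (hs x hx).summable.norm (ht x hx).summable.norm).congr_fun fun n => ?_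
  rw [Finset.sum_mul, Complex.ofReal_sum]
  refine Finset.sum_congr rfl fun k hk => ?_
  have hk' : k + (n - k) = n := by
    have := Finset.mem_range.1 hk
    omega
  rw [← Complex.ofReal_mul]
  congr 1
  calc a k * b (n - k) * x ^ n = a k * b (n - k) * x ^ (k + (n - k)) := by rw [hk']
    _ = _ := by rw [pow_add]; ring

theorem prod {F : ℕ → ℝ → ℂ} (hF : ∀ i, HasNonnegSeries (F i)) (n : ℕ) :
    HasNonnegSeries fun x => ∏ i ∈ Finset.range n, F i x := by
  induction n with
  | zero => exact (const_mul_pow zero_le_one 0).congr fun x _ => by simp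
  | succ n ih => exact (ih.mul (hF n)).congr fun x _ => (Finset.prod_range_succ _ _).symm

theorem pow {F : ℝ → ℂ} (hF : HasNonnegSeries F) (n : ℕ) : HasNonnegSeries fun x => F x ^ n :=
  (prod (fun _ => hF) n).congr fun x _ => by simp

theorem of_tendsto {F : ℕ → ℝ → ℂ} {G : ℝ → ℂ} (hF : ∀ k, HasNonnegSeries (F k))
    (h : ∀ x ∈ Set.Ioo (0 : ℝ) 1, Tendsto (fun k => F k x) atTop (𝓝 (G x))) : HasNonnegSeries G := by
  choose a ha hs using hF
  have hB : ∀ x ∈ Set.Ioo (0 : ℝ) 1, ∃ B, ∀ k n, a k n * x ^ n ≤ B := fun x hx => by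
    obtain ⟨B, hB⟩ := (h x hx).norm.bddAbove_range
    refine ⟨B, fun k n => ?_⟩
    have h1 := Complex.reCLM.hasSum (hs k x hx)
    have h2 := le_hasSum h1 n fun j _ => mul_nonneg (ha k j) (pow_nonneg hx.1.le j)
    exact (h2.trans (Complex.re_le_norm _)).trans (hB ⟨k, rfl⟩)
  have hlim : ∀ n, ∃ b, 0 ≤ b ∧ Tendsto (fun k => a k n) (hyperfilter ℕ) (𝓝 b) := fun n => by
    obtain ⟨B, hB⟩ := hB 2⁻¹ ⟨by norm_num, by norm_num⟩
    have hmem : ∀ k, a k n ∈ Set.Icc 0 (B * 2 ^ n) := fun k => ⟨ha k n, by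
      have := hB k n
      rwa [inv_pow, ← div_eq_mul_inv, div_le_iff₀ (by positivity)] at this⟩
    obtain ⟨b, hb, hl⟩ := (isCompact_Icc (a := (0 : ℝ)) (b := B * 2 ^ n)).ultrafilter_le_nhds
      ((hyperfilter ℕ).map fun k => a k n)
      (le_principal_iff.2 (Ultrafilter.mem_map.2 (Filter.univ_mem' hmem)))
    exact ⟨b, hb.1, hl⟩
  choose b hb hl using hlim
  refine ⟨b, hb, fun x hx => ?_⟩
  obtain ⟨y, hy1, hy2⟩ := exists_between hx.2
  have hy0 : 0 < y := hx.1.trans hy1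
  obtain ⟨B, hB⟩ := hB y ⟨hy0, hy2⟩
  have hle : ∀ k n, ‖((a k n * x ^ n : ℝ) : ℂ)‖ ≤ B * (x / y) ^ n := fun k n => by
    rw [Complex.norm_real, Real.norm_of_nonneg (mul_nonneg (ha k n) (pow_nonneg hx.1.le n)), div_pow]
    calc a k n * x ^ n = a k n * y ^ n * (x ^ n / y ^ n) := by field_simp
      _ ≤ _ := mul_le_mul_of_nonneg_right (hB k n) (by have := hx.1; positivity)
  have hsum : Summable fun n => B * (x / y) ^ n :=
    (summable_geometric_of_lt_one (div_nonneg hx.1.le hy0.le) ((div_lt_one hy0).2 hy1)).mul_left B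
  have ht : ∀ n, Tendsto (fun k => ((a k n * x ^ n : ℝ) : ℂ)) (hyperfilter ℕ) (𝓝 ((b n * x ^ n : ℝ) : ℂ)) := fun n =>
    (Complex.continuous_ofReal.tendsto _).comp ((hl n).mul_const _)
  have h1 := tendsto_tsum_of_dominated_convergence hsum ht (Filter.univ_mem' fun k n => hle k n)
  have h2 : Tendsto (fun k => F k x) (hyperfilter ℕ) (𝓝 (G x)) :=
    (h x hx).mono_left (Nat.cofinite_eq_atTop ▸ hyperfilter_le_cofinite)
  simp only [fun k => (hs k x hx).tsum_eq] at h1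
  rw [tendsto_nhds_unique h2 h1]
  refine (Summable.of_norm_bounded hsum fun n => ?_).hasSum
  exact le_of_tendsto (ht n).norm (Filter.univ_mem' fun k => hle k n)

theorem coeff_nonneg {F : ℝ → ℂ} (hF : HasNonnegSeries F) {c : ℕ → ℝ}
    (h : ∀ x ∈ Set.Ioo (0 : ℝ) 1, HasSum (fun n => ((c n * x ^ n : ℝ) : ℂ)) (F x)) (n : ℕ) : 0 ≤ c n := by
  obtain ⟨a, ha, hs⟩ := hF
  have hd : ∀ x ∈ Set.Ioo (0 : ℝ) 1, HasSum (fun n => (c n - a n) * x ^ n) 0 := fun x hx => by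
    have h1 := ((h x hx).sub (hs x hx))
    rw [sub_self] at h1
    have h2 := Complex.reCLM.hasSum h1
    rw [map_zero] at h2
    refine h2.congr_fun fun n => ?_
    rw [← Complex.ofReal_sub, Complex.reCLM_apply, Complex.ofReal_re]
    ring
  suffices h0 : c n - a n = 0 by
    rw [sub_eq_zero.1 h0]
    exact ha n
  induction n using Nat.strong_induction_on with
  | _ n ih =>
    have hd' : ∀ x ∈ Set.Ioo (0 : ℝ) 1, HasSum (fun k => (c (k + n) - a (k + n)) * x ^ k) 0 := fun x hx => by
      have h1 := (hasSum_nat_add_iff' n).2 (hd x hx)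
      rw [Finset.sum_eq_zero fun k hk => by rw [ih k (Finset.mem_range.1 hk), zero_mul], sub_zero] at h1
      have h2 := h1.mul_right (x ^ n)⁻¹
      rw [zero_mul] at h2
      refine h2.congr_fun fun k => ?_
      have := pow_ne_zero n hx.1.ne'
      rw [pow_add]
      field_simp
    have hsum := (hd' 2⁻¹ ⟨by norm_num, by norm_num⟩).summable.norm
    have ht : ∀ k, Tendsto (fun x : ℝ => (c (k + n) - a (k + n)) * x ^ k) (𝓝[>] 0)
        (𝓝 ((c (k + n) - a (k + n)) * 0 ^ k)) := fun k =>
      ((continuous_const.mul (continuous_id.pow k)).tendsto 0).mono_left nhdsWithin_le_nhds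
    have hI : Set.Ioo (0 : ℝ) 2⁻¹ ∈ 𝓝[>] (0 : ℝ) := Ioo_mem_nhdsGT (by norm_num)
    have h1 := tendsto_tsum_of_dominated_convergence hsum ht (by
      filter_upwards [hI] with x hx k
      rw [norm_mul, norm_mul, norm_pow, norm_pow, Real.norm_of_nonneg hx.1.le]
      refine mul_le_mul_of_nonneg_left (pow_le_pow_left₀ hx.1.le ?_ k) (norm_nonneg _)
      exact hx.2.le.trans (Real.le_norm_self _))
    have h2 : Tendsto (fun x : ℝ => ∑' k, (c (k + n) - a (k + n)) * x ^ k) (𝓝[>] 0) (𝓝 0) := by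
      refine tendsto_const_nhds.congr' ?_
      filter_upwards [hI] with x hx
      exact (hd' x ⟨hx.1, hx.2.trans (by norm_num)⟩).tsum_eq.symm
    have h3 := tendsto_nhds_unique h1 h2
    rw [tsum_eq_single 0 fun k hk => by rw [zero_pow hk, mul_zero]] at h3
    simpa using h3

end HasNonnegSeries

theorem qpoch_pow_ne_zero {x : ℝ} (hx : x ∈ Set.Ioo (0 : ℝ) 1) {m b : ℕ} (hm : m ≠ 0) (hb : b ≠ 0) :
    qpoch ((x : ℂ) ^ m) ((x : ℂ) ^ b) ≠ 0 := by
  have h1 : ‖(x : ℂ)‖ < 1 := by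
    rw [Complex.norm_real, Real.norm_of_nonneg hx.1.le]
    exact hx.2
  refine qpoch_ne_zero (norm_lt_one_pow h1 hm) fun k h => ?_
  rw [← pow_mul, ← pow_add] at h
  have h2 := norm_lt_one_pow h1 (n := b + m * k) (by omega)
  rw [h, norm_one] at h2
  exact lt_irrefl _ h2

theorem norm_ofReal_lt_one {x : ℝ} (hx : x ∈ Set.Ioo (0 : ℝ) 1) : ‖(x : ℂ)‖ < 1 := by
  rw [Complex.norm_real, Real.norm_of_nonneg hx.1.le]
  exact hx.2

namespace HasNonnegSeries

theorem inv_qpoch {m b : ℕ} (hm : m ≠ 0) (hb : b ≠ 0) :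
    HasNonnegSeries fun x => (qpoch ((x : ℂ) ^ m) ((x : ℂ) ^ b))⁻¹ := by
  refine of_tendsto (fun k => prod (fun i => one_div_one_sub_pow (m := b + m * i) (by omega)) k) fun x hx => ?_
  have h := (tendsto_qpoch (norm_lt_one_pow (norm_ofReal_lt_one hx) hm) ((x : ℂ) ^ b)).inv₀ (qpoch_pow_ne_zero hx hm hb)
  refine h.congr fun k => ?_
  rw [← Finset.prod_inv_distrib]
  exact Finset.prod_congr rfl fun i _ => by rw [pow_add, pow_mul]

theorem one_sub_pow_div {b c : ℕ} (hb : b ≠ 0) (hc : c ≠ 0) :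
    HasNonnegSeries fun x => (1 - (x : ℂ) ^ (b + c)) * ((1 - (x : ℂ) ^ b)⁻¹ * (1 - (x : ℂ) ^ c)⁻¹) := by
  refine ((one_div_one_sub_pow hb).add ((const_mul_pow zero_le_one c).mul (one_div_one_sub_pow hc))).congr
    fun x hx => ?_
  have h1 : 1 - (x : ℂ) ^ b ≠ 0 := fun h => by
    have h2 := norm_lt_one_pow (norm_ofReal_lt_one hx) hb
    rw [← sub_eq_zero.1 h, norm_one] at h2
    exact lt_irrefl _ h2
  have h2 : 1 - (x : ℂ) ^ c ≠ 0 := fun h => by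
    have h2 := norm_lt_one_pow (norm_ofReal_lt_one hx) hc
    rw [← sub_eq_zero.1 h, norm_one] at h2
    exact lt_irrefl _ h2
  rw [pow_add]
  push_cast
  field_simp
  ring

theorem qpoch_div {m b c : ℕ} (hm : m ≠ 0) (hb : b ≠ 0) (hc : c ≠ 0) :
    HasNonnegSeries fun x => qpoch (((x : ℂ) ^ m) ^ 2) ((x : ℂ) ^ (b + c)) *
      ((qpoch ((x : ℂ) ^ m) ((x : ℂ) ^ b))⁻¹ * (qpoch ((x : ℂ) ^ m) ((x : ℂ) ^ c))⁻¹) := by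
  refine of_tendsto (fun k => prod (fun i => one_sub_pow_div (b := b + m * i) (c := c + m * i)
    (by omega) (by omega)) k) fun x hx => ?_
  have h1 := norm_lt_one_pow (norm_ofReal_lt_one hx) hm
  have h := (tendsto_qpoch (norm_lt_one_pow h1 two_ne_zero) ((x : ℂ) ^ (b + c))).mul
    (((tendsto_qpoch h1 ((x : ℂ) ^ b)).inv₀ (qpoch_pow_ne_zero hx hm hb)).mul
      ((tendsto_qpoch h1 ((x : ℂ) ^ c)).inv₀ (qpoch_pow_ne_zero hx hm hc)))
  refine h.congr fun k => ?_
  rw [← Finset.prod_inv_distrib, ← Finset.prod_inv_distrib, ← Finset.prod_mul_distrib, ← Finset.prod_mul_distrib]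
  refine Finset.prod_congr rfl fun i _ => ?_
  rw [pow_add _ b (m * i), pow_add _ c (m * i), pow_mul, show b + m * i + (c + m * i) = b + c + m * i * 2 by ring,
    pow_add _ (b + c), pow_mul, pow_mul, ← pow_mul _ i 2, ← pow_mul _ 2 i, mul_comm i 2]

theorem eulerQuot (s f₁ f₂ e₃ e₄ e₅ : ℕ) :
    HasNonnegSeries fun x => 11 * (x : ℂ) ^ s * qpoch ((x : ℂ) ^ 11) ((x : ℂ) ^ 11) *
      ((qpoch ((x : ℂ) ^ 11) ((x : ℂ) ^ 1) * qpoch ((x : ℂ) ^ 11) ((x : ℂ) ^ 10)) ^ (f₁ + 1) *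
        (qpoch ((x : ℂ) ^ 11) ((x : ℂ) ^ 2) * qpoch ((x : ℂ) ^ 11) ((x : ℂ) ^ 9)) ^ (f₂ + 1) *
        (qpoch ((x : ℂ) ^ 11) ((x : ℂ) ^ 3) * qpoch ((x : ℂ) ^ 11) ((x : ℂ) ^ 8)) ^ e₃ *
        (qpoch ((x : ℂ) ^ 11) ((x : ℂ) ^ 4) * qpoch ((x : ℂ) ^ 11) ((x : ℂ) ^ 7)) ^ e₄ *
        (qpoch ((x : ℂ) ^ 11) ((x : ℂ) ^ 5) * qpoch ((x : ℂ) ^ 11) ((x : ℂ) ^ 6)) ^ e₅)⁻¹ := by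
  have i : ∀ a : ℕ, a ≠ 0 → HasNonnegSeries fun x => (qpoch ((x : ℂ) ^ 11) ((x : ℂ) ^ a))⁻¹ := fun a ha =>
    inv_qpoch (by norm_num) ha
  have d₁ := qpoch_div (m := 11) (b := 1) (c := 10) (by norm_num) (by norm_num) (by norm_num)
  have d₂ := qpoch_div (m := 11) (b := 13) (c := 9) (by norm_num) (by norm_num) (by norm_num)
  refine ((((((((const_mul_pow (c := 11) (by norm_num) s).mul d₁).mul d₂).mul
    (one_div_one_sub_pow (m := 2) two_ne_zero)).mul (((i 1 (by norm_num)).mul (i 10 (by norm_num))).pow f₁)).mul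
    (((i 2 (by norm_num)).mul (i 9 (by norm_num))).pow f₂)).mul
    (((i 3 (by norm_num)).mul (i 8 (by norm_num))).pow e₃)).mul
    ((((i 4 (by norm_num)).mul (i 7 (by norm_num))).pow e₄).mul
    (((i 5 (by norm_num)).mul (i 6 (by norm_num))).pow e₅))).congr fun x hx => ?_
  have h1 := norm_lt_one_pow (norm_ofReal_lt_one hx) (n := 11) (by norm_num)
  have hJ := qpoch_eq_prod_residues h1 ((x : ℂ) ^ 11) two_ne_zero
  rw [Finset.prod_range_succ, Finset.prod_range_one, pow_zero, mul_one, pow_one, ← pow_add] at hJ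
  have h2 := qpoch_eq_mul h1 ((x : ℂ) ^ 2)
  rw [← pow_add] at h2
  rw [hJ, h2]
  simp only [mul_inv, mul_pow, inv_pow, Nat.reduceAdd, pow_succ _ f₁, pow_succ _ f₂]
  push_cast
  ring

end HasNonnegSeries

theorem brk_eq_qpoch {t : ℂ} (h0 : t ≠ 0) (h1 : ‖t‖ < 1) {a N : ℕ} (ha : a ≤ 11) (hN : brkExp a = N) :
    brk t a = (t ^ N)⁻¹ * (qpoch ((t ^ 11) ^ 11) ((t ^ 11) ^ 11) *
      (qpoch ((t ^ 11) ^ 11) ((t ^ 11) ^ a) * qpoch ((t ^ 11) ^ 11) ((t ^ 11) ^ (11 - a)))) := by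
  have e1 : t ^ (11 * (a : ℤ)) = (t ^ 11) ^ a := by
    rw [← pow_mul]
    exact_mod_cast rfl
  have e2 : (t ^ 11) ^ 11 * ((t ^ 11) ^ a)⁻¹ = (t ^ 11) ^ (11 - a) := by
    rw [pow_sub₀ _ (pow_ne_zero _ h0) ha]
  rw [brk, hN, zpow_neg, zpow_natCast, e1, theta_eq_prod (pow_ne_zero _ h0) (norm_pow_121_lt_one h1)
    (pow_ne_zero _ (pow_ne_zero _ h0)), show t ^ 121 = (t ^ 11) ^ 11 by rw [← pow_mul], e2, mul_assoc (qpoch _ _)]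

theorem brk_monomial_eq {t : ℂ} (h0 : t ≠ 0) (h1 : ‖t‖ < 1) (e₁ e₂ e₃ e₄ e₅ : ℕ) :
    brk t 1 ^ e₁ * brk t 2 ^ e₂ * brk t 3 ^ e₃ * brk t 4 ^ e₄ * brk t 5 ^ e₅ =
      (t ^ (5 * e₁ + 9 * e₂ + 12 * e₃ + 14 * e₄ + 15 * e₅))⁻¹ *
        (qpoch ((t ^ 11) ^ 11) ((t ^ 11) ^ 11) ^ (e₁ + e₂ + e₃ + e₄ + e₅) *
        ((qpoch ((t ^ 11) ^ 11) ((t ^ 11) ^ 1) * qpoch ((t ^ 11) ^ 11) ((t ^ 11) ^ 10)) ^ e₁ *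
        (qpoch ((t ^ 11) ^ 11) ((t ^ 11) ^ 2) * qpoch ((t ^ 11) ^ 11) ((t ^ 11) ^ 9)) ^ e₂ *
        (qpoch ((t ^ 11) ^ 11) ((t ^ 11) ^ 3) * qpoch ((t ^ 11) ^ 11) ((t ^ 11) ^ 8)) ^ e₃ *
        (qpoch ((t ^ 11) ^ 11) ((t ^ 11) ^ 4) * qpoch ((t ^ 11) ^ 11) ((t ^ 11) ^ 7)) ^ e₄ *
        (qpoch ((t ^ 11) ^ 11) ((t ^ 11) ^ 5) * qpoch ((t ^ 11) ^ 11) ((t ^ 11) ^ 6)) ^ e₅)) := by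
  have k1 := brk_eq_qpoch h0 h1 (a := 1) (N := 5) (by norm_num) (by decide)
  have k2 := brk_eq_qpoch h0 h1 (a := 2) (N := 9) (by norm_num) (by decide)
  have k3 := brk_eq_qpoch h0 h1 (a := 3) (N := 12) (by norm_num) (by decide)
  have k4 := brk_eq_qpoch h0 h1 (a := 4) (N := 14) (by norm_num) (by decide)
  have k5 := brk_eq_qpoch h0 h1 (a := 5) (N := 15) (by norm_num) (by decide)
  norm_num only at k1 k2 k3 k4 k5
  rw [k1, k2, k3, k4, k5]
  generalize qpoch ((t ^ 11) ^ 11) ((t ^ 11) ^ 11) = j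
  simp only [mul_pow _ (j * _), mul_pow j, inv_pow, ← pow_mul, pow_add, mul_inv]
  ring

theorem residue_value_eq {t j b u B P Q Ψ m : ℂ} {s : ℕ} (h0 : t ≠ 0) (hj : j ≠ 0) (hb : b ≠ 0) (hu : u ≠ 0)
    (hB : B ≠ 0) (hP0 : P ≠ 0) (hP : P = (t ^ (128 + 11 * s))⁻¹ * (j ^ 13 * Q)) (hm : Ψ * m * P = b * u * B) :
    j ^ 2 * (t ^ 5)⁻¹ * (b * u * (-(t ^ 121 * B / j ^ 12)) ^ 5)⁻¹ *
      (Ψ * (-11 * (-(t ^ 121 * B / j ^ 12)) ^ 4 * m)) * (t ^ 2)⁻¹ = 11 * (t ^ 11) ^ s * j * Q⁻¹ := by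
  have hQ : Q ≠ 0 := by
    rintro rfl
    rw [mul_zero, mul_zero] at hP
    exact hP0 hP
  have hm' : Ψ * m = b * u * B * P⁻¹ := by rw [← hm, mul_inv_cancel_right₀ hP0]
  rw [show j ^ 2 * (t ^ 5)⁻¹ * (b * u * (-(t ^ 121 * B / j ^ 12)) ^ 5)⁻¹ *
      (Ψ * (-11 * (-(t ^ 121 * B / j ^ 12)) ^ 4 * m)) * (t ^ 2)⁻¹ = j ^ 2 * (t ^ 5)⁻¹ *
      (b * u * (-(t ^ 121 * B / j ^ 12)) ^ 5)⁻¹ * (-11 * (-(t ^ 121 * B / j ^ 12)) ^ 4) * (t ^ 2)⁻¹ * (Ψ * m) by ring,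
    hm', hP, pow_add, pow_mul]
  field_simp

theorem rankCrankComb_nonneg (c : Fin 7 → ℤ) (l : Fin 5 → ℤ)
    (hc : c 0 + c 1 + c 2 + c 3 + c 4 + c 5 = 0)
    (l1 : 3 * l 0 + 2 * l 1 + 2 * l 2 + 2 * l 3 + l 4 = 2 * c 2 - c 3 - c 1 - 2 * c 6)
    (l2 : l 3 + 2 * l 4 = c 2 - c 3 - 2 * c 0 + c 1)
    (l3 : -l 0 + l 1 = -c 3 + c 5)
    (l4 : l 2 - l 3 = -2 * c 0 + c 1 + c 4 - c 5 - c 6)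
    (l5 : -l 1 + l 2 - l 4 = c 3 - c 4 + c 1 - c 2 - c 6)
    (m : ℂ → ℂ → ℂ)
    (hE : ∀ x y : ℂ, y ^ 2 + (x ^ 2 + 1) * y + x = 0 →
      (∑ j ∈ Finset.range 6, thetaCoeff c l x y j * invCoeff x y (5 - j)) * (x ^ 3 * y ^ 2 * (1 - x) * (1 + y)) +
        ∑ j ∈ Finset.range 5, thetaCoeff c l x y (j + 6) * invCoeff x y (10 - j) =
      -11 * curveDisc x y ^ 4 * m x y * (x ^ 3 * y ^ 2 * (1 - x) * (1 + y)))
    (s f₁ f₂ e₃ e₄ e₅ : ℕ) (hs : 5 * (f₁ + 1) + 9 * (f₂ + 1) + 12 * e₃ + 14 * e₄ + 15 * e₅ = 128 + 11 * s)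
    (he : f₁ + 1 + (f₂ + 1) + e₃ + e₄ + e₅ = 13)
    (hm : ∀ t : ℂ, t ≠ 0 → ‖t‖ < 1 → thetaRatio t ^ 5 * m (curveX t) (curveY t) *
        (brk t 1 ^ (f₁ + 1) * brk t 2 ^ (f₂ + 1) * brk t 3 ^ e₃ * brk t 4 ^ e₄ * brk t 5 ^ e₅) =
      brk t 1 * (curveY t * (1 - curveX t) * (1 + curveY t)) *
        (brk t 1 ^ 5 * brk t 3 ^ 2 * brk t 4 ^ 3 * brk t 5 ^ 2)) (n : ℕ) :
    0 ≤ rankCrankComb c (11 * n + 2) := by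
  suffices h : 0 ≤ (rankCrankComb c (11 * n + 2) : ℝ) by exact_mod_cast h
  refine (HasNonnegSeries.eulerQuot s f₁ f₂ e₃ e₄ e₅).coeff_nonneg
    (c := fun n => (rankCrankComb c (11 * n + 2) : ℝ)) (fun x hx => ?_) n
  obtain ⟨t, ht0, htx⟩ : ∃ t : ℝ, 0 < t ∧ t ^ 11 = x :=
    ⟨x ^ ((11 : ℕ) : ℝ)⁻¹, Real.rpow_pos_of_pos hx.1 _, Real.rpow_inv_natCast_pow hx.1.le (by norm_num)⟩
  have ht1 : t < 1 := by
    by_contra! h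
    exact absurd (htx ▸ one_le_pow₀ h : 1 ≤ x) (not_le.2 hx.2)
  have h0 : (t : ℂ) ≠ 0 := Complex.ofReal_ne_zero.2 ht0.ne'
  have h1 : ‖(t : ℂ)‖ < 1 := norm_ofReal_lt_one ⟨ht0, ht1⟩
  have hxt : (x : ℂ) = (t : ℂ) ^ 11 := by rw [← htx, Complex.ofReal_pow]
  have h := (hasSum_rankCrankComb_residue h0 h1 c l hc l1 l2 l3 l4 l5 rfl (hE _ _ (curve_equation h0 h1))).mul_right
    ((t : ℂ) ^ 2)⁻¹
  have ht2 : (t : ℂ) ^ 2 ≠ 0 := pow_ne_zero _ h0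
  obtain ⟨-, hY, -, hg, hh⟩ := curve_units_ne_zero h0 h1
  obtain ⟨b1, b2, b3, b4, b5⟩ := brk_ne_zero_aux h0 h1
  have hJ := qpoch_self_ne_zero (norm_pow_121_lt_one h1)
  have hU := mul_ne_zero (mul_ne_zero hY hg) hh
  have hB : brk (t : ℂ) 1 ^ 5 * brk (t : ℂ) 3 ^ 2 * brk (t : ℂ) 4 ^ 3 * brk (t : ℂ) 5 ^ 2 ≠ 0 :=
    mul_ne_zero (mul_ne_zero (mul_ne_zero (pow_ne_zero _ b1) (pow_ne_zero _ b3)) (pow_ne_zero _ b4)) (pow_ne_zero _ b5)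
  have hP : brk (t : ℂ) 1 ^ (f₁ + 1) * brk (t : ℂ) 2 ^ (f₂ + 1) * brk (t : ℂ) 3 ^ e₃ * brk (t : ℂ) 4 ^ e₄ *
    brk (t : ℂ) 5 ^ e₅ ≠ 0 := mul_ne_zero (mul_ne_zero (mul_ne_zero (mul_ne_zero (pow_ne_zero _ b1)
      (pow_ne_zero _ b2)) (pow_ne_zero _ b3)) (pow_ne_zero _ b4)) (pow_ne_zero _ b5)
  have hP' := brk_monomial_eq h0 h1 (f₁ + 1) (f₂ + 1) e₃ e₄ e₅
  rw [hs, he, show ((t : ℂ) ^ 11) ^ 11 = (t : ℂ) ^ 121 by rw [← pow_mul]] at hP'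
  have hv := residue_value_eq h0 hJ b1 hU hB hP hP' (hm t h0 h1)
  rw [← curveDisc_eq h0 h1] at hv
  rw [hv] at h
  have e11 : (t : ℂ) ^ 121 = ((t : ℂ) ^ 11) ^ 11 := by rw [← pow_mul]
  rw [e11, ← hxt] at h
  refine h.congr_fun fun k => ?_
  rw [pow_add, ← mul_assoc, mul_inv_cancel_right₀ ht2, pow_mul, ← hxt]
  push_cast
  rfl

/-- Rank-crank inequalities for the residue 2 modulo 11. -/
theorem rank_crank_inequalities_residue_two (n : ℕ) :
    (3 * (rankCount 2 11 (11  *  n  +  2) : ℤ)  +  (rankCount 4 11 (11  *  n  +  2) : ℤ) ≥ 2 * (rankCount 0 11 (11  *  n  +  2) : ℤ)  +  2 * (rankCount 5 11 (11  *  n  +  2) : ℤ))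
    ∧ (2 * (rankCount 1 11 (11  *  n  +  2) : ℤ)  +  2 * (rankCount 3 11 (11  *  n  +  2) : ℤ)  +  (rankCount 5 11 (11  *  n  +  2) : ℤ)  +  2 * crankCount 0 (11  *  n  +  2) ≥ 2 * (rankCount 2 11 (11  *  n  +  2) : ℤ)  +  3 * (rankCount 4 11 (11  *  n  +  2) : ℤ)  +  2 * crankCount 2 (11  *  n  +  2))
    ∧ (3 * (rankCount 0 11 (11  *  n  +  2) : ℤ)  +  2 * (rankCount 2 11 (11  *  n  +  2) : ℤ)  +  crankCount 2 (11  *  n  +  2) ≥ (rankCount 1 11 (11  *  n  +  2) : ℤ)  +  (rankCount 3 11 (11  *  n  +  2) : ℤ)  +  3 * (rankCount 5 11 (11  *  n  +  2) : ℤ)  +  crankCount 0 (11  *  n  +  2))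
    ∧ (2 * (rankCount 0 11 (11  *  n  +  2) : ℤ)  +  (rankCount 1 11 (11  *  n  +  2) : ℤ)  +  (rankCount 3 11 (11  *  n  +  2) : ℤ)  +  3 * (rankCount 4 11 (11  *  n  +  2) : ℤ)  +  crankCount 0 (11  *  n  +  2) ≥ 4 * (rankCount 2 11 (11  *  n  +  2) : ℤ)  +  3 * (rankCount 5 11 (11  *  n  +  2) : ℤ)  +  crankCount 2 (11  *  n  +  2))
    ∧ ((rankCount 0 11 (11  *  n  +  2) : ℤ)  +  3 * (rankCount 1 11 (11  *  n  +  2) : ℤ)  +  (rankCount 2 11 (11  *  n  +  2) : ℤ)  +  8 * (rankCount 5 11 (11  *  n  +  2) : ℤ)  +  3 * crankCount 0 (11  *  n  +  2) ≥ 8 * (rankCount 3 11 (11  *  n  +  2) : ℤ)  +  5 * (rankCount 4 11 (11  *  n  +  2) : ℤ)  +  3 * crankCount 2 (11  *  n  +  2)) := by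
  have h1 := rankCrankComb_nonneg ![-2, 0, 3, 0, 1, -2, 0] ![2, 0, 2, -5, 6] (by decide) (by decide) (by decide) (by decide)
    (by decide) (by decide) (fun x y => x ^ 3 * y * (1 + y) ^ 3 * (1 - x))
    (fun x y hC => thetaCoeff_mul_invCoeff_one hC) 3 0 1 3 3 4 (by norm_num) (by norm_num)
    (fun t h0 h1 => by
      obtain ⟨b1, b2, b3, b4, b5⟩ := brk_ne_zero_aux h0 h1
      rw [one_sub_curveX h0 h1, one_add_curveY h0 h1, curveX, curveY, thetaRatio]
      field_simp
      ring) n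
  have h2 := rankCrankComb_nonneg ![0, 2, -2, 2, -3, 1, 2] ![-3, -4, 0, 4, -3] (by decide) (by decide) (by decide) (by decide)
    (by decide) (by decide) (fun x y => -(x ^ 3 * y ^ 2 * (1 + y) ^ 2 * (1 - x) ^ 2))
    (fun x y hC => (thetaCoeff_mul_invCoeff_two hC).trans (by ring)) 2 0 3 3 2 3 (by norm_num) (by norm_num)
    (fun t h0 h1 => by
      obtain ⟨b1, b2, b3, b4, b5⟩ := brk_ne_zero_aux h0 h1
      rw [one_sub_curveX h0 h1, one_add_curveY h0 h1, curveX, curveY, thetaRatio]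
      field_simp
      ring) n
  have h3 := rankCrankComb_nonneg ![3, -1, 2, -1, 0, -3, -1] ![4, 2, -3, 0, -2] (by decide) (by decide) (by decide) (by decide)
    (by decide) (by decide) (fun x y => x ^ 3 * y ^ 3 * (1 + y) * (1 - x) ^ 2)
    (fun x y hC => thetaCoeff_mul_invCoeff_three hC) 1 1 3 3 3 1 (by norm_num) (by norm_num)
    (fun t h0 h1 => by
      obtain ⟨b1, b2, b3, b4, b5⟩ := brk_ne_zero_aux h0 h1
      rw [one_sub_curveX h0 h1, one_add_curveY h0 h1, curveX, curveY, thetaRatio]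
      field_simp
      ring) n
  have h4 := rankCrankComb_nonneg ![2, 1, -4, 1, 3, -3, 1] ![2, -2, -2, -4, -2] (by decide) (by decide) (by decide) (by decide)
    (by decide) (by decide) (fun x y => -(x ^ 3 * y ^ 2 * (1 + y) ^ 2 * (1 - x)))
    (fun x y hC => (thetaCoeff_mul_invCoeff_four hC).trans (by ring)) 2 1 1 3 4 2 (by norm_num) (by norm_num)
    (fun t h0 h1 => by
      obtain ⟨b1, b2, b3, b4, b5⟩ := brk_ne_zero_aux h0 h1
      rw [one_sub_curveX h0 h1, one_add_curveY h0 h1, curveX, curveY, thetaRatio]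
      field_simp
      ring) n
  have h5 := rankCrankComb_nonneg ![1, 3, 1, -8, -5, 8, 3] ![-11, 5, -1, 14, -2] (by decide) (by decide) (by decide) (by decide)
    (by decide) (by decide) (fun x y => x ^ 2 * y * (1 + y) ^ 4)
    (fun x y hC => thetaCoeff_mul_invCoeff_five hC) 3 1 0 1 5 4 (by norm_num) (by norm_num)
    (fun t h0 h1 => by
      obtain ⟨b1, b2, b3, b4, b5⟩ := brk_ne_zero_aux h0 h1
      rw [one_sub_curveX h0 h1, one_add_curveY h0 h1, curveX, curveY, thetaRatio]
      field_simp
      ring) n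
  simp only [rankCrankComb, Matrix.cons_val] at h1 h2 h3 h4 h5
  refine ⟨?_, ?_, ?_, ?_, ?_⟩ <;> linarith
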